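/- Let ℓ ≥ 2 be an integer, λ > 0, c, c₁ ∈ (0,1), δ > 0 and K ≥ 1, and set θ(c,c₁) = min{c + c₁, 1/2 − 2c₁}. There exist C > 0 and ε₀ > 0 such that for every ε ∈ (0,ε₀) and every interval I ⊆ [0,1] with K⁻¹·ε^c ≤ |I| ≤ K·ε^c, one has |G^{(1)}_{ℓ,I,ε}(λ) − c_I·A(ℓ)·G^{(1)}(λ)| ≤ C·ε^{θ(c,c₁)−δ}, where G^{(1)}(λ) = ln(1−λ)·ln λ + ∫_λ^{1−λ} (1/u)·ln(1/(1−u)) du + 2∫_{1−λ}^1 ((1−u)/u)·ln(λ/(1−u)) du for λ ∈ (0,1/2], G^{(1)}(λ) = (ln λ)² + 2∫_λ^1 ((1−u)/u)·ln(λ/(1−u)) du for λ ∈ [1/2,1], and G^{(1)}(λ) = 0 for λ ≥ 1. -/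

import Mathlib

open MeasureTheory Real Set Filter
open scoped ENNReal Pointwise

noncomputable def zeta2 : ℝ := π ^ 2 / 6

noncomputable def Cconst (l : ℕ) : ℝ :=
  ((Nat.totient l : ℝ) / l) * ∏' p : {p : ℕ // p.Prime ∧ ¬ p ∣ l}, (1 - 1 / (p.1 : ℝ) ^ 2)

noncomputable def Aconst (l : ℕ) : ℝ := 1 / zeta2 - 2 * Cconst l / l

def Zl (l : ℕ) : Set (ℝ × ℝ) :=
  {p | ∃ m n : ℤ, p = ((m : ℝ), (n : ℝ)) ∧ ¬ ((l : ℤ) ∣ (m - n))}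

def Vseg (ε : ℝ) : Set (ℝ × ℝ) := {(0 : ℝ)} ×ˢ Set.Icc (-ε) ε

noncomputable def qfree (l : ℕ) (ε ω : ℝ) : ℝ≥0∞ :=
  ⨅ q : {q : ℝ // 0 < q ∧ (q, q * Real.tan ω) ∈ Zl l + Vseg ε}, ENNReal.ofReal q.1

def FareyQ (Q : ℕ) : Set ℚ := {x | 0 < x ∧ x ≤ 1 ∧ x.den ≤ Q}

def FareyCong (l : ℕ) : Set ℚ := {x | 0 < x ∧ x ≤ 1 ∧ (l : ℤ) ∣ ((x.den : ℤ) - x.num)}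

def ConsecFarey (Q : ℕ) (γ γ' : ℚ) : Prop :=
  γ ∈ FareyQ Q ∧ γ' ∈ FareyQ Q ∧ γ < γ' ∧ ∀ z ∈ FareyQ Q, ¬ (γ < z ∧ z < γ')

/-- `G^{(1)}_{ℓ,I,ε}(λ)`: the measure of the set of `ω ∈ arctan I` with `q_{ℓ,ε}(ω) > λQ`
(`Q = ⌊1/ε⌋`) and `γ < tan ω < γ'` for some consecutive `γ, γ'` in `F_Q` with
`γ, γ' ∈ (I ∩ F_Q) ∖ F^{(ℓ)}`. -/
noncomputable def Gmeas1 (l : ℕ) (I : Set ℝ) (ε lam : ℝ) : ℝ :=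
  (volume {ω ∈ Real.arctan '' I |
    ENNReal.ofReal (lam * (⌊1 / ε⌋₊ : ℝ)) < qfree l ε ω ∧
    ∃ γ γ' : ℚ, ConsecFarey ⌊1 / ε⌋₊ γ γ' ∧ (γ : ℝ) ∈ I ∧ (γ' : ℝ) ∈ I ∧
      γ ∉ FareyCong l ∧ γ' ∉ FareyCong l ∧
      (γ : ℝ) < Real.tan ω ∧ Real.tan ω < (γ' : ℝ)}).toReal

/-- The limit function `G^{(1)}(λ)`. -/
noncomputable def G1fun (lam : ℝ) : ℝ :=
  if lam ≤ 1 / 2 then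
    Real.log (1 - lam) * Real.log lam +
      (∫ u in lam..(1 - lam), (1 / u) * Real.log (1 / (1 - u))) +
      2 * ∫ u in (1 - lam)..1, ((1 - u) / u) * Real.log (lam / (1 - u))
  else if lam ≤ 1 then
    (Real.log lam) ^ 2 + 2 * ∫ u in lam..1, ((1 - u) / u) * Real.log (lam / (1 - u))
  else 0

/-- The divisor function grows slower than any power. -/
lemma exists_card_divisors_le (δ : ℝ) (hδ : 0 < δ) :
    ∃ C : ℝ, 1 ≤ C ∧ ∀ n : ℕ, 0 < n → ((Nat.divisors n).card : ℝ) ≤ C * (n : ℝ) ^ δ := by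
  obtain ⟨P, hP⟩ := exists_nat_ge ((2 : ℝ) ^ (1 / δ))
  set B : ℝ := 1 + 1 / (δ * Real.log 2) with hB
  have hl2 : 0 < Real.log 2 := Real.log_pos one_lt_two
  have hB1 : 1 ≤ B := by
    have : 0 < 1 / (δ * Real.log 2) := by positivity
    linarith
  refine ⟨B ^ P, one_le_pow₀ hB1, fun n hn => ?_⟩
  rw [Nat.card_divisors hn.ne']
  have hnprod : (n : ℝ) ^ δ = ∏ p ∈ n.primeFactors, ((p : ℝ) ^ (n.factorization p)) ^ δ := by
    conv_lhs => rw [← Nat.prod_factorization_pow_eq_self hn.ne']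
    rw [Finsupp.prod, Nat.cast_prod, ← Real.finsetProd_rpow]
    · simp
    · intro i _; positivity
  rw [hnprod]
  have key : ∀ p ∈ n.primeFactors, ((n.factorization p : ℝ) + 1) ≤
      (if p < P then B else 1) * ((p : ℝ) ^ (n.factorization p)) ^ δ := by
    intro p hp
    have hp2 : (2 : ℝ) ≤ p := by exact_mod_cast (Nat.prime_of_mem_primeFactors hp).two_le
    set e := n.factorization p
    have hpe : ((p : ℝ) ^ e) ^ δ = ((p : ℝ) ^ δ) ^ e := by
      rw [← Real.rpow_natCast, ← Real.rpow_natCast, ← Real.rpow_mul (by positivity),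
        ← Real.rpow_mul (by positivity), mul_comm]
    split_ifs with h
    · have h1 : (2 : ℝ) ^ (δ * e) ≤ ((p : ℝ) ^ e) ^ δ := by
        rw [← Real.rpow_natCast, ← Real.rpow_mul (by positivity), mul_comm δ]
        exact Real.rpow_le_rpow (by norm_num) hp2 (by positivity)
      have h2 : 1 + (δ * e) * Real.log 2 ≤ (2 : ℝ) ^ (δ * e) := by
        rw [Real.rpow_def_of_pos (by norm_num)]
        have := Real.add_one_le_exp (Real.log 2 * (δ * e))
        linarith
      have h3 : (e : ℝ) + 1 ≤ B * (1 + (δ * e) * Real.log 2) := by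
        have : (1 / (δ * Real.log 2)) * ((δ * e) * Real.log 2) = e := by
          field_simp
        have h4 : 0 ≤ (1 / (δ * Real.log 2)) := by positivity
        have h5 : 0 ≤ (δ * e) * Real.log 2 := by positivity
        rw [hB]; nlinarith
      calc (e : ℝ) + 1 ≤ B * (1 + (δ * e) * Real.log 2) := h3
        _ ≤ B * ((p : ℝ) ^ e) ^ δ := by gcongr; linarith
    · rw [one_mul, hpe]
      have h1 : (2 : ℝ) ≤ (p : ℝ) ^ δ := by
        have h3 : (2 : ℝ) ^ (1 / δ) ≤ p := hP.trans (by exact_mod_cast not_lt.mp h)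
        calc (2 : ℝ) = ((2 : ℝ) ^ (1 / δ)) ^ δ := by
              rw [← Real.rpow_mul (by norm_num), one_div_mul_cancel hδ.ne', Real.rpow_one]
          _ ≤ _ := Real.rpow_le_rpow (by positivity) h3 hδ.le
      calc (e : ℝ) + 1 ≤ 2 ^ e := by
            have := Nat.lt_two_pow_self (n := e)
            exact_mod_cast this
        _ ≤ _ := by gcongr
  push_cast
  calc ∏ p ∈ n.primeFactors, ((n.factorization p : ℝ) + 1)
      ≤ ∏ p ∈ n.primeFactors, ((if p < P then B else 1) * ((p : ℝ) ^ (n.factorization p)) ^ δ) :=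
        Finset.prod_le_prod (fun _ _ => by positivity) key
    _ = (∏ p ∈ n.primeFactors, (if p < P then B else 1)) *
        ∏ p ∈ n.primeFactors, ((p : ℝ) ^ (n.factorization p)) ^ δ := Finset.prod_mul_distrib
    _ ≤ _ := by
        gcongr
        rw [Finset.prod_ite, Finset.prod_const_one, mul_one, Finset.prod_const]
        apply pow_le_pow_right₀ hB1
        calc _ ≤ (Finset.range P).card := Finset.card_le_card (by
              intro x hx; simp at hx ⊢; exact hx.2)
          _ = P := Finset.card_range P

/-- `n / φ(n)` is at most the number of divisors of `n`. -/
lemma le_card_divisors_mul_totient (n : ℕ) : n ≤ (Nat.divisors n).card * n.totient := by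
  rcases Nat.eq_zero_or_pos n with rfl | hn
  · simp
  calc n = ∑ d ∈ n.divisors, d.totient := (Nat.sum_totient n).symm
    _ ≤ ∑ d ∈ n.divisors, n.totient := Finset.sum_le_sum fun d hd =>
        Nat.le_of_dvd (Nat.totient_pos.mpr hn) (Nat.totient_dvd_of_dvd (Nat.dvd_of_mem_divisors hd))
    _ = _ := by simp

/-- The Kloosterman sum modulo `y`. -/
noncomputable def kloosterman {y : ℕ} [NeZero y] (m n : ZMod y) : ℂ :=
  ∑ u : (ZMod y)ˣ, ZMod.stdAddChar (m * (u : ZMod y) + n * ((u⁻¹ : (ZMod y)ˣ) : ZMod y))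

lemma sum_sum_normSq_sum_stdAddChar {y : ℕ} [NeZero y] {P : Type*} [Fintype P] [DecidableEq P]
    (a b : P → ZMod y) :
    ∑ m : ZMod y, ∑ n : ZMod y, ‖∑ p, (ZMod.stdAddChar (m * a p + n * b p) : ℂ)‖ ^ 2 =
      (y : ℝ) ^ 2 *
        ((Finset.univ.filter fun x : P × P => a x.1 = a x.2 ∧ b x.1 = b x.2).card : ℝ) := by
  have hprim := ZMod.isPrimitive_stdAddChar y
  have hS : ∀ c : ZMod y, ∑ m : ZMod y, (ZMod.stdAddChar (m * c) : ℂ) =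
      if c = 0 then (y : ℂ) else 0 := by
    intro c
    rw [AddChar.sum_mulShift c hprim, ZMod.card]
    split_ifs <;> simp
  have hexp : ∀ m n : ZMod y,
      ((‖∑ p, (ZMod.stdAddChar (m * a p + n * b p) : ℂ)‖ ^ 2 : ℝ) : ℂ) =
      ∑ x : P × P, ZMod.stdAddChar (m * (a x.1 - a x.2)) *
        ZMod.stdAddChar (n * (b x.1 - b x.2)) := by
    intro m n
    rw [Complex.ofReal_pow, ← Complex.mul_conj', map_sum, Finset.sum_mul_sum,
      Fintype.sum_prod_type]
    refine Finset.sum_congr rfl fun p _ => Finset.sum_congr rfl fun p' _ => ?_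
    rw [← AddChar.map_neg_eq_conj, ← AddChar.map_add_eq_mul, ← AddChar.map_add_eq_mul]
    congr 1
    ring
  have : ((∑ m : ZMod y, ∑ n : ZMod y,
      ‖∑ p, (ZMod.stdAddChar (m * a p + n * b p) : ℂ)‖ ^ 2 : ℝ) : ℂ) =
      ((y : ℝ) ^ 2 *
        ((Finset.univ.filter fun x : P × P => a x.1 = a x.2 ∧ b x.1 = b x.2).card : ℝ) : ℝ) := by
    push_cast
    calc _ = ∑ m : ZMod y, ∑ n : ZMod y, ∑ x : P × P, ZMod.stdAddChar (m * (a x.1 - a x.2)) *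
        ZMod.stdAddChar (n * (b x.1 - b x.2)) := by
          refine Finset.sum_congr rfl fun m _ => Finset.sum_congr rfl fun n _ => ?_
          rw [← hexp]; push_cast; rfl
      _ = ∑ x : P × P, (∑ m : ZMod y, (ZMod.stdAddChar (m * (a x.1 - a x.2)) : ℂ)) *
        ∑ n : ZMod y, (ZMod.stdAddChar (n * (b x.1 - b x.2)) : ℂ) := by
          rw [Finset.sum_congr rfl fun m _ => Finset.sum_comm, Finset.sum_comm]
          refine Finset.sum_congr rfl fun x _ => ?_
          rw [Finset.sum_mul_sum]
      _ = ∑ x : P × P, if a x.1 = a x.2 ∧ b x.1 = b x.2 then (y : ℂ) ^ 2 else 0 := by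
          refine Finset.sum_congr rfl fun x _ => ?_
          rw [hS, hS]
          simp only [sub_eq_zero]
          by_cases h1 : a x.1 = a x.2 <;> by_cases h2 : b x.1 = b x.2 <;> simp [h1, h2, sq]
      _ = _ := by
          rw [← Finset.sum_filter, Finset.sum_const, nsmul_eq_mul, mul_comm]
  exact_mod_cast this

lemma card_mul_eq_le_gcd {y : ℕ} [NeZero y] (n c : ZMod y) :
    (Finset.univ.filter fun t : ZMod y => n * t = c).card ≤ Nat.gcd n.val y := by
  rcases (Finset.univ.filter fun t : ZMod y => n * t = c).eq_empty_or_nonempty with h | ⟨t₀, h₀⟩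
  · simp [h]
  have h₀' : n * t₀ = c := by simpa using h₀
  have hg : 0 < Nat.gcd n.val y := Nat.gcd_pos_of_pos_right _ (NeZero.pos y)
  refine le_trans ?_ (IsAddCyclic.card_nsmul_eq_zero_le (α := ZMod y) hg)
  refine Finset.card_le_card_of_injOn (fun t => t - t₀) ?_ ?_
  · intro t ht
    have ht' : n * t = c := by simpa using ht
    have h1 : n * (t - t₀) = 0 := by rw [mul_sub, ht', h₀', sub_self]
    have h2 : ((Nat.gcd n.val y : ℕ) : ZMod y) = n * ((Nat.gcdA n.val y : ℤ) : ZMod y) := by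
      have := congrArg (Int.cast : ℤ → ZMod y) (Nat.gcd_eq_gcd_ab n.val y)
      push_cast at this
      simpa using this
    simp only [Finset.coe_filter, Finset.mem_univ, true_and, Set.mem_ofPred_eq, nsmul_eq_mul]
    rw [h2, mul_right_comm, h1, zero_mul]
  · intro t _ t' _ h
    simpa using h

lemma sum_gcd_le (y : ℕ) [NeZero y] :
    ∑ a : ZMod y, Nat.gcd a.val y ≤ y * (Nat.divisors y).card := by
  have h1 : ∀ a : ZMod y, Nat.gcd a.val y ≤ ∑ d ∈ y.divisors, if d ∣ a.val then d else 0 := by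
    intro a
    have : (if Nat.gcd a.val y ∣ a.val then Nat.gcd a.val y else 0) ≤
        ∑ d ∈ y.divisors, if d ∣ a.val then d else 0 :=
      Finset.single_le_sum (f := fun d => if d ∣ a.val then d else 0) (fun _ _ => Nat.zero_le _)
        (Nat.mem_divisors.mpr ⟨Nat.gcd_dvd_right _ _, NeZero.ne y⟩)
    rwa [if_pos (Nat.gcd_dvd_left _ _)] at this
  have h2 : ∀ d ∈ y.divisors, ∑ a : ZMod y, (if d ∣ a.val then d else 0) ≤ y := by
    intro d hd
    have hdy := Nat.dvd_of_mem_divisors hd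
    have hd0 : 0 < d := Nat.pos_of_mem_divisors hd
    rw [← Finset.sum_filter, Finset.sum_const, smul_eq_mul]
    have : (Finset.univ.filter fun a : ZMod y => d ∣ a.val).card ≤ y / d := by
      calc _ ≤ (Finset.range (y / d)).card := by
            refine Finset.card_le_card_of_injOn (fun a => a.val / d) ?_ ?_
            · intro a _
              simp only [Finset.coe_range, Set.mem_Iio]
              exact Nat.div_lt_div_of_lt_of_dvd hdy (ZMod.val_lt a)
            · intro a ha b hb h
              have ha' : d ∣ a.val := by simpa using ha
              have hb' : d ∣ b.val := by simpa using hb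
              exact ZMod.val_injective y (Nat.div_left_inj ha' hb' |>.mp h)
        _ = y / d := by simp
    calc _ ≤ y / d * d := Nat.mul_le_mul_right _ this
      _ = y := Nat.div_mul_cancel hdy
  calc _ ≤ ∑ a : ZMod y, ∑ d ∈ y.divisors, (if d ∣ a.val then d else 0) :=
        Finset.sum_le_sum fun a _ => h1 a
    _ = ∑ d ∈ y.divisors, ∑ a : ZMod y, (if d ∣ a.val then d else 0) := Finset.sum_comm
    _ ≤ ∑ d ∈ y.divisors, y := Finset.sum_le_sum h2
    _ = _ := by simp [mul_comm]

lemma card_mul_mul_eq_zero_le (y : ℕ) [NeZero y] :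
    (Finset.univ.filter fun x : ZMod y × ZMod y × ZMod y => x.1 * x.2.1 * x.2.2 = 0).card ≤
      (y * (Nat.divisors y).card) ^ 2 := by
  calc _ = ∑ a : ZMod y, ∑ b : ZMod y,
        (Finset.univ.filter fun c : ZMod y => a * b * c = 0).card := by
        simp only [Finset.card_filter, Fintype.sum_prod_type]
    _ ≤ ∑ a : ZMod y, ∑ b : ZMod y, Nat.gcd a.val y * Nat.gcd b.val y := by
        refine Finset.sum_le_sum fun a _ => Finset.sum_le_sum fun b _ => ?_
        refine (card_mul_eq_le_gcd _ _).trans ?_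
        have : Nat.gcd (a * b).val y ∣ Nat.gcd a.val y * Nat.gcd b.val y := by
          rw [ZMod.val_mul, (Nat.mod_modEq _ _).gcd_eq, Nat.gcd_comm, Nat.gcd_comm a.val,
            Nat.gcd_comm b.val]
          exact Nat.gcd_mul_right_dvd_mul_gcd _ _ _
        exact Nat.le_of_dvd (Nat.mul_pos (Nat.gcd_pos_of_pos_right _ (NeZero.pos y))
          (Nat.gcd_pos_of_pos_right _ (NeZero.pos y))) this
    _ = (∑ a : ZMod y, Nat.gcd a.val y) ^ 2 := by rw [sq, Finset.sum_mul_sum]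
    _ ≤ _ := Nat.pow_le_pow_left (sum_gcd_le y) 2

lemma card_units_quadruples_le (y : ℕ) [NeZero y] :
    (Finset.univ.filter fun x : ((ZMod y)ˣ × (ZMod y)ˣ) × ((ZMod y)ˣ × (ZMod y)ˣ) =>
      (x.1.1 : ZMod y) + x.1.2 = x.2.1 + x.2.2 ∧
      ((x.1.1⁻¹ : (ZMod y)ˣ) : ZMod y) + ((x.1.2⁻¹ : (ZMod y)ˣ) : ZMod y) =
        ((x.2.1⁻¹ : (ZMod y)ˣ) : ZMod y) + ((x.2.2⁻¹ : (ZMod y)ˣ) : ZMod y)).card ≤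
      2 * (y * (Nat.divisors y).card) ^ 2 := by
  set s := Finset.univ.filter fun x : ((ZMod y)ˣ × (ZMod y)ˣ) × ((ZMod y)ˣ × (ZMod y)ˣ) =>
      (x.1.1 : ZMod y) + x.1.2 = x.2.1 + x.2.2 ∧
      ((x.1.1⁻¹ : (ZMod y)ˣ) : ZMod y) + ((x.1.2⁻¹ : (ZMod y)ˣ) : ZMod y) =
        ((x.2.1⁻¹ : (ZMod y)ˣ) : ZMod y) + ((x.2.2⁻¹ : (ZMod y)ˣ) : ZMod y) with hs
  set f : ((ZMod y)ˣ × (ZMod y)ˣ) × ((ZMod y)ˣ × (ZMod y)ˣ) → ZMod y × ZMod y × ZMod y :=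
    fun x => ((x.1.1 : ZMod y) + x.1.2, (x.1.1 : ZMod y) - x.2.1, (x.1.2 : ZMod y) - x.2.1) with hf
  have himg : s.image f ⊆
      Finset.univ.filter fun x : ZMod y × ZMod y × ZMod y => x.1 * x.2.1 * x.2.2 = 0 := by
    intro z hz
    obtain ⟨⟨⟨u1, u2⟩, ⟨u3, u4⟩⟩, hx, rfl⟩ := Finset.mem_image.mp hz
    simp only [hs, Finset.mem_filter, Finset.mem_univ, true_and] at hx
    obtain ⟨h1, h2⟩ := hx
    simp only [hf, Finset.mem_filter, Finset.mem_univ, true_and]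
    have e1 := Units.mul_inv u1
    have e2 := Units.mul_inv u2
    have e3 := Units.mul_inv u3
    have e4 := Units.mul_inv u4
    generalize (u1 : ZMod y) = a at *
    generalize (u2 : ZMod y) = b at *
    generalize (u3 : ZMod y) = c at *
    generalize (u4 : ZMod y) = d at *
    generalize ((u1⁻¹ : (ZMod y)ˣ) : ZMod y) = a' at *
    generalize ((u2⁻¹ : (ZMod y)ˣ) : ZMod y) = b' at *
    generalize ((u3⁻¹ : (ZMod y)ˣ) : ZMod y) = c' at *
    generalize ((u4⁻¹ : (ZMod y)ˣ) : ZMod y) = d' at *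
    have h3 : (a + b) * (c * d) = (a + b) * (a * b) := by
      have l1 : (a + b) * (c * d) = (a' + b') * (a * b) * (c * d) := by
        linear_combination (-(b * (c * d))) * e1 - (a * (c * d)) * e2
      have l2 : (c + d) * (a * b) = (c' + d') * (a * b) * (c * d) := by
        linear_combination (-(d * (a * b))) * e3 - (c * (a * b)) * e4
      rw [l1, h2, ← l2, h1]
    have hd : d = a + b - c := by rw [h1]; ring
    rw [hd] at h3
    linear_combination -h3
  have hfib : ∀ z ∈ s.image f, (s.filter fun x => f x = z).card ≤ 2 := by
    rintro ⟨A, B, C⟩ _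
    calc (s.filter fun x => f x = (A, B, C)).card
        ≤ (Finset.univ.filter fun t : ZMod y => 2 • t = A - B - C).card := by
          refine Finset.card_le_card_of_injOn (fun x => (x.2.1 : ZMod y)) ?_ ?_
          · rintro ⟨⟨u1, u2⟩, ⟨u3, u4⟩⟩ hx
            simp only [hf, Finset.coe_filter, Set.mem_ofPred_eq, Prod.mk.injEq] at hx
            obtain ⟨_, rfl, rfl, rfl⟩ := hx
            simp only [Finset.coe_filter, Finset.mem_univ, true_and, Set.mem_ofPred_eq]
            rw [two_nsmul]; ring
          · rintro ⟨⟨u1, u2⟩, ⟨u3, u4⟩⟩ hx ⟨⟨v1, v2⟩, ⟨v3, v4⟩⟩ hx' h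
            simp only [hf, hs, Finset.coe_filter, Finset.mem_filter, Finset.mem_univ, true_and,
              Set.mem_ofPred_eq, Prod.mk.injEq] at hx hx'
            simp only at h
            obtain ⟨⟨p1, _⟩, _, q2, q3⟩ := hx
            obtain ⟨⟨p1', _⟩, _, q2', q3'⟩ := hx'
            have r1 : (u1 : ZMod y) = v1 := by linear_combination q2 - q2' + h
            have r2 : (u2 : ZMod y) = v2 := by linear_combination q3 - q3' + h
            have r4 : (u4 : ZMod y) = v4 := by linear_combination p1' - p1 + r1 + r2 - h
            rw [Units.ext r1, Units.ext r2, Units.ext h, Units.ext r4]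
      _ ≤ 2 := by
          rcases (Finset.univ.filter fun t : ZMod y => 2 • t = A - B - C).eq_empty_or_nonempty
            with h | ⟨t₀, h₀⟩
          · rw [h]; simp
          refine le_trans ?_ (IsAddCyclic.card_nsmul_eq_zero_le (α := ZMod y) two_pos)
          refine Finset.card_le_card_of_injOn (fun t => t - t₀) ?_ ?_
          · intro t ht
            simp only [Finset.coe_filter, Finset.mem_filter, Finset.mem_univ, true_and,
              Set.mem_ofPred_eq] at ht h₀ ⊢
            rw [nsmul_sub, ht, h₀, sub_self]
          · intro t _ t' _ h
            simpa using h
  calc s.card ≤ 2 * (s.image f).card := Finset.card_le_mul_card_image s 2 hfib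
    _ ≤ 2 * (y * (Nat.divisors y).card) ^ 2 :=
        Nat.mul_le_mul_left _ ((Finset.card_le_card himg).trans (card_mul_mul_eq_zero_le y))

lemma kloosterman_mul_unit {y : ℕ} [NeZero y] (m n : ZMod y) (t : (ZMod y)ˣ) :
    kloosterman (m * (t : ZMod y)) (n * ((t⁻¹ : (ZMod y)ˣ) : ZMod y)) = kloosterman m n := by
  unfold kloosterman
  refine Fintype.sum_equiv (Equiv.mulLeft t) _ _ fun u => ?_
  congr 1
  simp only [Equiv.coe_mulLeft, mul_inv, Units.val_mul]
  ring

lemma sum_norm_kloosterman_pow_four_le (y : ℕ) [NeZero y] :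
    ∑ m : ZMod y, ∑ n : ZMod y, ‖kloosterman m n‖ ^ 4 ≤
      2 * (y : ℝ) ^ 4 * ((Nat.divisors y).card : ℝ) ^ 2 := by
  have h := sum_sum_normSq_sum_stdAddChar (y := y) (P := (ZMod y)ˣ × (ZMod y)ˣ)
    (fun p => (p.1 : ZMod y) + (p.2 : ZMod y))
    (fun p => ((p.1⁻¹ : (ZMod y)ˣ) : ZMod y) + ((p.2⁻¹ : (ZMod y)ˣ) : ZMod y))
  have h' : ∀ m n : ZMod y, ‖kloosterman m n‖ ^ 4 =
      ‖∑ p : (ZMod y)ˣ × (ZMod y)ˣ, (ZMod.stdAddChar (m * ((p.1 : ZMod y) + (p.2 : ZMod y)) +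
        n * (((p.1⁻¹ : (ZMod y)ˣ) : ZMod y) + ((p.2⁻¹ : (ZMod y)ˣ) : ZMod y))) : ℂ)‖ ^ 2 := by
    intro m n
    rw [show (4 : ℕ) = 2 * 2 from rfl, pow_mul, ← norm_pow, sq (kloosterman m n), kloosterman,
      Finset.sum_mul_sum, Fintype.sum_prod_type]
    refine congrArg (fun z : ℂ => ‖z‖ ^ 2) ?_
    refine Finset.sum_congr rfl fun p _ => Finset.sum_congr rfl fun p' _ => ?_
    rw [← AddChar.map_add_eq_mul]
    congr 1
    ring
  simp only [h']
  rw [h]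
  have hc := card_units_quadruples_le y
  have hc' : ((Finset.univ.filter fun x : ((ZMod y)ˣ × (ZMod y)ˣ) × ((ZMod y)ˣ × (ZMod y)ˣ) =>
      (x.1.1 : ZMod y) + x.1.2 = x.2.1 + x.2.2 ∧
      ((x.1.1⁻¹ : (ZMod y)ˣ) : ZMod y) + ((x.1.2⁻¹ : (ZMod y)ˣ) : ZMod y) =
        ((x.2.1⁻¹ : (ZMod y)ˣ) : ZMod y) + ((x.2.2⁻¹ : (ZMod y)ˣ) : ZMod y)).card : ℝ) ≤
      2 * (y * (Nat.divisors y).card) ^ 2 := by exact_mod_cast hc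
  calc _ ≤ (y : ℝ) ^ 2 * (2 * (y * (Nat.divisors y).card) ^ 2) :=
        mul_le_mul_of_nonneg_left hc' (by positivity)
    _ = _ := by ring

/-- Kloosterman's bound, by the fourth moment method. -/
lemma norm_kloosterman_pow_four_le {y : ℕ} [NeZero y] (m n : ZMod y) :
    ‖kloosterman m n‖ ^ 4 ≤
      2 * (Nat.gcd n.val y : ℝ) * (y : ℝ) ^ 3 * ((Nat.divisors y).card : ℝ) ^ 3 := by
  set d : ℝ := ((Nat.divisors y).card : ℝ)
  have hy : (0 : ℝ) < y := by exact_mod_cast NeZero.pos y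
  set F : ZMod y × ZMod y → ℝ := fun z => ‖kloosterman z.1 z.2‖ ^ 4 with hF
  set g : (ZMod y)ˣ → ZMod y × ZMod y := fun t => (m * (t : ZMod y), n * ((t⁻¹ : (ZMod y)ˣ) : ZMod y)) with hg
  have h1 : ∑ t : (ZMod y)ˣ, F (g t) = (Nat.totient y : ℝ) * ‖kloosterman m n‖ ^ 4 := by
    simp only [hF, hg, kloosterman_mul_unit]
    rw [Finset.sum_const, Finset.card_univ, ZMod.card_units_eq_totient, nsmul_eq_mul]
  have h2 : ∑ t : (ZMod y)ˣ, F (g t) ≤ (Nat.gcd n.val y : ℝ) * ∑ z, F z := by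
    rw [Finset.sum_comp, Finset.mul_sum]
    calc _ ≤ ∑ b ∈ Finset.univ.image g, (Nat.gcd n.val y : ℝ) * F b := by
          refine Finset.sum_le_sum fun b _ => ?_
          rw [nsmul_eq_mul]
          refine mul_le_mul_of_nonneg_right ?_ (by positivity)
          norm_cast
          refine le_trans ?_ (card_mul_eq_le_gcd n b.2)
          refine Finset.card_le_card_of_injOn (fun t => ((t⁻¹ : (ZMod y)ˣ) : ZMod y)) ?_ ?_
          · intro t ht
            simp only [hg, Finset.coe_filter, Finset.mem_univ, true_and, Set.mem_ofPred_eq] at ht ⊢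
            rw [← ht]
          · intro t _ t' _ h
            exact inv_injective (Units.ext h)
      _ ≤ _ := Finset.sum_le_sum_of_subset_of_nonneg (Finset.subset_univ _)
          fun _ _ _ => by positivity
  have h3 : ∑ z, F z ≤ 2 * (y : ℝ) ^ 4 * d ^ 2 := by
    rw [Fintype.sum_prod_type]
    exact sum_norm_kloosterman_pow_four_le y
  have h4 : (y : ℝ) ≤ d * (Nat.totient y : ℝ) := by
    simp only [d]
    exact_mod_cast le_card_divisors_mul_totient y
  have hd : 0 ≤ d := by positivity
  have h5 : (y : ℝ) * ‖kloosterman m n‖ ^ 4 ≤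
      y * (2 * (Nat.gcd n.val y : ℝ) * (y : ℝ) ^ 3 * d ^ 3) := by
    calc (y : ℝ) * ‖kloosterman m n‖ ^ 4 ≤ d * (Nat.totient y : ℝ) * ‖kloosterman m n‖ ^ 4 := by
          gcongr
      _ = d * ∑ t : (ZMod y)ˣ, F (g t) := by rw [h1]; ring
      _ ≤ d * ((Nat.gcd n.val y : ℝ) * (2 * (y : ℝ) ^ 4 * d ^ 2)) := by
          gcongr
          exact h2.trans (by gcongr)
      _ = _ := by ring
  exact le_of_mul_le_mul_left h5 hy

/-- The weight bounding geometric sums of the additive character `x` modulo `y`. -/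
noncomputable def geomWeight {y : ℕ} (x : ZMod y) : ℝ :=
  (y : ℝ) / 2 * (1 / (x.val : ℝ) + 1 / ((y : ℝ) - x.val))

lemma geomWeight_nonneg {y : ℕ} [NeZero y] (x : ZMod y) : 0 ≤ geomWeight x := by
  have : (x.val : ℝ) < y := by exact_mod_cast ZMod.val_lt x
  have : 0 < (y : ℝ) - x.val := by linarith
  unfold geomWeight
  positivity

lemma two_mul_mul_one_sub_le_sin (t : ℝ) (h0 : 0 ≤ t) (h1 : t ≤ 1) :
    2 * (t * (1 - t)) ≤ Real.sin (π * t) := by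
  have key : ∀ s : ℝ, 0 ≤ s → s ≤ 1 / 2 → 2 * s ≤ Real.sin (π * s) := by
    intro s hs0 hs1
    have := Real.mul_le_sin (x := π * s) (by positivity) (by nlinarith [Real.pi_pos])
    calc 2 * s = 2 / π * (π * s) := by field_simp
      _ ≤ _ := this
  rcases le_total t (1 / 2) with h | h
  · nlinarith [key t h0 h]
  · have := key (1 - t) (by linarith) (by linarith)
    rw [show π * (1 - t) = π - π * t by ring, Real.sin_pi_sub] at this
    nlinarith

lemma two_le_geomWeight_mul_norm_sub_one {y : ℕ} [NeZero y] (x : ZMod y) (hx : x ≠ 0) :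
    2 ≤ geomWeight x * ‖(ZMod.stdAddChar x : ℂ) - 1‖ := by
  have hy : (0 : ℝ) < y := by exact_mod_cast NeZero.pos y
  have hv0 : (0 : ℝ) < x.val := by
    exact_mod_cast Nat.pos_of_ne_zero fun h => hx ((ZMod.val_eq_zero x).mp h)
  have hv1 : (x.val : ℝ) < y := by exact_mod_cast ZMod.val_lt x
  set t : ℝ := x.val / y with ht
  have ht0 : 0 < t := by positivity
  have ht1 : t < 1 := by rw [ht, div_lt_one hy]; exact hv1
  have e1 : (ZMod.stdAddChar x : ℂ) = Complex.exp (Complex.I * ((2 * π * t : ℝ) : ℂ)) := by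
    have : x = ((x.val : ℤ) : ZMod y) := by simp
    conv_lhs => rw [this, ZMod.stdAddChar_coe]
    congr 1
    rw [ht]
    push_cast
    ring
  rw [e1, Complex.norm_exp_I_mul_ofReal_sub_one, show 2 * π * t / 2 = π * t by ring]
  have hs := two_mul_mul_one_sub_le_sin t ht0.le ht1.le
  have hpos : 0 < 2 * (t * (1 - t)) := by
    have : 0 < 1 - t := by linarith
    positivity
  have hn : 4 * (t * (1 - t)) ≤ ‖2 * Real.sin (π * t)‖ := by
    rw [Real.norm_eq_abs]
    exact le_trans (by linarith) (le_abs_self _)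
  have hW : geomWeight x = 1 / (2 * (t * (1 - t))) := by
    unfold geomWeight
    have h3 : (y : ℝ) - x.val ≠ 0 := by linarith
    have hx : (x.val : ℝ) = t * y := by rw [ht]; field_simp
    have h4 : 1 - t ≠ 0 := by linarith
    rw [hx] at h3 ⊢
    have : (y : ℝ) - t * y = y * (1 - t) := by ring
    rw [this]
    field_simp
    ring
  rw [hW]
  calc (2 : ℝ) = 1 / (2 * (t * (1 - t))) * (4 * (t * (1 - t))) := by
        have h4 : 1 - t ≠ 0 := by linarith
        field_simp; norm_num
    _ ≤ _ := by gcongr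

lemma norm_sum_Ico_stdAddChar_le {y : ℕ} [NeZero y] (x : ZMod y) (hx : x ≠ 0) (p q : ℤ) :
    ‖∑ j ∈ Finset.Ico p q, (ZMod.stdAddChar (x * (j : ZMod y)) : ℂ)‖ ≤ geomWeight x := by
  rcases le_or_gt q p with h | h
  · rw [Finset.Ico_eq_empty (by simpa using h)]
    simpa using geomWeight_nonneg x
  have tel : ∀ q : ℤ, p ≤ q → ((ZMod.stdAddChar x : ℂ) - 1) *
      ∑ j ∈ Finset.Ico p q, (ZMod.stdAddChar (x * (j : ZMod y)) : ℂ) =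
      ZMod.stdAddChar (x * (q : ZMod y)) - ZMod.stdAddChar (x * (p : ZMod y)) := by
    intro q hq
    induction q, hq using Int.leInduction with
    | base => simp
    | succ n hn ih =>
      have : Finset.Ico p (n + 1) = insert n (Finset.Ico p n) :=
        (Finset.insert_Ico_right_eq_Ico_succ hn).symm
      rw [this, Finset.sum_insert (by simp), mul_add, ih]
      push_cast
      rw [mul_add, AddChar.map_add_eq_mul, mul_one]
      ring
  have h2 : ‖((ZMod.stdAddChar x : ℂ) - 1) *
      ∑ j ∈ Finset.Ico p q, (ZMod.stdAddChar (x * (j : ZMod y)) : ℂ)‖ ≤ 2 := by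
    rw [tel q h.le]
    refine (norm_sub_le _ _).trans ?_
    rw [AddChar.norm_apply, AddChar.norm_apply]
    norm_num
  rw [norm_mul] at h2
  have h3 := two_le_geomWeight_mul_norm_sub_one x hx
  have h4 : 0 < ‖(ZMod.stdAddChar x : ℂ) - 1‖ := by
    by_contra h5
    have : ‖(ZMod.stdAddChar x : ℂ) - 1‖ = 0 := le_antisymm (not_lt.mp h5) (norm_nonneg _)
    rw [this] at h3
    norm_num at h3
  refine le_of_mul_le_mul_left ?_ h4
  linarith

lemma norm_sum_Ico_modEq_stdAddChar_le {y : ℕ} [NeZero y] (x : ZMod y) (L : ℕ) (hL : 0 < L)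
    (k₀ a b : ℤ) (hab : a ≤ b) :
    ‖∑ k ∈ (Finset.Ico a b).filter (fun k => k ≡ k₀ [ZMOD L]),
      (ZMod.stdAddChar (x * (k : ZMod y)) : ℂ)‖ ≤
      if L • x = 0 then (b - a : ℝ) else geomWeight (L • x) := by
  split_ifs with h
  · calc _ ≤ ∑ k ∈ (Finset.Ico a b).filter (fun k => k ≡ k₀ [ZMOD L]), (1 : ℝ) := by
          refine norm_sum_le_of_le _ fun k _ => ?_
          rw [AddChar.norm_apply]
      _ = (((Finset.Ico a b).filter (fun k => k ≡ k₀ [ZMOD L])).card : ℝ) := by simp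
      _ ≤ ((Finset.Ico a b).card : ℝ) := by exact_mod_cast Finset.card_filter_le _ _
      _ = _ := by
          rw [Int.card_Ico]
          have : (((b - a).toNat : ℤ) : ℝ) = ((b - a : ℤ) : ℝ) := by
            rw [Int.toNat_of_nonneg (by linarith)]
          rw [← Int.cast_natCast, this]; push_cast; ring
  · rw [Int.Ico_filter_modEq_eq, Int.Ico_filter_dvd_eq _ _ (by exact_mod_cast hL),
      Finset.sum_map, Finset.sum_map]
    simp only [Function.Embedding.coeFn_mk]
    have : ∀ j : ℤ, (ZMod.stdAddChar (x * ((j * (L : ℤ) + k₀ : ℤ) : ZMod y)) : ℂ) =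
        ZMod.stdAddChar ((L • x) * (j : ZMod y)) * ZMod.stdAddChar (x * (k₀ : ZMod y)) := by
      intro j
      rw [← AddChar.map_add_eq_mul]
      congr 1
      push_cast
      rw [nsmul_eq_mul]
      ring
    simp only [this]
    rw [← Finset.sum_mul, norm_mul, AddChar.norm_apply, mul_one]
    exact norm_sum_Ico_stdAddChar_le _ h _ _

lemma sum_geomWeight_mul_gcd_le (y : ℕ) [NeZero y] :
    ∑ x ∈ Finset.univ.filter (fun x : ZMod y => x ≠ 0), geomWeight x * (Nat.gcd x.val y : ℝ) ≤
      (y : ℝ) * ((Nat.divisors y).card * (1 + Real.log y)) := by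
  have hy : (0 : ℝ) < y := by exact_mod_cast NeZero.pos y
  have hharm : ∀ N : ℕ, N ≤ y → ∑ v ∈ Finset.Icc 1 N, (1 / (v : ℝ)) ≤ 1 + Real.log y := by
    intro N hN
    rcases Nat.eq_zero_or_pos N with rfl | hN0
    · have : 0 ≤ Real.log y := Real.log_natCast_nonneg y
      simp; linarith
    have := harmonic_le_one_add_log N
    rw [harmonic_eq_sum_Icc] at this
    push_cast at this
    simp only [one_div]
    refine this.trans ?_
    have : Real.log N ≤ Real.log y := Real.log_le_log (by exact_mod_cast hN0) (by exact_mod_cast hN)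
    linarith
  have h1 : ∑ v ∈ Finset.Icc 1 (y - 1), (Nat.gcd v y : ℝ) * (1 / (v : ℝ)) ≤
      (Nat.divisors y).card * (1 + Real.log y) := by
    have hb : ∀ v ∈ Finset.Icc 1 (y - 1), (Nat.gcd v y : ℝ) * (1 / (v : ℝ)) ≤
        ∑ d ∈ y.divisors, if d ∣ v then (d : ℝ) * (1 / v) else 0 := by
      intro v _
      have := Finset.single_le_sum (f := fun d : ℕ => if d ∣ v then (d : ℝ) * (1 / v) else 0)
        (s := y.divisors) (fun d _ => by positivity)
        (Nat.mem_divisors.mpr ⟨Nat.gcd_dvd_right v y, NeZero.ne y⟩)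
      simpa [Nat.gcd_dvd_left] using this
    refine (Finset.sum_le_sum hb).trans ?_
    rw [Finset.sum_comm]
    rw [← nsmul_eq_mul, ← Finset.sum_const]
    refine Finset.sum_le_sum fun d hd => ?_
    have hd0 : 0 < d := Nat.pos_of_mem_divisors hd
    refine le_trans ?_ (hharm (y / d) (Nat.div_le_self y d))
    rw [← Finset.sum_filter]
    have hd0' : (d : ℝ) ≠ 0 := by positivity
    have hinj : Set.InjOn (fun v : ℕ => v / d)
        ((Finset.Icc 1 (y - 1)).filter (fun v => d ∣ v) : Finset ℕ) := by
      intro v hv w hw h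
      simp only [Finset.coe_filter, Set.mem_ofPred_eq] at hv hw
      exact (Nat.div_left_inj hv.2 hw.2).mp h
    calc ∑ v ∈ (Finset.Icc 1 (y - 1)).filter (fun v => d ∣ v), (d : ℝ) * (1 / v)
        = ∑ v ∈ (Finset.Icc 1 (y - 1)).filter (fun v => d ∣ v), 1 / (((v / d : ℕ)) : ℝ) := by
          refine Finset.sum_congr rfl fun v hv => ?_
          rw [Nat.cast_div (Finset.mem_filter.mp hv).2 hd0']
          simp; ring
      _ = ∑ w ∈ ((Finset.Icc 1 (y - 1)).filter (fun v => d ∣ v)).image (fun v => v / d),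
            1 / (w : ℝ) := by rw [Finset.sum_image hinj]
      _ ≤ _ := by
          refine Finset.sum_le_sum_of_subset_of_nonneg ?_ fun _ _ _ => by positivity
          intro w hw
          obtain ⟨v, hv, rfl⟩ := Finset.mem_image.mp hw
          obtain ⟨hv1, hv2⟩ := Finset.mem_filter.mp hv
          rw [Finset.mem_Icc] at hv1 ⊢
          exact ⟨Nat.div_pos (Nat.le_of_dvd (by omega) hv2) hd0,
            Nat.div_le_div_right (by omega)⟩
  have h2 : ∑ v ∈ Finset.Icc 1 (y - 1), (Nat.gcd v y : ℝ) * (1 / ((y : ℝ) - v)) =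
      ∑ v ∈ Finset.Icc 1 (y - 1), (Nat.gcd v y : ℝ) * (1 / (v : ℝ)) := by
    refine Finset.sum_nbij' (fun v => y - v) (fun v => y - v) ?_ ?_ ?_ ?_ ?_
    · intro v hv; simp only [Finset.mem_Icc] at hv ⊢; omega
    · intro v hv; simp only [Finset.mem_Icc] at hv ⊢; omega
    · intro v hv; simp only [Finset.mem_Icc] at hv; omega
    · intro v hv; simp only [Finset.mem_Icc] at hv; omega
    · intro v hv
      simp only [Finset.mem_Icc] at hv
      rw [Nat.cast_sub (by omega), Nat.gcd_self_sub_left (by omega)]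
  have h3 : ∑ x ∈ Finset.univ.filter (fun x : ZMod y => x ≠ 0),
      geomWeight x * (Nat.gcd x.val y : ℝ) =
      ∑ v ∈ Finset.Icc 1 (y - 1), (y : ℝ) / 2 * ((Nat.gcd v y : ℝ) * (1 / (v : ℝ)) +
        (Nat.gcd v y : ℝ) * (1 / ((y : ℝ) - v))) := by
    refine Finset.sum_nbij (fun x => x.val) ?_ ?_ ?_ ?_
    · intro x hx
      have h0 : x ≠ 0 := by simpa using hx
      have := ZMod.val_lt x
      have h1 : x.val ≠ 0 := fun h => h0 ((ZMod.val_eq_zero x).mp h)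
      simp only [Finset.mem_Icc]; omega
    · intro x _ x' _ h
      exact ZMod.val_injective y h
    · intro v hv
      simp only [Finset.coe_Icc, Set.mem_Icc] at hv
      refine ⟨(v : ZMod y), ?_, ZMod.val_cast_of_lt (by omega)⟩
      have : (v : ZMod y).val = v := ZMod.val_cast_of_lt (by omega)
      simp only [Finset.coe_filter, Finset.mem_univ, true_and, Set.mem_ofPred_eq]
      intro h
      rw [h, ZMod.val_zero] at this
      omega
    · intro x _
      unfold geomWeight
      ring
  rw [h3, ← Finset.mul_sum, Finset.sum_add_distrib, h2]
  calc _ = (y : ℝ) * ∑ v ∈ Finset.Icc 1 (y - 1), (Nat.gcd v y : ℝ) * (1 / (v : ℝ)) := by ring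
    _ ≤ _ := by gcongr

lemma card_nsmul_eq_le {y : ℕ} [NeZero y] (L : ℕ) (hL : 0 < L) (c : ZMod y) :
    (Finset.univ.filter fun t : ZMod y => L • t = c).card ≤ L := by
  rcases (Finset.univ.filter fun t : ZMod y => L • t = c).eq_empty_or_nonempty with h | ⟨t₀, h₀⟩
  · rw [h]; simp
  refine le_trans ?_ (IsAddCyclic.card_nsmul_eq_zero_le (α := ZMod y) hL)
  refine Finset.card_le_card_of_injOn (fun t => t - t₀) ?_ ?_
  · intro t ht
    simp only [Finset.coe_filter, Finset.mem_filter, Finset.mem_univ, true_and,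
      Set.mem_ofPred_eq] at ht h₀ ⊢
    rw [nsmul_sub, ht, h₀, sub_self]
  · intro t _ t' _ h
    simpa using h

/-- The size of the generic Kloosterman sum bound. -/
noncomputable def kloostermanSize (y : ℕ) : ℝ :=
  (2 * (y : ℝ) ^ 3 * ((Nat.divisors y).card : ℝ) ^ 3) ^ (1 / 4 : ℝ)

/-- The number of divisors of `y` times a logarithm. -/
noncomputable def divisorLog (y : ℕ) : ℝ := (Nat.divisors y).card * (1 + Real.log y)

lemma norm_kloosterman_le {y : ℕ} [NeZero y] (m n : ZMod y) :
    ‖kloosterman m n‖ ≤ (Nat.gcd n.val y : ℝ) * kloostermanSize y := by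
  have h1 := norm_kloosterman_pow_four_le m n
  have hg : (1 : ℝ) ≤ Nat.gcd n.val y := by
    exact_mod_cast Nat.gcd_pos_of_pos_right n.val (NeZero.pos y)
  have h2 : kloostermanSize y ^ 4 = 2 * (y : ℝ) ^ 3 * ((Nat.divisors y).card : ℝ) ^ 3 := by
    unfold kloostermanSize
    rw [← Real.rpow_natCast, ← Real.rpow_mul (by positivity)]
    norm_num
  have h3 : 0 ≤ kloostermanSize y := by unfold kloostermanSize; positivity
  refine le_of_pow_le_pow_left₀ (n := 4) (by norm_num) (by positivity) (h1.trans ?_)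
  rw [mul_pow, h2]
  have : (Nat.gcd n.val y : ℝ) ≤ (Nat.gcd n.val y : ℝ) ^ 4 := le_self_pow₀ hg (by norm_num)
  calc 2 * (Nat.gcd n.val y : ℝ) * (y : ℝ) ^ 3 * ((Nat.divisors y).card : ℝ) ^ 3
      = (Nat.gcd n.val y : ℝ) * (2 * (y : ℝ) ^ 3 * ((Nat.divisors y).card : ℝ) ^ 3) := by ring
    _ ≤ _ := by gcongr

lemma stdAddChar_inv_expansion {y : ℕ} [NeZero y] (g k : ZMod y) :
    (if IsUnit k then (ZMod.stdAddChar (g * k⁻¹) : ℂ) else 0) =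
      (1 / (y : ℂ)) * ∑ m : ZMod y, kloosterman m g * ZMod.stdAddChar (m * (-k)) := by
  have hy : (y : ℂ) ≠ 0 := by exact_mod_cast NeZero.ne y
  have hprim := ZMod.isPrimitive_stdAddChar y
  have hS : ∀ c : ZMod y, ∑ m : ZMod y, (ZMod.stdAddChar (m * c) : ℂ) =
      if c = 0 then (y : ℂ) else 0 := by
    intro c
    rw [AddChar.sum_mulShift c hprim, ZMod.card]
    split_ifs <;> simp
  have h1 : ∑ m : ZMod y, kloosterman m g * (ZMod.stdAddChar (m * (-k)) : ℂ) =
      ∑ u : (ZMod y)ˣ, (ZMod.stdAddChar (g * ((u⁻¹ : (ZMod y)ˣ) : ZMod y)) : ℂ) *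
        if (u : ZMod y) = k then (y : ℂ) else 0 := by
    unfold kloosterman
    simp only [Finset.sum_mul]
    rw [Finset.sum_comm]
    refine Finset.sum_congr rfl fun u _ => ?_
    have := hS ((u : ZMod y) - k)
    simp only [sub_eq_zero] at this
    rw [← this, Finset.mul_sum]
    refine Finset.sum_congr rfl fun m _ => ?_
    rw [← AddChar.map_add_eq_mul, ← AddChar.map_add_eq_mul]
    congr 1
    ring
  rw [h1]
  split_ifs with hk
  · obtain ⟨u, rfl⟩ := hk
    rw [Finset.sum_eq_single u]
    · rw [if_pos rfl, ZMod.inv_coe_unit]; field_simp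
    · intro v _ hv
      rw [if_neg fun h => hv (Units.ext h), mul_zero]
    · simp
  · rw [Finset.sum_eq_zero, mul_zero]
    intro u _
    rw [if_neg, mul_zero]
    rintro rfl
    exact hk u.isUnit

lemma norm_sum_stdAddChar_inv_le {y : ℕ} [NeZero y] (g : ZMod y) (L : ℕ) (hL : 0 < L)
    (k₀ a b : ℤ) (hab : a ≤ b) :
    ‖∑ k ∈ (Finset.Ico a b).filter (fun k => k ≡ k₀ [ZMOD L]),
      (if IsUnit (k : ZMod y) then (ZMod.stdAddChar (g * (k : ZMod y)⁻¹) : ℂ) else 0)‖ ≤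
    (Nat.gcd g.val y : ℝ) * (kloostermanSize y * L * ((b - a : ℝ) / y + divisorLog y)) := by
  have hy : (0 : ℝ) < y := by exact_mod_cast NeZero.pos y
  have hab' : (0 : ℝ) ≤ b - a := by
    have : (a : ℝ) ≤ b := by exact_mod_cast hab
    linarith
  have hks : 0 ≤ kloostermanSize y := by unfold kloostermanSize; positivity
  set S := (Finset.Ico a b).filter (fun k => k ≡ k₀ [ZMOD L]) with hS
  set φ : ZMod y → ℝ := fun x => if x = 0 then (b - a : ℝ) else geomWeight x with hφ
  have hφ0 : ∀ x, 0 ≤ φ x := by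
    intro x
    simp only [hφ]
    split_ifs
    · exact hab'
    · exact geomWeight_nonneg x
  have h1 : ∑ k ∈ S,
      (if IsUnit (k : ZMod y) then (ZMod.stdAddChar (g * (k : ZMod y)⁻¹) : ℂ) else 0) =
      (1 / (y : ℂ)) * ∑ m : ZMod y, kloosterman m g *
        ∑ k ∈ S, (ZMod.stdAddChar ((-m) * (k : ZMod y)) : ℂ) := by
    simp only [stdAddChar_inv_expansion, ← Finset.mul_sum]
    rw [Finset.sum_comm]
    congr 1
    refine Finset.sum_congr rfl fun m _ => ?_
    rw [Finset.mul_sum]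
    refine Finset.sum_congr rfl fun k _ => ?_
    rw [mul_neg, neg_mul]
  have h2 : ∑ x, φ x ≤ (b - a : ℝ) + y * divisorLog y := by
    rw [← Finset.sum_filter_add_sum_filter_not _ (fun x : ZMod y => x = 0)]
    refine add_le_add ?_ ?_
    · rw [Finset.filter_eq' _ (0 : ZMod y), if_pos (Finset.mem_univ _)]
      simp [hφ]
    · refine le_trans ?_ (sum_geomWeight_mul_gcd_le y)
      refine Finset.sum_le_sum fun x hx => ?_
      have hx0 : x ≠ 0 := by simpa using hx
      simp only [hφ, if_neg hx0]
      have hg : (1 : ℝ) ≤ Nat.gcd x.val y := by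
        exact_mod_cast Nat.gcd_pos_of_pos_right x.val (NeZero.pos y)
      nlinarith [geomWeight_nonneg x]
  have h3 : ∑ m : ZMod y, φ (L • (-m)) ≤ L * ∑ x, φ x := by
    rw [Finset.sum_comp φ (fun m : ZMod y => L • (-m)), Finset.mul_sum]
    calc _ ≤ ∑ x ∈ Finset.univ.image (fun m : ZMod y => L • (-m)), (L : ℝ) * φ x := by
          refine Finset.sum_le_sum fun x _ => ?_
          rw [nsmul_eq_mul]
          refine mul_le_mul_of_nonneg_right ?_ (hφ0 x)
          norm_cast
          refine le_trans (Finset.card_le_card_of_injOn (fun t => -t) ?_ ?_)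
            (card_nsmul_eq_le L hL x)
          · intro t ht
            simpa using ht
          · intro t _ t' _ h
            simpa using h
      _ ≤ _ := Finset.sum_le_sum_of_subset_of_nonneg (Finset.subset_univ _)
          fun x _ _ => mul_nonneg (by positivity) (hφ0 x)
  rw [h1, norm_mul]
  have h4 : ‖(1 / (y : ℂ))‖ = 1 / y := by simp
  rw [h4]
  calc (1 / (y : ℝ)) * ‖∑ m : ZMod y, kloosterman m g *
        ∑ k ∈ S, (ZMod.stdAddChar ((-m) * (k : ZMod y)) : ℂ)‖
      ≤ (1 / (y : ℝ)) * ∑ m : ZMod y,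
          ((Nat.gcd g.val y : ℝ) * kloostermanSize y) * φ (L • (-m)) := by
        gcongr
        refine norm_sum_le_of_le _ fun m _ => ?_
        rw [norm_mul]
        refine mul_le_mul (norm_kloosterman_le m g) ?_ (norm_nonneg _) (by positivity)
        exact norm_sum_Ico_modEq_stdAddChar_le (-m) L hL k₀ a b hab
    _ ≤ (1 / (y : ℝ)) * (((Nat.gcd g.val y : ℝ) * kloostermanSize y) *
          (L * ((b - a : ℝ) + y * divisorLog y))) := by
        rw [← Finset.mul_sum]
        have : ∑ m : ZMod y, φ (L • (-m)) ≤ L * ((b - a : ℝ) + y * divisorLog y) :=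
          h3.trans (by gcongr)
        gcongr
    _ = _ := by field_simp

lemma gcd_val_neg {y : ℕ} [NeZero y] (h : ZMod y) : Nat.gcd (-h).val y = Nat.gcd h.val y := by
  rw [ZMod.neg_val]
  split_ifs with h0
  · simp [h0]
  · rw [Nat.gcd_comm, Nat.gcd_comm h.val, Nat.gcd_self_sub_right (ZMod.val_lt h).le]

lemma abs_sum_card_hyperbola_sub_le {y : ℕ} [NeZero y] (L : ℕ) (hL : 0 < L) (k₀ a b B C σ : ℤ)
    (hσ : σ = 1 ∨ σ = -1) (hab : a ≤ b) (hBC : B ≤ C) :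
    |∑ k ∈ (Finset.Ico a b).filter (fun k => k ≡ k₀ [ZMOD L]), (if IsUnit (k : ZMod y) then
      ((((Finset.Ioc B C).filter (fun n : ℤ => (k : ZMod y) * n + σ = 0)).card : ℝ) -
        (C - B : ℝ) / y) else 0)| ≤
      divisorLog y * (kloostermanSize y * L * ((b - a : ℝ) / y + divisorLog y)) := by
  have hy : (0 : ℝ) < y := by exact_mod_cast NeZero.pos y
  have hyc : (y : ℂ) ≠ 0 := by exact_mod_cast NeZero.ne y
  have hks : 0 ≤ kloostermanSize y := by unfold kloostermanSize; positivity
  have hdl : 0 ≤ divisorLog y := by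
    unfold divisorLog
    have := Real.log_natCast_nonneg y
    positivity
  have hab' : (0 : ℝ) ≤ b - a := by
    have : (a : ℝ) ≤ b := by exact_mod_cast hab
    linarith
  have hprim := ZMod.isPrimitive_stdAddChar y
  have hSum : ∀ c : ZMod y, ∑ m : ZMod y, (ZMod.stdAddChar (m * c) : ℂ) =
      if c = 0 then (y : ℂ) else 0 := by
    intro c
    rw [AddChar.sum_mulShift c hprim, ZMod.card]
    split_ifs <;> simp
  set S := (Finset.Ico a b).filter (fun k => k ≡ k₀ [ZMOD L]) with hS
  set N : ZMod y → ℂ := fun h => ∑ n ∈ Finset.Ioc B C, (ZMod.stdAddChar (h * (n : ZMod y)) : ℂ)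
    with hN
  have hN0 : N 0 = (C - B : ℂ) := by
    simp only [hN, zero_mul, AddChar.map_zero_eq_one, Finset.sum_const, Int.card_Ioc, nsmul_eq_mul,
      mul_one]
    have : (((C - B).toNat : ℤ) : ℂ) = ((C - B : ℤ) : ℂ) := by
      rw [Int.toNat_of_nonneg (by linarith)]
    rw [← Int.cast_natCast, this]; push_cast; ring
  have hterm : ∀ k : ZMod y, (if IsUnit k then
      ((((Finset.Ioc B C).filter (fun n : ℤ => k * n + σ = 0)).card : ℂ) -
        (C - B : ℂ) / y) else 0) =
      (1 / (y : ℂ)) * ∑ h ∈ Finset.univ.filter (fun h : ZMod y => h ≠ 0), N h *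
        (if IsUnit k then (ZMod.stdAddChar ((h * (σ : ZMod y)) * k⁻¹) : ℂ) else 0) := by
    intro k
    split_ifs with hk
    · have e1 : (((Finset.Ioc B C).filter (fun n : ℤ => k * n + σ = 0)).card : ℂ) =
          (1 / (y : ℂ)) * ∑ h : ZMod y, N h * (ZMod.stdAddChar ((h * (σ : ZMod y)) * k⁻¹) : ℂ) := by
        have e2 : ∀ n : ℤ, (∑ h : ZMod y, (ZMod.stdAddChar (h * ((n : ZMod y) + (σ : ZMod y) * k⁻¹)) : ℂ)) =
            if k * n + σ = 0 then (y : ℂ) else 0 := by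
          intro n
          rw [hSum]
          have : ((n : ZMod y) + (σ : ZMod y) * k⁻¹ = 0) ↔ k * n + σ = 0 := by
            have hkk : k * k⁻¹ = 1 := ZMod.mul_inv_of_unit k hk
            constructor
            · intro h
              calc k * n + σ = k * ((n : ZMod y) + (σ : ZMod y) * k⁻¹) := by
                    linear_combination (-(σ : ZMod y)) * hkk
                _ = 0 := by rw [h, mul_zero]
            · intro h
              calc (n : ZMod y) + (σ : ZMod y) * k⁻¹ = k⁻¹ * (k * n + σ) := by
                    linear_combination (-(n : ZMod y)) * hkk
                _ = 0 := by rw [h, mul_zero]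
          simp only [this]
        rw [Finset.card_filter]
        push_cast
        simp only [hN, Finset.sum_mul]
        rw [Finset.sum_comm, Finset.mul_sum]
        refine Finset.sum_congr rfl fun n _ => ?_
        have := e2 n
        have e3 : ∑ h : ZMod y, (ZMod.stdAddChar (h * (n : ZMod y)) : ℂ) *
            ZMod.stdAddChar (h * (σ : ZMod y) * k⁻¹) = if k * n + σ = 0 then (y : ℂ) else 0 := by
          rw [← this]
          refine Finset.sum_congr rfl fun h _ => ?_
          rw [← AddChar.map_add_eq_mul]
          congr 1
          ring
        rw [e3]
        split_ifs <;> simp [hyc]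
      rw [e1, ← Finset.sum_filter_add_sum_filter_not _ (fun h : ZMod y => h = 0)]
      rw [Finset.filter_eq' _ (0 : ZMod y), if_pos (Finset.mem_univ _), Finset.sum_singleton, hN0]
      simp only [zero_mul, AddChar.map_zero_eq_one, mul_one]
      ring
    · simp
  have key : ((∑ k ∈ S, (if IsUnit (k : ZMod y) then
      ((((Finset.Ioc B C).filter (fun n : ℤ => (k : ZMod y) * n + σ = 0)).card : ℝ) -
        (C - B : ℝ) / y) else 0) : ℝ) : ℂ) =
      (1 / (y : ℂ)) * ∑ h ∈ Finset.univ.filter (fun h : ZMod y => h ≠ 0), N h *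
        ∑ k ∈ S, (if IsUnit (k : ZMod y) then
          (ZMod.stdAddChar ((h * (σ : ZMod y)) * (k : ZMod y)⁻¹) : ℂ) else 0) := by
    push_cast
    calc _ = ∑ k ∈ S, (1 / (y : ℂ)) * ∑ h ∈ Finset.univ.filter (fun h : ZMod y => h ≠ 0), N h *
        (if IsUnit (k : ZMod y) then (ZMod.stdAddChar ((h * (σ : ZMod y)) * (k : ZMod y)⁻¹) : ℂ) else 0) := by
          refine Finset.sum_congr rfl fun k _ => ?_
          rw [← hterm]
          split_ifs <;> push_cast <;> rfl
      _ = _ := by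
          rw [← Finset.mul_sum, Finset.sum_comm]
          simp only [Finset.mul_sum]
  rw [← Real.norm_eq_abs, ← Complex.norm_real, key, norm_mul]
  have h4 : ‖(1 / (y : ℂ))‖ = 1 / y := by simp
  rw [h4]
  set R : ℝ := kloostermanSize y * L * ((b - a : ℝ) / y + divisorLog y) with hR
  have hR0 : 0 ≤ R := by positivity
  calc _ ≤ (1 / (y : ℝ)) * ∑ h ∈ Finset.univ.filter (fun h : ZMod y => h ≠ 0),
        (geomWeight h * (Nat.gcd h.val y : ℝ)) * R := by
        gcongr
        refine norm_sum_le_of_le _ fun h hh => ?_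
        have hh0 : h ≠ 0 := by simpa using hh
        rw [norm_mul, mul_assoc]
        refine mul_le_mul ?_ ?_ (norm_nonneg _) (geomWeight_nonneg h)
        · have : Finset.Ioc B C = Finset.Ico (B + 1) (C + 1) := by
            ext x; simp only [Finset.mem_Ioc, Finset.mem_Ico]; omega
          simp only [hN, this]
          exact norm_sum_Ico_stdAddChar_le h hh0 _ _
        · have := norm_sum_stdAddChar_inv_le (h * (σ : ZMod y)) L hL k₀ a b hab
          have hg : Nat.gcd (h * (σ : ZMod y)).val y = Nat.gcd h.val y := by
            rcases hσ with rfl | rfl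
            · simp
            · push_cast
              rw [mul_neg, mul_one, gcd_val_neg]
          rw [hg] at this
          exact this
    _ ≤ (1 / (y : ℝ)) * ((y * divisorLog y) * R) := by
        rw [← Finset.sum_mul]
        gcongr
        exact sum_geomWeight_mul_gcd_le y
    _ = _ := by field_simp

lemma exists_one_add_log_le (δ : ℝ) (hδ : 0 < δ) :
    ∃ C : ℝ, 1 ≤ C ∧ ∀ x : ℝ, 1 ≤ x → 1 + Real.log x ≤ C * x ^ δ := by
  refine ⟨1 + 1 / δ, by have : 0 < 1 / δ := by positivity
                        linarith, fun x hx => ?_⟩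
  have h1 := Real.log_le_rpow_div (by linarith : 0 ≤ x) hδ
  have h2 : 1 ≤ x ^ δ := Real.one_le_rpow hx hδ.le
  calc 1 + Real.log x ≤ x ^ δ + x ^ δ / δ := add_le_add h2 h1
    _ = _ := by ring

/-- Equidistribution of the solutions of `k n + σ ≡ 0` modulo `y` on average over an interval
of `k` in a residue class. -/
lemma exists_card_hyperbola_le (L : ℕ) (hL : 0 < L) (δ : ℝ) (hδ : 0 < δ) :
    ∃ K : ℝ, 1 ≤ K ∧ ∀ (y : ℕ) [NeZero y] (k₀ a b B C σ : ℤ), (σ = 1 ∨ σ = -1) → a ≤ b → B ≤ C →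
    |∑ k ∈ (Finset.Ico a b).filter (fun k => k ≡ k₀ [ZMOD L]), (if IsUnit (k : ZMod y) then
      ((((Finset.Ioc B C).filter (fun n : ℤ => (k : ZMod y) * n + σ = 0)).card : ℝ) -
        (C - B : ℝ) / y) else 0)| ≤
      K * (1 + (b - a : ℝ) / y) * (y : ℝ) ^ (3 / 4 + δ) := by
  obtain ⟨C₁, hC₁, h1⟩ := exists_card_divisors_le (δ / 5) (by positivity)
  obtain ⟨C₂, hC₂, h2⟩ := exists_one_add_log_le (δ / 5) (by positivity)
  have hL1 : (1 : ℝ) ≤ L := by exact_mod_cast hL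
  have hp : (1 : ℝ) ≤ (2 * C₁ ^ 3) ^ (1 / 4 : ℝ) := by
    apply Real.one_le_rpow _ (by norm_num)
    have := one_le_pow₀ hC₁ (n := 3)
    linarith
  have hq : 1 ≤ C₁ * C₂ := one_le_mul_of_one_le_of_one_le hC₁ hC₂
  refine ⟨(C₁ * C₂) ^ 2 * (2 * C₁ ^ 3) ^ (1 / 4 : ℝ) * L, ?_, ?_⟩
  · exact one_le_mul_of_one_le_of_one_le
      (one_le_mul_of_one_le_of_one_le (one_le_pow₀ hq) hp) hL1
  intro y _ k₀ a b B C σ hσ hab hBC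
  refine (abs_sum_card_hyperbola_sub_le L hL k₀ a b B C σ hσ hab hBC).trans ?_
  have hy0 : 0 < y := NeZero.pos y
  have hy1 : (1 : ℝ) ≤ y := by exact_mod_cast hy0
  have hy : (0 : ℝ) < y := by linarith
  have hd := h1 y hy0
  have hl := h2 y hy1
  have hd1 : (1 : ℝ) ≤ (Nat.divisors y).card := by
    have : 0 < (Nat.divisors y).card := Finset.card_pos.mpr ⟨1, by simp [NeZero.ne y]⟩
    exact_mod_cast this
  have hl0 : 0 ≤ Real.log y := Real.log_natCast_nonneg y
  have hab' : (0 : ℝ) ≤ b - a := by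
    have : (a : ℝ) ≤ b := by exact_mod_cast hab
    linarith
  set Y := (y : ℝ) ^ (δ / 5) with hY
  have hY1 : 1 ≤ Y := Real.one_le_rpow hy1 (by positivity)
  have hD1 : 1 ≤ divisorLog y := by
    unfold divisorLog
    exact one_le_mul_of_one_le_of_one_le hd1 (by linarith)
  have hD : divisorLog y ≤ (C₁ * C₂) * Y ^ 2 := by
    unfold divisorLog
    calc _ ≤ (C₁ * Y) * (C₂ * Y) := by gcongr
      _ = _ := by ring
  have hK : kloostermanSize y ≤ (2 * C₁ ^ 3) ^ (1 / 4 : ℝ) * ((y : ℝ) ^ (3 / 4 : ℝ) * Y) := by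
    unfold kloostermanSize
    calc (2 * (y : ℝ) ^ 3 * ((Nat.divisors y).card : ℝ) ^ 3) ^ (1 / 4 : ℝ)
        ≤ (2 * (y : ℝ) ^ 3 * (C₁ * Y) ^ 3) ^ (1 / 4 : ℝ) := by gcongr
      _ = ((2 * C₁ ^ 3) * ((y : ℝ) ^ 3 * Y ^ 3)) ^ (1 / 4 : ℝ) := by congr 1; ring
      _ = (2 * C₁ ^ 3) ^ (1 / 4 : ℝ) * ((y : ℝ) ^ (3 / 4 : ℝ) * Y ^ (3 / 4 : ℝ)) := by
          have hcube : ∀ x : ℝ, 0 ≤ x → (x ^ 3) ^ (1 / 4 : ℝ) = x ^ (3 / 4 : ℝ) := by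
            intro x hx
            rw [← Real.rpow_natCast, ← Real.rpow_mul hx]
            norm_num
          rw [Real.mul_rpow (by positivity) (by positivity),
            Real.mul_rpow (x := (y : ℝ) ^ 3) (by positivity) (by positivity),
            hcube _ (by positivity), hcube _ (by positivity)]
      _ ≤ _ := by
          gcongr
          calc Y ^ (3 / 4 : ℝ) ≤ Y ^ (1 : ℝ) := Real.rpow_le_rpow_of_exponent_le hY1 (by norm_num)
            _ = Y := Real.rpow_one Y
  have hks : 0 ≤ kloostermanSize y := by unfold kloostermanSize; positivity
  have hYpow : (y : ℝ) ^ (3 / 4 + δ) = (y : ℝ) ^ (3 / 4 : ℝ) * Y ^ 5 := by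
    rw [hY, ← Real.rpow_natCast, ← Real.rpow_mul hy.le, ← Real.rpow_add hy]
    congr 1
    push_cast
    ring
  rw [hYpow]
  calc divisorLog y * (kloostermanSize y * L * ((b - a : ℝ) / y + divisorLog y))
      ≤ divisorLog y * (kloostermanSize y * L * (divisorLog y * (1 + (b - a : ℝ) / y))) := by
        have : (b - a : ℝ) / y + divisorLog y ≤ divisorLog y * (1 + (b - a : ℝ) / y) := by
          have : 0 ≤ (b - a : ℝ) / y := by positivity
          nlinarith
        gcongr
    _ = divisorLog y ^ 2 * kloostermanSize y * L * (1 + (b - a : ℝ) / y) := by ring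
    _ ≤ ((C₁ * C₂) * Y ^ 2) ^ 2 * ((2 * C₁ ^ 3) ^ (1 / 4 : ℝ) * ((y : ℝ) ^ (3 / 4 : ℝ) * Y)) *
          L * (1 + (b - a : ℝ) / y) := by gcongr
    _ = _ := by ring

lemma exists_card_hyperbola_ordConnected_le (L : ℕ) (hL : 0 < L) (δ : ℝ) (hδ : 0 < δ) :
    ∃ K : ℝ, 1 ≤ K ∧ ∀ (y : ℕ) [NeZero y] (A : Finset ℤ) (α β B C σ : ℤ),
      (A : Set ℤ).OrdConnected → (σ = 1 ∨ σ = -1) → B ≤ C →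
    |∑ k ∈ A.filter (fun k => (L : ℤ) ∣ α * k + β ∧ IsUnit (k : ZMod y)),
      ((((Finset.Ioc B C).filter (fun n : ℤ => (y : ℤ) ∣ k * n + σ)).card : ℝ) -
        (C - B : ℝ) / y)| ≤
      K * (1 + (A.card : ℝ) / y) * (y : ℝ) ^ (3 / 4 + δ) := by
  obtain ⟨K, hK, h⟩ := exists_card_hyperbola_le L hL δ hδ
  have hL1 : (1 : ℝ) ≤ L := by exact_mod_cast hL
  refine ⟨L * K, one_le_mul_of_one_le_of_one_le hL1 hK, ?_⟩
  intro y _ A α β B C σ hA hσ hBC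
  have hy : (0 : ℝ) < y := by exact_mod_cast NeZero.pos y
  obtain ⟨a, b, hab, hAeq⟩ : ∃ a b : ℤ, a ≤ b ∧ A = Finset.Ico a b := by
    rcases A.eq_empty_or_nonempty with rfl | hne
    · exact ⟨0, 0, le_rfl, by simp⟩
    · refine ⟨A.min' hne, A.max' hne + 1, ?_, ?_⟩
      · have := A.min'_le_max' hne; omega
      · ext x
        rw [Finset.mem_Ico]
        constructor
        · intro hx
          have := A.min'_le x hx
          have := A.le_max' x hx
          omega
        · intro hx
          have := hA.out (Finset.mem_coe.mpr (A.min'_mem hne)) (Finset.mem_coe.mpr (A.max'_mem hne))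
          exact this ⟨hx.1, by omega⟩
  have hcard : (A.card : ℝ) = b - a := by
    rw [hAeq, Int.card_Ico]
    have : (((b - a).toNat : ℤ) : ℝ) = ((b - a : ℤ) : ℝ) := by
      rw [Int.toNat_of_nonneg (by linarith)]
    rw [← Int.cast_natCast, this]; push_cast; ring
  rw [hcard]
  set G : ℤ → ℝ := fun k => if IsUnit (k : ZMod y) then
      ((((Finset.Ioc B C).filter (fun n : ℤ => (k : ZMod y) * n + σ = 0)).card : ℝ) -
        (C - B : ℝ) / y) else 0 with hG
  have e1 : ∑ k ∈ A.filter (fun k => (L : ℤ) ∣ α * k + β ∧ IsUnit (k : ZMod y)),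
      ((((Finset.Ioc B C).filter (fun n : ℤ => (y : ℤ) ∣ k * n + σ)).card : ℝ) -
        (C - B : ℝ) / y) =
      ∑ k ∈ (Finset.Ico a b).filter (fun k => (L : ℤ) ∣ α * k + β), G k := by
    rw [← Finset.filter_filter, Finset.sum_filter, hAeq]
    refine Finset.sum_congr rfl fun k _ => ?_
    simp only [hG]
    have : ∀ n : ℤ, ((y : ℤ) ∣ k * n + σ) ↔ (k : ZMod y) * n + σ = 0 := by
      intro n
      rw [← ZMod.intCast_zmod_eq_zero_iff_dvd]
      push_cast
      rfl
    simp only [this]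
  have hmod : ∀ k k₀ : ℤ, k ≡ k₀ [ZMOD L] → ((L : ℤ) ∣ α * k + β ↔ (L : ℤ) ∣ α * k₀ + β) := by
    intro k k₀ hk
    have h1 : (L : ℤ) ∣ (α * k₀ + β) - (α * k + β) := by
      have h2 := (Int.modEq_iff_dvd.mp hk).mul_left α
      have h3 : (α * k₀ + β) - (α * k + β) = α * (k₀ - k) := by ring
      rw [h3]; exact h2
    exact ⟨fun h2 => (dvd_iff_dvd_of_dvd_sub h1).mpr h2, fun h2 => (dvd_iff_dvd_of_dvd_sub h1).mp h2⟩
  have hL0 : (0 : ℤ) < L := by exact_mod_cast hL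
  have e2 : ∑ k ∈ (Finset.Ico a b).filter (fun k => (L : ℤ) ∣ α * k + β), G k =
      ∑ k₀ ∈ Finset.Ico (0 : ℤ) L, if (L : ℤ) ∣ α * k₀ + β then
        ∑ k ∈ (Finset.Ico a b).filter (fun k => k ≡ k₀ [ZMOD L]), G k else 0 := by
    rw [← Finset.sum_fiberwise_of_maps_to (t := Finset.Ico (0 : ℤ) L) (g := fun k => k % L)]
    · refine Finset.sum_congr rfl fun k₀ hk₀ => ?_
      rw [Finset.filter_filter]
      have hk₀' : k₀ % L = k₀ := by
        rw [Finset.mem_Ico] at hk₀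
        exact Int.emod_eq_of_lt hk₀.1 hk₀.2
      split_ifs with hd
      · refine Finset.sum_congr ?_ fun _ _ => rfl
        ext k
        simp only [Finset.mem_filter, and_congr_right_iff]
        intro _
        constructor
        · rintro ⟨_, h⟩
          rw [Int.ModEq, h, hk₀']
        · intro h
          exact ⟨(hmod k k₀ h).mpr hd, by rw [Int.ModEq, hk₀'] at h; exact h⟩
      · refine Finset.sum_eq_zero fun k hk => ?_
        obtain ⟨_, h1, h2⟩ := Finset.mem_filter.mp hk
        exact absurd ((hmod k k₀ (by rw [Int.ModEq, h2, hk₀'])).mp h1) hd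
    · intro k _
      rw [Finset.mem_Ico]
      exact ⟨Int.emod_nonneg _ hL0.ne', Int.emod_lt_of_pos _ hL0⟩
  rw [e1, e2]
  refine (Finset.abs_sum_le_sum_abs _ _).trans ?_
  have hba : (0 : ℝ) ≤ b - a := by
    have : (a : ℝ) ≤ b := by exact_mod_cast hab
    linarith
  calc _ ≤ ∑ k₀ ∈ Finset.Ico (0 : ℤ) L, K * (1 + (b - a : ℝ) / y) * (y : ℝ) ^ (3 / 4 + δ) := by
        refine Finset.sum_le_sum fun k₀ _ => ?_
        split_ifs
        · exact h y k₀ a b B C σ hσ hab hBC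
        · rw [abs_zero]; positivity
    _ = _ := by
        rw [Finset.sum_const, Int.card_Ico, nsmul_eq_mul]
        simp; ring

/-- The number of solutions of `a r + σ ≡ 0 (mod q)` with `Q - q < r ≤ s`. -/
noncomputable def hypCount (σ Q s a q : ℤ) : ℕ :=
  ((Finset.Ioc (Q - q) s).filter fun r => q ∣ a * r + σ).card

/-- The deviation of `hypCount` from its expected value. -/
noncomputable def hypDisc (σ Q s a q : ℤ) : ℝ := hypCount σ Q s a q - (s - Q + q : ℝ) / q

/-- A unimodular change of variables exchanging the modulus `q` for `y`. -/
lemma hypCount_eq_card (p t m n x y σ Q s : ℤ) (hdet : p * m - t * n = 1) (hy : 0 < y)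
    (hq : 0 < t * x + m * y) :
    hypCount σ Q s (p * x + n * y) (t * x + m * y) =
      ((Finset.Ioc ⌊((y * (Q - (t * x + m * y)) - t * σ : ℤ) : ℝ) / ((t * x + m * y : ℤ) : ℝ)⌋
        ⌊((y * s - t * σ : ℤ) : ℝ) / ((t * x + m * y : ℤ) : ℝ)⌋).filter
          fun r => y ∣ x * r + σ).card := by
  unfold hypCount
  set q := t * x + m * y with hqdef
  set a := p * x + n * y with hadef
  have hx : x = m * a - n * q := by rw [hqdef, hadef]; linear_combination -x * hdet
  have hyy : y = p * q - t * a := by rw [hqdef, hadef]; linear_combination -y * hdet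
  have hq' : (0 : ℝ) < (q : ℝ) := by exact_mod_cast hq
  have hlt : ∀ z r : ℤ, ⌊(z : ℝ) / (q : ℝ)⌋ < r ↔ z < r * q := by
    intro z r
    rw [Int.floor_lt, div_lt_iff₀ hq']
    exact_mod_cast Iff.rfl
  have hle : ∀ z r : ℤ, r ≤ ⌊(z : ℝ) / (q : ℝ)⌋ ↔ r * q ≤ z := by
    intro z r
    rw [Int.le_floor, le_div_iff₀ hq']
    exact_mod_cast Iff.rfl
  refine Finset.card_nbij' (fun r => p * r - t * ((a * r + σ) / q))
    (fun r => m * r + t * ((x * r + σ) / y)) ?_ ?_ ?_ ?_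
  · intro r hr
    simp only [Finset.coe_filter, Finset.mem_Ioc, Set.mem_ofPred_eq] at hr ⊢
    obtain ⟨⟨h1, h2⟩, k, hk⟩ := hr
    rw [hk, Int.mul_ediv_cancel_left _ hq.ne']
    have e : (p * r - t * k) * q = r * y - t * σ := by
      rw [hyy]; linear_combination t * hk
    refine ⟨⟨?_, ?_⟩, ⟨-n * r + m * k, ?_⟩⟩
    · rw [hlt, e]; nlinarith
    · rw [hle, e]; nlinarith
    · rw [hx, hyy]
      linear_combination (a * r - q * k) * hdet + hk
  · intro r hr
    simp only [Finset.coe_filter, Finset.mem_Ioc, Set.mem_ofPred_eq] at hr ⊢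
    obtain ⟨⟨h1, h2⟩, k, hk⟩ := hr
    rw [hk, Int.mul_ediv_cancel_left _ hy.ne']
    rw [hlt] at h1
    rw [hle] at h2
    have e : (m * r + t * k) * y = r * q + t * σ := by
      rw [hqdef]; linear_combination (-t) * hk
    refine ⟨⟨?_, ?_⟩, ⟨n * r + p * k, ?_⟩⟩
    · by_contra h3
      nlinarith
    · by_contra h3
      nlinarith
    · rw [hqdef, hadef]
      linear_combination (x * r - y * k) * hdet + hk
  · intro r hr
    simp only [Finset.coe_filter, Finset.mem_Ioc, Set.mem_ofPred_eq] at hr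
    obtain ⟨_, k, hk⟩ := hr
    have hk2 : x * (p * r - t * k) + σ = y * (-n * r + m * k) := by
      rw [hx, hyy]
      linear_combination (a * r - q * k) * hdet + hk
    simp only
    rw [hk, Int.mul_ediv_cancel_left _ hq.ne', hk2, Int.mul_ediv_cancel_left _ hy.ne']
    linear_combination r * hdet
  · intro r hr
    simp only [Finset.coe_filter, Finset.mem_Ioc, Set.mem_ofPred_eq] at hr
    obtain ⟨_, k, hk⟩ := hr
    have hk2 : a * (m * r + t * k) + σ = q * (n * r + p * k) := by
      rw [hqdef, hadef]
      linear_combination (x * r - y * k) * hdet + hk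
    simp only
    rw [hk, Int.mul_ediv_cancel_left _ hy.ne', hk2, Int.mul_ediv_cancel_left _ hq.ne']
    linear_combination r * hdet

lemma abs_inv_sub_inv_le_of_abs_log_sub_log_le {q q₀ ρ : ℝ} (hq : 0 < q) (hq₀ : 0 < q₀)
    (hρ : ρ ≤ 1) (h : |log q - log q₀| ≤ ρ) : |1 / q - 1 / q₀| ≤ 2 * ρ / q₀ := by
  have h' : |log q₀ - log q| ≤ ρ := by rwa [abs_sub_comm]
  have h1 := Real.abs_exp_sub_one_le (h'.trans hρ)
  rw [Real.exp_sub, Real.exp_log hq, Real.exp_log hq₀] at h1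
  have h2 : 1 / q - 1 / q₀ = (q₀ / q - 1) / q₀ := by field_simp
  rw [h2, abs_div, abs_of_pos hq₀]
  gcongr
  linarith

lemma one_div_le_three_mul_of_abs_log_sub_log_le {q q₀ ρ : ℝ} (hq : 0 < q) (hq₀ : 0 < q₀)
    (hρ : ρ ≤ 1) (h : |log q - log q₀| ≤ ρ) : 1 / q₀ ≤ 3 * (1 / q) := by
  have h1 : q ≤ 3 * q₀ := by
    have h2 : log q ≤ 1 + log q₀ := by linarith [(abs_le.mp h).2]
    have h3 := Real.exp_le_exp.mpr h2
    rw [Real.exp_add, Real.exp_log hq, Real.exp_log hq₀] at h3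
    nlinarith [Real.exp_one_lt_d9]
  rw [show 3 * (1 / q) = 3 / q by ring, div_le_div_iff₀ hq₀ hq]
  linarith

lemma exists_sum_hypDisc_fiber_le (L : ℕ) (hL : 0 < L) (δ : ℝ) (hδ : 0 < δ) :
    ∃ K : ℝ, 1 ≤ K ∧ ∀ (y : ℕ) [NeZero y] (A : Finset ℤ) (p t m n σ Q s : ℤ) (ρ : ℝ),
      (A : Set ℤ).OrdConnected → p * m - t * n = 1 → (σ = 1 ∨ σ = -1) → 0 < ρ → ρ ≤ 1 →
      |t| ≤ Q → 0 ≤ s → s ≤ Q →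
      (∀ x ∈ A, 0 < t * x + m * y ∧ Q - s ≤ t * x + m * y) →
      (∀ x ∈ A, ∀ x' ∈ A, |log ((t * x + m * y : ℤ) : ℝ) - log ((t * x' + m * y : ℤ) : ℝ)| ≤ ρ) →
    |∑ x ∈ A.filter (fun x => (L : ℤ) ∣ (t - p) * x + (m - n) * y ∧ IsUnit (x : ZMod y)),
      hypDisc σ Q s (p * x + n * y) (t * x + m * y)| ≤
      K * (1 + (A.card : ℝ) / y) * (y : ℝ) ^ (3 / 4 + δ) +
      ∑ x ∈ A, (1 / (y : ℝ) + 48 * ρ * Q / ((t * x + m * y : ℤ) : ℝ)) := by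
  obtain ⟨K, hK, h⟩ := exists_card_hyperbola_ordConnected_le L hL δ hδ
  refine ⟨K, hK, ?_⟩
  intro y _ A p t m n σ Q s ρ hA hdet hσ hρ hρ1 ht hs0 hsQ hq hlog
  have hyZ : (0 : ℤ) < y := by exact_mod_cast NeZero.pos y
  have hy : (0 : ℝ) < y := by exact_mod_cast NeZero.pos y
  have hy1 : (1 : ℝ) ≤ y := by exact_mod_cast NeZero.one_le
  rcases A.eq_empty_or_nonempty with rfl | ⟨x₀, hx₀⟩
  · simp; positivity
  have hQ0 : (0 : ℝ) ≤ Q := by exact_mod_cast hs0.trans hsQ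
  have htσ : |((t * σ : ℤ) : ℝ)| ≤ Q := by
    have : |t * σ| ≤ Q := by rcases hσ with rfl | rfl <;> simpa using ht
    exact_mod_cast this
  obtain ⟨htσ1, htσ2⟩ := abs_le.mp htσ
  push_cast at htσ1 htσ2
  have hsQ' : (s : ℝ) ≤ Q := by exact_mod_cast hsQ
  have hs0' : (0 : ℝ) ≤ s := by exact_mod_cast hs0
  set q : ℤ → ℝ := fun x => ((t * x + m * y : ℤ) : ℝ) with hqdef
  have hqpos : ∀ x ∈ A, 0 < q x := fun x hx => by
    simp only [hqdef]; exact_mod_cast (hq x hx).1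
  have hqs : ∀ x ∈ A, (Q : ℝ) - s ≤ q x := fun x hx => by
    simp only [hqdef]; exact_mod_cast (hq x hx).2
  set Bf : ℤ → ℝ := fun x => ((y * (Q - (t * x + m * y)) - t * σ : ℤ) : ℝ) / q x with hBf
  set Cf : ℤ → ℝ := fun x => ((y * s - t * σ : ℤ) : ℝ) / q x with hCf
  set w : ℝ := 4 * y * Q * ρ / q x₀ with hw
  have hw0 : 0 ≤ w := by have := hqpos x₀ hx₀; positivity
  have hinv : ∀ x ∈ A, |1 / q x - 1 / q x₀| ≤ 2 * ρ / q x₀ := fun x hx =>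
    abs_inv_sub_inv_le_of_abs_log_sub_log_le (hqpos x hx) (hqpos x₀ hx₀) hρ1 (hlog x hx x₀ hx₀)
  have hmulw : ∀ (z : ℝ), |z| ≤ 2 * y * Q → ∀ x ∈ A, |z * (1 / q x - 1 / q x₀)| ≤ w := by
    intro z hz x hx
    have h0 := hqpos x₀ hx₀
    rw [abs_mul]
    calc |z| * |1 / q x - 1 / q x₀| ≤ (2 * y * Q) * (2 * ρ / q x₀) := by
          gcongr; exact hinv x hx
      _ = w := by rw [hw]; ring
  have hBw : ∀ x ∈ A, |Bf x - Bf x₀| ≤ w := by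
    intro x hx
    have h1 := (hqpos x hx).ne'
    have h0 := (hqpos x₀ hx₀).ne'
    have e : Bf x - Bf x₀ = (y * Q - t * σ : ℝ) * (1 / q x - 1 / q x₀) := by
      have e1 : ∀ x, q x ≠ 0 → Bf x = (y * Q - t * σ : ℝ) * (1 / q x) - y := by
        intro x hx
        have : ((y * (Q - (t * x + m * y)) - t * σ : ℤ) : ℝ) = (y * Q - t * σ) - y * q x := by
          simp only [hqdef]; push_cast; ring
        simp only [hBf, this]; field_simp
      rw [e1 x h1, e1 x₀ h0]; ring
    rw [e]
    refine hmulw _ ?_ x hx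
    rw [abs_le]; constructor <;> nlinarith
  have hCw : ∀ x ∈ A, |Cf x - Cf x₀| ≤ w := by
    intro x hx
    have e : Cf x - Cf x₀ = (y * s - t * σ : ℝ) * (1 / q x - 1 / q x₀) := by
      simp only [hCf]; push_cast; ring
    rw [e]
    refine hmulw _ ?_ x hx
    rw [abs_le]; constructor <;> nlinarith
  have hCB : ∀ x ∈ A, Cf x - Bf x = y * ((s - Q + q x) / q x) := by
    intro x hx
    have h1 := (hqpos x hx).ne'
    simp only [hCf, hBf]
    rw [← sub_div, ← mul_div_assoc]
    congr 1
    simp only [hqdef]; push_cast; ring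
  have hCB0 : 0 ≤ Cf x₀ - Bf x₀ := by
    rw [hCB x₀ hx₀]
    have := hqpos x₀ hx₀
    have := hqs x₀ hx₀
    exact mul_nonneg hy.le (div_nonneg (by linarith) (by linarith))
  set N : ℤ → ℤ → ℤ → ℝ := fun B C x =>
    (((Finset.Ioc B C).filter fun r : ℤ => (y : ℤ) ∣ x * r + σ).card : ℝ) with hN
  have hNmono : ∀ B C B' C' x, B' ≤ B → C ≤ C' → N B C x ≤ N B' C' x := by
    intro B C B' C' x h1 h2
    simp only [hN]
    exact_mod_cast Finset.card_le_card
      (Finset.filter_subset_filter _ (Finset.Ioc_subset_Ioc h1 h2))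
  have hcount : ∀ x ∈ A, (hypCount σ Q s (p * x + n * y) (t * x + m * y) : ℝ) =
      N ⌊Bf x⌋ ⌊Cf x⌋ x := by
    intro x hx
    rw [hypCount_eq_card p t m n x y σ Q s hdet hyZ (hq x hx).1]
  have hdisc : ∀ x ∈ A, hypDisc σ Q s (p * x + n * y) (t * x + m * y) =
      N ⌊Bf x⌋ ⌊Cf x⌋ x - (Cf x - Bf x) / y := by
    intro x hx
    rw [hypDisc, hcount x hx, hCB x hx, mul_div_cancel_left₀ _ hy.ne']
  set S := A.filter (fun x => (L : ℤ) ∣ (t - p) * x + (m - n) * y ∧ IsUnit (x : ZMod y)) with hS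
  have hSA : S ⊆ A := Finset.filter_subset _ _
  set T : ℝ := K * (1 + (A.card : ℝ) / y) * (y : ℝ) ^ (3 / 4 + δ) with hT
  set W : ℝ := (4 * w + 1) / y with hW
  have hW0 : 0 ≤ W := by positivity
  have hWsum : (S.card : ℝ) * W ≤ ∑ x ∈ A, (1 / (y : ℝ) + 48 * ρ * Q / q x) := by
    calc (S.card : ℝ) * W ≤ (A.card : ℝ) * W := by
          gcongr
      _ = ∑ x ∈ A, W := by rw [Finset.sum_const, nsmul_eq_mul]
      _ ≤ _ := by
        refine Finset.sum_le_sum fun x hx => ?_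
        have h3 := one_div_le_three_mul_of_abs_log_sub_log_le (hqpos x hx) (hqpos x₀ hx₀) hρ1
          (hlog x hx x₀ hx₀)
        have e : W = 1 / y + 16 * ρ * Q * (1 / q x₀) := by
          rw [hW, hw]; field_simp; ring
        rw [e]
        have : 16 * ρ * Q * (1 / q x₀) ≤ 16 * ρ * Q * (3 * (1 / q x)) := by gcongr
        calc _ ≤ 1 / (y : ℝ) + 16 * ρ * Q * (3 * (1 / q x)) := by linarith
          _ = _ := by ring
  have hup : ∑ x ∈ S, hypDisc σ Q s (p * x + n * y) (t * x + m * y) ≤ T + S.card * W := by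
    set b := ⌊Bf x₀ - w⌋ with hb
    set c := ⌊Cf x₀ + w⌋ with hc
    have hbc : b ≤ c := Int.floor_le_floor (by linarith)
    have h1 := (le_abs_self _).trans (h y A (t - p) ((m - n) * y) b c σ hA hσ hbc)
    calc _ ≤ ∑ x ∈ S, ((N b c x - (c - b : ℝ) / y) + W) := by
          refine Finset.sum_le_sum fun x hx => ?_
          have hx' := hSA hx
          rw [hdisc x hx']
          obtain ⟨hb1, hb2⟩ := abs_le.mp (hBw x hx')
          obtain ⟨hc1, hc2⟩ := abs_le.mp (hCw x hx')
          have h2 := hNmono ⌊Bf x⌋ ⌊Cf x⌋ b c x (Int.floor_le_floor (by linarith))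
            (Int.floor_le_floor (by linarith))
          have h3 : (c - b : ℝ) ≤ Cf x - Bf x + (4 * w + 1) := by
            have := Int.floor_le (Cf x₀ + w)
            have := Int.lt_floor_add_one (Bf x₀ - w)
            linarith
          have h4 := div_le_div_of_nonneg_right h3 hy.le
          rw [add_div] at h4
          linarith
      _ ≤ _ := by
          rw [Finset.sum_add_distrib, Finset.sum_const, nsmul_eq_mul]
          linarith
  have hlow : -(T + S.card * W) ≤
      ∑ x ∈ S, hypDisc σ Q s (p * x + n * y) (t * x + m * y) := by
    set b := ⌊Bf x₀ + w⌋ with hb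
    set c := max b ⌊Cf x₀ - w⌋ with hc
    have h1 := (abs_le.mp (h y A (t - p) ((m - n) * y) b c σ hA hσ (le_max_left _ _))).1
    calc _ ≤ ∑ x ∈ S, ((N b c x - (c - b : ℝ) / y) - W) := by
          rw [Finset.sum_sub_distrib, Finset.sum_const, nsmul_eq_mul]
          linarith
      _ ≤ _ := by
          refine Finset.sum_le_sum fun x hx => ?_
          have hx' := hSA hx
          rw [hdisc x hx']
          obtain ⟨hb1, hb2⟩ := abs_le.mp (hBw x hx')
          obtain ⟨hc1, hc2⟩ := abs_le.mp (hCw x hx')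
          have h2 : N b c x ≤ N ⌊Bf x⌋ ⌊Cf x⌋ x := by
            rcases le_total b ⌊Cf x₀ - w⌋ with hh | hh
            · refine hNmono _ _ _ _ x (Int.floor_le_floor (by linarith)) ?_
              rw [hc, max_eq_right hh]
              exact Int.floor_le_floor (by linarith)
            · rw [hc, max_eq_left hh]
              simp [hN]
          have h3 : Cf x - Bf x - (4 * w + 1) ≤ (c - b : ℝ) := by
            have := Int.floor_le (Bf x₀ + w)
            have := Int.lt_floor_add_one (Cf x₀ - w)
            have h5 : ((⌊Cf x₀ - w⌋ : ℤ) : ℝ) ≤ c := by exact_mod_cast le_max_right _ _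
            linarith
          have h4 := div_le_div_of_nonneg_right h3 hy.le
          rw [sub_div] at h4
          linarith
  rw [abs_le]
  constructor <;> linarith

lemma card_image_int_le (A : Finset ℤ) (g : ℤ → ℤ) (R : ℝ) (hR : 0 ≤ R)
    (h : ∀ x ∈ A, ∀ x' ∈ A, (g x - g x' : ℝ) ≤ R) : ((A.image g).card : ℝ) ≤ 1 + R := by
  rcases (A.image g).eq_empty_or_nonempty with h0 | hne
  · rw [h0]; simp; positivity
  have hsub : A.image g ⊆ Finset.Icc ((A.image g).min' hne) ((A.image g).max' hne) := fun i hi =>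
    Finset.mem_Icc.mpr ⟨Finset.min'_le _ _ hi, Finset.le_max' _ _ hi⟩
  obtain ⟨x, hx, ex⟩ := Finset.mem_image.mp ((A.image g).max'_mem hne)
  obtain ⟨x', hx', ex'⟩ := Finset.mem_image.mp ((A.image g).min'_mem hne)
  have h1 := Finset.card_le_card hsub
  rw [← ex, ← ex', Int.card_Icc] at h1
  have h2 : g x' ≤ g x := by
    rw [ex, ex']; exact Finset.min'_le_max' _ hne
  have h3 : ((A.image g).card : ℤ) ≤ g x + 1 - g x' := by omega
  have h4 : ((A.image g).card : ℝ) ≤ g x + 1 - g x' := by exact_mod_cast h3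
  linarith [h x hx x' hx']

lemma linear_mem_of_ordConnected {S : Set ℤ} (hS : S.OrdConnected) (t b : ℤ) {x₁ x x₂ : ℤ}
    (h₁ : t * x₁ + b ∈ S) (h₂ : t * x₂ + b ∈ S) (hx₁ : x₁ ≤ x) (hx₂ : x ≤ x₂) :
    t * x + b ∈ S := by
  rcases le_total 0 t with ht | ht
  · exact hS.out h₁ h₂ ⟨by nlinarith, by nlinarith⟩
  · exact hS.out h₂ h₁ ⟨by nlinarith, by nlinarith⟩

lemma exists_sum_hypDisc_line_le (L : ℕ) (hL : 0 < L) (δ : ℝ) (hδ : 0 < δ) :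
    ∃ K : ℝ, 1 ≤ K ∧ ∀ (y : ℕ) [NeZero y] (A : Finset ℤ) (p t m n σ Q s : ℤ) (ρ R : ℝ),
      (A : Set ℤ).OrdConnected → p * m - t * n = 1 → (σ = 1 ∨ σ = -1) → 0 < ρ → ρ ≤ 1 →
      |t| ≤ Q → 0 ≤ s → s ≤ Q → 0 ≤ R →
      (∀ x ∈ A, 0 < t * x + m * y ∧ Q - s ≤ t * x + m * y) →
      (∀ x ∈ A, ∀ x' ∈ A, |log ((t * x + m * y : ℤ) : ℝ) - log ((t * x' + m * y : ℤ) : ℝ)| ≤ R) →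
    |∑ x ∈ A.filter (fun x => (L : ℤ) ∣ (t - p) * x + (m - n) * y ∧ IsUnit (x : ZMod y)),
      hypDisc σ Q s (p * x + n * y) (t * x + m * y)| ≤
      K * (2 + R / ρ + (A.card : ℝ) / y) * (y : ℝ) ^ (3 / 4 + δ) +
      ∑ x ∈ A, (1 / (y : ℝ) + 48 * ρ * Q / ((t * x + m * y : ℤ) : ℝ)) := by
  obtain ⟨K, hK, h⟩ := exists_sum_hypDisc_fiber_le L hL δ hδ
  refine ⟨K, hK, ?_⟩
  intro y _ A p t m n σ Q s ρ R hA hdet hσ hρ hρ1 ht hs0 hsQ hR hq hlog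
  set g : ℤ → ℤ := fun x => ⌊log ((t * x + m * y : ℤ) : ℝ) / ρ⌋ with hg
  have hcard : ((A.image g).card : ℝ) ≤ 2 + R / ρ := by
    have := card_image_int_le A g (1 + R / ρ) (by positivity) ?_
    · linarith
    intro x hx x' hx'
    have h1 := Int.floor_le (log ((t * x + m * y : ℤ) : ℝ) / ρ)
    have h2 := Int.lt_floor_add_one (log ((t * x' + m * y : ℤ) : ℝ) / ρ)
    have h3 := div_le_div_of_nonneg_right (abs_le.mp (hlog x hx x' hx')).2 hρ.le
    rw [sub_div] at h3
    simp only [hg]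
    linarith
  have hfib : ∀ i, ((A.filter fun x => g x = i : Finset ℤ) : Set ℤ).OrdConnected := by
    intro i
    constructor
    intro x₁ hx₁ x₂ hx₂ x hx
    simp only [Finset.coe_filter, Set.mem_ofPred_eq] at hx₁ hx₂ ⊢
    have hxA : x ∈ A := hA.out hx₁.1 hx₂.1 hx
    refine ⟨hxA, ?_⟩
    have hmono : ∀ x x', x ∈ A → t * x + m * y ≤ t * x' + m * y → g x ≤ g x' := by
      intro x x' hx hxx
      simp only [hg]
      refine Int.floor_le_floor (div_le_div_of_nonneg_right (Real.log_le_log ?_ ?_) hρ.le)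
      · exact_mod_cast (hq x hx).1
      · exact_mod_cast hxx
    rcases le_total 0 t with h0 | h0
    · have := hmono x₁ x hx₁.1 (by nlinarith [hx.1])
      have := hmono x x₂ hxA (by nlinarith [hx.2])
      omega
    · have := hmono x x₁ hxA (by nlinarith [hx.1])
      have := hmono x₂ x hx₂.1 (by nlinarith [hx.2])
      omega
  rw [← Finset.sum_fiberwise_of_maps_to (s := A.filter _) (t := A.image g) (g := g)
    (fun x hx => Finset.mem_image_of_mem g (Finset.mem_filter.mp hx).1)]
  refine (Finset.abs_sum_le_sum_abs _ _).trans ?_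
  have hstep : ∀ i ∈ A.image g, |∑ x ∈ (A.filter (fun x => (L : ℤ) ∣ (t - p) * x + (m - n) * y ∧
      IsUnit (x : ZMod y))).filter (fun x => g x = i),
      hypDisc σ Q s (p * x + n * y) (t * x + m * y)| ≤
      K * (1 + ((A.filter fun x => g x = i).card : ℝ) / y) * (y : ℝ) ^ (3 / 4 + δ) +
      ∑ x ∈ A.filter (fun x => g x = i),
        (1 / (y : ℝ) + 48 * ρ * Q / ((t * x + m * y : ℤ) : ℝ)) := by
    intro i _
    rw [Finset.filter_comm]
    refine h y _ p t m n σ Q s ρ (hfib i) hdet hσ hρ hρ1 ht hs0 hsQ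
      (fun x hx => hq x (Finset.mem_filter.mp hx).1) ?_
    intro x hx x' hx'
    have e : g x = g x' := by
      rw [(Finset.mem_filter.mp hx).2, (Finset.mem_filter.mp hx').2]
    have h1 := Int.floor_le (log ((t * x + m * y : ℤ) : ℝ) / ρ)
    have h2 := Int.lt_floor_add_one (log ((t * x' + m * y : ℤ) : ℝ) / ρ)
    have h3 := Int.floor_le (log ((t * x' + m * y : ℤ) : ℝ) / ρ)
    have h4 := Int.lt_floor_add_one (log ((t * x + m * y : ℤ) : ℝ) / ρ)
    have e' : (⌊log ((t * x + m * y : ℤ) : ℝ) / ρ⌋ : ℝ) = ⌊log ((t * x' + m * y : ℤ) : ℝ) / ρ⌋ := by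
      exact_mod_cast e
    have h5 : |log ((t * x + m * y : ℤ) : ℝ) / ρ - log ((t * x' + m * y : ℤ) : ℝ) / ρ| ≤ 1 := by
      rw [abs_le]; constructor <;> linarith
    rw [← sub_div, abs_div, abs_of_pos hρ, div_le_one hρ] at h5
    exact h5
  refine (Finset.sum_le_sum hstep).trans ?_
  rw [Finset.sum_add_distrib]
  have hc : (A.card : ℝ) = ∑ i ∈ A.image g, ((A.filter fun x => g x = i).card : ℝ) := by
    exact_mod_cast Finset.card_eq_sum_card_image g A
  have e1 : ∑ i ∈ A.image g, K * (1 + ((A.filter fun x => g x = i).card : ℝ) / y) *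
      (y : ℝ) ^ (3 / 4 + δ) = K * ((A.image g).card + (A.card : ℝ) / y) * (y : ℝ) ^ (3 / 4 + δ) := by
    rw [hc, Finset.sum_div, ← Finset.sum_mul, ← Finset.mul_sum, Finset.sum_add_distrib]
    simp
  rw [e1]
  refine add_le_add ?_ ?_
  · gcongr
  · rw [Finset.sum_fiberwise_of_maps_to (fun x hx => Finset.mem_image_of_mem g hx)]

open Classical in
/-- The lattice points `(a, q)` with `0 < a ≤ Q`, `r₁ < q ≤ r₂` and slope `a / q` in `J`. -/
noncomputable def slopeBox (Q r₁ r₂ : ℤ) (J : Set ℝ) : Finset (ℤ × ℤ) :=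
  (Finset.Ioc 0 Q ×ˢ Finset.Ioc r₁ r₂).filter fun v => (v.1 : ℝ) / v.2 ∈ J

lemma mem_slopeBox {Q r₁ r₂ : ℤ} {J : Set ℝ} {v : ℤ × ℤ} : v ∈ slopeBox Q r₁ r₂ J ↔
    (v.1 ∈ Set.Ioc 0 Q ∧ v.2 ∈ Set.Ioc r₁ r₂) ∧ (v.1 : ℝ) / v.2 ∈ J := by
  simp [slopeBox]

/-- The points of `slopeBox` on the line `p q - t a = y`, in unimodular coordinates. -/
noncomputable def slopeLine (Q r₁ r₂ : ℤ) (J : Set ℝ) (p t m n y : ℤ) : Finset ℤ :=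
  ((slopeBox Q r₁ r₂ J).filter fun v => p * v.2 - t * v.1 = y).image fun v => m * v.1 - n * v.2

lemma mem_slopeLine {Q r₁ r₂ : ℤ} {J : Set ℝ} {p t m n y x : ℤ} (hdet : p * m - t * n = 1) :
    x ∈ slopeLine Q r₁ r₂ J p t m n y ↔ (p * x + n * y, t * x + m * y) ∈ slopeBox Q r₁ r₂ J := by
  constructor
  · intro h
    obtain ⟨⟨a, q⟩, hv, rfl⟩ := Finset.mem_image.mp h
    obtain ⟨hv1, rfl⟩ := Finset.mem_filter.mp hv
    have e1 : p * (m * a - n * q) + n * (p * q - t * a) = a := by linear_combination a * hdet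
    have e2 : t * (m * a - n * q) + m * (p * q - t * a) = q := by linear_combination q * hdet
    simp only [e1, e2]; exact hv1
  · intro h
    refine Finset.mem_image.mpr ⟨_, Finset.mem_filter.mpr ⟨h, ?_⟩, ?_⟩
    · simp only; linear_combination y * hdet
    · simp only; linear_combination x * hdet

lemma slope_sub_slope {p t m n y x x' : ℤ} (hdet : p * m - t * n = 1)
    (h : 0 < t * x + m * y) (h' : 0 < t * x' + m * y) :
    ((p * x' + n * y : ℤ) : ℝ) / ((t * x' + m * y : ℤ) : ℝ) -
      ((p * x + n * y : ℤ) : ℝ) / ((t * x + m * y : ℤ) : ℝ) =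
      y * (x' - x) / (((t * x + m * y : ℤ) : ℝ) * ((t * x' + m * y : ℤ) : ℝ)) := by
  have h1 : (0 : ℝ) < ((t * x + m * y : ℤ) : ℝ) := by exact_mod_cast h
  have h2 : (0 : ℝ) < ((t * x' + m * y : ℤ) : ℝ) := by exact_mod_cast h'
  have hd : (p * m - t * n : ℝ) = 1 := by exact_mod_cast hdet
  rw [div_sub_div _ _ h2.ne' h1.ne', div_eq_div_iff (by positivity) (by positivity)]
  push_cast
  linear_combination (y * (x' - x) * ((t * x + m * y) * (t * x' + m * y)) : ℝ) * hd

section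

variable {Q r₁ r₂ : ℤ} {J : Set ℝ} {p t m n y : ℤ}

lemma ordConnected_slopeLine (hJ : J.OrdConnected) (hdet : p * m - t * n = 1) (hy : 0 < y)
    (hr₁ : 0 ≤ r₁) : (slopeLine Q r₁ r₂ J p t m n y : Set ℤ).OrdConnected := by
  constructor
  intro x₁ hx₁ x₂ hx₂ x hx
  simp only [Finset.mem_coe, mem_slopeLine hdet, mem_slopeBox] at hx₁ hx₂ ⊢
  have ha := linear_mem_of_ordConnected Set.ordConnected_Ioc p (n * y) hx₁.1.1 hx₂.1.1 hx.1 hx.2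
  have hq := linear_mem_of_ordConnected Set.ordConnected_Ioc t (m * y) hx₁.1.2 hx₂.1.2 hx.1 hx.2
  refine ⟨⟨ha, hq⟩, hJ.out hx₁.2 hx₂.2 ⟨?_, ?_⟩⟩
  · have hq1 : 0 < t * x₁ + m * y := hr₁.trans_lt hx₁.1.2.1
    have hq2 : 0 < t * x + m * y := hr₁.trans_lt hq.1
    rw [← sub_nonneg, slope_sub_slope hdet hq1 hq2]
    have : (x₁ : ℝ) ≤ x := by exact_mod_cast hx.1
    have h1 : (0 : ℝ) < ((t * x₁ + m * y : ℤ) : ℝ) := by exact_mod_cast hq1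
    have h2 : (0 : ℝ) < ((t * x + m * y : ℤ) : ℝ) := by exact_mod_cast hq2
    have h3 : (0 : ℝ) < y := by exact_mod_cast hy
    exact div_nonneg (mul_nonneg h3.le (by linarith)) (by positivity)
  · have hq1 : 0 < t * x₂ + m * y := hr₁.trans_lt hx₂.1.2.1
    have hq2 : 0 < t * x + m * y := hr₁.trans_lt hq.1
    rw [← sub_nonneg, slope_sub_slope hdet hq2 hq1]
    have : (x : ℝ) ≤ x₂ := by exact_mod_cast hx.2
    have h1 : (0 : ℝ) < ((t * x₂ + m * y : ℤ) : ℝ) := by exact_mod_cast hq1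
    have h2 : (0 : ℝ) < ((t * x + m * y : ℤ) : ℝ) := by exact_mod_cast hq2
    have h3 : (0 : ℝ) < y := by exact_mod_cast hy
    exact div_nonneg (mul_nonneg h3.le (by linarith)) (by positivity)

lemma abs_sub_le_of_mem_slopeLine {u η : ℝ} (hJ : J ⊆ Set.Icc u (u + η))
    (hdet : p * m - t * n = 1) (hy : 0 < y) (hr₁ : 0 ≤ r₁) {x x' : ℤ}
    (hx : x ∈ slopeLine Q r₁ r₂ J p t m n y) (hx' : x' ∈ slopeLine Q r₁ r₂ J p t m n y) :
    |(x' - x : ℝ)| ≤ η / y * (((t * x + m * y : ℤ) : ℝ) * ((t * x' + m * y : ℤ) : ℝ)) := by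
  rw [mem_slopeLine hdet, mem_slopeBox] at hx hx'
  have hq1 : 0 < t * x + m * y := hr₁.trans_lt hx.1.2.1
  have hq2 : 0 < t * x' + m * y := hr₁.trans_lt hx'.1.2.1
  have h1 : (0 : ℝ) < ((t * x + m * y : ℤ) : ℝ) := by exact_mod_cast hq1
  have h2 : (0 : ℝ) < ((t * x' + m * y : ℤ) : ℝ) := by exact_mod_cast hq2
  have h3 : (0 : ℝ) < y := by exact_mod_cast hy
  have h4 := hJ hx.2
  have h5 := hJ hx'.2
  have h6 : |((p * x' + n * y : ℤ) : ℝ) / ((t * x' + m * y : ℤ) : ℝ) -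
      ((p * x + n * y : ℤ) : ℝ) / ((t * x + m * y : ℤ) : ℝ)| ≤ η := by
    rw [abs_le]; constructor <;> linarith [h4.1, h4.2, h5.1, h5.2]
  rw [slope_sub_slope hdet hq1 hq2, abs_div, abs_mul, abs_of_pos h3,
    abs_of_pos (mul_pos h1 h2), div_le_iff₀ (mul_pos h1 h2)] at h6
  rw [div_mul_eq_mul_div, le_div_iff₀ h3]
  linarith

lemma card_slopeLine_le {u η : ℝ} (hη : 0 ≤ η) (hJ : J ⊆ Set.Icc u (u + η))
    (hdet : p * m - t * n = 1) (hy : 0 < y) (hr₁ : 0 ≤ r₁) (hr₂ : r₂ ≤ Q) (hQ : 0 ≤ Q) :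
    ((slopeLine Q r₁ r₂ J p t m n y).card : ℝ) ≤
      1 + (Q : ℝ) ^ (7 / 4 : ℝ) * η ^ (3 / 4 : ℝ) * (y : ℝ) ^ (-(3 / 4) : ℝ) := by
  set A := slopeLine Q r₁ r₂ J p t m n y with hA
  have hQ' : (0 : ℝ) ≤ Q := by exact_mod_cast hQ
  have hy' : (0 : ℝ) < y := by exact_mod_cast hy
  have hmem : ∀ x ∈ A, (p * x + n * y ∈ Set.Ioc 0 Q) ∧ t * x + m * y ∈ Set.Ioc r₁ r₂ :=
    fun x hx => ((mem_slopeBox).mp ((mem_slopeLine hdet).mp hx)).1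
  have hcQ : (A.card : ℝ) ≤ Q := by
    have key : (A.card : ℤ) ≤ Q := by
      have hQc : ((Finset.Ioc (0 : ℤ) Q).card : ℤ) = Q := by
        rw [Int.card_Ioc, sub_zero, Int.toNat_of_nonneg hQ]
      rw [← hQc]
      rcases eq_or_ne t 0 with h0 | h0
      · have hp : p ≠ 0 := by rintro rfl; simp [h0] at hdet
        exact_mod_cast Finset.card_le_card_of_injOn (fun x => p * x + n * y)
          (fun x hx => by simpa using (hmem x hx).1)
          (fun x _ x' _ h => by simpa [hp] using h)
      · exact_mod_cast Finset.card_le_card_of_injOn (fun x => t * x + m * y)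
          (fun x hx => by
            have := (hmem x hx).2
            simp only [Finset.coe_Ioc]
            exact ⟨hr₁.trans_lt this.1, this.2.trans hr₂⟩)
          (fun x _ x' _ h => by simpa [h0] using h)
    exact_mod_cast key
  have hqle : ∀ x ∈ A, (0 : ℝ) ≤ ((t * x + m * y : ℤ) : ℝ) ∧ ((t * x + m * y : ℤ) : ℝ) ≤ Q := by
    intro x hx
    have := (hmem x hx).2
    exact ⟨by exact_mod_cast hr₁.trans this.1.le, by exact_mod_cast this.2.trans hr₂⟩
  have hcη : (A.card : ℝ) ≤ 1 + η / y * (Q * Q) := by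
    have := card_image_int_le A id (η / y * (Q * Q)) (by positivity) ?_
    · simpa using this
    intro x hx x' hx'
    refine (le_abs_self _).trans
      ((abs_sub_le_of_mem_slopeLine hJ hdet hy hr₁ hx' hx).trans ?_)
    have h1 := hqle x hx
    have h2 := hqle x' hx'
    gcongr
    · exact h1.1
    · exact_mod_cast h2.2
    · exact_mod_cast h1.2
  set H := η / y * ((Q : ℝ) * Q) with hH
  have hH0 : 0 ≤ H := by positivity
  have e : (Q : ℝ) ^ (7 / 4 : ℝ) * η ^ (3 / 4 : ℝ) * (y : ℝ) ^ (-(3 / 4) : ℝ) =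
      (Q : ℝ) ^ (1 / 4 : ℝ) * H ^ (3 / 4 : ℝ) := by
    rw [hH, Real.mul_rpow (by positivity) (by positivity), Real.div_rpow hη hy'.le,
      Real.mul_rpow hQ' hQ', Real.rpow_neg hy'.le]
    have : (Q : ℝ) ^ (7 / 4 : ℝ) =
        (Q : ℝ) ^ (1 / 4 : ℝ) * ((Q : ℝ) ^ (3 / 4 : ℝ) * (Q : ℝ) ^ (3 / 4 : ℝ)) := by
      rw [← Real.rpow_add_of_nonneg hQ' (by norm_num) (by norm_num),
        ← Real.rpow_add_of_nonneg hQ' (by norm_num) (by norm_num)]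
      norm_num
    rw [this]; ring
  rw [e]
  have hself : ∀ z : ℝ, 0 ≤ z → z ^ (1 / 4 : ℝ) * z ^ (3 / 4 : ℝ) = z := by
    intro z hz
    rw [← Real.rpow_add_of_nonneg hz (by norm_num) (by norm_num)]; norm_num
  rcases le_total H Q with hle | hle
  · have h1 : H ≤ (Q : ℝ) ^ (1 / 4 : ℝ) * H ^ (3 / 4 : ℝ) := by
      calc H = H ^ (1 / 4 : ℝ) * H ^ (3 / 4 : ℝ) := (hself H hH0).symm
        _ ≤ _ := by gcongr
    linarith
  · have h1 : (Q : ℝ) ≤ (Q : ℝ) ^ (1 / 4 : ℝ) * H ^ (3 / 4 : ℝ) := by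
      calc (Q : ℝ) = (Q : ℝ) ^ (1 / 4 : ℝ) * (Q : ℝ) ^ (3 / 4 : ℝ) := (hself Q hQ').symm
        _ ≤ _ := by gcongr
    linarith

lemma abs_log_sub_log_le_of_mem_slopeLine {u η : ℝ} (hη : 0 ≤ η) (hJ : J ⊆ Set.Icc u (u + η))
    (hdet : p * m - t * n = 1) (hy : 0 < y) (hr₁ : 0 ≤ r₁) (hr₂ : r₂ ≤ Q) {x x' : ℤ}
    (hx : x ∈ slopeLine Q r₁ r₂ J p t m n y) (hx' : x' ∈ slopeLine Q r₁ r₂ J p t m n y) :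
    |log ((t * x + m * y : ℤ) : ℝ) - log ((t * x' + m * y : ℤ) : ℝ)| ≤ |(t : ℝ)| * Q * η / y := by
  have key : ∀ x x' : ℤ, x ∈ slopeLine Q r₁ r₂ J p t m n y → x' ∈ slopeLine Q r₁ r₂ J p t m n y →
      log ((t * x + m * y : ℤ) : ℝ) - log ((t * x' + m * y : ℤ) : ℝ) ≤ |(t : ℝ)| * Q * η / y := by
    intro x x' hx hx'
    have h := abs_sub_le_of_mem_slopeLine hJ hdet hy hr₁ hx hx'
    rw [mem_slopeLine hdet, mem_slopeBox] at hx hx'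
    have hq1 : (0 : ℝ) < ((t * x + m * y : ℤ) : ℝ) := by exact_mod_cast hr₁.trans_lt hx.1.2.1
    have hq2 : (0 : ℝ) < ((t * x' + m * y : ℤ) : ℝ) := by exact_mod_cast hr₁.trans_lt hx'.1.2.1
    have hq3 : ((t * x + m * y : ℤ) : ℝ) ≤ Q := by exact_mod_cast hx.1.2.2.trans hr₂
    have hy' : (0 : ℝ) < y := by exact_mod_cast hy
    rw [← Real.log_div hq1.ne' hq2.ne']
    refine (Real.log_le_sub_one_of_pos (div_pos hq1 hq2)).trans ?_
    rw [div_sub_one hq2.ne', div_le_iff₀ hq2]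
    have e : ((t * x + m * y : ℤ) : ℝ) - ((t * x' + m * y : ℤ) : ℝ) = -(t * (x' - x)) := by
      push_cast; ring
    rw [e]
    refine (neg_le_abs _).trans ?_
    rw [abs_mul]
    calc |(t : ℝ)| * |(x' - x : ℝ)| ≤ |(t : ℝ)| *
          (η / y * (((t * x + m * y : ℤ) : ℝ) * ((t * x' + m * y : ℤ) : ℝ))) := by gcongr
      _ ≤ |(t : ℝ)| * (η / y * (Q * ((t * x' + m * y : ℤ) : ℝ))) := by gcongr
      _ = _ := by ring
  rw [abs_le]
  constructor
  · linarith [key x' x hx' hx]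
  · exact key x x' hx hx'

end

lemma sum_Icc_inv_le (N : ℕ) : ∑ i ∈ Finset.Icc 1 N, (1 / (i : ℝ)) ≤ 1 + log N := by
  have := harmonic_le_one_add_log N
  rw [harmonic_eq_sum_Icc] at this
  push_cast at this
  simpa [one_div] using this

open Classical in
/-- The sum of `hypDisc` over the points of `V` with coprime entries, congruent modulo `L`. -/
noncomputable def discSum (L : ℕ) (σ Q s : ℤ) (V : Finset (ℤ × ℤ)) : ℝ :=
  ∑ v ∈ V.filter (fun v => IsCoprime v.1 v.2 ∧ (L : ℤ) ∣ v.2 - v.1), hypDisc σ Q s v.1 v.2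

lemma discSum_line (L : ℕ) (σ Q s r₁ r₂ : ℤ) (J : Set ℝ) (p t m n : ℤ) (y : ℕ) [NeZero y]
    (hdet : p * m - t * n = 1) :
    discSum L σ Q s ((slopeBox Q r₁ r₂ J).filter fun v => p * v.2 - t * v.1 = y) =
      ∑ x ∈ (slopeLine Q r₁ r₂ J p t m n y).filter
        (fun x => (L : ℤ) ∣ (t - p) * x + (m - n) * y ∧ IsUnit (x : ZMod y)),
        hypDisc σ Q s (p * x + n * y) (t * x + m * y) := by
  unfold discSum
  refine Finset.sum_nbij' (fun v => m * v.1 - n * v.2) (fun x => (p * x + n * y, t * x + m * y))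
    ?_ ?_ ?_ ?_ ?_
  · rintro ⟨a, q⟩ hv
    simp only [Finset.mem_filter, mem_slopeLine hdet] at hv ⊢
    obtain ⟨⟨hv, hy⟩, hc, hL⟩ := hv
    have e1 : p * (m * a - n * q) + n * y = a := by rw [← hy]; linear_combination a * hdet
    have e2 : t * (m * a - n * q) + m * y = q := by rw [← hy]; linear_combination q * hdet
    refine ⟨by rw [e1, e2]; exact hv, ?_, ?_⟩
    · have : (t - p) * (m * a - n * q) + (m - n) * y = q - a := by linear_combination e2 - e1
      rw [this]; exact hL
    · rw [ZMod.coe_int_isUnit_iff_isCoprime]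
      obtain ⟨c, d, hcd⟩ := hc
      exact ⟨c * n + d * m, c * p + d * t, by linear_combination c * e1 + d * e2 + hcd⟩
  · intro x hx
    simp only [Finset.mem_filter, mem_slopeLine hdet] at hx ⊢
    obtain ⟨hx, hL, hu⟩ := hx
    refine ⟨⟨hx, by linear_combination (y : ℤ) * hdet⟩, ?_, ?_⟩
    · rw [ZMod.coe_int_isUnit_iff_isCoprime] at hu
      obtain ⟨c, d, hcd⟩ := hu
      exact ⟨d * m - c * t, c * p - d * n, by
        linear_combination (d * x + c * y) * hdet + hcd⟩
    · have : t * x + m * y - (p * x + n * y) = (t - p) * x + (m - n) * y := by ring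
      rw [this]; exact hL
  · rintro ⟨a, q⟩ hv
    simp only [Finset.mem_filter] at hv
    obtain ⟨⟨hv, hy⟩, -⟩ := hv
    ext
    · simp only; rw [← hy]; linear_combination a * hdet
    · simp only; rw [← hy]; linear_combination q * hdet
  · intro x hx
    simp only; linear_combination x * hdet
  · rintro ⟨a, q⟩ hv
    simp only [Finset.mem_filter] at hv
    obtain ⟨⟨hv, hy⟩, -⟩ := hv
    have e1 : p * (m * a - n * q) + n * y = a := by rw [← hy]; linear_combination a * hdet
    have e2 : t * (m * a - n * q) + m * y = q := by rw [← hy]; linear_combination q * hdet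
    simp only [e1, e2]

lemma exists_discSum_halfPlane_le (L : ℕ) (hL : 0 < L) (δ : ℝ) (hδ : 0 < δ) :
    ∃ K : ℝ, 1 ≤ K ∧ ∀ (p t m n σ Q s r₁ r₂ : ℤ) (J : Set ℝ) (u η ρ : ℝ) (Y : ℕ),
      J.OrdConnected → J ⊆ Set.Icc u (u + η) → 0 ≤ η → p * m - t * n = 1 → (σ = 1 ∨ σ = -1) →
      0 < ρ → ρ ≤ 1 → |t| ≤ Q → 0 ≤ s → s ≤ Q → 0 ≤ r₁ → Q - s ≤ r₁ → r₂ ≤ Q → 1 ≤ Y →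
      (∀ v ∈ slopeBox Q r₁ r₂ J, p * v.2 - t * v.1 ≤ Y) →
      |discSum L σ Q s ((slopeBox Q r₁ r₂ J).filter fun v => 0 < p * v.2 - t * v.1)| ≤
      K * (Y : ℝ) ^ δ * ((Y : ℝ) ^ (7 / 4 : ℝ) + |(t : ℝ)| * Q * η / ρ * (Y : ℝ) ^ (3 / 4 : ℝ) +
        (Q : ℝ) ^ (7 / 4 : ℝ) * η ^ (3 / 4 : ℝ)) +
      48 * ρ * Q * ∑ v ∈ slopeBox Q r₁ r₂ J, (1 / (v.2 : ℝ)) := by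
  obtain ⟨K₁, hK₁, h⟩ := exists_sum_hypDisc_line_le L hL (δ / 2) (by linarith)
  obtain ⟨K₂, hK₂, hlog⟩ := exists_one_add_log_le (δ / 2) (by linarith)
  refine ⟨4 * K₁ * K₂, by nlinarith, ?_⟩
  intro p t m n σ Q s r₁ r₂ J u η ρ Y hJ hJu hη hdet hσ hρ hρ1 ht hs0 hsQ hr₁ hr₁s hr₂ hY hV
  set V := slopeBox Q r₁ r₂ J with hVdef
  have hQ0 : 0 ≤ Q := hs0.trans hsQ
  have hQ' : (0 : ℝ) ≤ Q := by exact_mod_cast hQ0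
  set Z : ℝ := |(t : ℝ)| * Q * η / ρ with hZ
  set H : ℝ := (Q : ℝ) ^ (7 / 4 : ℝ) * η ^ (3 / 4 : ℝ) with hH
  have hZ0 : 0 ≤ Z := by positivity
  have hH0 : 0 ≤ H := by positivity
  have hY0 : (0 : ℝ) < Y := by exact_mod_cast hY
  have hsplit : discSum L σ Q s (V.filter fun v => 0 < p * v.2 - t * v.1) =
      ∑ y ∈ Finset.Icc 1 Y, discSum L σ Q s (V.filter fun v => p * v.2 - t * v.1 = y) := by
    unfold discSum
    rw [← Finset.sum_fiberwise_of_maps_to (t := Finset.Icc 1 Y)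
      (g := fun v : ℤ × ℤ => (p * v.2 - t * v.1).toNat)]
    · refine Finset.sum_congr rfl fun y hy => Finset.sum_congr ?_ fun _ _ => rfl
      ext v
      simp only [Finset.mem_filter, Finset.mem_Icc] at hy ⊢
      constructor
      · rintro ⟨⟨⟨h1, h2⟩, h3⟩, h4⟩
        exact ⟨⟨h1, by omega⟩, h3⟩
      · rintro ⟨⟨h1, h2⟩, h3⟩
        exact ⟨⟨⟨h1, by omega⟩, h3⟩, by omega⟩
    · intro v hv
      simp only [Finset.mem_filter, Finset.mem_Icc] at hv ⊢
      have := hV v hv.1.1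
      omega
  have hsum2 : ∑ y ∈ Finset.Icc 1 Y, ∑ x ∈ slopeLine Q r₁ r₂ J p t m n y,
      (1 / ((t * x + m * y : ℤ) : ℝ)) ≤ ∑ v ∈ V, (1 / (v.2 : ℝ)) := by
    have hline : ∀ y : ℕ, ∑ x ∈ slopeLine Q r₁ r₂ J p t m n y, (1 / ((t * x + m * y : ℤ) : ℝ)) =
        ∑ v ∈ V.filter (fun v => p * v.2 - t * v.1 = y), (1 / (v.2 : ℝ)) := by
      intro y
      refine Finset.sum_nbij' (fun x => (p * x + n * y, t * x + m * y))
        (fun v => m * v.1 - n * v.2) ?_ ?_ ?_ ?_ ?_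
      · intro x hx
        rw [mem_slopeLine hdet] at hx
        exact Finset.mem_filter.mpr ⟨hx, by simp only; linear_combination (y : ℤ) * hdet⟩
      · rintro ⟨a, q⟩ hv
        obtain ⟨hv, hy⟩ := Finset.mem_filter.mp hv
        exact Finset.mem_image.mpr ⟨(a, q), Finset.mem_filter.mpr ⟨hv, hy⟩, rfl⟩
      · intro x hx
        simp only; linear_combination x * hdet
      · rintro ⟨a, q⟩ hv
        obtain ⟨hv, hy⟩ := Finset.mem_filter.mp hv
        simp only at hy
        ext
        · simp only; rw [← hy]; linear_combination a * hdet
        · simp only; rw [← hy]; linear_combination q * hdet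
      · intro x _; rfl
    simp only [hline]
    rw [← Finset.sum_biUnion]
    · refine Finset.sum_le_sum_of_subset_of_nonneg ?_ fun v hv _ => ?_
      · intro v hv
        obtain ⟨y, _, hv⟩ := Finset.mem_biUnion.mp hv
        exact (Finset.mem_filter.mp hv).1
      · have : 0 < v.2 := hr₁.trans_lt (mem_slopeBox.mp hv).1.2.1
        positivity
    · intro y _ y' _ hne
      simp only [Function.onFun]
      rw [Finset.disjoint_left]
      intro v hv hv'
      have := (Finset.mem_filter.mp hv).2
      have := (Finset.mem_filter.mp hv').2
      omega
  have hstep : ∀ y ∈ Finset.Icc 1 Y,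
      |discSum L σ Q s (V.filter fun v => p * v.2 - t * v.1 = y)| ≤
      K₁ * (Y : ℝ) ^ (δ / 2) * (4 * (Y : ℝ) ^ (3 / 4 : ℝ) +
        (Z * (Y : ℝ) ^ (3 / 4 : ℝ) + 2 * H) * (1 / (y : ℝ))) +
      48 * ρ * Q * ∑ x ∈ slopeLine Q r₁ r₂ J p t m n y, (1 / ((t * x + m * y : ℤ) : ℝ)) := by
    intro y hy
    obtain ⟨hy1, hyY⟩ := Finset.mem_Icc.mp hy
    have : NeZero y := ⟨by omega⟩
    have hyZ : (0 : ℤ) < y := by exact_mod_cast hy1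
    have hy0 : (0 : ℝ) < y := by exact_mod_cast hy1
    have hy1' : (1 : ℝ) ≤ y := by exact_mod_cast hy1
    have hyY' : (y : ℝ) ≤ Y := by exact_mod_cast hyY
    rw [discSum_line L σ Q s r₁ r₂ J p t m n y hdet]
    refine (h y (slopeLine Q r₁ r₂ J p t m n y) p t m n σ Q s ρ (|(t : ℝ)| * Q * η / y)
      (ordConnected_slopeLine hJ hdet hyZ hr₁) hdet hσ hρ hρ1 ht hs0 hsQ (by positivity) ?_ ?_).trans ?_
    · intro x hx
      rw [mem_slopeLine hdet, mem_slopeBox] at hx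
      have := hx.1.2.1
      simp only at this
      exact ⟨by omega, by omega⟩
    · intro x hx x' hx'
      exact_mod_cast abs_log_sub_log_le_of_mem_slopeLine hη hJu hdet hyZ hr₁ hr₂ hx hx'
    · have hc : ((slopeLine Q r₁ r₂ J p t m n y).card : ℝ) ≤ 1 + H * (y : ℝ) ^ (-(3 / 4) : ℝ) := by
        exact_mod_cast card_slopeLine_le hη hJu hdet hyZ hr₁ hr₂ hQ0
      rw [Finset.sum_add_distrib, Finset.sum_const, nsmul_eq_mul, Finset.mul_sum, ← add_assoc]
      have e3 : ∑ x ∈ slopeLine Q r₁ r₂ J p t m n y, 48 * ρ * Q / ((t * x + m * y : ℤ) : ℝ) =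
          ∑ x ∈ slopeLine Q r₁ r₂ J p t m n y, 48 * ρ * Q * (1 / ((t * x + m * y : ℤ) : ℝ)) :=
        Finset.sum_congr rfl fun x _ => by ring
      rw [e3]
      refine add_le_add_left ?_ _
      set c : ℝ := ((slopeLine Q r₁ r₂ J p t m n y).card : ℝ) with hcdef
      have hc0 : 0 ≤ c := Nat.cast_nonneg _
      have hpw : (1 : ℝ) ≤ K₁ * (y : ℝ) ^ (3 / 4 + δ / 2) :=
        one_le_mul_of_one_le_of_one_le hK₁ (Real.one_le_rpow hy1' (by linarith))
      have h34 : (y : ℝ) ^ (3 / 4 : ℝ) ≤ (Y : ℝ) ^ (3 / 4 : ℝ) := by gcongr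
      have hneg : (y : ℝ) ^ (3 / 4 : ℝ) * (y : ℝ) ^ (-(3 / 4) : ℝ) = 1 := by
        rw [← Real.rpow_add hy0]; norm_num
      have h1y : 1 / (y : ℝ) ≤ 1 := by rw [div_le_one hy0]; exact hy1'
      calc K₁ * (2 + |(t : ℝ)| * Q * η / y / ρ + c / y) * (y : ℝ) ^ (3 / 4 + δ / 2) + c * (1 / y)
          ≤ K₁ * (2 + |(t : ℝ)| * Q * η / y / ρ + c / y) * (y : ℝ) ^ (3 / 4 + δ / 2) +
            c * (1 / y) * (K₁ * (y : ℝ) ^ (3 / 4 + δ / 2)) := by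
              have := le_mul_of_one_le_right (show 0 ≤ c * (1 / (y : ℝ)) by positivity) hpw
              linarith
        _ = K₁ * (y : ℝ) ^ (3 / 4 + δ / 2) * (2 + Z * (1 / y) + 2 * c * (1 / y)) := by
              rw [hZ]; ring
        _ ≤ K₁ * (y : ℝ) ^ (3 / 4 + δ / 2) *
            (2 + Z * (1 / y) + 2 * (1 + H * (y : ℝ) ^ (-(3 / 4) : ℝ)) * (1 / y)) := by gcongr
        _ = K₁ * (y : ℝ) ^ (δ / 2) * ((2 + 2 * (1 / y)) * (y : ℝ) ^ (3 / 4 : ℝ) +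
            Z * (y : ℝ) ^ (3 / 4 : ℝ) * (1 / y) +
            2 * H * ((y : ℝ) ^ (3 / 4 : ℝ) * (y : ℝ) ^ (-(3 / 4) : ℝ)) * (1 / y)) := by
              rw [Real.rpow_add hy0]; ring
        _ ≤ K₁ * (Y : ℝ) ^ (δ / 2) * ((2 + 2 * 1) * (Y : ℝ) ^ (3 / 4 : ℝ) +
            Z * (Y : ℝ) ^ (3 / 4 : ℝ) * (1 / y) + 2 * H * 1 * (1 / y)) := by
              rw [hneg]; gcongr
        _ = _ := by ring
  rw [hsplit]
  refine (Finset.abs_sum_le_sum_abs _ _).trans ((Finset.sum_le_sum hstep).trans ?_)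
  rw [Finset.sum_add_distrib, ← Finset.mul_sum, ← Finset.mul_sum]
  refine add_le_add ?_ (by gcongr)
  rw [Finset.sum_add_distrib, Finset.sum_const, ← Finset.mul_sum, Nat.card_Icc, nsmul_eq_mul]
  have hYl := hlog Y (by exact_mod_cast hY)
  have hS := sum_Icc_inv_le Y
  have h74 : (Y : ℝ) * (Y : ℝ) ^ (3 / 4 : ℝ) = (Y : ℝ) ^ (7 / 4 : ℝ) := by
    rw [← Real.rpow_one_add' hY0.le (by norm_num)]; norm_num
  have hsq : (Y : ℝ) ^ (δ / 2) * (Y : ℝ) ^ (δ / 2) = (Y : ℝ) ^ δ := by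
    rw [← Real.rpow_add hY0]; ring_nf
  have hYd : (1 : ℝ) ≤ K₂ * (Y : ℝ) ^ (δ / 2) :=
    one_le_mul_of_one_le_of_one_le hK₂
      (Real.one_le_rpow (by exact_mod_cast hY) (by linarith))
  set D := (Y : ℝ) ^ (δ / 2) with hD
  set E := (Y : ℝ) ^ (3 / 4 : ℝ) with hE
  have hE0 : 0 ≤ E := by positivity
  have hD0 : 0 ≤ D := by positivity
  calc K₁ * D * (((Y + 1 - 1 : ℕ) : ℝ) * (4 * E) +
        (Z * E + 2 * H) * ∑ i ∈ Finset.Icc 1 Y, 1 / (i : ℝ))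
      ≤ K₁ * D * ((Y : ℝ) * (4 * E) * (K₂ * D) + (Z * E + 2 * H) * (K₂ * D)) := by
        rw [Nat.add_sub_cancel]
        refine mul_le_mul_of_nonneg_left (add_le_add ?_ ?_) (by positivity)
        · exact le_mul_of_one_le_right (by positivity) hYd
        · exact mul_le_mul_of_nonneg_left (hS.trans hYl) (by positivity)
    _ = K₁ * K₂ * (Y : ℝ) ^ δ * (4 * (Y : ℝ) ^ (7 / 4 : ℝ) + Z * E + 2 * H) := by
        rw [← hsq, ← h74]; ring
    _ ≤ K₁ * K₂ * (Y : ℝ) ^ δ * (4 * ((Y : ℝ) ^ (7 / 4 : ℝ) + Z * E + H)) := by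
        gcongr
        nlinarith [mul_nonneg hZ0 hE0]
    _ = _ := by ring

lemma abs_hypDisc_le {σ Q s a q : ℤ} (hq : 0 < q) (hqQ : q ≤ Q) (hs : Q - s ≤ q) (hsQ : s ≤ Q) :
    |hypDisc σ Q s a q| ≤ Q := by
  have hq' : (0 : ℝ) < q := by exact_mod_cast hq
  have hq1 : (1 : ℝ) ≤ q := by exact_mod_cast hq
  have hqQ' : (q : ℝ) ≤ Q := by exact_mod_cast hqQ
  have hs' : (Q : ℝ) - s ≤ q := by exact_mod_cast hs
  have hsQ' : (s : ℝ) ≤ Q := by exact_mod_cast hsQ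
  have h1 : (hypCount σ Q s a q : ℝ) ≤ q := by
    have h2 : (hypCount σ Q s a q : ℤ) ≤ q := by
      have := Finset.card_filter_le (Finset.Ioc (Q - q) s) (fun r => q ∣ a * r + σ)
      rw [Int.card_Ioc] at this
      unfold hypCount
      omega
    exact_mod_cast h2
  have h3 : (0 : ℝ) ≤ (s - Q + q) / q := div_nonneg (by linarith) hq'.le
  have h4 : (s - Q + q : ℝ) / q ≤ 1 := by rw [div_le_one hq']; linarith
  have h5 : (0 : ℝ) ≤ hypCount σ Q s a q := Nat.cast_nonneg _
  unfold hypDisc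
  rw [abs_le]; constructor <;> linarith

lemma sum_slopeBox_inv_le {Q r₁ r₂ : ℤ} {J : Set ℝ} {u η : ℝ} (hη : 0 ≤ η)
    (hJ : J ⊆ Set.Icc u (u + η)) (hQ : 0 ≤ Q) (hr₁ : 0 ≤ r₁) (hr₂ : r₂ ≤ Q) :
    ∑ v ∈ slopeBox Q r₁ r₂ J, (1 / (v.2 : ℝ)) ≤ Q * η + (1 + log Q) := by
  classical
  have hmaps : ∀ v ∈ slopeBox Q r₁ r₂ J, v.2 ∈ Finset.Ioc 0 Q := by
    intro v hv
    have := (mem_slopeBox.mp hv).1.2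
    rw [Finset.mem_Ioc]
    exact ⟨hr₁.trans_lt this.1, this.2.trans hr₂⟩
  rw [← Finset.sum_fiberwise_of_maps_to hmaps]
  have hstep : ∀ q ∈ Finset.Ioc 0 Q, ∑ v ∈ slopeBox Q r₁ r₂ J with v.2 = q, (1 / (v.2 : ℝ)) ≤
      η + 1 / q := by
    intro q hq
    have hq0 : (0 : ℝ) < q := by exact_mod_cast (Finset.mem_Ioc.mp hq).1
    have e : ∑ v ∈ slopeBox Q r₁ r₂ J with v.2 = q, (1 / (v.2 : ℝ)) =
        ((slopeBox Q r₁ r₂ J).filter fun v => v.2 = q).card * (1 / (q : ℝ)) := by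
      rw [← nsmul_eq_mul, ← Finset.sum_const]
      exact Finset.sum_congr rfl fun v hv => by rw [(Finset.mem_filter.mp hv).2]
    rw [e]
    have hc : (((slopeBox Q r₁ r₂ J).filter fun v => v.2 = q).card : ℝ) ≤ 1 + q * η := by
      have hinj : (((slopeBox Q r₁ r₂ J).filter fun v => v.2 = q).image Prod.fst).card =
          ((slopeBox Q r₁ r₂ J).filter fun v => v.2 = q).card := by
        refine Finset.card_image_of_injOn ?_
        intro v hv v' hv' h
        have h1 := (Finset.mem_filter.mp hv).2
        have h2 := (Finset.mem_filter.mp hv').2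
        exact Prod.ext h (h1.trans h2.symm)
      rw [← hinj]
      have := card_image_int_le (((slopeBox Q r₁ r₂ J).filter fun v => v.2 = q).image Prod.fst) id
        (q * η) (by positivity) ?_
      · simpa using this
      intro x hx x' hx'
      obtain ⟨v, hv, rfl⟩ := Finset.mem_image.mp hx
      obtain ⟨v', hv', rfl⟩ := Finset.mem_image.mp hx'
      obtain ⟨hv1, rfl⟩ := Finset.mem_filter.mp hv
      obtain ⟨hv', e⟩ := Finset.mem_filter.mp hv'
      have h1 := (hJ (mem_slopeBox.mp hv1).2).2
      have h2 := (hJ (mem_slopeBox.mp hv').2).1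
      rw [e] at h2
      rw [div_le_iff₀ hq0] at h1
      rw [le_div_iff₀ hq0] at h2
      simp only [id]
      nlinarith
    calc _ ≤ (1 + q * η) * (1 / (q : ℝ)) := by gcongr
      _ = _ := by field_simp; ring
  refine (Finset.sum_le_sum hstep).trans ?_
  rw [Finset.sum_add_distrib, Finset.sum_const, Int.card_Ioc, nsmul_eq_mul]
  have e1 : (((Q - 0).toNat : ℕ) : ℝ) = Q := by
    rw [← Int.cast_natCast, Int.toNat_of_nonneg (by omega)]; simp
  rw [e1]
  refine add_le_add le_rfl ?_
  have e2 : ∑ q ∈ Finset.Ioc 0 Q, (1 / (q : ℝ)) = ∑ i ∈ Finset.Icc 1 Q.toNat, (1 / (i : ℝ)) := by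
    refine Finset.sum_nbij' (fun q => q.toNat) (fun i => (i : ℤ)) ?_ ?_ ?_ ?_ ?_
    · intro q hq; simp only [Finset.mem_Ioc, Finset.mem_Icc] at hq ⊢; omega
    · intro q hq; simp only [Finset.mem_Ioc, Finset.mem_Icc] at hq ⊢; omega
    · intro q hq; simp only [Finset.mem_Ioc] at hq; omega
    · intro q hq; simp
    · intro q hq
      simp only [Finset.mem_Ioc] at hq
      rw [← Int.cast_natCast, Int.toNat_of_nonneg (by omega)]
  rw [e2]
  have := sum_Icc_inv_le Q.toNat
  rwa [← Int.cast_natCast, Int.toNat_of_nonneg hQ] at this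

lemma abs_discSum_axis_le (L : ℕ) {σ Q s r₁ r₂ p t m n : ℤ} {J : Set ℝ} (hdet : p * m - t * n = 1)
    (hs : s ≤ Q) (hr₁ : 0 ≤ r₁) (hr₁s : Q - s ≤ r₁) (hr₂ : r₂ ≤ Q) (hQ : 0 ≤ Q) :
    |discSum L σ Q s ((slopeBox Q r₁ r₂ J).filter fun v => p * v.2 - t * v.1 = 0)| ≤ Q := by
  have hQ' : (0 : ℝ) ≤ Q := by exact_mod_cast hQ
  unfold discSum
  set S := ((slopeBox Q r₁ r₂ J).filter fun v => p * v.2 - t * v.1 = 0).filter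
    (fun v => IsCoprime v.1 v.2 ∧ (L : ℤ) ∣ v.2 - v.1) with hS
  have key : ∀ v ∈ S, (v = (p, t) ∧ 0 < t) ∨ (v = (-p, -t) ∧ t < 0) := by
    rintro ⟨a, q⟩ hv
    obtain ⟨hv, ⟨c, d, hcd⟩, -⟩ := Finset.mem_filter.mp hv
    obtain ⟨hv, h0⟩ := Finset.mem_filter.mp hv
    have hq : 0 < q := hr₁.trans_lt (mem_slopeBox.mp hv).1.2.1
    simp only at h0 hcd
    set x := m * a - n * q with hx
    have e1 : a = p * x := by rw [hx]; linear_combination (-a) * hdet + n * h0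
    have e2 : q = t * x := by rw [hx]; linear_combination (-q) * hdet + m * h0
    have hu : IsUnit x := by
      refine isUnit_of_dvd_one ⟨c * p + d * t, ?_⟩
      linear_combination (-1) * hcd + c * e1 + d * e2
    rcases Int.isUnit_iff.mp hu with h1 | h1
    · left; rw [h1] at e1 e2; refine ⟨Prod.ext (by simp [e1]) (by simp [e2]), by omega⟩
    · right; rw [h1] at e1 e2; refine ⟨Prod.ext (by simp [e1]) (by simp [e2]), by omega⟩
  have hcard : S.card ≤ 1 := by
    rw [Finset.card_le_one]
    intro v hv v' hv'
    rcases key v hv with ⟨h1, h2⟩ | ⟨h1, h2⟩ <;> rcases key v' hv' with ⟨h3, h4⟩ | ⟨h3, h4⟩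
    · rw [h1, h3]
    · omega
    · omega
    · rw [h1, h3]
  refine (Finset.abs_sum_le_sum_abs _ _).trans ?_
  calc _ ≤ ∑ v ∈ S, (Q : ℝ) := by
        refine Finset.sum_le_sum fun v hv => ?_
        have := (mem_slopeBox.mp (Finset.mem_filter.mp (Finset.mem_filter.mp hv).1).1).1.2
        exact abs_hypDisc_le (hr₁.trans_lt this.1) (this.2.trans hr₂) (hr₁s.trans this.1.le) hs
    _ ≤ Q := by
        rw [Finset.sum_const, nsmul_eq_mul]
        have : (S.card : ℝ) ≤ 1 := by exact_mod_cast hcard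
        nlinarith

lemma exists_discSum_le (L : ℕ) (hL : 0 < L) (δ : ℝ) (hδ : 0 < δ) :
    ∃ K : ℝ, 1 ≤ K ∧ ∀ (p t m n σ Q s r₁ r₂ : ℤ) (J : Set ℝ) (u η ρ : ℝ) (Y : ℕ),
      J.OrdConnected → J ⊆ Set.Icc u (u + η) → 0 ≤ η → p * m - t * n = 1 → (σ = 1 ∨ σ = -1) →
      0 < ρ → ρ ≤ 1 → |t| ≤ Q → 0 ≤ s → s ≤ Q → 0 ≤ r₁ → Q - s ≤ r₁ → r₂ ≤ Q → 1 ≤ Y →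
      (∀ v ∈ slopeBox Q r₁ r₂ J, |p * v.2 - t * v.1| ≤ Y) →
      |discSum L σ Q s (slopeBox Q r₁ r₂ J)| ≤
      K * ((Y : ℝ) ^ δ * ((Y : ℝ) ^ (7 / 4 : ℝ) + |(t : ℝ)| * Q * η / ρ * (Y : ℝ) ^ (3 / 4 : ℝ) +
        (Q : ℝ) ^ (7 / 4 : ℝ) * η ^ (3 / 4 : ℝ)) + ρ * Q * (Q * η + (1 + log Q)) + Q) := by
  obtain ⟨K, hK, h⟩ := exists_discSum_halfPlane_le L hL δ hδ
  refine ⟨2 * K + 96, by linarith, ?_⟩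
  intro p t m n σ Q s r₁ r₂ J u η ρ Y hJ hJu hη hdet hσ hρ hρ1 ht hs0 hsQ hr₁ hr₁s hr₂ hY hV
  have hQ0 : 0 ≤ Q := hs0.trans hsQ
  have hQ' : (0 : ℝ) ≤ Q := by exact_mod_cast hQ0
  set V := slopeBox Q r₁ r₂ J with hVdef
  have h1 := h p t m n σ Q s r₁ r₂ J u η ρ Y hJ hJu hη hdet hσ hρ hρ1 ht hs0 hsQ hr₁ hr₁s hr₂ hY
    fun v hv => (le_abs_self _).trans (hV v hv)
  have h2 := h (-p) (-t) (-m) (-n) σ Q s r₁ r₂ J u η ρ Y hJ hJu hη (by linarith) hσ hρ hρ1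
    (by rwa [abs_neg]) hs0 hsQ hr₁ hr₁s hr₂ hY
    fun v hv => (by linarith : -p * v.2 - -t * v.1 ≤ -(p * v.2 - t * v.1)).trans
      ((neg_le_abs _).trans (hV v hv))
  have h3 := abs_discSum_axis_le L (σ := σ) (J := J) hdet hsQ hr₁ hr₁s hr₂ hQ0
  have h4 := sum_slopeBox_inv_le hη hJu hQ0 hr₁ hr₂
  have hsplit : discSum L σ Q s V = discSum L σ Q s (V.filter fun v => 0 < p * v.2 - t * v.1) +
      discSum L σ Q s (V.filter fun v => 0 < -p * v.2 - -t * v.1) +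
      discSum L σ Q s (V.filter fun v => p * v.2 - t * v.1 = 0) := by
    simp only [discSum, Finset.sum_filter]
    rw [← Finset.sum_add_distrib, ← Finset.sum_add_distrib]
    refine Finset.sum_congr rfl fun v _ => ?_
    have e : -p * v.2 - -t * v.1 = -(p * v.2 - t * v.1) := by ring
    rw [e]
    set z := p * v.2 - t * v.1
    split_ifs <;> first | omega | ring
  have ht' : |((-t : ℤ) : ℝ)| = |(t : ℝ)| := by push_cast; rw [abs_neg]
  rw [ht'] at h2
  rw [hsplit]
  refine (abs_add_three _ _ _).trans ?_
  set X := (Y : ℝ) ^ δ * ((Y : ℝ) ^ (7 / 4 : ℝ) + |(t : ℝ)| * Q * η / ρ * (Y : ℝ) ^ (3 / 4 : ℝ) +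
        (Q : ℝ) ^ (7 / 4 : ℝ) * η ^ (3 / 4 : ℝ)) with hX
  have hX0 : 0 ≤ X := by positivity
  rw [mul_assoc K, ← hX] at h1 h2
  set S := ∑ v ∈ V, (1 / (v.2 : ℝ)) with hS
  have hS0 : 0 ≤ S := by
    refine Finset.sum_nonneg fun v hv => ?_
    have : 0 < v.2 := hr₁.trans_lt (mem_slopeBox.mp hv).1.2.1
    positivity
  have h5 : ρ * Q * S ≤ ρ * Q * (Q * η + (1 + log Q)) := by gcongr
  have h6 : 0 ≤ ρ * Q * S := by positivity
  set W := ρ * Q * (Q * η + (1 + log Q)) with hW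
  nlinarith [mul_nonneg (by linarith : (0:ℝ) ≤ 2 * K) (by linarith : 0 ≤ W),
    mul_nonneg (by linarith : (0:ℝ) ≤ 2 * K + 95) hQ']

/-- The data used to reduce a window of slopes to a short hyperbola. -/
lemma exists_slope_approx {c K₀ : ℝ} (hc0 : 0 < c) (hc : c < 1 / 2) (hK₀ : 1 ≤ K₀) {Q r₁ r₂ : ℤ}
    {J : Set ℝ} {u η : ℝ} (hJu : J ⊆ Set.Icc u (u + η)) (hη : 0 ≤ η)
    (hηK : η ≤ K₀ * (Q : ℝ) ^ (-c)) (hQ : 1 ≤ Q) (hr₁ : 0 ≤ r₁) (hr₂ : r₂ ≤ Q) :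
    ∃ (p t m n : ℤ) (ρ : ℝ) (Y : ℕ), p * m - t * n = 1 ∧ 0 < ρ ∧ ρ ≤ 1 ∧ |t| ≤ Q ∧ 1 ≤ Y ∧
      (∀ v ∈ slopeBox Q r₁ r₂ J, |p * v.2 - t * v.1| ≤ Y) ∧ (Y : ℝ) ≤ 4 * K₀ * Q ∧
      (Y : ℝ) ^ (7 / 4 : ℝ) ≤ (4 * K₀) ^ 3 * (Q : ℝ) ^ (2 - c - (1 / 2 - c) / 3) ∧
      |(t : ℝ)| * Q * η / ρ * (Y : ℝ) ^ (3 / 4 : ℝ) ≤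
        (4 * K₀) ^ 3 * (Q : ℝ) ^ (2 - c - (1 / 2 - c) / 3) ∧
      ρ * Q ≤ (Q : ℝ) ^ (1 - (1 / 2 - c) / 3) := by
  have hX1 : (1 : ℝ) ≤ Q := by exact_mod_cast hQ
  have hX0 : (0 : ℝ) < Q := by linarith
  set X : ℝ := (Q : ℝ) with hX
  set κ : ℝ := (1 / 2 - c) / 3 with hκ
  have hκ0 : 0 < κ := by rw [hκ]; linarith
  have h4K : (4 : ℝ) ≤ 4 * K₀ := by linarith
  have h4K3 : 4 * K₀ ≤ (4 * K₀) ^ 3 := le_self_pow₀ (by linarith) (by norm_num)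
  have h4K1 : (1 : ℝ) ≤ (4 * K₀) ^ 3 := by linarith
  have hle : ∀ a b : ℝ, a ≤ b → X ^ a ≤ X ^ b := fun a b h => Real.rpow_le_rpow_of_exponent_le hX1 h
  rcases le_total c (1 / 8) with hc8 | hc8
  · refine ⟨1, 0, 1, 0, 1 / X, Q.toNat, by ring, by positivity, ?_, by simp; linarith, by omega,
      ?_, ?_, ?_, ?_, ?_⟩
    · rw [div_le_one hX0]; exact hX1
    · intro v hv
      have := (mem_slopeBox.mp hv).1.2
      rw [abs_le]
      constructor <;> simp only [one_mul, zero_mul, sub_zero]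
      · have := this.1; omega
      · have := this.2; omega
    · rw [← Int.cast_natCast, Int.toNat_of_nonneg (by omega)]
      nlinarith
    · rw [← Int.cast_natCast, Int.toNat_of_nonneg (by omega)]
      calc X ^ (7 / 4 : ℝ) ≤ X ^ (2 - c - κ) := hle _ _ (by rw [hκ]; linarith)
        _ ≤ _ := le_mul_of_one_le_left (by positivity) h4K1
    · simp; positivity
    · rw [one_div, inv_mul_cancel₀ hX0.ne']
      exact Real.one_le_rpow hX1 (by rw [hκ]; linarith)
  set g : ℝ := (c - κ) / 2 with hg
  have hg0 : 0 ≤ g := by rw [hg, hκ]; linarith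
  have hg1 : g ≤ 1 := by rw [hg, hκ]; linarith
  set N : ℕ := ⌊X ^ g⌋₊ with hN
  have hXg1 : 1 ≤ X ^ g := Real.one_le_rpow hX1 hg0
  have hN1 : 1 ≤ N := (Nat.one_le_floor_iff _).mpr hXg1
  have hNle : (N : ℝ) ≤ X ^ g := Nat.floor_le (by positivity)
  have hNlt : X ^ g < N + 1 := Nat.lt_floor_add_one _
  obtain ⟨r, hr, hrN⟩ := Real.exists_rat_abs_sub_le_and_den_le u (n := N) (by omega)
  have hden0 : (0 : ℝ) < r.den := by exact_mod_cast r.den_pos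
  have hdenN : (r.den : ℝ) ≤ X ^ g := le_trans (by exact_mod_cast hrN) hNle
  have hcop : IsCoprime r.num (r.den : ℤ) := Rat.isCoprime_num_den r
  obtain ⟨a, b, hab⟩ := hcop
  have hnear : |(r.den : ℝ) * u - r.num| ≤ X ^ (-g) := by
    have e : (r.den : ℝ) * u - r.num = r.den * (u - r) := by
      have : (r : ℝ) = r.num / r.den := by exact_mod_cast (Rat.num_div_den r).symm
      rw [this]; field_simp
    rw [e, abs_mul, abs_of_pos hden0]
    calc (r.den : ℝ) * |u - r| ≤ r.den * (1 / ((N + 1) * r.den)) := by gcongr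
      _ = 1 / (N + 1 : ℝ) := by field_simp
      _ ≤ 1 / X ^ g := by gcongr
      _ = _ := by rw [Real.rpow_neg hX0.le, one_div]
  have hY1 : 1 ≤ 2 * K₀ * X ^ (1 - g) := by
    have := Real.one_le_rpow hX1 (by linarith : 0 ≤ 1 - g)
    nlinarith
  set Y : ℕ := ⌈2 * K₀ * X ^ (1 - g)⌉₊ with hY
  have hYle : (Y : ℝ) ≤ 4 * K₀ * X ^ (1 - g) := by
    have := (Nat.ceil_lt_add_one (by linarith : 0 ≤ 2 * K₀ * X ^ (1 - g))).le
    linarith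
  have hYpow : ∀ z : ℝ, 0 ≤ z → z ≤ 2 → (Y : ℝ) ^ z ≤ (4 * K₀) ^ 2 * X ^ ((1 - g) * z) := by
    intro z hz hz2
    calc (Y : ℝ) ^ z ≤ (4 * K₀ * X ^ (1 - g)) ^ z := by gcongr
      _ = (4 * K₀) ^ z * X ^ ((1 - g) * z) := by
        rw [Real.mul_rpow (by linarith) (by positivity), ← Real.rpow_mul hX0.le]
      _ ≤ _ := by
        gcongr
        rw [← Real.rpow_natCast]
        exact Real.rpow_le_rpow_of_exponent_le (by linarith) (by exact_mod_cast hz2)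
  have h4K2 : (4 * K₀) ^ 2 ≤ (4 * K₀) ^ 3 := pow_le_pow_right₀ (by linarith) (by norm_num)
  have ht : |((r.den : ℤ) : ℝ)| = r.den := by simp
  refine ⟨r.num, r.den, a, -b, X ^ (-κ), Y, by linear_combination hab, by positivity,
    Real.rpow_le_one_of_one_le_of_nonpos hX1 (by linarith), ?_, ?_, ?_, ?_, ?_, ?_, ?_⟩
  · rw [abs_of_nonneg (by positivity)]
    have : (r.den : ℝ) ≤ Q := by
      calc (r.den : ℝ) ≤ X ^ (1 : ℝ) := hdenN.trans (hle _ _ hg1)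
        _ = Q := by rw [Real.rpow_one]
    exact_mod_cast this
  · exact Nat.one_le_ceil_iff.mpr (by linarith)
  · rintro ⟨a, q⟩ hv
    obtain ⟨⟨-, hq⟩, hJv⟩ := mem_slopeBox.mp hv
    simp only at hq hJv ⊢
    have hq0 : (0 : ℝ) < q := by exact_mod_cast hr₁.trans_lt hq.1
    have hqX : (q : ℝ) ≤ X := by rw [hX]; exact_mod_cast hq.2.trans hr₂
    have huv := hJu hJv
    have hfinal : |((r.num * q - r.den * a : ℤ) : ℝ)| ≤ 2 * K₀ * X ^ (1 - g) := by
      have e : ((r.num * q - r.den * a : ℤ) : ℝ) =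
          -(q * ((r.den * u - r.num) + r.den * ((a : ℝ) / q - u))) := by
        push_cast; field_simp; ring
      rw [e, abs_neg, abs_mul, abs_of_pos hq0]
      have h1 : |(a : ℝ) / q - u| ≤ η := by rw [abs_le]; constructor <;> linarith [huv.1, huv.2]
      have h2 : |(r.den * u - r.num) + r.den * ((a : ℝ) / q - u)| ≤ 2 * K₀ * X ^ (-g) := by
        refine (abs_add_le _ _).trans ?_
        rw [abs_mul (r.den : ℝ), abs_of_pos hden0]
        have h3 : (r.den : ℝ) * |(a : ℝ) / q - u| ≤ K₀ * X ^ (-g) := by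
          calc (r.den : ℝ) * |(a : ℝ) / q - u| ≤ X ^ g * (K₀ * X ^ (-c)) := by
                gcongr; exact h1.trans hηK
            _ = K₀ * X ^ (g + -c) := by rw [Real.rpow_add hX0]; ring
            _ ≤ K₀ * X ^ (-g) := by
                gcongr (?_ : ℝ) * ?_
                exact hle _ _ (by rw [hg]; linarith)
        have h4 : X ^ (-g) ≤ K₀ * X ^ (-g) := le_mul_of_one_le_left (by positivity) hK₀
        linarith
      calc _ ≤ X * (2 * K₀ * X ^ (-g)) := by gcongr
        _ = 2 * K₀ * X ^ (1 - g) := by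
          rw [sub_eq_add_neg, Real.rpow_add hX0, Real.rpow_one]; ring
    have : |((r.num * q - r.den * a : ℤ) : ℝ)| ≤ Y := hfinal.trans (Nat.le_ceil _)
    exact_mod_cast this
  · refine hYle.trans ?_
    have : X ^ (1 - g) ≤ X ^ (1 : ℝ) := hle _ _ (by linarith)
    rw [Real.rpow_one] at this
    gcongr
  · calc (Y : ℝ) ^ (7 / 4 : ℝ) ≤ (4 * K₀) ^ 2 * X ^ ((1 - g) * (7 / 4)) :=
          hYpow _ (by norm_num) (by norm_num)
      _ ≤ _ := by
        gcongr (?_ : ℝ) * ?_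
        exact hle _ _ (by rw [hg, hκ]; linarith)
  · rw [ht]
    calc (r.den : ℝ) * X * η / X ^ (-κ) * (Y : ℝ) ^ (3 / 4 : ℝ)
        ≤ X ^ g * X * (K₀ * X ^ (-c)) / X ^ (-κ) * ((4 * K₀) ^ 2 * X ^ ((1 - g) * (3 / 4))) := by
          gcongr
          exact hYpow _ (by norm_num) (by norm_num)
      _ = (K₀ * (4 * K₀) ^ 2) * X ^ (g + 1 + -c - -κ + (1 - g) * (3 / 4)) := by
          rw [Real.rpow_add hX0, Real.rpow_sub hX0, Real.rpow_add hX0, Real.rpow_add hX0,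
            Real.rpow_one]
          ring
      _ ≤ (4 * K₀) ^ 3 * X ^ (2 - c - κ) := by
          gcongr (?_ : ℝ) * ?_
          · rw [pow_succ (4 * K₀) 2]; nlinarith [sq_nonneg (4 * K₀)]
          · exact hle _ _ (by rw [hg, hκ]; linarith)
  · rw [mul_comm, sub_eq_add_neg, Real.rpow_add hX0, Real.rpow_one]

lemma exists_discSum_le_rpow (L : ℕ) (hL : 0 < L) {c K₀ δ : ℝ} (hc0 : 0 < c) (hc : c < 1 / 2)
    (hK₀ : 1 ≤ K₀) (hδ : 0 < δ) :
    ∃ C : ℝ, 1 ≤ C ∧ ∀ (σ Q s r₁ r₂ : ℤ) (J : Set ℝ) (u η : ℝ),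
      J.OrdConnected → J ⊆ Set.Icc u (u + η) → 0 ≤ η →
      η ≤ K₀ * (Q : ℝ) ^ (-c) → 1 ≤ Q → (σ = 1 ∨ σ = -1) → 0 ≤ s → s ≤ Q → 0 ≤ r₁ → Q - s ≤ r₁ →
      r₂ ≤ Q →
      |discSum L σ Q s (slopeBox Q r₁ r₂ J)| ≤ C * (Q : ℝ) ^ (2 - c - (1 / 2 - c) / 3 + δ) := by
  obtain ⟨K, hK, h⟩ := exists_discSum_le L hL δ hδ
  obtain ⟨K₂, hK₂, hlog⟩ := exists_one_add_log_le δ hδ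
  set D : ℝ := (4 * K₀) ^ δ with hD
  have hD1 : 1 ≤ D := Real.one_le_rpow (by linarith) hδ.le
  refine ⟨K * (D * ((4 * K₀) ^ 3 + (4 * K₀) ^ 3 + K₀) + (K₀ + K₂) + 1), ?_, ?_⟩
  · have : (0 : ℝ) ≤ D * ((4 * K₀) ^ 3 + (4 * K₀) ^ 3 + K₀) + (K₀ + K₂) := by positivity
    nlinarith
  intro σ Q s r₁ r₂ J u η hJ hJu hη hηK hQ hσ hs0 hsQ hr₁ hr₁s hr₂
  obtain ⟨p, t, m, n, ρ, Y, hdet, hρ, hρ1, ht, hY, hV, hYQ, hY7, hY3, hρQ⟩ :=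
    exists_slope_approx hc0 hc hK₀ hJu hη hηK hQ hr₁ hr₂
  have hX1 : (1 : ℝ) ≤ Q := by exact_mod_cast hQ
  have hX0 : (0 : ℝ) < Q := by linarith
  have hmain := h p t m n σ Q s r₁ r₂ J u η ρ Y hJ hJu hη hdet hσ hρ hρ1 ht hs0 hsQ hr₁ hr₁s hr₂
    hY hV
  have hlogQ := hlog Q hX1
  set X : ℝ := (Q : ℝ) with hX
  set κ : ℝ := (1 / 2 - c) / 3 with hκ
  set e : ℝ := 2 - c - κ with he
  have hle : ∀ a b : ℝ, a ≤ b → X ^ a ≤ X ^ b := fun a b h => Real.rpow_le_rpow_of_exponent_le hX1 h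
  have hYδ : (Y : ℝ) ^ δ ≤ D * X ^ δ := by
    rw [hD, ← Real.mul_rpow (by linarith) hX0.le]
    gcongr
  have h3 : X ^ (7 / 4 : ℝ) * η ^ (3 / 4 : ℝ) ≤ K₀ * X ^ e := by
    calc X ^ (7 / 4 : ℝ) * η ^ (3 / 4 : ℝ) ≤ X ^ (7 / 4 : ℝ) * (K₀ * X ^ (-c)) ^ (3 / 4 : ℝ) := by
          gcongr
      _ = K₀ ^ (3 / 4 : ℝ) * X ^ (7 / 4 + (-c) * (3 / 4)) := by
          rw [Real.mul_rpow (by linarith) (by positivity), ← Real.rpow_mul hX0.le,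
            Real.rpow_add hX0]; ring
      _ ≤ K₀ ^ (1 : ℝ) * X ^ e := by
          gcongr (?_ : ℝ) * ?_
          · exact Real.rpow_le_rpow_of_exponent_le hK₀ (by norm_num)
          · exact hle _ _ (by rw [he, hκ]; linarith)
      _ = _ := by rw [Real.rpow_one]
  have h4 : ρ * X * (X * η + (1 + log X)) ≤ (K₀ + K₂) * X ^ (e + δ) := by
    have hlog0 := Real.log_nonneg hX1
    calc ρ * X * (X * η + (1 + log X)) ≤
          X ^ (1 - κ) * (X * (K₀ * X ^ (-c)) + K₂ * X ^ δ) := by gcongr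
      _ = K₀ * X ^ (1 - κ + 1 + -c) + K₂ * X ^ (1 - κ + δ) := by
          rw [Real.rpow_add hX0, Real.rpow_add hX0 (1 - κ) 1, Real.rpow_one,
            Real.rpow_add hX0 (1 - κ) δ]
          ring
      _ ≤ K₀ * X ^ (e + δ) + K₂ * X ^ (e + δ) := by
          have i1 := hle (1 - κ + 1 + -c) (e + δ) (by rw [he]; linarith)
          have i2 := hle (1 - κ + δ) (e + δ) (by rw [he]; linarith)
          gcongr
      _ = _ := by ring
  have h5 : X ≤ X ^ (e + δ) := by
    have := hle 1 (e + δ) (by rw [he, hκ]; linarith)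
    rwa [Real.rpow_one] at this
  refine hmain.trans ?_
  rw [mul_assoc K]
  refine mul_le_mul_of_nonneg_left ?_ (by linarith)
  calc _ ≤ (D * X ^ δ) * ((4 * K₀) ^ 3 * X ^ e + (4 * K₀) ^ 3 * X ^ e + K₀ * X ^ e) +
        (K₀ + K₂) * X ^ (e + δ) + X ^ (e + δ) := by gcongr
    _ = _ := by rw [Real.rpow_add hX0]; ring

lemma abs_sum_mul_le_of_antitone {ι : Type*} (S : Finset ι) (k : ι → ℝ) (f : ℝ → ℝ) (x : ι → ℝ)
    {M E : ℝ} (hE : 0 ≤ E)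
    (hanti : ∀ i ∈ S, ∀ j ∈ S, k i ≤ k j → f (k j) ≤ f (k i))
    (h0 : ∀ i ∈ S, 0 ≤ f (k i)) (hM : ∀ i ∈ S, f (k i) ≤ M) (hM0 : 0 ≤ M)
    (hpart : ∀ t, |∑ i ∈ S.filter (fun i => k i ≤ t), x i| ≤ E) :
    |∑ i ∈ S, f (k i) * x i| ≤ M * E := by
  induction hn : S.card using Nat.strong_induction_on generalizing S f M with
  | _ n ih =>
    rcases S.eq_empty_or_nonempty with rfl | hne
    · simp; positivity
    obtain ⟨i₀, hi₀, hmax⟩ := S.exists_max_image k hne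
    set m := f (k i₀) with hm
    set S' := S.filter (fun i => k i < k i₀) with hS'
    have hS'S : S' ⊆ S := Finset.filter_subset _ _
    have hlt : S'.card < n := by
      rw [← hn]
      refine Finset.card_lt_card (Finset.ssubset_iff_subset_ne.mpr ⟨hS'S, fun h => ?_⟩)
      have := (Finset.mem_filter.mp (h ▸ hi₀ : i₀ ∈ S')).2
      exact lt_irrefl _ this
    have hfull : |∑ i ∈ S, x i| ≤ E := by
      have := hpart (k i₀)
      rwa [Finset.filter_true_of_mem hmax] at this
    have hmM : m ≤ M := hM i₀ hi₀
    have hrec := ih S'.card hlt S' (fun t => f t - m) (M := M - m)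
      (fun i hi j hj hij => by
        have := hanti i (hS'S hi) j (hS'S hj) hij
        linarith)
      (fun i hi => by
        have := hanti i (hS'S hi) i₀ hi₀ (hmax i (hS'S hi))
        linarith)
      (fun i hi => by
        have := hM i (hS'S hi)
        linarith) (by linarith) ?_ rfl
    · have e : ∑ i ∈ S, f (k i) * x i = m * ∑ i ∈ S, x i + ∑ i ∈ S', (f (k i) - m) * x i := by
        rw [hS', Finset.sum_filter, Finset.mul_sum, ← Finset.sum_add_distrib]
        refine Finset.sum_congr rfl fun i hi => ?_
        split_ifs with h
        · ring
        · have h1 : k i₀ ≤ k i := not_lt.mp h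
          have : f (k i) = m := le_antisymm (hanti i₀ hi₀ i hi h1) (hanti i hi i₀ hi₀ (hmax i hi))
          rw [this]; ring
      rw [e]
      refine (abs_add_le _ _).trans ?_
      rw [abs_mul, abs_of_nonneg (h0 i₀ hi₀)]
      have := mul_le_mul_of_nonneg_left hfull (h0 i₀ hi₀)
      linarith
    · intro t
      rcases lt_or_ge t (k i₀) with ht | ht
      · have : S'.filter (fun i => k i ≤ t) = S.filter (fun i => k i ≤ t) := by
          ext i
          simp only [hS', Finset.mem_filter]
          constructor
          · rintro ⟨⟨a, _⟩, b⟩; exact ⟨a, b⟩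
          · rintro ⟨a, b⟩; exact ⟨⟨a, b.trans_lt ht⟩, b⟩
        rw [this]; exact hpart t
      · have h1 : S'.filter (fun i => k i ≤ t) = S' :=
          Finset.filter_true_of_mem fun i hi => ((Finset.mem_filter.mp hi).2.le).trans ht
        rw [h1]
        rcases S'.eq_empty_or_nonempty with he | hne'
        · rw [he]; simpa using hE
        · obtain ⟨j, hj, hjmax⟩ := S'.exists_max_image k hne'
          have : S' = S.filter (fun i => k i ≤ k j) := by
            ext i
            constructor
            · intro hi
              exact Finset.mem_filter.mpr ⟨hS'S hi, hjmax i hi⟩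
            · intro hi
              obtain ⟨a, b⟩ := Finset.mem_filter.mp hi
              exact Finset.mem_filter.mpr ⟨a, b.trans_lt (Finset.mem_filter.mp hj).2⟩
          rw [this]; exact hpart _

open Classical in
/-- The points of `V` with coprime entries that are congruent modulo `L`. -/
noncomputable def primPts (L : ℕ) (V : Finset (ℤ × ℤ)) : Finset (ℤ × ℤ) :=
  V.filter fun v => IsCoprime v.1 v.2 ∧ (L : ℤ) ∣ v.2 - v.1

/-- The density of `arctan` at the slope of `v`. -/
noncomputable def slopeDens (v : ℤ × ℤ) : ℝ := 1 / (1 + ((v.1 : ℝ) / v.2) ^ 2)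

lemma abs_sum_slopeDens_mul_le (L : ℕ) {σ Q s r₁ r₂ : ℤ} {J : Set ℝ} {E M : ℝ} {f : ℤ → ℝ}
    (hE : 0 ≤ E) (hM : 0 ≤ M) (hr₁ : 0 ≤ r₁)
    (hdisc : ∀ (r : ℤ) (t : ℝ), r ≤ r₂ →
      |discSum L σ Q s (slopeBox Q r₁ r (J ∩ Set.Iic t))| ≤ E)
    (hanti : ∀ q q', r₁ < q → q ≤ q' → q' ≤ r₂ → f q' ≤ f q)
    (h0 : ∀ q, r₁ < q → q ≤ r₂ → 0 ≤ f q) (hfM : ∀ q, r₁ < q → q ≤ r₂ → f q ≤ M) :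
    |∑ v ∈ primPts L (slopeBox Q r₁ r₂ J), slopeDens v * (f v.2 * hypDisc σ Q s v.1 v.2)| ≤
      M * E := by
  have hmem : ∀ v ∈ primPts L (slopeBox Q r₁ r₂ J), (0 < v.1 ∧ v.1 ≤ Q) ∧ (r₁ < v.2 ∧ v.2 ≤ r₂) :=
    fun v hv => (mem_slopeBox.mp (Finset.mem_filter.mp hv).1).1
  have hslope : ∀ v ∈ primPts L (slopeBox Q r₁ r₂ J), 0 ≤ (v.1 : ℝ) / v.2 := fun v hv => by
    obtain ⟨h1, h2⟩ := hmem v hv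
    have h3 : (0 : ℝ) < v.1 := by exact_mod_cast h1.1
    have h4 : (0 : ℝ) < v.2 := by exact_mod_cast hr₁.trans_lt h2.1
    positivity
  have key := abs_sum_mul_le_of_antitone (primPts L (slopeBox Q r₁ r₂ J))
    (fun v => (v.1 : ℝ) / v.2) (fun u => 1 / (1 + u ^ 2))
    (fun v => f v.2 * hypDisc σ Q s v.1 v.2) (M := 1) (E := M * E) (by positivity) ?_ ?_ ?_
    zero_le_one ?_
  · rw [one_mul] at key
    exact key
  · intro v hv v' hv' h
    have := hslope v hv
    gcongr
  · intro v hv; positivity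
  · intro v hv
    rw [div_le_one (by positivity)]
    nlinarith [sq_nonneg ((v.1 : ℝ) / v.2)]
  · intro t
    set S := (primPts L (slopeBox Q r₁ r₂ J)).filter (fun v => (v.1 : ℝ) / v.2 ≤ t) with hS
    have hSm : ∀ v ∈ S, r₁ < v.2 ∧ v.2 ≤ r₂ := fun v hv => (hmem v (Finset.mem_filter.mp hv).1).2
    have key2 := abs_sum_mul_le_of_antitone S (fun v => (v.2 : ℝ)) (fun z => f ⌊z⌋)
      (fun v => hypDisc σ Q s v.1 v.2) (M := M) hE ?_ ?_ ?_ hM ?_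
    · simpa using key2
    · intro v hv v' hv' h
      simp only [Int.floor_intCast]
      exact hanti _ _ (hSm v hv).1 (by exact_mod_cast h) (hSm v' hv').2
    · intro v hv
      simp only [Int.floor_intCast]
      exact h0 _ (hSm v hv).1 (hSm v hv).2
    · intro v hv
      simp only [Int.floor_intCast]
      exact hfM _ (hSm v hv).1 (hSm v hv).2
    · intro z
      have := hdisc (min r₂ ⌊z⌋) t (min_le_left _ _)
      have e : S.filter (fun v => (v.2 : ℝ) ≤ z) =
          primPts L (slopeBox Q r₁ (min r₂ ⌊z⌋) (J ∩ Set.Iic t)) := by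
        ext v
        simp only [hS, primPts, Finset.mem_filter, mem_slopeBox, Set.mem_Ioc, le_min_iff,
          Set.mem_inter_iff, Set.mem_Iic, Int.le_floor]
        tauto
      rw [e]
      exact this

lemma sum_Ioc_int_telescope (g : ℤ → ℝ) {A B : ℤ} (h : A ≤ B) :
    ∑ s ∈ Finset.Ioc A B, (g (s + 1) - g s) = g (B + 1) - g (A + 1) := by
  refine Int.leInduction (by simp) ?_ B h
  intro n hn ih
  have : Finset.Ioc A (n + 1) = insert (n + 1) (Finset.Ioc A n) := by
    ext x; simp only [Finset.mem_Ioc, Finset.mem_insert]; omega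
  rw [this, Finset.sum_insert (by simp), ih]
  ring

lemma sum_mul_indicator_sub_eq {σ Q a q : ℤ} (hq : 0 < q) (w : ℤ → ℝ) :
    ∑ s ∈ (Finset.Ioc (Q - q) Q).filter (fun s => q ∣ a * s + σ), w s -
      (1 / (q : ℝ)) * ∑ s ∈ Finset.Ioc (Q - q) Q, w s =
    ∑ s ∈ Finset.Ioc (Q - q) Q, (w s - if s < Q then w (s + 1) else 0) * hypDisc σ Q s a q := by
  have hq' : (q : ℝ) ≠ 0 := by exact_mod_cast hq.ne'
  have hstep : ∀ s ∈ Finset.Ioc (Q - q) Q, hypDisc σ Q s a q - hypDisc σ Q (s - 1) a q =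
      (if q ∣ a * s + σ then 1 else 0) - 1 / (q : ℝ) := by
    intro s hs
    have hs := (Finset.mem_Ioc.mp hs).1
    have h1 : hypCount σ Q s a q = hypCount σ Q (s - 1) a q + if q ∣ a * s + σ then 1 else 0 := by
      unfold hypCount
      have : Finset.Ioc (Q - q) s = insert s (Finset.Ioc (Q - q) (s - 1)) := by
        ext x; simp only [Finset.mem_Ioc, Finset.mem_insert]; omega
      rw [this, Finset.filter_insert]
      split_ifs with h
      · rw [Finset.card_insert_of_notMem (by simp)]
      · simp
    unfold hypDisc
    rw [h1]
    push_cast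
    field_simp
    ring
  set g : ℤ → ℝ := fun s => (if s ≤ Q then w s else 0) * hypDisc σ Q (s - 1) a q with hg
  have htel := sum_Ioc_int_telescope g (A := Q - q) (B := Q) (by omega)
  have hz : hypDisc σ Q (Q - q) a q = 0 := by
    simp [hypDisc, hypCount]
  have g1 : g (Q + 1) = 0 := by simp [hg]
  have g2 : g (Q - q + 1) = 0 := by simp [hg, hz]
  rw [g1, g2, sub_zero] at htel
  suffices h : ∑ s ∈ (Finset.Ioc (Q - q) Q).filter (fun s => q ∣ a * s + σ), w s -
      (1 / (q : ℝ)) * ∑ s ∈ Finset.Ioc (Q - q) Q, w s -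
      ∑ s ∈ Finset.Ioc (Q - q) Q, (w s - if s < Q then w (s + 1) else 0) * hypDisc σ Q s a q =
      ∑ s ∈ Finset.Ioc (Q - q) Q, (g (s + 1) - g s) by
    rw [htel] at h
    linarith
  rw [Finset.sum_filter, Finset.mul_sum, ← Finset.sum_sub_distrib, ← Finset.sum_sub_distrib]
  refine Finset.sum_congr rfl fun s hs => ?_
  have h2 := hstep s hs
  have h3 : s ≤ Q := (Finset.mem_Ioc.mp hs).2
  have e1 : (if q ∣ a * s + σ then w s else 0) = w s * (if q ∣ a * s + σ then 1 else 0) := by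
    split_ifs <;> simp
  simp only [hg, h3, if_true, add_sub_cancel_right, Int.add_one_le_iff]
  rw [e1]
  linear_combination (-w s) * h2

/-- `f` agrees on `(r₁, r₂]` with a difference of two nonincreasing functions valued in
`[0, B]`. -/
def AntiDiff (r₁ r₂ : ℤ) (B : ℝ) (f : ℤ → ℝ) : Prop :=
  ∃ g h : ℤ → ℝ, (∀ q, r₁ < q → q ≤ r₂ → f q = g q - h q) ∧
    (∀ q q', r₁ < q → q ≤ q' → q' ≤ r₂ → g q' ≤ g q) ∧
    (∀ q q', r₁ < q → q ≤ q' → q' ≤ r₂ → h q' ≤ h q) ∧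
    (∀ q, r₁ < q → q ≤ r₂ → 0 ≤ g q ∧ g q ≤ B) ∧ (∀ q, r₁ < q → q ≤ r₂ → 0 ≤ h q ∧ h q ≤ B)

namespace AntiDiff

variable {r₁ r₂ : ℤ} {B B' : ℝ} {f f' : ℤ → ℝ}

lemma of_antitone (hB : 0 ≤ B) (h1 : ∀ q q', r₁ < q → q ≤ q' → q' ≤ r₂ → f q' ≤ f q)
    (h2 : ∀ q, r₁ < q → q ≤ r₂ → 0 ≤ f q ∧ f q ≤ B) : AntiDiff r₁ r₂ B f :=
  ⟨f, fun _ => 0, by simp, h1, by simp, h2, by simp [hB]⟩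

lemma congr (h : AntiDiff r₁ r₂ B f) (hf : ∀ q, r₁ < q → q ≤ r₂ → f' q = f q) :
    AntiDiff r₁ r₂ B f' := by
  obtain ⟨g, k, h1, h2⟩ := h
  exact ⟨g, k, fun q hq hq' => (hf q hq hq').trans (h1 q hq hq'), h2⟩

lemma mono (h : AntiDiff r₁ r₂ B f) (hB : B ≤ B') : AntiDiff r₁ r₂ B' f := by
  obtain ⟨g, k, h1, h2, h3, h4, h5⟩ := h
  exact ⟨g, k, h1, h2, h3, fun q hq hq' => ⟨(h4 q hq hq').1, (h4 q hq hq').2.trans hB⟩,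
    fun q hq hq' => ⟨(h5 q hq hq').1, (h5 q hq hq').2.trans hB⟩⟩

lemma subset (h : AntiDiff r₁ r₂ B f) {r : ℤ} (hr : r₁ ≤ r) : AntiDiff r r₂ B f := by
  obtain ⟨g, k, h1, h2, h3, h4, h5⟩ := h
  exact ⟨g, k, fun q hq => h1 q (hr.trans_lt hq), fun q q' hq => h2 q q' (hr.trans_lt hq),
    fun q q' hq => h3 q q' (hr.trans_lt hq), fun q hq => h4 q (hr.trans_lt hq),
    fun q hq => h5 q (hr.trans_lt hq)⟩

lemma neg (h : AntiDiff r₁ r₂ B f) : AntiDiff r₁ r₂ B (fun q => - f q) := by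
  obtain ⟨g, k, h1, h2, h3, h4, h5⟩ := h
  exact ⟨k, g, fun q hq hq' => by beta_reduce; rw [h1 q hq hq']; ring, h3, h2, h5, h4⟩

lemma add (h : AntiDiff r₁ r₂ B f) (h' : AntiDiff r₁ r₂ B' f') :
    AntiDiff r₁ r₂ (B + B') (fun q => f q + f' q) := by
  obtain ⟨g, k, h1, h2, h3, h4, h5⟩ := h
  obtain ⟨g', k', h1', h2', h3', h4', h5'⟩ := h'
  refine ⟨fun q => g q + g' q, fun q => k q + k' q, fun q hq hq' => ?_,
    fun q q' a b c => add_le_add (h2 q q' a b c) (h2' q q' a b c),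
    fun q q' a b c => add_le_add (h3 q q' a b c) (h3' q q' a b c),
    fun q a b => ⟨add_nonneg (h4 q a b).1 (h4' q a b).1, add_le_add (h4 q a b).2 (h4' q a b).2⟩,
    fun q a b => ⟨add_nonneg (h5 q a b).1 (h5' q a b).1, add_le_add (h5 q a b).2 (h5' q a b).2⟩⟩
  beta_reduce
  rw [h1 q hq hq', h1' q hq hq']; ring

lemma sub (h : AntiDiff r₁ r₂ B f) (h' : AntiDiff r₁ r₂ B' f') :
    AntiDiff r₁ r₂ (B + B') (fun q => f q - f' q) :=
  (h.add h'.neg).congr fun q _ _ => by ring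

lemma cut_gt {N : ℤ} (hB : 0 ≤ B)
    (h1 : ∀ q q', r₁ < q → N < q → q ≤ q' → q' ≤ r₂ → f q' ≤ f q)
    (h2 : ∀ q, r₁ < q → N < q → q ≤ r₂ → 0 ≤ f q ∧ f q ≤ B) :
    AntiDiff r₁ r₂ B (fun q => if N < q then f q else 0) := by
  by_cases hN : N + 1 ≤ r₂
  · by_cases hN' : r₁ < N + 1
    · refine ⟨fun q => f (max q (N + 1)), fun q => if N < q then 0 else f (N + 1),
        fun q hq hq' => ?_, fun q q' a b c => h1 _ _ (by omega) (by omega) (by omega) (by omega),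
        fun q q' a b c => ?_, fun q a b => h2 _ (by omega) (by omega) (by omega),
        fun q a b => ?_⟩
      · beta_reduce
        split_ifs with h
        · rw [max_eq_left (by omega)]; ring
        · rw [max_eq_right (by omega)]; ring
      · have := h2 (N + 1) hN' (by omega) hN
        beta_reduce
        split_ifs <;> first | exact le_rfl | exact this.1 | omega
      · have := h2 (N + 1) hN' (by omega) hN
        beta_reduce
        split_ifs
        · exact ⟨le_rfl, hB⟩
        · exact this
    · refine (of_antitone (f := f) hB (fun q q' a b c => h1 q q' a (by omega) b c)
        fun q a b => h2 q a (by omega) b).congr fun q a b => ?_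
      rw [if_pos (by omega)]
  · refine (of_antitone (f := fun _ => 0) hB (fun q q' a b c => le_rfl)
      fun q a b => ⟨le_rfl, hB⟩).congr fun q a b => ?_
    rw [if_neg (by omega)]

end AntiDiff

lemma abs_sum_slopeDens_antiDiff_le (L : ℕ) {σ Q s r₁ r₂ : ℤ} {J : Set ℝ} {E B : ℝ} {f : ℤ → ℝ}
    (hE : 0 ≤ E) (hB : 0 ≤ B) (hr₁ : 0 ≤ r₁)
    (hdisc : ∀ (r : ℤ) (t : ℝ), r ≤ r₂ →
      |discSum L σ Q s (slopeBox Q r₁ r (J ∩ Set.Iic t))| ≤ E)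
    (hf : AntiDiff r₁ r₂ B f) :
    |∑ v ∈ primPts L (slopeBox Q r₁ r₂ J), slopeDens v * (f v.2 * hypDisc σ Q s v.1 v.2)| ≤
      2 * B * E := by
  obtain ⟨g, h, h1, h2, h3, h4, h5⟩ := hf
  have e : ∑ v ∈ primPts L (slopeBox Q r₁ r₂ J),
      slopeDens v * (f v.2 * hypDisc σ Q s v.1 v.2) =
      ∑ v ∈ primPts L (slopeBox Q r₁ r₂ J), slopeDens v * (g v.2 * hypDisc σ Q s v.1 v.2) -
      ∑ v ∈ primPts L (slopeBox Q r₁ r₂ J), slopeDens v * (h v.2 * hypDisc σ Q s v.1 v.2) := by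
    rw [← Finset.sum_sub_distrib]
    refine Finset.sum_congr rfl fun v hv => ?_
    have hm := (mem_slopeBox.mp (Finset.mem_filter.mp hv).1).1.2
    rw [h1 _ hm.1 hm.2]; ring
  rw [e]
  have k1 := abs_sum_slopeDens_mul_le L hE hB hr₁ hdisc h2 (fun q a b => (h4 q a b).1)
    (fun q a b => (h4 q a b).2)
  have k2 := abs_sum_slopeDens_mul_le L hE hB hr₁ hdisc h3 (fun q a b => (h5 q a b).1)
    (fun q a b => (h5 q a b).2)
  refine (abs_sub _ _).trans ?_
  linarith

/-- The length of the part of a Farey interval with denominators `q` and `s` that is not covered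
by the arcs of radius `1 / (Q q)` and `1 / (Q s)` around end points of denominator at most `N`. -/
noncomputable def wt (Q N q s : ℤ) : ℝ :=
  if N < q then (if N < s then 1 / ((q : ℝ) * s) else (1 / (q : ℝ) - 1 / Q) / s)
  else if N < s then 1 / (q : ℝ) * (1 / (s : ℝ) - 1 / Q) else 0

section
variable {Q N : ℤ} {lam : ℝ}

lemma antiDiff_wt (hlam : 0 < lam) (hN0 : 0 ≤ N) (hNQ : N < Q) (hN : lam * Q < N + 1) {s : ℤ}
    (hs : 0 < s) (hsQ : s ≤ Q) : AntiDiff (Q - s) Q (2 / (lam * Q ^ 2)) (fun q => wt Q N q s) := by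
  have hQ : (0 : ℝ) < Q := by exact_mod_cast hN0.trans_lt hNQ
  have hs' : (0 : ℝ) < s := by exact_mod_cast hs
  have hsQ' : (s : ℝ) ≤ Q := by exact_mod_cast hsQ
  have hB : 0 ≤ 1 / (lam * (Q : ℝ) ^ 2) := by positivity
  have hbig : ∀ q : ℤ, N < q → lam * Q < q := fun q hq =>
    hN.trans_le (by exact_mod_cast hq)
  by_cases h : N < s
  · have p1 : AntiDiff (Q - s) Q (1 / (lam * Q ^ 2))
        (fun q => 1 / (q : ℝ) * (1 / (s : ℝ) - 1 / Q)) := by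
      have hk : 0 ≤ 1 / (s : ℝ) - 1 / Q := sub_nonneg.mpr (one_div_le_one_div_of_le hs' hsQ')
      refine AntiDiff.of_antitone hB (fun q q' a b c => ?_) fun q a b => ?_
      · have : (0 : ℝ) < q := by exact_mod_cast (show 0 < q by omega)
        have : (q : ℝ) ≤ q' := by exact_mod_cast b
        gcongr
      · have hq : (0 : ℝ) < q := by exact_mod_cast (show 0 < q by omega)
        refine ⟨by positivity, ?_⟩
        have h1 : (Q : ℝ) - s ≤ q := by exact_mod_cast a.le
        have h2 := hbig s h
        rw [div_sub_div _ _ hs'.ne' hQ.ne', div_mul_div_comm, div_le_div_iff₀ (by positivity)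
          (by positivity)]
        have : (1 * (1 * (Q : ℝ) - s * 1)) * (lam * Q ^ 2) ≤ q * (lam * Q ^ 2) := by
          gcongr; linarith
        have h3 : (q : ℝ) * (lam * Q ^ 2) = q * Q * (lam * Q) := by ring
        have h4 : (q : ℝ) * Q * (lam * Q) ≤ q * Q * s := by gcongr
        linarith
    have p2 : AntiDiff (Q - s) Q (1 / (lam * Q ^ 2))
        (fun q => if N < q then 1 / ((q : ℝ) * Q) else 0) := by
      refine AntiDiff.cut_gt (f := fun q => 1 / ((q : ℝ) * Q)) hB (fun q q' a d b c => ?_)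
        fun q a d b => ?_
      · have : (0 : ℝ) < q := by exact_mod_cast (show 0 < q by omega)
        have : (q : ℝ) ≤ q' := by exact_mod_cast b
        gcongr
      · have hq : (0 : ℝ) < q := by exact_mod_cast (show 0 < q by omega)
        refine ⟨by positivity, ?_⟩
        have := hbig q d
        rw [pow_two, ← mul_assoc]
        gcongr
    refine ((p1.add p2).mono (by rw [← add_div]; norm_num)).congr fun q a b => ?_
    have hq : (0 : ℝ) < q := by exact_mod_cast (show 0 < q by omega)
    unfold wt
    rw [if_pos h, if_pos h]
    split_ifs
    · field_simp; ring
    · ring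
  · have hle : 1 / (lam * (Q : ℝ) ^ 2) ≤ 2 / (lam * Q ^ 2) := by gcongr; norm_num
    refine (AntiDiff.mono (AntiDiff.cut_gt (N := N) (f := fun q : ℤ => (1 / (q : ℝ) - 1 / Q) / s)
      hB (fun q q' a d b c => ?_) fun q a d b => ?_) hle).congr fun q a b => ?_
    · have : (0 : ℝ) < q := by exact_mod_cast (show 0 < q by omega)
      have : (q : ℝ) ≤ q' := by exact_mod_cast b
      gcongr
    · have hq : (0 : ℝ) < q := by exact_mod_cast (show 0 < q by omega)
      have hqQ : (q : ℝ) ≤ Q := by exact_mod_cast b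
      have hk : 0 ≤ 1 / (q : ℝ) - 1 / Q := sub_nonneg.mpr (one_div_le_one_div_of_le hq hqQ)
      refine ⟨by positivity, ?_⟩
      have h1 : (Q : ℝ) - s ≤ q := by exact_mod_cast a.le
      have h2 := hbig q d
      rw [div_sub_div _ _ hq.ne' hQ.ne', div_div, div_le_div_iff₀ (by positivity) (by positivity)]
      have : (1 * (Q : ℝ) - q * 1) * (lam * Q ^ 2) ≤ s * (lam * Q ^ 2) := by
        gcongr; linarith
      have h3 : (s : ℝ) * (lam * Q ^ 2) = s * Q * (lam * Q) := by ring
      have h4 : (s : ℝ) * Q * (lam * Q) ≤ s * Q * q := by gcongr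
      linarith
    · unfold wt
      rw [if_neg h, if_neg h]

lemma antiDiff_wt_sub (hlam : 0 < lam) (hlam1 : lam ≤ 1) (hN0 : 0 ≤ N) (hNQ : N < Q)
    (hN : lam * Q < N + 1) {s : ℤ} (hs : 0 < s) (hsQ : s ≤ Q) :
    AntiDiff (Q - s) Q
      (4 / (lam ^ 2 * Q ^ 2) * (1 / s + 1 / ((Q : ℝ) - s + 1) + if s = N then 1 else 0))
      (fun q => wt Q N q s - if s < Q then wt Q N q (s + 1) else 0) := by
  have hQ : (0 : ℝ) < Q := by exact_mod_cast hN0.trans_lt hNQ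
  have hs' : (0 : ℝ) < s := by exact_mod_cast hs
  have hsQ' : (s : ℝ) ≤ Q := by exact_mod_cast hsQ
  have hd : (0 : ℝ) < (Q : ℝ) - s + 1 := by linarith
  have hbig : ∀ q : ℤ, N < q → lam * Q < q := fun q hq =>
    hN.trans_le (by exact_mod_cast hq)
  have hll : lam ^ 2 ≤ lam := by nlinarith
  have hC : 2 / (lam * (Q : ℝ) ^ 2) + 2 / (lam * (Q : ℝ) ^ 2) ≤ 4 / (lam ^ 2 * Q ^ 2) * 1 := by
    rw [← add_div, mul_one]; norm_num; gcongr
  rcases lt_trichotomy s N with h | h | h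
  · have hB : 0 ≤ 1 / (lam ^ 2 * (Q : ℝ) ^ 2) * (1 / s) := by positivity
    refine (AntiDiff.mono (AntiDiff.cut_gt (N := N)
      (f := fun q : ℤ => (1 / (q : ℝ) - 1 / Q) * (1 / s - 1 / (s + 1)))
      hB (fun q q' a d b c => ?_) fun q a d b => ?_) ?_).congr fun q a b => ?_
    · have : (0 : ℝ) < q := by exact_mod_cast (show 0 < q by omega)
      have : (q : ℝ) ≤ q' := by exact_mod_cast b
      have hk' : 0 ≤ 1 / (s : ℝ) - 1 / (s + 1) :=
        sub_nonneg.mpr (one_div_le_one_div_of_le hs' (by linarith))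
      gcongr
    · have hq : (0 : ℝ) < q := by exact_mod_cast (show 0 < q by omega)
      have hqQ : (q : ℝ) ≤ Q := by exact_mod_cast b
      have hk : 0 ≤ 1 / (q : ℝ) - 1 / Q := sub_nonneg.mpr (one_div_le_one_div_of_le hq hqQ)
      have hk' : 0 ≤ 1 / (s : ℝ) - 1 / (s + 1) :=
        sub_nonneg.mpr (one_div_le_one_div_of_le hs' (by linarith))
      refine ⟨by positivity, ?_⟩
      have h1 : (Q : ℝ) - s ≤ q := by exact_mod_cast a.le
      have h2 := hbig q d
      have e1 : 1 / (q : ℝ) - 1 / Q ≤ s * (1 / (lam ^ 2 * Q ^ 2)) := by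
        rw [div_sub_div _ _ hq.ne' hQ.ne', mul_one_div, div_le_div_iff₀ (by positivity)
          (by positivity)]
        have : (1 * (Q : ℝ) - q * 1) * (lam ^ 2 * Q ^ 2) ≤ s * (lam * Q ^ 2) := by
          gcongr; linarith
        have h3 : (s : ℝ) * (lam * Q ^ 2) = s * Q * (lam * Q) := by ring
        have h4 : (s : ℝ) * Q * (lam * Q) ≤ s * Q * q := by gcongr
        linarith
      have e2 : 1 / (s : ℝ) - 1 / (s + 1) ≤ 1 / (s * s) := by
        rw [div_sub_div _ _ hs'.ne' (by positivity), div_le_div_iff₀ (by positivity) (by positivity)]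
        nlinarith
      calc _ ≤ s * (1 / (lam ^ 2 * (Q : ℝ) ^ 2)) * (1 / (s * s)) := by gcongr
        _ = _ := by field_simp
    · rw [if_neg h.ne]
      have : 0 ≤ 1 / ((Q : ℝ) - s + 1) := by positivity
      gcongr
      · norm_num
      · linarith
    · have : (s + 1 : ℤ) ≤ Q := by omega
      unfold wt
      simp only [if_pos (show s < Q by omega), if_neg (show ¬ N < s by omega),
        if_neg (show ¬ N < s + 1 by omega)]
      split_ifs
      · push_cast; ring
      · ring
  · subst h
    have k1 := antiDiff_wt hlam hN0 hNQ hN hs hsQ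
    have k2 := antiDiff_wt hlam hN0 hNQ hN (s := s + 1) (by omega) (by omega)
    refine ((k1.sub (k2.subset (r := Q - s) (by omega))).mono ?_).congr fun q a b => ?_
    · rw [if_pos rfl]
      refine hC.trans ?_
      gcongr
      have : 0 ≤ 1 / ((Q : ℝ) - s + 1) := by positivity
      have : 0 ≤ 1 / (s : ℝ) := by positivity
      linarith
    · rw [if_pos hNQ]
  · have hsl := hbig s h
    rw [if_neg h.ne']
    rcases hsQ.lt_or_eq with h' | h'
    · have hk' : 0 ≤ 1 / (s : ℝ) - 1 / (s + 1) :=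
        sub_nonneg.mpr (one_div_le_one_div_of_le hs' (by linarith))
      refine (AntiDiff.mono (AntiDiff.of_antitone
        (B := 1 / (lam ^ 2 * (Q : ℝ) ^ 2) * (1 / ((Q : ℝ) - s + 1)))
        (f := fun q : ℤ => 1 / (q : ℝ) * (1 / s - 1 / (s + 1)))
        (by positivity) (fun q q' a b c => ?_) fun q a b => ?_) ?_).congr fun q a b => ?_
      · have : (0 : ℝ) < q := by exact_mod_cast (show 0 < q by omega)
        have : (q : ℝ) ≤ q' := by exact_mod_cast b
        gcongr
      · have hq : (0 : ℝ) < q := by exact_mod_cast (show 0 < q by omega)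
        refine ⟨by positivity, ?_⟩
        have h1 : (Q : ℝ) - s + 1 ≤ q := by exact_mod_cast (show Q - s + 1 ≤ q by omega)
        rw [mul_comm (1 / (lam ^ 2 * (Q : ℝ) ^ 2))]
        have e2 : 1 / (s : ℝ) - 1 / (s + 1) ≤ 1 / (s * s) := by
          rw [div_sub_div _ _ hs'.ne' (by positivity), div_le_div_iff₀ (by positivity) (by positivity)]
          nlinarith
        have e3 : 1 / ((s : ℝ) * s) ≤ 1 / (lam ^ 2 * (Q : ℝ) ^ 2) := by
          have : lam ^ 2 * (Q : ℝ) ^ 2 = (lam * Q) * (lam * Q) := by ring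
          rw [this]
          gcongr
        gcongr
        exact e2.trans e3
      · have : 0 ≤ 1 / (s : ℝ) := by positivity
        gcongr
        · norm_num
        · linarith
      · unfold wt
        simp only [if_pos h', if_pos h, if_pos (show N < s + 1 by omega)]
        have hq : (q : ℝ) ≠ 0 := by exact_mod_cast (show q ≠ 0 by omega)
        split_ifs
        · push_cast; field_simp
        · push_cast; ring
    · refine ((antiDiff_wt hlam hN0 hNQ hN hs hsQ).mono ?_).congr fun q a b => ?_
      · have h0 : 0 ≤ 2 / (lam * (Q : ℝ) ^ 2) := by positivity
        have : 1 / ((Q : ℝ) - s + 1) = 1 := by rw [h']; simp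
        rw [this]
        have h1 : 4 / (lam ^ 2 * (Q : ℝ) ^ 2) * 1 ≤
            4 / (lam ^ 2 * (Q : ℝ) ^ 2) * (1 / s + 1 + 0) := by
          gcongr
          have : 0 ≤ 1 / (s : ℝ) := by positivity
          linarith
        linarith
      · rw [if_neg (by omega), sub_zero]

end

lemma sum_Ioc_int_inv_le {Q : ℤ} (hQ : 0 < Q) :
    ∑ s ∈ Finset.Ioc 0 Q, 1 / (s : ℝ) ≤ 1 + log Q := by
  obtain ⟨n, rfl⟩ := Int.eq_ofNat_of_zero_le hQ.le
  have h := sum_Icc_inv_le n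
  refine le_trans (le_of_eq ?_) h
  refine Finset.sum_nbij' (fun s => s.toNat) (fun i => (i : ℤ)) ?_ ?_ ?_ ?_ ?_
  · intro s hs; simp only [Finset.mem_Ioc, Finset.mem_Icc] at *; omega
  · intro s hs; simp only [Finset.mem_Ioc, Finset.mem_Icc] at *; omega
  · intro s hs; simp only [Finset.mem_Ioc] at *; omega
  · intro s hs; simp
  · intro s hs
    simp only [Finset.mem_Ioc] at hs
    have : ((s.toNat : ℤ) : ℝ) = s := by rw [Int.toNat_of_nonneg hs.1.le]
    rw [← this, Int.cast_natCast]

/-- The sum of `slopeDens v * wt Q N q s` over the primitive `v = (a, q)` in a slope box and the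
`s ∈ (Q - q, Q]` with `q ∣ a s + σ`. -/
noncomputable def pairSum (L : ℕ) (σ Q N : ℤ) (J : Set ℝ) : ℝ :=
  ∑ v ∈ primPts L (slopeBox Q 0 Q J), slopeDens v *
    ∑ s ∈ (Finset.Ioc (Q - v.2) Q).filter (fun s => v.2 ∣ v.1 * s + σ), wt Q N v.2 s

/-- The sum `pairSum` with the divisibility condition replaced by its density. -/
noncomputable def meanSum (L : ℕ) (Q N : ℤ) (J : Set ℝ) : ℝ :=
  ∑ v ∈ primPts L (slopeBox Q 0 Q J), slopeDens v *
    (1 / (v.2 : ℝ) * ∑ s ∈ Finset.Ioc (Q - v.2) Q, wt Q N v.2 s)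

lemma abs_pairSum_sub_meanSum_le (L : ℕ) {σ Q N : ℤ} {lam E : ℝ} {J : Set ℝ}
    (hlam : 0 < lam) (hlam1 : lam ≤ 1) (hN0 : 0 ≤ N) (hNQ : N < Q)
    (hN : lam * Q < N + 1) (hE : 0 ≤ E)
    (hdisc : ∀ (s r : ℤ) (t : ℝ), 0 < s → s ≤ Q → r ≤ Q →
      |discSum L σ Q s (slopeBox Q (Q - s) r (J ∩ Set.Iic t))| ≤ E) :
    |pairSum L σ Q N J - meanSum L Q N J| ≤
      24 / lam ^ 2 * ((1 + log Q) * (E / (Q : ℝ) ^ 2)) := by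
  have hQ0 : 0 < Q := hN0.trans_lt hNQ
  have hQ : (0 : ℝ) < Q := by exact_mod_cast hQ0
  have e : pairSum L σ Q N J - meanSum L Q N J = ∑ s ∈ Finset.Ioc 0 Q,
      ∑ v ∈ primPts L (slopeBox Q (Q - s) Q J), slopeDens v *
        ((wt Q N v.2 s - if s < Q then wt Q N v.2 (s + 1) else 0) * hypDisc σ Q s v.1 v.2) := by
    rw [Finset.sum_comm' (t' := primPts L (slopeBox Q 0 Q J))
      (s' := fun v => Finset.Ioc (Q - v.2) Q)]
    · unfold pairSum meanSum
      rw [← Finset.sum_sub_distrib]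
      refine Finset.sum_congr rfl fun v hv => ?_
      have hm := (mem_slopeBox.mp (Finset.mem_filter.mp hv).1).1.2
      rw [← mul_sub, sum_mul_indicator_sub_eq hm.1, Finset.mul_sum]
    · intro s v
      simp only [primPts, Finset.mem_filter, mem_slopeBox, Set.mem_Ioc, Finset.mem_Ioc]
      constructor
      · rintro ⟨h1, ⟨⟨h2, h3⟩, h4⟩, h5⟩
        exact ⟨by omega, ⟨⟨h2, by omega⟩, h4⟩, h5⟩
      · rintro ⟨h1, ⟨⟨h2, h3⟩, h4⟩, h5⟩
        exact ⟨by omega, ⟨⟨h2, by omega⟩, h4⟩, h5⟩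
  rw [e]
  refine (Finset.abs_sum_le_sum_abs _ _).trans ?_
  have hterm : ∀ s ∈ Finset.Ioc 0 Q, |∑ v ∈ primPts L (slopeBox Q (Q - s) Q J), slopeDens v *
      ((wt Q N v.2 s - if s < Q then wt Q N v.2 (s + 1) else 0) * hypDisc σ Q s v.1 v.2)| ≤
      (8 * E / (lam ^ 2 * Q ^ 2)) *
        (1 / s + 1 / ((Q : ℝ) - s + 1) + if s = N then 1 else 0) := by
    intro s hs
    obtain ⟨h1, h2⟩ := Finset.mem_Ioc.mp hs
    have hs' : (0 : ℝ) < s := by exact_mod_cast h1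
    have hsQ' : (s : ℝ) ≤ Q := by exact_mod_cast h2
    have hd : (0 : ℝ) < (Q : ℝ) - s + 1 := by linarith
    have hB : 0 ≤ 4 / (lam ^ 2 * (Q : ℝ) ^ 2) *
        (1 / s + 1 / ((Q : ℝ) - s + 1) + if s = N then 1 else 0) := by
      have : (0 : ℝ) ≤ if s = N then 1 else 0 := by split_ifs <;> norm_num
      positivity
    refine (abs_sum_slopeDens_antiDiff_le L hE hB (by omega)
      (fun r t hr => hdisc s r t h1 h2 hr)
      (antiDiff_wt_sub hlam hlam1 hN0 hNQ hN h1 h2)).trans (le_of_eq ?_)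
    ring
  refine (Finset.sum_le_sum hterm).trans ?_
  rw [← Finset.mul_sum, Finset.sum_add_distrib, Finset.sum_add_distrib]
  have s1 := sum_Ioc_int_inv_le hQ0
  have s2 : ∑ s ∈ Finset.Ioc 0 Q, 1 / ((Q : ℝ) - s + 1) ≤ 1 + log Q := by
    refine le_trans (le_of_eq ?_) s1
    refine Finset.sum_nbij' (fun s => Q - s + 1) (fun s => Q - s + 1) ?_ ?_ ?_ ?_ ?_ <;>
      intro s hs <;> (try simp only [Finset.mem_Ioc] at *) <;> (try omega)
    push_cast; rfl
  have s3 : ∑ s ∈ Finset.Ioc 0 Q, (if s = N then (1 : ℝ) else 0) ≤ 1 + log Q := by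
    have : ∑ s ∈ Finset.Ioc 0 Q, (if s = N then (1 : ℝ) else 0) ≤ 1 := by
      rw [Finset.sum_ite_eq']; split_ifs <;> norm_num
    have h1 : 0 ≤ log (Q : ℝ) := log_nonneg (by exact_mod_cast hQ0)
    linarith
  calc _ ≤ 8 * E / (lam ^ 2 * Q ^ 2) * ((1 + log Q) + (1 + log Q) + (1 + log Q)) := by gcongr
    _ = _ := by field_simp; ring

lemma exists_abs_pairSum_sub_meanSum_le (L : ℕ) (hL : 0 < L) {c K₀ δ lam : ℝ} (hc0 : 0 < c)
    (hc : c < 1 / 2) (hK₀ : 1 ≤ K₀) (hδ : 0 < δ) (hlam : 0 < lam) (hlam1 : lam ≤ 1) :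
    ∃ C : ℝ, 0 ≤ C ∧ ∀ (σ Q N : ℤ) (J : Set ℝ) (u η : ℝ),
      J.OrdConnected → J ⊆ Set.Icc u (u + η) → 0 ≤ η → η ≤ K₀ * (Q : ℝ) ^ (-c) →
      (σ = 1 ∨ σ = -1) → 0 ≤ N → N < Q → lam * Q < N + 1 →
      |pairSum L σ Q N J - meanSum L Q N J| ≤ C * (Q : ℝ) ^ (-(c + (1 / 2 - c) / 3) + δ) := by
  obtain ⟨K, hK, h⟩ := exists_discSum_le_rpow L hL hc0 hc hK₀ (half_pos hδ)
  obtain ⟨K₂, hK₂, hlog⟩ := exists_one_add_log_le (δ / 2) (half_pos hδ)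
  refine ⟨24 / lam ^ 2 * (K₂ * K), by positivity, ?_⟩
  intro σ Q N J u η hJ hJu hη hηK hσ hN0 hNQ hN
  have hQ1 : 1 ≤ Q := by omega
  have hX1 : (1 : ℝ) ≤ Q := by exact_mod_cast hQ1
  have hX0 : (0 : ℝ) < Q := by linarith
  refine (abs_pairSum_sub_meanSum_le L (σ := σ) (J := J)
    (E := K * (Q : ℝ) ^ (2 - c - (1 / 2 - c) / 3 + δ / 2)) hlam hlam1 hN0 hNQ hN
    (by positivity) ?_).trans ?_
  · intro s r t hs hsQ hr
    exact h σ Q s (Q - s) r (J ∩ Set.Iic t) u η (hJ.inter Set.ordConnected_Iic)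
      (Set.inter_subset_left.trans hJu) hη hηK hQ1 hσ hs.le hsQ (by omega) le_rfl hr
  · rw [mul_assoc]
    refine mul_le_mul_of_nonneg_left ?_ (by positivity)
    have e : (Q : ℝ) ^ (-(c + (1 / 2 - c) / 3) + δ) = (Q : ℝ) ^ (δ / 2) *
        ((Q : ℝ) ^ (2 - c - (1 / 2 - c) / 3 + δ / 2) / (Q : ℝ) ^ 2) := by
      rw [← Real.rpow_natCast, ← Real.rpow_sub hX0, ← Real.rpow_add hX0]
      congr 1; push_cast; ring
    rw [e]
    have := hlog (Q : ℝ) hX1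
    calc _ ≤ (K₂ * (Q : ℝ) ^ (δ / 2)) *
          (K * (Q : ℝ) ^ (2 - c - (1 / 2 - c) / 3 + δ / 2) / (Q : ℝ) ^ 2) := by gcongr
      _ = _ := by ring

lemma Ioc_int_succ {A B : ℤ} (h : A ≤ B) :
    Finset.Ioc A (B + 1) = insert (B + 1) (Finset.Ioc A B) := by
  ext x; simp only [Finset.mem_Ioc, Finset.mem_insert]; omega

lemma sum_Ioc_int_integral {f : ℝ → ℝ} {A B : ℤ} (h : A ≤ B)
    (hf : AntitoneOn f (Set.Icc (A : ℝ) B)) :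
    ∑ q ∈ Finset.Ioc A B, f q ≤ ∫ x in (A : ℝ)..B, f x ∧
      ∫ x in (A : ℝ)..B, f x ≤ ∑ q ∈ Finset.Ioc A B, f q + (f A - f B) := by
  induction B, h using Int.leInduction with
  | base => simp
  | succ n hn ih =>
    have hn' : (A : ℝ) ≤ n := by exact_mod_cast hn
    push_cast at hf ⊢
    have hsub : AntitoneOn f (Set.Icc (A : ℝ) n) :=
      hf.mono (Set.Icc_subset_Icc_right (by linarith))
    have hsub' : AntitoneOn f (Set.Icc (n : ℝ) (n + 1)) := hf.mono (Set.Icc_subset_Icc_left hn')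
    obtain ⟨i1, i2⟩ := ih hsub
    have int1 : IntervalIntegrable f volume A n :=
      AntitoneOn.intervalIntegrable (by rwa [Set.uIcc_of_le hn'])
    have int2 : IntervalIntegrable f volume n (n + 1) :=
      AntitoneOn.intervalIntegrable (by rwa [Set.uIcc_of_le (by linarith)])
    rw [Ioc_int_succ hn, Finset.sum_insert (by simp),
      ← intervalIntegral.integral_add_adjacent_intervals int1 int2]
    push_cast
    have l1 : f (n + 1) ≤ ∫ x in (n : ℝ)..(n + 1), f x := by
      have := intervalIntegral.integral_mono_on (μ := volume) (a := (n : ℝ)) (b := n + 1)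
        (f := fun _ => f (n + 1)) (g := f) (by linarith) (by simp) int2
        (fun x hx => hsub' hx ⟨by linarith, le_rfl⟩ hx.2)
      simpa using this
    have l2 : ∫ x in (n : ℝ)..(n + 1), f x ≤ f n := by
      have := intervalIntegral.integral_mono_on (μ := volume) (a := (n : ℝ)) (b := n + 1)
        (g := fun _ => f n) (f := f) (by linarith) int2 (by simp)
        (fun x hx => hsub' ⟨le_rfl, by linarith⟩ hx hx.1)
      simpa using this
    constructor <;> linarith

lemma sum_Ioc_int_inv_log {a b : ℤ} (ha : 0 < a) (hab : a ≤ b) :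
    ∑ s ∈ Finset.Ioc a b, 1 / (s : ℝ) ≤ log (b / a) ∧
      log (b / a) ≤ ∑ s ∈ Finset.Ioc a b, 1 / (s : ℝ) + 1 / a := by
  have ha' : (0 : ℝ) < a := by exact_mod_cast ha
  have hab' : (a : ℝ) ≤ b := by exact_mod_cast hab
  obtain ⟨h1, h2⟩ := sum_Ioc_int_integral (f := fun x => 1 / x) hab (fun x hx y hy hxy => by
    have : 0 < x := ha'.trans_le hx.1
    beta_reduce
    gcongr)
  rw [integral_one_div_of_pos ha' (by linarith)] at h1 h2
  have : 0 < 1 / (b : ℝ) := by apply one_div_pos.mpr; linarith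
  exact ⟨h1, by linarith⟩

lemma abs_riemann_le {F : ℝ → ℝ} {Q m : ℤ} {B : ℝ} (hQ : 0 < Q) (hmQ : m ≤ Q)
    {g h : ℝ → ℝ} (hF : ∀ x ∈ Set.Icc ((m : ℝ) / Q) 1, F x = g x - h x)
    (hg : AntitoneOn g (Set.Icc ((m : ℝ) / Q) 1)) (hh : AntitoneOn h (Set.Icc ((m : ℝ) / Q) 1))
    (hgB : g (m / Q) - g 1 ≤ B) (hhB : h (m / Q) - h 1 ≤ B) :
    |∑ q ∈ Finset.Ioc m Q, F (q / Q) / Q - ∫ x in (m / Q : ℝ)..1, F x| ≤ B / Q := by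
  have hQ' : (0 : ℝ) < Q := by exact_mod_cast hQ
  have hmQ' : (m : ℝ) ≤ Q := by exact_mod_cast hmQ
  have hle : (m : ℝ) / Q ≤ 1 := by rw [div_le_one hQ']; exact hmQ'
  have main : ∀ k : ℝ → ℝ, AntitoneOn k (Set.Icc ((m : ℝ) / Q) 1) → k (m / Q) - k 1 ≤ B →
      ∑ q ∈ Finset.Ioc m Q, k (q / Q) / Q ≤ ∫ x in (m / Q : ℝ)..1, k x ∧
      ∫ x in (m / Q : ℝ)..1, k x ≤ ∑ q ∈ Finset.Ioc m Q, k (q / Q) / Q + B / Q := by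
    intro k hk hkB
    have hanti : AntitoneOn (fun x : ℝ => k (x / Q) / Q) (Set.Icc (m : ℝ) Q) := by
      intro x hx y hy hxy
      have hx' : x / Q ∈ Set.Icc ((m : ℝ) / Q) 1 :=
        ⟨by gcongr; exact hx.1, by rw [div_le_one hQ']; exact hx.2⟩
      have hy' : y / Q ∈ Set.Icc ((m : ℝ) / Q) 1 :=
        ⟨by gcongr; exact hy.1, by rw [div_le_one hQ']; exact hy.2⟩
      have := hk hx' hy' (by gcongr)
      beta_reduce
      gcongr
    obtain ⟨h1, h2⟩ := sum_Ioc_int_integral hmQ hanti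
    have e : ∫ x in (m : ℝ)..Q, k (x / Q) / Q = ∫ x in (m / Q : ℝ)..1, k x := by
      rw [intervalIntegral.integral_div, intervalIntegral.integral_comp_div _ hQ'.ne', div_self hQ'.ne',
        smul_eq_mul]
      field_simp
    rw [e] at h1 h2
    refine ⟨h1, h2.trans ?_⟩
    rw [div_self hQ'.ne', ← sub_div]
    gcongr
  obtain ⟨g1, g2⟩ := main g hg hgB
  obtain ⟨h1, h2⟩ := main h hh hhB
  have eI : ∫ x in (m / Q : ℝ)..1, F x =
      (∫ x in (m / Q : ℝ)..1, g x) - ∫ x in (m / Q : ℝ)..1, h x := by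
    rw [← intervalIntegral.integral_sub]
    · refine intervalIntegral.integral_congr fun x hx => ?_
      rw [Set.uIcc_of_le hle] at hx
      exact hF x hx
    · exact AntitoneOn.intervalIntegrable (by rwa [Set.uIcc_of_le hle])
    · exact AntitoneOn.intervalIntegrable (by rwa [Set.uIcc_of_le hle])
  have eS : ∑ q ∈ Finset.Ioc m Q, F (q / Q) / Q =
      ∑ q ∈ Finset.Ioc m Q, g (q / Q) / Q - ∑ q ∈ Finset.Ioc m Q, h (q / Q) / Q := by
    rw [← Finset.sum_sub_distrib]
    refine Finset.sum_congr rfl fun q hq => ?_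
    obtain ⟨a, b⟩ := Finset.mem_Ioc.mp hq
    rw [hF, sub_div]
    have a' : (m : ℝ) ≤ q := by exact_mod_cast a.le
    have b' : (q : ℝ) ≤ Q := by exact_mod_cast b
    exact ⟨by gcongr, by rwa [div_le_one hQ']⟩
  rw [eI, eS, abs_le]
  constructor <;> linarith

lemma monotoneOn_add_negMulLog : MonotoneOn (fun y => y + negMulLog y) (Set.Icc 0 1) := by
  refine monotoneOn_of_deriv_nonneg (convex_Icc 0 1)
    (continuous_id.add continuous_negMulLog).continuousOn ?_ ?_
  · rw [interior_Icc]
    intro x hx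
    exact (differentiableAt_id.add (differentiableAt_negMulLog hx.1.ne')).differentiableWithinAt
  · rw [interior_Icc]
    intro x hx
    have : deriv (fun y => y + negMulLog y) x = 1 + (- log x - 1) := by
      refine HasDerivAt.deriv ?_
      exact (hasDerivAt_id x).add (hasDerivAt_negMulLog hx.1.ne')
    rw [this]
    have := log_nonpos hx.1.le hx.2.le
    linarith

/-- The density whose integral over `(lam, 1)` is the contribution to `G1fun lam` of pairs of large
denominators. -/
noncomputable def bigDens (lam x : ℝ) : ℝ := 1 / x * log (1 / max lam (1 - x))

/-- The density whose integral is the contribution to `G1fun lam` of pairs of a large and a small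
denominator. -/
noncomputable def mixDens (lam x : ℝ) : ℝ := (1 - x) / x * log (lam / (1 - x))

section
variable {Q N : ℤ} {lam : ℝ}

lemma abs_integral_sub_le {F : ℝ → ℝ} {a b B d : ℝ} (hI : ∀ c ∈ Set.Icc (min a b) 1,
    IntervalIntegrable F volume c 1)
    (ha : a ≤ 1) (hb : b ≤ 1) (hab : |a - b| ≤ d) (hB0 : 0 ≤ B)
    (hB : ∀ x ∈ Set.Icc (min a b) 1, |F x| ≤ B) :
    |(∫ x in a..1, F x) - ∫ x in b..1, F x| ≤ B * d := by
  have h1 := hI a ⟨min_le_left _ _, ha⟩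
  have h2 := hI b ⟨min_le_right _ _, hb⟩
  have e : (∫ x in a..1, F x) - ∫ x in b..1, F x = ∫ x in a..b, F x := by
    rw [← intervalIntegral.integral_add_adjacent_intervals (h1.trans h2.symm) h2]; ring
  rw [e, ← Real.norm_eq_abs]
  refine (intervalIntegral.norm_integral_le_of_norm_le_const (C := B) fun x hx => ?_).trans ?_
  · rw [Set.mem_uIoc] at hx
    refine hB x ⟨?_, ?_⟩
    · rcases hx with hx | hx
      · exact (min_le_left _ _).trans hx.1.le
      · exact (min_le_right _ _).trans hx.1.le
    · rcases hx with hx | hx <;> linarith [hx.2]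
  · rw [abs_sub_comm]; gcongr

lemma bigDens_eq (hlam : 0 < lam) (x : ℝ) :
    bigDens lam x = 1 / x * (-log lam) - 1 / x * (-log lam + log (max lam (1 - x))) := by
  unfold bigDens
  have : 0 < max lam (1 - x) := lt_max_of_lt_left hlam
  rw [one_div (max _ _), log_inv]; ring

lemma antitoneOn_inv_mul {k : ℝ → ℝ} {a : ℝ} (ha : 0 < a)
    (hk : AntitoneOn k (Set.Icc a 1)) (hk0 : ∀ x ∈ Set.Icc a 1, 0 ≤ k x) :
    AntitoneOn (fun x => 1 / x * k x) (Set.Icc a 1) := by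
  intro x hx y hy hxy
  have h1 : 0 < x := ha.trans_le hx.1
  have := hk0 y hy
  have := hk hx hy hxy
  have : 0 < 1 / x := by positivity
  beta_reduce
  gcongr

lemma log_max_bound (hlam : 0 < lam) (hlam1 : lam < 1) {x : ℝ} (hx : 0 ≤ x) :
    0 ≤ -log lam + log (max lam (1 - x)) ∧ -log lam + log (max lam (1 - x)) ≤ - log lam := by
  have h1 := log_le_log hlam (le_max_left lam (1 - x))
  have h2 : log (max lam (1 - x)) ≤ 0 :=
    log_nonpos (hlam.le.trans (le_max_left _ _)) (max_le hlam1.le (by linarith))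
  constructor <;> linarith

lemma antitoneOn_bigDens_pos (hlam : 0 < lam) (hlam1 : lam < 1) {a : ℝ} (ha : 0 < a) :
    AntitoneOn (fun x => 1 / x * (-log lam)) (Set.Icc a 1) :=
  antitoneOn_inv_mul ha antitoneOn_const fun x _ => by
    have := log_neg hlam hlam1; linarith

lemma antitoneOn_bigDens_neg (hlam : 0 < lam) (hlam1 : lam < 1) {a : ℝ} (ha : 0 < a) :
    AntitoneOn (fun x => 1 / x * (-log lam + log (max lam (1 - x)))) (Set.Icc a 1) := by
  refine antitoneOn_inv_mul ha (fun x hx y hy hxy => ?_)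
    fun x hx => (log_max_bound hlam hlam1 (ha.le.trans hx.1)).1
  have : 0 < max lam (1 - y) := lt_max_of_lt_left hlam
  gcongr

lemma mixDens_eq (hlam : 0 < lam) (x : ℝ) :
    mixDens lam x = 1 / x * ((1 - x) + negMulLog (1 - x)) - 1 / x * ((1 - x) * (1 - log lam)) := by
  unfold mixDens negMulLog
  rcases eq_or_ne (1 - x) 0 with h | h
  · rw [h]; simp
  · rw [log_div hlam.ne' h]; ring

lemma antitoneOn_mixDens_pos {a : ℝ} (ha : 0 < a) :
    AntitoneOn (fun x => 1 / x * ((1 - x) + negMulLog (1 - x))) (Set.Icc a 1) := by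
  refine antitoneOn_inv_mul ha (fun x hx y hy hxy => ?_) fun x hx => ?_
  · exact monotoneOn_add_negMulLog ⟨by linarith [hy.2], by linarith [hy.1]⟩
      ⟨by linarith [hx.2], by linarith [hx.1]⟩ (by linarith)
  · exact add_nonneg (by linarith [hx.2])
      (negMulLog_nonneg (by linarith [hx.2]) (by linarith [hx.1]))

lemma antitoneOn_mixDens_neg (hlam : 0 < lam) (hlam1 : lam < 1) {a : ℝ} (ha : 0 < a) :
    AntitoneOn (fun x => 1 / x * ((1 - x) * (1 - log lam))) (Set.Icc a 1) := by
  have := log_neg hlam hlam1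
  refine antitoneOn_inv_mul ha (fun x hx y hy hxy => ?_) fun x hx => ?_
  · have : 0 ≤ 1 - log lam := by linarith
    gcongr
  · exact mul_nonneg (by linarith [hx.2]) (by linarith)

lemma dens_bounds (hlam : 0 < lam) (hlam1 : lam < 1) {x : ℝ} (hx : lam / 2 ≤ x) (hx1 : x ≤ 1) :
    (0 ≤ 1 / x * (-log lam) ∧ 1 / x * (-log lam) ≤ 2 / lam * (1 - log lam)) ∧
    (0 ≤ 1 / x * (-log lam + log (max lam (1 - x))) ∧
      1 / x * (-log lam + log (max lam (1 - x))) ≤ 2 / lam * (1 - log lam)) ∧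
    (0 ≤ 1 / x * ((1 - x) + negMulLog (1 - x)) ∧
      1 / x * ((1 - x) + negMulLog (1 - x)) ≤ 2 / lam * (1 - log lam)) ∧
    (0 ≤ 1 / x * ((1 - x) * (1 - log lam)) ∧
      1 / x * ((1 - x) * (1 - log lam)) ≤ 2 / lam * (1 - log lam)) := by
  have hl := log_neg hlam hlam1
  have hx0 : 0 < x := by linarith
  have h1 : 1 / x ≤ 2 / lam := by rw [div_le_div_iff₀ hx0 hlam]; linarith
  have h0 : 0 ≤ 1 / x := by positivity
  obtain ⟨m1, m2⟩ := log_max_bound hlam hlam1 hx0.le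
  have n0 : 0 ≤ (1 - x) + negMulLog (1 - x) :=
    add_nonneg (by linarith) (negMulLog_nonneg (by linarith) (by linarith))
  have n1 : (1 - x) + negMulLog (1 - x) ≤ 1 := by
    have := monotoneOn_add_negMulLog (a := 1 - x) (b := 1) ⟨by linarith, by linarith⟩ (by simp)
      (by linarith)
    simpa using this
  have l0 : 0 ≤ (1 - x) * (1 - log lam) := mul_nonneg (by linarith) (by linarith)
  have l1 : (1 - x) * (1 - log lam) ≤ 1 - log lam := by nlinarith
  refine ⟨⟨mul_nonneg h0 (by linarith), ?_⟩, ⟨mul_nonneg h0 m1, ?_⟩, ⟨mul_nonneg h0 n0, ?_⟩,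
    ⟨mul_nonneg h0 l0, ?_⟩⟩
  all_goals exact mul_le_mul h1 (by linarith) (by linarith) (by positivity)

lemma floor_bounds (hN1 : 1 ≤ N) (hN : lam * Q < N + 1) :
    lam * Q / 2 ≤ N := by
  have : (1 : ℝ) ≤ N := by exact_mod_cast hN1
  linarith

lemma abs_sum_bigDens_sub_le (hlam : 0 < lam) (hlam1 : lam < 1) (hN1 : 1 ≤ N)
    (hNl : (N : ℝ) ≤ lam * Q) (hN : lam * Q < N + 1) (hNQ : N < Q) :
    |∑ q ∈ Finset.Ioc N Q, bigDens lam (q / Q) / Q - ∫ x in lam..1, bigDens lam x| ≤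
      4 / lam * (1 - log lam) / Q := by
  have hQ : (0 : ℝ) < Q := by exact_mod_cast (show 0 < Q by omega)
  have hl := log_neg hlam hlam1
  set B := 2 / lam * (1 - log lam) with hB
  have hB0 : 0 ≤ B := mul_nonneg (by positivity) (by linarith)
  have h2 := floor_bounds hN1 hN
  have hx : lam / 2 ≤ (N : ℝ) / Q := by rw [le_div_iff₀ hQ]; linarith
  have hx0 : 0 < (N : ℝ) / Q := by linarith
  have hxl : (N : ℝ) / Q ≤ lam := by rwa [div_le_iff₀ hQ]
  have hx1 : (N : ℝ) / Q ≤ 1 := by linarith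
  have r := abs_riemann_le (F := bigDens lam) (B := B) (show 0 < Q by omega) hNQ.le
    (fun x _ => bigDens_eq hlam x)
    (antitoneOn_bigDens_pos hlam hlam1 hx0) (antitoneOn_bigDens_neg hlam hlam1 hx0)
    (by linarith [(dens_bounds hlam hlam1 hx hx1).1.2,
      (dens_bounds hlam hlam1 (x := 1) (by linarith) le_rfl).1.1])
    (by linarith [(dens_bounds hlam hlam1 hx hx1).2.1.2,
      (dens_bounds hlam hlam1 (x := 1) (by linarith) le_rfl).2.1.1])
  have hmin : min ((N : ℝ) / Q) lam = N / Q := min_eq_left hxl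
  have k := abs_integral_sub_le (F := bigDens lam) (a := (N : ℝ) / Q) (b := lam) (B := B)
    (d := 1 / Q) (fun c hc => ?_) hx1 hlam1.le ?_ hB0 fun x hx' => ?_
  · have := (abs_sub_le _ _ _).trans (add_le_add r k)
    refine this.trans (le_of_eq ?_)
    rw [hB]; ring
  · rw [hmin] at hc
    refine (IntervalIntegrable.sub (f := fun x => 1 / x * (-log lam))
      (g := fun x => 1 / x * (-log lam + log (max lam (1 - x)))) ?_ ?_).congr
        fun x _ => (bigDens_eq hlam x).symm
    · exact AntitoneOn.intervalIntegrable (by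
        rw [Set.uIcc_of_le hc.2]; exact antitoneOn_bigDens_pos hlam hlam1 (hx0.trans_le hc.1))
    · exact AntitoneOn.intervalIntegrable (by
        rw [Set.uIcc_of_le hc.2]; exact antitoneOn_bigDens_neg hlam hlam1 (hx0.trans_le hc.1))
  · rw [abs_sub_comm, abs_of_nonneg (by linarith), le_div_iff₀ hQ, sub_mul,
      div_mul_cancel₀ _ hQ.ne']
    linarith
  · rw [hmin] at hx'
    obtain ⟨⟨a1, a2⟩, ⟨b1, b2⟩, -⟩ := dens_bounds hlam hlam1 (hx.trans hx'.1) hx'.2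
    rw [bigDens_eq hlam, abs_le]
    constructor <;> linarith

lemma abs_sum_mixDens_sub_le (hlam : 0 < lam) (hlam1 : lam < 1) (hN1 : 1 ≤ N)
    (hNl : (N : ℝ) ≤ lam * Q) (hN : lam * Q < N + 1) (hNQ : N < Q) :
    |∑ q ∈ Finset.Ioc (max N (Q - N)) Q, mixDens lam (q / Q) / Q -
      ∫ x in max lam (1 - lam)..1, mixDens lam x| ≤ 4 / lam * (1 - log lam) / Q := by
  have hQ : (0 : ℝ) < Q := by exact_mod_cast (show 0 < Q by omega)
  have hl := log_neg hlam hlam1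
  set B := 2 / lam * (1 - log lam) with hB
  have hB0 : 0 ≤ B := mul_nonneg (by positivity) (by linarith)
  have h2 := floor_bounds hN1 hN
  set m := max N (Q - N) with hm
  have hmN : (N : ℝ) ≤ m := by exact_mod_cast le_max_left _ _
  have hmQ : m ≤ Q := by omega
  have hx : lam / 2 ≤ (m : ℝ) / Q := by rw [le_div_iff₀ hQ]; linarith
  have hx0 : 0 < (m : ℝ) / Q := by linarith
  have hx1 : (m : ℝ) / Q ≤ 1 := by rw [div_le_one hQ]; exact_mod_cast hmQ
  have hmax1 : max lam (1 - lam) ≤ 1 := max_le hlam1.le (by linarith)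
  have hmul : max lam (1 - lam) * Q = max (lam * Q) ((1 - lam) * Q) :=
    max_mul_of_nonneg _ _ hQ.le
  have hmc : (m : ℝ) = max (N : ℝ) (Q - N) := by rw [hm]; push_cast; rfl
  have r := abs_riemann_le (F := mixDens lam) (B := B) (show 0 < Q by omega) hmQ
    (fun x _ => mixDens_eq hlam x)
    (antitoneOn_mixDens_pos hx0) (antitoneOn_mixDens_neg hlam hlam1 hx0)
    (by linarith [(dens_bounds hlam hlam1 hx hx1).2.2.1.2,
      (dens_bounds hlam hlam1 (x := 1) (by linarith) le_rfl).2.2.1.1])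
    (by linarith [(dens_bounds hlam hlam1 hx hx1).2.2.2.2,
      (dens_bounds hlam hlam1 (x := 1) (by linarith) le_rfl).2.2.2.1])
  have hmin : lam / 2 ≤ min ((m : ℝ) / Q) (max lam (1 - lam)) :=
    le_min hx ((by linarith : lam / 2 ≤ lam).trans (le_max_left _ _))
  have k := abs_integral_sub_le (F := mixDens lam) (a := (m : ℝ) / Q) (b := max lam (1 - lam))
    (B := B) (d := 1 / Q) (fun c hc => ?_) hx1 hmax1 ?_ hB0 fun x hx' => ?_
  · have := (abs_sub_le _ _ _).trans (add_le_add r k)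
    refine this.trans (le_of_eq ?_)
    rw [hB]; ring
  · have hc0 : 0 < c := by linarith [hc.1]
    refine (IntervalIntegrable.sub (f := fun x => 1 / x * ((1 - x) + negMulLog (1 - x)))
      (g := fun x => 1 / x * ((1 - x) * (1 - log lam))) ?_ ?_).congr
        fun x _ => (mixDens_eq hlam x).symm
    · exact AntitoneOn.intervalIntegrable (by
        rw [Set.uIcc_of_le hc.2]; exact antitoneOn_mixDens_pos hc0)
    · exact AntitoneOn.intervalIntegrable (by
        rw [Set.uIcc_of_le hc.2]; exact antitoneOn_mixDens_neg hlam hlam1 hc0)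
  · have : ((m : ℝ) / Q - max lam (1 - lam)) = (m - max lam (1 - lam) * Q) / Q := by
      field_simp
    rw [this, abs_div, abs_of_pos hQ]
    gcongr
    rw [hmul, hmc]
    refine (abs_max_sub_max_le_max _ _ _ _).trans (max_le ?_ ?_) <;> rw [abs_le] <;>
      constructor <;> nlinarith
  · obtain ⟨-, -, ⟨a1, a2⟩, ⟨b1, b2⟩⟩ := dens_bounds hlam hlam1 (hmin.trans hx'.1) hx'.2
    rw [mixDens_eq hlam, abs_le]
    constructor <;> linarith

end

section
variable {Q N : ℤ} {lam : ℝ}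

lemma abs_inner_big_sub_le (hlam : 0 < lam) (hN1 : 1 ≤ N)
    (hNl : (N : ℝ) ≤ lam * Q) (hN : lam * Q < N + 1) (hNQ : N < Q) {q : ℤ} (hq : N < q)
    (hqQ : q ≤ Q) :
    |1 / (q : ℝ) * ∑ s ∈ Finset.Ioc (max N (Q - q)) Q, 1 / (s : ℝ) - bigDens lam (q / Q) / Q| ≤
      2 / (N : ℝ) ^ 2 := by
  have hQ : (0 : ℝ) < Q := by exact_mod_cast (show 0 < Q by omega)
  have hN0 : (0 : ℝ) < N := by exact_mod_cast (show 0 < N by omega)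
  have hNq : (N : ℝ) ≤ q := by exact_mod_cast hq.le
  have hq0 : (0 : ℝ) < q := by linarith
  set k := max N (Q - q) with hk
  have hkN : (N : ℝ) ≤ k := by exact_mod_cast le_max_left _ _
  have hk0 : (0 : ℝ) < k := by linarith
  obtain ⟨h1, h2⟩ := sum_Ioc_int_inv_log (a := k) (b := Q) (by omega) (by omega)
  set M := max lam (1 - (q : ℝ) / Q) with hM
  have hM0 : 0 < M := lt_max_of_lt_left hlam
  have hMQ : M * Q = max (lam * Q) (Q - q) := by
    rw [hM, max_mul_of_nonneg _ _ hQ.le, sub_mul, div_mul_cancel₀ _ hQ.ne', one_mul]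
  have hkc : (k : ℝ) = max (N : ℝ) (Q - q) := by rw [hk]; push_cast; rfl
  have hM1 : (k : ℝ) ≤ M * Q := by rw [hMQ, hkc]; exact max_le_max_right _ hNl
  have hM2 : M * Q ≤ k + 1 := by
    rw [hMQ, hkc]
    exact max_le (by linarith [le_max_left (N : ℝ) (Q - q)])
      (by linarith [le_max_right (N : ℝ) (Q - q)])
  have e : log ((Q : ℝ) / k) - log (1 / M) = log (M * Q / k) := by
    rw [log_div hQ.ne' hk0.ne', log_div (mul_pos hM0 hQ).ne' hk0.ne', log_mul hM0.ne' hQ.ne',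
      one_div, log_inv]
    ring
  have l0 : 0 ≤ log (M * Q / k) := log_nonneg (by rwa [le_div_iff₀ hk0, one_mul])
  have l1 : log (M * Q / k) ≤ 1 / k := by
    refine (log_le_sub_one_of_pos (by positivity)).trans ?_
    rw [div_sub_one hk0.ne']
    gcongr
    linarith
  have hkinv : 1 / (k : ℝ) ≤ 1 / N := by gcongr
  have key : |∑ s ∈ Finset.Ioc k Q, 1 / (s : ℝ) - log (1 / M)| ≤ 2 / N := by
    have : 2 / (N : ℝ) = 1 / N + 1 / N := by ring
    rw [abs_le]; constructor <;> linarith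
  have e2 : bigDens lam (q / Q) / Q = 1 / q * log (1 / M) := by
    unfold bigDens
    rw [← hM]; field_simp
  rw [e2, ← mul_sub, abs_mul, abs_of_pos (by positivity)]
  calc _ ≤ 1 / (N : ℝ) * (2 / N) := by gcongr
    _ = _ := by ring

lemma abs_inner_mix_sub_le (hlam : 0 < lam) (hN1 : 1 ≤ N)
    (hNl : (N : ℝ) ≤ lam * Q) (hN : lam * Q < N + 1) {q : ℤ} (hq : N < q)
    (hqN : Q - N < q) (hqQ : q ≤ Q) :
    |(1 / (q : ℝ) - 1 / Q) * ∑ s ∈ Finset.Ioc (Q - q) N, 1 / (s : ℝ) - mixDens lam (q / Q) / Q| ≤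
      2 / (N * Q : ℝ) := by
  have hQ : (0 : ℝ) < Q := by exact_mod_cast (show 0 < Q by omega)
  have hN0 : (0 : ℝ) < N := by exact_mod_cast (show 0 < N by omega)
  have hNq : (N : ℝ) ≤ q := by exact_mod_cast hq.le
  have hq0 : (0 : ℝ) < q := by linarith
  rcases hqQ.lt_or_eq with h | h
  · set a := Q - q with ha
    have hac : (a : ℝ) = Q - q := by rw [ha]; push_cast; ring
    have ha0 : (0 : ℝ) < a := by exact_mod_cast (show 0 < a by omega)
    have haN : (a : ℝ) ≤ N := by exact_mod_cast (show a ≤ N by omega)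
    obtain ⟨h1, h2⟩ := sum_Ioc_int_inv_log (a := a) (b := N) (by omega) (by omega)
    have e : log (lam * Q / a) - log ((N : ℝ) / a) = log (lam * Q / N) := by
      rw [log_div hN0.ne' ha0.ne', log_div (mul_pos hlam hQ).ne' ha0.ne',
        log_div (mul_pos hlam hQ).ne' hN0.ne']
      ring
    have l0 : 0 ≤ log (lam * Q / N) := log_nonneg (by rwa [le_div_iff₀ hN0, one_mul])
    have l1 : log (lam * Q / N) ≤ 1 / N := by
      refine (log_le_sub_one_of_pos (by positivity)).trans ?_
      rw [div_sub_one hN0.ne']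
      gcongr
      linarith
    have hinv : 1 / (N : ℝ) ≤ 1 / a := by gcongr
    have key : |∑ s ∈ Finset.Ioc a N, 1 / (s : ℝ) - log (lam * Q / a)| ≤ 2 / a := by
      have : 2 / (a : ℝ) = 1 / a + 1 / a := by ring
      rw [abs_le]; constructor <;> linarith
    have e3 : 1 / (q : ℝ) - 1 / Q = a / (q * Q) := by rw [hac]; field_simp
    have e2 : mixDens lam (q / Q) / Q = (1 / (q : ℝ) - 1 / Q) * log (lam * Q / a) := by
      unfold mixDens
      have : 1 - (q : ℝ) / Q = a / Q := by rw [hac]; field_simp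
      rw [this, e3]
      have : lam / ((a : ℝ) / Q) = lam * Q / a := by field_simp
      rw [this]; field_simp
    rw [e2, ← mul_sub, abs_mul, e3, abs_of_pos (by positivity)]
    calc _ ≤ (a : ℝ) / (q * Q) * (2 / a) := by gcongr
      _ = 2 / (q * Q) := by field_simp
      _ ≤ _ := by gcongr
  · have : mixDens lam (q / Q) = 0 := by unfold mixDens; rw [h, div_self hQ.ne']; simp
    rw [this, h]
    simp only [sub_self, zero_mul, zero_div, abs_zero]
    positivity

lemma sum_wt_eq (hN0 : 0 ≤ N) (hNQ : N ≤ Q) :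
    ∑ q ∈ Finset.Ioc 0 Q, ∑ s ∈ Finset.Ioc (Q - q) Q, wt Q N q s =
      ∑ q ∈ Finset.Ioc N Q, 1 / (q : ℝ) * ∑ s ∈ Finset.Ioc (max N (Q - q)) Q, 1 / (s : ℝ) +
      2 * ∑ q ∈ Finset.Ioc (max N (Q - N)) Q,
        (1 / (q : ℝ) - 1 / Q) * ∑ s ∈ Finset.Ioc (Q - q) N, 1 / (s : ℝ) := by
  set A : ℤ → ℤ → ℝ := fun q s => if N < q ∧ N < s then 1 / (q : ℝ) * (1 / (s : ℝ)) else 0 with hA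
  set B : ℤ → ℤ → ℝ := fun q s => if N < q ∧ s ≤ N then (1 / (q : ℝ) - 1 / Q) * (1 / (s : ℝ))
    else 0 with hB
  have e1 : ∀ q s, wt Q N q s = A q s + B q s + B s q := by
    intro q s
    simp only [wt, hA, hB]
    split_ifs <;> first | omega | skip
    · simp only [add_zero]; rw [one_div_mul_one_div]
    · ring
    · ring
    · ring
  have e2 : ∑ q ∈ Finset.Ioc 0 Q, ∑ s ∈ Finset.Ioc (Q - q) Q, B s q =
      ∑ q ∈ Finset.Ioc 0 Q, ∑ s ∈ Finset.Ioc (Q - q) Q, B q s := by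
    refine Finset.sum_comm' fun q s => ?_
    simp only [Finset.mem_Ioc]; omega
  have eA : ∑ q ∈ Finset.Ioc 0 Q, ∑ s ∈ Finset.Ioc (Q - q) Q, A q s =
      ∑ q ∈ Finset.Ioc N Q, 1 / (q : ℝ) * ∑ s ∈ Finset.Ioc (max N (Q - q)) Q, 1 / (s : ℝ) := by
    have : Finset.Ioc N Q = (Finset.Ioc 0 Q).filter fun q => N < q := by
      ext q; simp only [Finset.mem_Ioc, Finset.mem_filter]; omega
    rw [this, Finset.sum_filter]
    refine Finset.sum_congr rfl fun q hq => ?_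
    have h2 : Finset.Ioc (max N (Q - q)) Q = (Finset.Ioc (Q - q) Q).filter fun s => N < s := by
      ext s; simp only [Finset.mem_Ioc, Finset.mem_filter]; omega
    rw [h2, Finset.sum_filter, Finset.mul_sum]
    by_cases h : N < q
    · simp only [hA, h, true_and, if_true, mul_ite, mul_zero]
    · simp only [hA, h, false_and, if_false, Finset.sum_const_zero]
  have eB : ∑ q ∈ Finset.Ioc 0 Q, ∑ s ∈ Finset.Ioc (Q - q) Q, B q s =
      ∑ q ∈ Finset.Ioc (max N (Q - N)) Q,
        (1 / (q : ℝ) - 1 / Q) * ∑ s ∈ Finset.Ioc (Q - q) N, 1 / (s : ℝ) := by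
    have : Finset.Ioc (max N (Q - N)) Q = (Finset.Ioc 0 Q).filter fun q => N < q ∧ Q - N < q := by
      ext q; simp only [Finset.mem_Ioc, Finset.mem_filter]; omega
    rw [this, Finset.sum_filter]
    refine Finset.sum_congr rfl fun q hq => ?_
    have h2 : Finset.Ioc (Q - q) N = (Finset.Ioc (Q - q) Q).filter fun s => s ≤ N := by
      ext s; simp only [Finset.mem_Ioc, Finset.mem_filter]; omega
    by_cases h : N < q
    · have h3 : ∑ s ∈ Finset.Ioc (Q - q) Q, B q s =
          (1 / (q : ℝ) - 1 / Q) * ∑ s ∈ Finset.Ioc (Q - q) N, 1 / (s : ℝ) := by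
        rw [h2, Finset.sum_filter, Finset.mul_sum]
        simp only [hB, h, true_and, mul_ite, mul_zero]
      rw [h3]
      split_ifs with h4
      · rfl
      · have : Finset.Ioc (Q - q) N = ∅ := Finset.Ioc_eq_empty (by omega)
        rw [this]; simp
    · simp only [hB, h, false_and, if_false, Finset.sum_const_zero]
  simp only [e1, Finset.sum_add_distrib]
  rw [e2, eA, eB]; ring

lemma abs_sum_wt_sub_le (hlam : 0 < lam) (hlam1 : lam < 1) (hN1 : 1 ≤ N)
    (hNl : (N : ℝ) ≤ lam * Q) (hN : lam * Q < N + 1) (hNQ : N < Q) :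
    |∑ q ∈ Finset.Ioc 0 Q, ∑ s ∈ Finset.Ioc (Q - q) Q, wt Q N q s -
      ((∫ x in lam..1, bigDens lam x) + 2 * ∫ x in max lam (1 - lam)..1, mixDens lam x)| ≤
      (8 / lam ^ 2 + 8 / lam + 12 / lam * (1 - log lam)) / Q := by
  have hQ : (0 : ℝ) < Q := by exact_mod_cast (show 0 < Q by omega)
  have hN0 : (0 : ℝ) < N := by exact_mod_cast (show 0 < N by omega)
  have h2 := floor_bounds hN1 hN
  rw [sum_wt_eq (by omega) hNQ.le]
  have b1 := abs_sum_bigDens_sub_le hlam hlam1 hN1 hNl hN hNQ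
  have b2 := abs_sum_mixDens_sub_le hlam hlam1 hN1 hNl hN hNQ
  have hcard : ∀ a : ℤ, 0 ≤ a → a ≤ Q → ((Finset.Ioc a Q).card : ℝ) ≤ Q := by
    intro a ha haQ
    rw [Int.card_Ioc]
    have : (((Q - a).toNat : ℤ) : ℝ) ≤ Q := by
      rw [Int.toNat_of_nonneg (by omega)]; push_cast
      have : (0 : ℝ) ≤ a := by exact_mod_cast ha
      linarith
    exact_mod_cast this
  have a1 : |∑ q ∈ Finset.Ioc N Q, 1 / (q : ℝ) * ∑ s ∈ Finset.Ioc (max N (Q - q)) Q, 1 / (s : ℝ) -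
      ∑ q ∈ Finset.Ioc N Q, bigDens lam (q / Q) / Q| ≤ 8 / lam ^ 2 / Q := by
    rw [← Finset.sum_sub_distrib]
    refine (Finset.abs_sum_le_sum_abs _ _).trans ?_
    refine (Finset.sum_le_card_nsmul _ _ (2 / (N : ℝ) ^ 2) fun q hq => ?_).trans ?_
    · obtain ⟨c, d⟩ := Finset.mem_Ioc.mp hq
      exact abs_inner_big_sub_le hlam hN1 hNl hN hNQ c d
    · rw [nsmul_eq_mul]
      calc _ ≤ (Q : ℝ) * (2 / (lam * Q / 2) ^ 2) := by
            gcongr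
            exact hcard N (by omega) hNQ.le
        _ = _ := by field_simp; norm_num
  have a2 : |∑ q ∈ Finset.Ioc (max N (Q - N)) Q,
        (1 / (q : ℝ) - 1 / Q) * ∑ s ∈ Finset.Ioc (Q - q) N, 1 / (s : ℝ) -
      ∑ q ∈ Finset.Ioc (max N (Q - N)) Q, mixDens lam (q / Q) / Q| ≤ 4 / lam / Q := by
    rw [← Finset.sum_sub_distrib]
    refine (Finset.abs_sum_le_sum_abs _ _).trans ?_
    refine (Finset.sum_le_card_nsmul _ _ (2 / (N * Q : ℝ)) fun q hq => ?_).trans ?_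
    · obtain ⟨c, d⟩ := Finset.mem_Ioc.mp hq
      exact abs_inner_mix_sub_le hlam hN1 hNl hN (by omega) (by omega) d
    · rw [nsmul_eq_mul]
      calc _ ≤ (Q : ℝ) * (2 / (lam * Q / 2 * Q)) := by
            gcongr
            exact hcard _ (by omega) (by omega)
        _ = _ := by field_simp; norm_num
  have c1 := abs_le.mp ((abs_sub_le _ _ _).trans (add_le_add a1 b1))
  have c2 := abs_le.mp ((abs_sub_le _ _ _).trans (add_le_add a2 b2))
  have e : (8 / lam ^ 2 + 8 / lam + 12 / lam * (1 - log lam)) / Q =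
      (8 / lam ^ 2 / Q + 4 / lam * (1 - log lam) / Q) +
      2 * (4 / lam / Q + 4 / lam * (1 - log lam) / Q) := by ring
  rw [e, abs_le]
  constructor <;> linarith [c1.1, c1.2, c2.1, c2.2]

end

lemma integral_bigDens_add_eq_G1fun {lam : ℝ} (hlam : 0 < lam) (hlam1 : lam < 1) :
    (∫ x in lam..1, bigDens lam x) + 2 * ∫ x in max lam (1 - lam)..1, mixDens lam x =
      G1fun lam := by
  unfold G1fun
  have hIntv : ∀ a b, lam ≤ a → a ≤ b → b ≤ 1 → IntervalIntegrable (bigDens lam) volume a b := by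
    intro a b ha hab hb
    refine (IntervalIntegrable.sub (f := fun x => 1 / x * (-log lam))
      (g := fun x => 1 / x * (-log lam + log (max lam (1 - x)))) ?_ ?_).congr
        fun x _ => (bigDens_eq hlam x).symm
    · exact AntitoneOn.intervalIntegrable (by
        rw [Set.uIcc_of_le hab]
        exact (antitoneOn_bigDens_pos hlam hlam1 (hlam.trans_le ha)).mono
          (Set.Icc_subset_Icc_right hb))
    · exact AntitoneOn.intervalIntegrable (by
        rw [Set.uIcc_of_le hab]
        exact (antitoneOn_bigDens_neg hlam hlam1 (hlam.trans_le ha)).mono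
          (Set.Icc_subset_Icc_right hb))
  have hconst : ∀ a, 0 < a → a ≤ 1 → 1 - a ≤ lam →
      ∫ x in a..1, bigDens lam x = log a * log lam := by
    intro a ha ha1 hal
    have : ∫ x in a..1, bigDens lam x = ∫ x in a..1, 1 / x * log (1 / lam) := by
      refine intervalIntegral.integral_congr fun x hx => ?_
      rw [Set.uIcc_of_le ha1] at hx
      unfold bigDens
      rw [max_eq_left (by linarith [hx.1])]
    rw [this, intervalIntegral.integral_mul_const, integral_one_div_of_pos ha one_pos, one_div,
      one_div, log_inv, log_inv]
    ring
  by_cases h : lam ≤ 1 / 2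
  · rw [if_pos h, max_eq_right (by linarith),
      ← intervalIntegral.integral_add_adjacent_intervals
        (hIntv lam (1 - lam) le_rfl (by linarith) (by linarith))
        (hIntv (1 - lam) 1 (by linarith) (by linarith) le_rfl),
      hconst (1 - lam) (by linarith) (by linarith) (by linarith)]
    have : ∫ x in lam..(1 - lam), bigDens lam x =
        ∫ u in lam..(1 - lam), (1 / u) * log (1 / (1 - u)) := by
      refine intervalIntegral.integral_congr fun x hx => ?_
      rw [Set.uIcc_of_le (by linarith)] at hx
      unfold bigDens
      rw [max_eq_right (by linarith [hx.2])]
    rw [this]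
    simp only [mixDens]
    ring
  · push Not at h
    rw [if_neg (by linarith), if_pos hlam1.le, max_eq_left (by linarith),
      hconst lam hlam hlam1.le (by linarith)]
    simp only [mixDens]
    ring

lemma totient_div_eq_sum_moebius (n : ℕ) (hn : 0 < n) :
    (n.totient : ℝ) / n = ∑ d ∈ n.divisors, (ArithmeticFunction.moebius d : ℝ) / d := by
  have h := (ArithmeticFunction.sum_eq_iff_sum_mul_moebius_eq (R := ℝ)
    (f := fun n => (n.totient : ℝ)) (g := fun n => (n : ℝ))).mp
    (fun n _ => by exact_mod_cast Nat.sum_totient n) n hn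
  rw [← h, Nat.sum_divisorsAntidiagonal
    (f := fun d e => (ArithmeticFunction.moebius d : ℝ) * (e : ℝ)), Finset.sum_div]
  refine Finset.sum_congr rfl fun d hd => ?_
  have hdn := Nat.dvd_of_mem_divisors hd
  have hd0 : (d : ℝ) ≠ 0 := by exact_mod_cast (Nat.pos_of_mem_divisors hd).ne'
  have hn0 : (n : ℝ) ≠ 0 := by exact_mod_cast hn.ne'
  rw [Nat.cast_div hdn hd0]
  field_simp

lemma sum_moebius_divisors_gcd (a n : ℕ) (hn : 0 < n) :
    ∑ d ∈ n.divisors with d ∣ a, (ArithmeticFunction.moebius d : ℝ) =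
      if a.Coprime n then 1 else 0 := by
  have hg : 0 < a.gcd n := Nat.gcd_pos_of_pos_right _ hn
  have h : n.divisors.filter (fun d => d ∣ a) = (a.gcd n).divisors := by
    ext d
    simp only [Finset.mem_filter, Nat.mem_divisors, Nat.dvd_gcd_iff]
    constructor
    · rintro ⟨⟨h1, _⟩, h2⟩; exact ⟨⟨h2, h1⟩, hg.ne'⟩
    · rintro ⟨⟨h2, h1⟩, _⟩; exact ⟨⟨h1, hn.ne'⟩, h2⟩
  rw [h]
  have h3 : ∑ d ∈ (a.gcd n).divisors, (ArithmeticFunction.moebius d : ℝ) =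
      ((∑ d ∈ (a.gcd n).divisors, ArithmeticFunction.moebius d : ℤ) : ℝ) := by push_cast; rfl
  rw [h3, ← ArithmeticFunction.coe_mul_zeta_apply, ArithmeticFunction.moebius_mul_coe_zeta,
    ArithmeticFunction.one_apply]
  simp only [Nat.coprime_iff_gcd_eq_one]
  split_ifs <;> simp

lemma abs_moebius_cast_le (d : ℕ) : |(ArithmeticFunction.moebius d : ℝ)| ≤ 1 := by
  exact_mod_cast ArithmeticFunction.abs_moebius_le_one (n := d)

lemma abs_nat_div_sub_le (X d : ℕ) (hd : 0 < d) :
    |((X / d : ℕ) : ℝ) - (X : ℝ) / d| ≤ 1 := by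
  have hd' : (0 : ℝ) < d := by exact_mod_cast hd
  have h1 : ((X / d : ℕ) : ℝ) ≤ (X : ℝ) / d := Nat.cast_div_le
  have h2 : (X : ℝ) / d < ((X / d : ℕ) : ℝ) + 1 := by
    rw [div_lt_iff₀ hd']
    exact_mod_cast Nat.lt_mul_of_div_lt (Nat.lt_succ_self _) hd
  rw [abs_le]; constructor <;> linarith

lemma card_multiples_coprime (L : ℕ) (hL : 0 < L) (X d : ℕ) (hd : 0 < d) (hdL : d.Coprime L) :
    |(((Finset.Ioc 0 X).filter fun q => d ∣ q ∧ q.Coprime L).card : ℝ) -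
      (L.totient : ℝ) / L * (X / d)| ≤ L := by
  have e : (((Finset.Ioc 0 X).filter fun q => d ∣ q ∧ q.Coprime L).card : ℝ) =
      ∑ e ∈ L.divisors, (ArithmeticFunction.moebius e : ℝ) * ((X / (d * e) : ℕ) : ℝ) := by
    have h1 : ∀ e ∈ L.divisors, (ArithmeticFunction.moebius e : ℝ) * ((X / (d * e) : ℕ) : ℝ) =
        ∑ q ∈ (Finset.Ioc 0 X).filter (fun q => d ∣ q),
          if e ∣ q then (ArithmeticFunction.moebius e : ℝ) else 0 := by
      intro e he
      have hde : d.Coprime e := hdL.coprime_dvd_right (Nat.dvd_of_mem_divisors he)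
      rw [← Finset.sum_filter, Finset.sum_const, nsmul_eq_mul, Finset.filter_filter,
        ← Nat.Ioc_filter_dvd_card_eq_div, mul_comm]
      congr 3
      ext q
      simp only [Finset.mem_filter, and_congr_right_iff]
      intro _
      exact ⟨fun h => ⟨(dvd_mul_right _ _).trans h, (dvd_mul_left _ _).trans h⟩,
        fun h => hde.mul_dvd_of_dvd_of_dvd h.1 h.2⟩
    rw [Finset.sum_congr rfl h1, Finset.sum_comm]
    simp_rw [← Finset.sum_filter, sum_moebius_divisors_gcd _ L hL]
    rw [← Finset.sum_filter, Finset.filter_filter, Finset.sum_const, nsmul_eq_mul, mul_one]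
  rw [e, totient_div_eq_sum_moebius L hL, Finset.sum_mul, ← Finset.sum_sub_distrib]
  refine (Finset.abs_sum_le_sum_abs _ _).trans ?_
  refine (Finset.sum_le_card_nsmul _ _ 1 fun e he => ?_).trans ?_
  · have he0 := Nat.pos_of_mem_divisors he
    have he' : (e : ℝ) ≠ 0 := by exact_mod_cast he0.ne'
    have hd' : (d : ℝ) ≠ 0 := by exact_mod_cast hd.ne'
    have : (ArithmeticFunction.moebius e : ℝ) * ((X / (d * e) : ℕ) : ℝ) -
        (ArithmeticFunction.moebius e : ℝ) / e * (X / d) =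
        (ArithmeticFunction.moebius e : ℝ) * (((X / (d * e) : ℕ) : ℝ) - (X : ℝ) / (d * e : ℕ)) := by
      push_cast; field_simp
    rw [this, abs_mul]
    exact mul_le_one₀ (abs_moebius_cast_le e) (abs_nonneg _)
      (abs_nat_div_sub_le X (d * e) (Nat.mul_pos hd he0))
  · rw [nsmul_eq_mul, mul_one]
    exact_mod_cast Nat.card_divisors_le_self L

/-- `μ(n) / n²` restricted to `n` coprime to `L`. -/
noncomputable def moebiusSq (L n : ℕ) : ℝ :=
  if n.Coprime L then (ArithmeticFunction.moebius n : ℝ) / (n : ℝ) ^ 2 else 0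

lemma abs_moebiusSq_le (L n : ℕ) : |moebiusSq L n| ≤ 1 / (n : ℝ) ^ 2 := by
  unfold moebiusSq
  split_ifs
  · rw [abs_div, abs_of_nonneg (by positivity : (0 : ℝ) ≤ (n : ℝ) ^ 2)]
    gcongr
    exact abs_moebius_cast_le n
  · simp

lemma summable_moebiusSq (L : ℕ) : Summable fun n => ‖moebiusSq L n‖ :=
  Summable.of_nonneg_of_le (fun _ => norm_nonneg _) (fun n => abs_moebiusSq_le L n)
    (Real.summable_one_div_nat_pow.mpr (by norm_num))

lemma hasProd_moebiusSq (L : ℕ) :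
    HasProd (fun p : Nat.Primes => if (p : ℕ) ∣ L then 1 else 1 - 1 / ((p : ℕ) : ℝ) ^ 2)
      (∑' n, moebiusSq L n) := by
  have h := EulerProduct.eulerProduct_hasProd (f := moebiusSq L) (by simp [moebiusSq])
    (fun {m n} hmn => by
      unfold moebiusSq
      have hiff : (m * n).Coprime L ↔ m.Coprime L ∧ n.Coprime L := Nat.coprime_mul_iff_left
      by_cases hm : m.Coprime L
      · by_cases hn : n.Coprime L
        · rw [if_pos (hiff.mpr ⟨hm, hn⟩), if_pos hm, if_pos hn]
          rw [
            ArithmeticFunction.isMultiplicative_moebius.map_mul_of_coprime hmn]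
          push_cast
          rw [mul_pow, mul_div_mul_comm]
        · rw [if_neg fun h => hn (hiff.mp h).2, if_neg hn, mul_zero]
      · rw [if_neg fun h => hm (hiff.mp h).1, if_neg hm, zero_mul]) (summable_moebiusSq L) (by simp [moebiusSq])
  have hloc : ∀ p : Nat.Primes, ∑' e, moebiusSq L (p ^ e) =
      if (p : ℕ) ∣ L then 1 else 1 - 1 / ((p : ℕ) : ℝ) ^ 2 := by
    intro p
    have hp := p.2
    have hz : ∀ e ∉ Finset.range 2, moebiusSq L ((p : ℕ) ^ e) = 0 := by
      intro e he
      have he : 1 < e := by simpa using he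
      unfold moebiusSq
      rw [ArithmeticFunction.moebius_apply_prime_pow hp (by omega), if_neg (show ¬ e = 1 by omega)]
      simp
    rw [tsum_eq_sum hz, Finset.sum_range_succ, Finset.sum_range_one, pow_zero, pow_one]
    unfold moebiusSq
    simp only [hp.coprime_iff_not_dvd, ArithmeticFunction.moebius_apply_prime hp]
    by_cases h1 : (p : ℕ) ∣ L
    · simp [h1]
    · simp only [h1, if_false, not_false_eq_true, if_true]
      simp
      ring
  simpa only [hloc] using h

lemma tsum_moebiusSq (L : ℕ) :
    ∑' n, moebiusSq L n = ∏' p : {p : ℕ // p.Prime ∧ ¬ p ∣ L}, (1 - 1 / (p.1 : ℝ) ^ 2) := by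
  rw [← (hasProd_moebiusSq L).tprod_eq]
  set i : {p : ℕ // p.Prime ∧ ¬ p ∣ L} → Nat.Primes := fun p => ⟨p.1, p.2.1⟩ with hi
  have hinj : Function.Injective i := fun a b hab => Subtype.ext (congrArg (fun p : Nat.Primes => (p : ℕ)) hab)
  rw [← hinj.tprod_eq (f := fun p : Nat.Primes =>
    if (p : ℕ) ∣ L then (1 : ℝ) else 1 - 1 / ((p : ℕ) : ℝ) ^ 2)]
  · refine tprod_congr fun p => ?_
    simp only [hi]
    rw [if_neg p.2.2]
  · intro p hp
    rw [Function.mem_mulSupport] at hp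
    have : ¬ (p : ℕ) ∣ L := fun h => hp (if_pos h)
    exact ⟨⟨p.1, p.2, this⟩, rfl⟩

lemma Cconst_eq (L : ℕ) : Cconst L = (L.totient : ℝ) / L * ∑' n, moebiusSq L n := by
  rw [tsum_moebiusSq]; rfl

lemma abs_sum_moebiusSq_sub_tsum_le (L X : ℕ) (hX : 0 < X) :
    |∑ d ∈ Finset.Ioc 0 X, moebiusSq L d - ∑' n, moebiusSq L n| ≤ 1 / X := by
  have hs : Summable (moebiusSq L) := (summable_moebiusSq L).of_norm
  have h0 : moebiusSq L 0 = 0 := by simp [moebiusSq]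
  have hr : ∀ n, ∑ d ∈ Finset.Ioc 0 n, moebiusSq L d = ∑ d ∈ Finset.range (n + 1), moebiusSq L d := by
    intro n
    rw [Finset.range_eq_Ico, Finset.sum_eq_sum_Ico_succ_bot (Nat.succ_pos n), h0, zero_add]
    refine Finset.sum_congr ?_ fun _ _ => rfl
    ext d; simp only [Finset.mem_Ioc, Finset.mem_Ico]; omega
  have ht : Tendsto (fun n => |∑ d ∈ Finset.Ioc 0 X, moebiusSq L d -
      ∑ d ∈ Finset.Ioc 0 n, moebiusSq L d|) atTop
      (nhds |∑ d ∈ Finset.Ioc 0 X, moebiusSq L d - ∑' n, moebiusSq L n|) := by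
    simp_rw [hr]
    exact (tendsto_const_nhds.sub
      ((tendsto_add_atTop_iff_nat 1).mpr hs.hasSum.tendsto_sum_nat)).abs
  refine le_of_tendsto ht (eventually_atTop.mpr ⟨X, fun n hn => ?_⟩)
  have hsplit : ∑ d ∈ Finset.Ioc 0 n, moebiusSq L d =
      ∑ d ∈ Finset.Ioc 0 X, moebiusSq L d + ∑ d ∈ Finset.Ioc X n, moebiusSq L d :=
    (Finset.sum_Ioc_consecutive _ (Nat.zero_le _) hn).symm
  rw [hsplit, sub_add_cancel_left, abs_neg]
  refine (Finset.abs_sum_le_sum_abs _ _).trans ?_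
  have h2 : ∑ i ∈ Finset.Ioc X n, ((i : ℝ) ^ 2)⁻¹ ≤ (X : ℝ)⁻¹ - (n : ℝ)⁻¹ :=
    sum_Ioc_inv_sq_le_sub hX.ne' hn
  have h3 : (0 : ℝ) ≤ (n : ℝ)⁻¹ := by positivity
  rw [one_div]
  refine (Finset.sum_le_sum fun d _ => (abs_moebiusSq_le L d).trans_eq (one_div _)).trans ?_
  linarith

/-- `φ(n) / n` restricted to `n` coprime to `L`. -/
noncomputable def totDens (L n : ℕ) : ℝ := if n.Coprime L then (n.totient : ℝ) / n else 0

lemma abs_sum_totDens_sub_le (L X : ℕ) (hL : 0 < L) (hX : 0 < X) :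
    |∑ q ∈ Finset.Ioc 0 X, totDens L q - Cconst L * X| ≤ L * (1 + log X) + 1 := by
  have hXR : (0 : ℝ) < X := by exact_mod_cast hX
  have e1 : ∑ q ∈ Finset.Ioc 0 X, totDens L q = ∑ d ∈ Finset.Ioc 0 X,
      (ArithmeticFunction.moebius d : ℝ) / d *
        (((Finset.Ioc 0 X).filter fun q => d ∣ q ∧ q.Coprime L).card : ℝ) := by
    have h1 : ∀ q ∈ Finset.Ioc 0 X, totDens L q = ∑ d ∈ Finset.Ioc 0 X,
        if d ∣ q ∧ q.Coprime L then (ArithmeticFunction.moebius d : ℝ) / d else 0 := by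
      intro q hq
      rw [Finset.mem_Ioc] at hq
      unfold totDens
      by_cases hc : q.Coprime L
      · rw [if_pos hc, Finset.sum_congr rfl fun d _ => if_congr (and_iff_left hc) rfl rfl]
        rw [totient_div_eq_sum_moebius q hq.1, ← Finset.sum_filter]
        refine Finset.sum_congr ?_ fun _ _ => rfl
        ext d
        simp only [Nat.mem_divisors, Finset.mem_filter, Finset.mem_Ioc]
        constructor
        · rintro ⟨h, _⟩
          exact ⟨⟨Nat.pos_of_dvd_of_pos h hq.1, (Nat.le_of_dvd hq.1 h).trans hq.2⟩, h⟩
        · rintro ⟨_, h⟩; exact ⟨h, hq.1.ne'⟩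
      · rw [if_neg hc, Finset.sum_congr rfl fun d _ => if_neg fun h => hc h.2,
          Finset.sum_const_zero]
    rw [Finset.sum_congr rfl h1, Finset.sum_comm]
    refine Finset.sum_congr rfl fun d _ => ?_
    rw [← Finset.sum_filter, Finset.sum_const, nsmul_eq_mul, mul_comm]
  have e2 : ∑ q ∈ Finset.Ioc 0 X, totDens L q -
      (L.totient : ℝ) / L * X * ∑ d ∈ Finset.Ioc 0 X, moebiusSq L d =
      ∑ d ∈ Finset.Ioc 0 X, ((ArithmeticFunction.moebius d : ℝ) / d *
        (((Finset.Ioc 0 X).filter fun q => d ∣ q ∧ q.Coprime L).card : ℝ) -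
        (L.totient : ℝ) / L * X * moebiusSq L d) := by
    rw [e1, Finset.mul_sum, Finset.sum_sub_distrib]
  have b2 : |∑ q ∈ Finset.Ioc 0 X, totDens L q -
      (L.totient : ℝ) / L * X * ∑ d ∈ Finset.Ioc 0 X, moebiusSq L d| ≤ L * (1 + log X) := by
    rw [e2]
    refine (Finset.abs_sum_le_sum_abs _ _).trans ?_
    have h3 : ∀ d ∈ Finset.Ioc 0 X, |(ArithmeticFunction.moebius d : ℝ) / d *
        (((Finset.Ioc 0 X).filter fun q => d ∣ q ∧ q.Coprime L).card : ℝ) -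
        (L.totient : ℝ) / L * X * moebiusSq L d| ≤ L * (1 / (d : ℝ)) := by
      intro d hd
      rw [Finset.mem_Ioc] at hd
      have hd0 : (0 : ℝ) < d := by exact_mod_cast hd.1
      unfold moebiusSq
      by_cases hc : d.Coprime L
      · rw [if_pos hc]
        have : (ArithmeticFunction.moebius d : ℝ) / d *
          (((Finset.Ioc 0 X).filter fun q => d ∣ q ∧ q.Coprime L).card : ℝ) -
          (L.totient : ℝ) / L * X * ((ArithmeticFunction.moebius d : ℝ) / (d : ℝ) ^ 2) =
          (ArithmeticFunction.moebius d : ℝ) / d *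
          ((((Finset.Ioc 0 X).filter fun q => d ∣ q ∧ q.Coprime L).card : ℝ) -
            (L.totient : ℝ) / L * (X / d)) := by
          field_simp
        rw [this, abs_mul, abs_div, abs_of_pos hd0, mul_comm]
        gcongr
        · exact card_multiples_coprime L hL X d hd.1 hc
        · exact abs_moebius_cast_le d
      · rw [if_neg hc, Finset.filter_false_of_mem (fun q _ h => hc (h.2.coprime_dvd_left h.1))]
        simp
        positivity
    refine (Finset.sum_le_sum h3).trans ?_
    rw [← Finset.mul_sum]
    gcongr
    exact sum_Icc_inv_le X
  have b3 : |(L.totient : ℝ) / L * X * ∑ d ∈ Finset.Ioc 0 X, moebiusSq L d - Cconst L * X| ≤ 1 := by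
    have : (L.totient : ℝ) / L * X * ∑ d ∈ Finset.Ioc 0 X, moebiusSq L d - Cconst L * X =
        (L.totient : ℝ) / L * X *
          (∑ d ∈ Finset.Ioc 0 X, moebiusSq L d - ∑' n, moebiusSq L n) := by
      rw [Cconst_eq]; ring
    have hL' : (0 : ℝ) < L := by exact_mod_cast hL
    have ht : (L.totient : ℝ) / L ≤ 1 := by
      rw [div_le_one hL']; exact_mod_cast Nat.totient_le L
    rw [this, abs_mul, abs_of_nonneg (by positivity)]
    calc (L.totient : ℝ) / L * X * _ ≤ 1 * X * (1 / X) := by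
          gcongr
          exact abs_sum_moebiusSq_sub_tsum_le L X hX
      _ = 1 := by field_simp
  have := abs_add_le (∑ q ∈ Finset.Ioc 0 X, totDens L q -
      (L.totient : ℝ) / L * X * ∑ d ∈ Finset.Ioc 0 X, moebiusSq L d)
      ((L.totient : ℝ) / L * X * ∑ d ∈ Finset.Ioc 0 X, moebiusSq L d - Cconst L * X)
  rw [sub_add_sub_cancel] at this
  linarith

lemma abs_sum_antiDiff_mul_le {r₁ r₂ : ℤ} {B E : ℝ} {f x : ℤ → ℝ} (hB : 0 ≤ B) (hE : 0 ≤ E)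
    (hf : AntiDiff r₁ r₂ B f)
    (hx : ∀ r, r₁ ≤ r → r ≤ r₂ → |∑ q ∈ Finset.Ioc r₁ r, x q| ≤ E) :
    |∑ q ∈ Finset.Ioc r₁ r₂, f q * x q| ≤ 2 * B * E := by
  obtain ⟨g, h, h1, h2, h3, h4, h5⟩ := hf
  have key : ∀ g : ℤ → ℝ, (∀ q q', r₁ < q → q ≤ q' → q' ≤ r₂ → g q' ≤ g q) →
      (∀ q, r₁ < q → q ≤ r₂ → 0 ≤ g q ∧ g q ≤ B) →
      |∑ q ∈ Finset.Ioc r₁ r₂, g q * x q| ≤ B * E := by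
    intro g hg hgB
    have := abs_sum_mul_le_of_antitone (Finset.Ioc r₁ r₂) (fun q => (q : ℝ)) (fun z => g ⌊z⌋) x
      (M := B) (E := E) hE ?_ ?_ ?_ hB ?_
    · simpa only [Int.floor_intCast] using this
    · intro i hi j hj hij
      rw [Finset.mem_Ioc] at hi hj
      simp only [Int.floor_intCast]
      exact hg i j hi.1 (by exact_mod_cast hij) hj.2
    · intro i hi
      rw [Finset.mem_Ioc] at hi
      simp only [Int.floor_intCast]
      exact (hgB i hi.1 hi.2).1
    · intro i hi
      rw [Finset.mem_Ioc] at hi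
      simp only [Int.floor_intCast]
      exact (hgB i hi.1 hi.2).2
    · intro t
      by_cases ht : r₁ ≤ ⌊t⌋ ∧ r₁ ≤ r₂
      · have e : (Finset.Ioc r₁ r₂).filter (fun q : ℤ => (q : ℝ) ≤ t) =
            Finset.Ioc r₁ (min ⌊t⌋ r₂) := by
          ext q
          simp only [Finset.mem_filter, Finset.mem_Ioc, ← Int.le_floor]
          omega
        rw [e]
        exact hx _ (by omega) (by omega)
      · rw [Finset.filter_false_of_mem]
        · simpa using hE
        · intro q hq h
          rw [Finset.mem_Ioc] at hq
          rw [← Int.le_floor] at h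
          omega
  have e : ∑ q ∈ Finset.Ioc r₁ r₂, f q * x q =
      ∑ q ∈ Finset.Ioc r₁ r₂, g q * x q - ∑ q ∈ Finset.Ioc r₁ r₂, h q * x q := by
    rw [← Finset.sum_sub_distrib]
    refine Finset.sum_congr rfl fun q hq => ?_
    rw [Finset.mem_Ioc] at hq
    rw [h1 q hq.1 hq.2]; ring
  rw [e]
  have a1 := key g h2 h4
  have a2 := key h h3 h5
  have := abs_sub (∑ q ∈ Finset.Ioc r₁ r₂, g q * x q) (∑ q ∈ Finset.Ioc r₁ r₂, h q * x q)
  linarith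

lemma abs_sum_totDens_int_sub_le {L : ℕ} {r Q : ℤ} (hL : 0 < L) (hr : 0 ≤ r) (hrQ : r ≤ Q)
    (hQ : 0 < Q) :
    |∑ q ∈ Finset.Ioc 0 r, (totDens L q.toNat - Cconst L)| ≤ L * (1 + log Q) + 1 := by
  have hQ1 : (1 : ℝ) ≤ Q := by exact_mod_cast hQ
  have hlQ := log_nonneg hQ1
  rcases hr.eq_or_lt with rfl | hr
  · simp; positivity
  obtain ⟨X, rfl⟩ := Int.eq_ofNat_of_zero_le hr.le
  have hX : 0 < X := by exact_mod_cast hr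
  have h := abs_sum_totDens_sub_le L X hL hX
  have e : ∑ q ∈ Finset.Ioc 0 (X : ℤ), (totDens L q.toNat - Cconst L) =
      ∑ q ∈ Finset.Ioc 0 X, totDens L q - Cconst L * X := by
    rw [Finset.sum_sub_distrib, Finset.sum_const, Int.card_Ioc, nsmul_eq_mul]
    congr 1
    · refine Finset.sum_nbij' (fun s => s.toNat) (fun i => (i : ℤ)) ?_ ?_ ?_ ?_ ?_
      · intro s hs; simp only [Finset.mem_Ioc] at *; omega
      · intro s hs; simp only [Finset.mem_Ioc] at *; omega
      · intro s hs; simp only [Finset.mem_Ioc] at *; omega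
      · intro s hs; simp
      · intro s hs; rfl
    · simp [mul_comm]
  rw [e]
  refine h.trans ?_
  have : log X ≤ log Q := log_le_log (by exact_mod_cast hX) (by exact_mod_cast hrQ)
  gcongr

section
variable {Q N : ℤ} {lam : ℝ}

lemma abs_sum_totDens_mul_wt_sub_le {L : ℕ} (hL : 0 < L) (hlam : 0 < lam) (hN0 : 0 ≤ N)
    (hNQ : N < Q) (hN : lam * Q < N + 1) :
    |∑ q ∈ Finset.Ioc 0 Q, totDens L q.toNat * ∑ s ∈ Finset.Ioc (Q - q) Q, wt Q N q s -
      Cconst L * ∑ q ∈ Finset.Ioc 0 Q, ∑ s ∈ Finset.Ioc (Q - q) Q, wt Q N q s| ≤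
      8 / lam * (L * (1 + log Q) + 1) / Q := by
  have hQ0 : 0 < Q := hN0.trans_lt hNQ
  have hQ : (0 : ℝ) < Q := by exact_mod_cast hQ0
  have hQ1 : (1 : ℝ) ≤ Q := by exact_mod_cast hQ0
  have hlQ := log_nonneg hQ1
  have e : ∑ q ∈ Finset.Ioc 0 Q, totDens L q.toNat * ∑ s ∈ Finset.Ioc (Q - q) Q, wt Q N q s -
      Cconst L * ∑ q ∈ Finset.Ioc 0 Q, ∑ s ∈ Finset.Ioc (Q - q) Q, wt Q N q s =
      ∑ s ∈ Finset.Ioc 0 Q, ∑ q ∈ Finset.Ioc (Q - s) Q,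
        wt Q N q s * (totDens L q.toNat - Cconst L) := by
    rw [Finset.mul_sum, ← Finset.sum_sub_distrib,
      Finset.sum_comm' (t' := Finset.Ioc 0 Q) (s' := fun q => Finset.Ioc (Q - q) Q)]
    · refine Finset.sum_congr rfl fun q _ => ?_
      rw [← Finset.sum_mul]; ring
    · intro s q; simp only [Finset.mem_Ioc]; omega
  rw [e]
  refine (Finset.abs_sum_le_sum_abs _ _).trans ?_
  have hterm : ∀ s ∈ Finset.Ioc 0 Q, |∑ q ∈ Finset.Ioc (Q - s) Q,
      wt Q N q s * (totDens L q.toNat - Cconst L)| ≤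
      2 * (2 / (lam * Q ^ 2)) * (2 * (L * (1 + log Q) + 1)) := by
    intro s hs
    rw [Finset.mem_Ioc] at hs
    refine abs_sum_antiDiff_mul_le (by positivity) (by positivity)
      (antiDiff_wt hlam hN0 hNQ hN hs.1 hs.2) fun r hr1 hr2 => ?_
    have e2 : ∑ q ∈ Finset.Ioc (Q - s) r, (totDens L q.toNat - Cconst L) =
        ∑ q ∈ Finset.Ioc 0 r, (totDens L q.toNat - Cconst L) -
        ∑ q ∈ Finset.Ioc 0 (Q - s), (totDens L q.toNat - Cconst L) := by
      rw [eq_sub_iff_add_eq']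
      rw [← Finset.sum_union]
      · congr 1
        ext q; simp only [Finset.mem_union, Finset.mem_Ioc]; omega
      · rw [Finset.disjoint_left]
        intro q hq hq'
        rw [Finset.mem_Ioc] at hq hq'
        omega
    rw [e2]
    have a1 := abs_sum_totDens_int_sub_le (L := L) (r := r) (Q := Q) hL (by omega) hr2 hQ0
    have a2 := abs_sum_totDens_int_sub_le (L := L) (r := Q - s) (Q := Q) hL (by omega)
      (by omega) hQ0
    have := abs_sub (∑ q ∈ Finset.Ioc 0 r, (totDens L q.toNat - Cconst L))
      (∑ q ∈ Finset.Ioc 0 (Q - s), (totDens L q.toNat - Cconst L))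
    linarith
  refine (Finset.sum_le_card_nsmul _ _ _ hterm).trans (le_of_eq ?_)
  rw [nsmul_eq_mul, Int.card_Ioc, sub_zero]
  have : ((Q.toNat : ℕ) : ℝ) = Q := by exact_mod_cast Int.toNat_of_nonneg hQ0.le
  rw [this]
  field_simp
  ring

end

lemma Cconst_one : Cconst 1 = 1 / zeta2 := by
  set f : ℕ →*₀ ℝ :=
    { toFun := fun n => 1 / (n : ℝ) ^ 2
      map_zero' := by simp
      map_one' := by simp
      map_mul' := fun a b => by push_cast; rw [mul_pow, one_div_mul_one_div] } with hf
  have hfe : ∀ n, f n = 1 / (n : ℝ) ^ 2 := fun n => rfl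
  have hsum : Summable fun n => ‖f n‖ := by
    simp only [hfe]
    exact (Real.summable_one_div_nat_pow.mpr one_lt_two).norm
  have h1 := EulerProduct.eulerProduct_completely_multiplicative_hasProd hsum
  have h2 := h1.mul (hasProd_moebiusSq 1)
  have h3 : ∀ p : Nat.Primes, (1 - f p)⁻¹ *
      (if (p : ℕ) ∣ 1 then 1 else 1 - 1 / ((p : ℕ) : ℝ) ^ 2) = 1 := by
    intro p
    have hp : ¬ (p : ℕ) ∣ 1 := p.2.one_lt.ne' ∘ Nat.dvd_one.mp
    have h4 : (1 : ℝ) < ((p : ℕ) : ℝ) ^ 2 :=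
      one_lt_pow₀ (by exact_mod_cast p.2.one_lt) two_ne_zero
    have h5 : 1 / ((p : ℕ) : ℝ) ^ 2 < 1 := (div_lt_one (by linarith)).mpr h4
    rw [if_neg hp, hfe]
    exact inv_mul_cancel₀ (by linarith)
  simp only [h3] at h2
  have h4 : (∑' n, f n) * ∑' n, moebiusSq 1 n = 1 := h2.unique hasProd_one
  have h5 : ∑' n, f n = zeta2 := hasSum_zeta_two.tsum_eq
  rw [h5] at h4
  have h6 : zeta2 ≠ 0 := by unfold zeta2; positivity
  rw [Cconst_eq]
  simp only [Nat.totient_one, Nat.cast_one, div_one, one_mul]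
  field_simp
  linarith

lemma abs_card_int_sub_volume_le {T : Set ℝ} (hT : T.OrdConnected) {A B : ℝ}
    (hAB : T ⊆ Set.Icc A B) {S : Finset ℤ} (hS : ∀ k : ℤ, k ∈ S ↔ (k : ℝ) ∈ T) :
    |(S.card : ℝ) - (volume T).toReal| ≤ 1 := by
  have hfin : volume T ≠ ⊤ := ((measure_mono hAB).trans_lt measure_Icc_lt_top).ne
  have upper : ∀ a b : ℝ, a ≤ b → T ⊆ Set.Icc a b → (volume T).toReal ≤ b - a := by
    intro a b hab h
    have := ENNReal.toReal_mono (by simp) (measure_mono (μ := volume) h)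
    rwa [Real.volume_Icc, ENNReal.toReal_ofReal (by linarith)] at this
  rcases S.eq_empty_or_nonempty with rfl | hne
  · have h1 : (volume T).toReal ≤ 1 := by
      rcases T.eq_empty_or_nonempty with rfl | ⟨x, hx⟩
      · simp
      · refine (upper ⌊x⌋ (⌊x⌋ + 1) (by linarith) fun y hy => ⟨?_, ?_⟩).trans (by linarith)
        · by_contra! h
          exact absurd ((hS _).mpr (hT.out hy hx ⟨h.le, Int.floor_le x⟩)) (by simp)
        · by_contra! h
          refine absurd ((hS (⌊x⌋ + 1)).mpr (hT.out hx hy ⟨?_, ?_⟩)) (by simp)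
          · push_cast; exact (Int.lt_floor_add_one x).le
          · push_cast; exact h.le
    have h0 : 0 ≤ (volume T).toReal := ENNReal.toReal_nonneg
    rw [abs_le]; constructor <;> simp <;> linarith
  · set a := S.min' hne
    set b := S.max' hne
    have ha : (a : ℝ) ∈ T := (hS a).mp (S.min'_mem hne)
    have hb : (b : ℝ) ∈ T := (hS b).mp (S.max'_mem hne)
    have hab : a ≤ b := S.min'_le _ (S.max'_mem hne)
    have hab' : (a : ℝ) ≤ b := by exact_mod_cast hab
    have hSI : S = Finset.Icc a b := by
      ext k
      rw [Finset.mem_Icc]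
      refine ⟨fun h => ⟨S.min'_le _ h, S.le_max' _ h⟩, fun h => (hS k).mpr (hT.out ha hb ?_)⟩
      exact ⟨by exact_mod_cast h.1, by exact_mod_cast h.2⟩
    have hcard : (S.card : ℝ) = b + 1 - a := by
      have h1 : (S.card : ℤ) = b + 1 - a := by rw [hSI, Int.card_Icc]; omega
      exact_mod_cast h1
    have hu := upper (a - 1) (b + 1) (by linarith) fun y hy => ⟨?_, ?_⟩
    · have hl : (b : ℝ) - a ≤ (volume T).toReal := by
        have := ENNReal.toReal_mono hfin (measure_mono (μ := volume) (hT.out ha hb))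
        rwa [Real.volume_Icc, ENNReal.toReal_ofReal (by linarith)] at this
      rw [hcard, abs_le]; constructor <;> linarith
    · by_contra! h
      have : a - 1 ∈ S := (hS _).mpr (hT.out hy ha ⟨by push_cast; exact h.le, by simp⟩)
      have := S.min'_le _ this
      omega
    · by_contra! h
      have : b + 1 ∈ S := (hS _).mpr (hT.out hb hy ⟨by simp, by push_cast; exact h.le⟩)
      have := S.le_max' _ this
      omega

lemma abs_card_slope_modEq_sub_le {J : Set ℝ} (hJ : J.OrdConnected) (hJ1 : J ⊆ Set.Icc 0 1)
    {q m : ℕ} (hq : 0 < q) (hm : 0 < m) (r : ℤ) {Q : ℤ} (hqQ : (q : ℤ) ≤ Q) [DecidablePred (· ∈ J)] :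
    |(((Finset.Ioc 0 Q).filter fun a : ℤ => (a : ℝ) / q ∈ J ∧ (m : ℤ) ∣ a - r).card : ℝ) -
      q * (volume J).toReal / m| ≤ 2 := by
  have hq' : (0 : ℝ) < q := by exact_mod_cast hq
  have hm' : (0 : ℝ) < m := by exact_mod_cast hm
  have hm0 : (m : ℤ) ≠ 0 := by exact_mod_cast hm.ne'
  set T : Set ℝ := (fun x => (m / q : ℝ) * x) ⁻¹' ((fun y => (r / q : ℝ) + y) ⁻¹' J) with hTdef
  have hTmem : ∀ x : ℝ, x ∈ T ↔ (r + m * x) / q ∈ J := by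
    intro x
    have : (r / q : ℝ) + (m / q : ℝ) * x = (r + m * x) / q := by ring
    simp only [hTdef, Set.mem_preimage, this]
  have hTv : (volume T).toReal = q * (volume J).toReal / m := by
    rw [hTdef, Real.volume_preimage_mul_left (by positivity), measure_preimage_add,
      ENNReal.toReal_mul, ENNReal.toReal_ofReal (abs_nonneg _), abs_of_pos (by positivity)]
    field_simp
  have hTo : T.OrdConnected := by
    refine ⟨fun x hx y hy z hz => ?_⟩
    rw [hTmem] at hx hy ⊢
    refine hJ.out hx hy ⟨?_, ?_⟩
    · have := hz.1; gcongr
    · have := hz.2; gcongr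
  have hTb : T ⊆ Set.Icc ((0 * q - r) / m) ((1 * q - r) / m) := by
    intro x hx
    have h := hJ1 ((hTmem x).mp hx)
    rw [Set.mem_Icc, le_div_iff₀ hq', div_le_iff₀ hq'] at h
    rw [Set.mem_Icc, div_le_iff₀ hm', le_div_iff₀ hm']
    constructor <;> linarith
  classical
  set S : Finset ℤ := ((Finset.Ioc (-1) Q).filter fun a : ℤ => (a : ℝ) / q ∈ J ∧
    (m : ℤ) ∣ a - r) with hSdef
  set S' : Finset ℤ := S.image fun a => (a - r) / m with hS'
  have hS'm : ∀ k : ℤ, k ∈ S' ↔ (k : ℝ) ∈ T := by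
    intro k
    rw [hTmem]
    simp only [hS', hSdef, Finset.mem_image, Finset.mem_filter, Finset.mem_Ioc]
    constructor
    · rintro ⟨a, ⟨_, h1, c, hc⟩, rfl⟩
      rw [hc, Int.mul_ediv_cancel_left _ hm0]
      have : (r : ℝ) + m * c = a := by
        have : a = r + m * c := by omega
        rw [this]; push_cast; ring
      rwa [this]
    · intro h
      refine ⟨r + m * k, ⟨?_, by push_cast; exact h, ⟨k, by ring⟩⟩, ?_⟩
      · have h2 := hJ1 h
        rw [Set.mem_Icc, le_div_iff₀ hq', div_le_iff₀ hq', zero_mul, one_mul] at h2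
        have h3 : 0 ≤ r + m * k := by exact_mod_cast h2.1
        have h4 : r + m * k ≤ q := by exact_mod_cast h2.2
        exact ⟨by omega, by omega⟩
      · rw [add_sub_cancel_left, Int.mul_ediv_cancel_left _ hm0]
  have hcard : S'.card = S.card := by
    refine Finset.card_image_of_injOn fun a ha b hb hab => ?_
    simp only [hSdef, Finset.coe_filter, Set.mem_ofPred_eq] at ha hb
    obtain ⟨c, hc⟩ := ha.2.2
    obtain ⟨c', hc'⟩ := hb.2.2
    simp only [hc, hc', Int.mul_ediv_cancel_left _ hm0] at hab
    subst hab
    omega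
  have main := abs_card_int_sub_volume_le hTo hTb hS'm
  rw [hcard, hTv] at main
  set S0 : Finset ℤ := ((Finset.Ioc 0 Q).filter fun a : ℤ => (a : ℝ) / q ∈ J ∧
    (m : ℤ) ∣ a - r) with hS0
  have h1 : S0.card ≤ S.card := by
    refine Finset.card_le_card fun a ha => ?_
    simp only [hS0, hSdef, Finset.mem_filter, Finset.mem_Ioc] at ha ⊢
    exact ⟨by omega, ha.2⟩
  have h2 : S.card ≤ S0.card + 1 := by
    refine (Finset.card_le_card (t := insert 0 S0) fun a ha => ?_).trans (Finset.card_insert_le _ _)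
    simp only [hS0, hSdef, Finset.mem_insert, Finset.mem_filter, Finset.mem_Ioc] at ha ⊢
    by_cases h : a = 0
    · exact Or.inl h
    · exact Or.inr ⟨by omega, ha.2⟩
  have h1' : (S0.card : ℝ) ≤ S.card := by exact_mod_cast h1
  have h2' : (S.card : ℝ) ≤ S0.card + 1 := by exact_mod_cast h2
  rw [abs_le] at main ⊢
  constructor <;> linarith

lemma abs_card_prim_slope_sub_le {J : Set ℝ} (hJ : J.OrdConnected) (hJ1 : J ⊆ Set.Icc 0 1)
    {L q : ℕ} (hL : 0 < L) (hq : 0 < q) {Q : ℤ} (hqQ : (q : ℤ) ≤ Q)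
    [DecidablePred fun a : ℤ => (a : ℝ) / q ∈ J ∧ IsCoprime a q ∧ (L : ℤ) ∣ q - a] :
    |(((Finset.Ioc 0 Q).filter fun a : ℤ =>
        (a : ℝ) / q ∈ J ∧ IsCoprime a q ∧ (L : ℤ) ∣ q - a).card : ℝ) -
      totDens L q * (q * (volume J).toReal / L)| ≤ 2 * q.divisors.card := by
  classical
  by_cases hc : q.Coprime L
  · have e : (((Finset.Ioc 0 Q).filter fun a : ℤ =>
        (a : ℝ) / q ∈ J ∧ IsCoprime a q ∧ (L : ℤ) ∣ q - a).card : ℝ) =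
        ∑ d ∈ q.divisors, (ArithmeticFunction.moebius d : ℝ) *
          (((Finset.Ioc 0 Q).filter fun a : ℤ =>
            (a : ℝ) / q ∈ J ∧ ((L : ℤ) ∣ q - a ∧ (d : ℤ) ∣ a)).card : ℝ) := by
      have h1 : ∀ d ∈ q.divisors, (ArithmeticFunction.moebius d : ℝ) *
          (((Finset.Ioc 0 Q).filter fun a : ℤ =>
            (a : ℝ) / q ∈ J ∧ ((L : ℤ) ∣ q - a ∧ (d : ℤ) ∣ a)).card : ℝ) =
          ∑ a ∈ (Finset.Ioc 0 Q).filter (fun a : ℤ => (a : ℝ) / q ∈ J ∧ (L : ℤ) ∣ q - a),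
            if (d : ℤ) ∣ a then (ArithmeticFunction.moebius d : ℝ) else 0 := by
        intro d _
        rw [← Finset.sum_filter, Finset.sum_const, nsmul_eq_mul, Finset.filter_filter, mul_comm]
        congr 3
        ext a
        simp only [Finset.mem_filter, and_assoc]
      rw [Finset.sum_congr rfl h1, Finset.sum_comm]
      have h2 : ∀ a ∈ (Finset.Ioc 0 Q).filter
          (fun a : ℤ => (a : ℝ) / q ∈ J ∧ (L : ℤ) ∣ q - a),
          (∑ d ∈ q.divisors, if (d : ℤ) ∣ a then (ArithmeticFunction.moebius d : ℝ) else 0) =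
          if IsCoprime a q then 1 else 0 := by
        intro a ha
        rw [Finset.mem_filter, Finset.mem_Ioc] at ha
        obtain ⟨n, rfl⟩ := Int.eq_ofNat_of_zero_le ha.1.1.le
        simp only [Int.natCast_dvd_natCast]
        rw [← Finset.sum_filter, sum_moebius_divisors_gcd n q hq]
        exact if_congr Nat.isCoprime_iff_coprime.symm rfl rfl
      rw [Finset.sum_congr rfl h2, ← Finset.sum_filter, Finset.filter_filter, Finset.sum_const,
        nsmul_eq_mul, mul_one]
      congr 2
      ext a
      simp only [Finset.mem_filter]
      tauto
    have e2 : totDens L q * (q * (volume J).toReal / L) =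
        ∑ d ∈ q.divisors, (ArithmeticFunction.moebius d : ℝ) *
          (q * (volume J).toReal / (d * L : ℕ)) := by
      unfold totDens
      rw [if_pos hc, totient_div_eq_sum_moebius q hq, Finset.sum_mul]
      refine Finset.sum_congr rfl fun d hd => ?_
      have : (d : ℝ) ≠ 0 := by exact_mod_cast (Nat.pos_of_mem_divisors hd).ne'
      push_cast
      field_simp
    rw [e, e2, ← Finset.sum_sub_distrib]
    refine (Finset.abs_sum_le_sum_abs _ _).trans ?_
    refine (Finset.sum_le_card_nsmul _ _ 2 fun d hd => ?_).trans ?_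
    · rw [← mul_sub, abs_mul]
      have hd0 := Nat.pos_of_mem_divisors hd
      have hdL : d.Coprime L := hc.coprime_dvd_left (Nat.dvd_of_mem_divisors hd)
      obtain ⟨u, v, huv⟩ := Nat.isCoprime_iff_coprime.mpr hdL
      have hcr : ∀ a : ℤ, ((L : ℤ) ∣ q - a ∧ (d : ℤ) ∣ a) ↔ ((d * L : ℕ) : ℤ) ∣ a - q * u * d := by
        intro a
        have hr : (q : ℤ) - q * u * d = q * v * L := by linear_combination (-(q : ℤ)) * huv
        constructor
        · rintro ⟨h1, h2⟩
          push_cast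
          refine IsCoprime.mul_dvd ⟨u, v, huv⟩ (dvd_sub h2 (dvd_mul_left _ _)) ?_
          have : a - q * u * d = q * v * L - (q - a) := by rw [← hr]; ring
          rw [this]
          exact dvd_sub (dvd_mul_left _ _) h1
        · intro h
          push_cast at h
          constructor
          · have : q - a = q * v * L - (a - q * u * d) := by rw [← hr]; ring
            rw [this]
            exact dvd_sub (dvd_mul_left _ _) ((dvd_mul_left _ _).trans h)
          · have : a = (a - q * u * d) + q * u * d := by ring
            rw [this]
            exact dvd_add ((dvd_mul_right _ _).trans h) (dvd_mul_left _ _)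
      have := abs_card_slope_modEq_sub_le hJ hJ1 hq (Nat.mul_pos hd0 hL) (q * u * d) hqQ
      simp only [hcr]
      exact (mul_le_mul (abs_moebius_cast_le d) this (abs_nonneg _) zero_le_one).trans
        (one_mul _).le
    · rw [nsmul_eq_mul, mul_comm]
  · rw [Finset.filter_false_of_mem]
    · unfold totDens
      rw [if_neg hc]
      simp
    · rintro a - ⟨-, h1, h2⟩
      apply hc
      rw [← Nat.isCoprime_iff_coprime]
      obtain ⟨k, hk⟩ := h2
      have : (a : ℤ) = q - L * k := by omega
      rw [this] at h1
      obtain ⟨u, v, huv⟩ := h1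
      exact ⟨u + v, -u * k, by linear_combination huv⟩

section
variable {Q N : ℤ} {lam : ℝ}

lemma abs_wt_le (hlam : 0 < lam) (hN0 : 0 ≤ N) (hNQ : N < Q) (hN : lam * Q < N + 1) {q s : ℤ}
    (hq : q ≤ Q) (hs : s ≤ Q) (hqs : Q < q + s) : |wt Q N q s| ≤ 2 / (lam * Q ^ 2) := by
  obtain ⟨g, h, h1, -, -, h4, h5⟩ := antiDiff_wt hlam hN0 hNQ hN (s := s) (by omega) hs
  have e : wt Q N q s = g q - h q := h1 q (by omega) hq
  rw [e]
  have := h4 q (by omega) hq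
  have := h5 q (by omega) hq
  rw [abs_le]; constructor <;> linarith

lemma abs_sum_wt_le (hlam : 0 < lam) (hN0 : 0 ≤ N) (hNQ : N < Q) (hN : lam * Q < N + 1) {q : ℤ}
    (hq0 : 0 < q) (hq : q ≤ Q) :
    |∑ s ∈ Finset.Ioc (Q - q) Q, wt Q N q s| ≤ q * (2 / (lam * Q ^ 2)) := by
  refine (Finset.abs_sum_le_sum_abs _ _).trans ?_
  refine (Finset.sum_le_card_nsmul _ _ (2 / (lam * Q ^ 2)) fun s hs => ?_).trans (le_of_eq ?_)
  · rw [Finset.mem_Ioc] at hs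
    exact abs_wt_le hlam hN0 hNQ hN hq hs.2 (by omega)
  · rw [nsmul_eq_mul, Int.card_Ioc]
    congr 1
    have : ((Q - (Q - q)).toNat : ℤ) = q := by omega
    exact_mod_cast this

/-- `meanSum` without the density of `arctan`. -/
noncomputable def flatSum (L : ℕ) (Q N : ℤ) (J : Set ℝ) : ℝ :=
  ∑ v ∈ primPts L (slopeBox Q 0 Q J), 1 / (v.2 : ℝ) * ∑ s ∈ Finset.Ioc (Q - v.2) Q, wt Q N v.2 s

open Classical in
lemma flatSum_eq (L : ℕ) (J : Set ℝ) : flatSum L Q N J = ∑ q ∈ Finset.Ioc 0 Q,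
    (((Finset.Ioc 0 Q).filter fun a : ℤ =>
      (a : ℝ) / q.toNat ∈ J ∧ IsCoprime a q.toNat ∧ (L : ℤ) ∣ q.toNat - a).card : ℝ) *
    (1 / (q : ℝ) * ∑ s ∈ Finset.Ioc (Q - q) Q, wt Q N q s) := by
  have h1 : ∀ q ∈ Finset.Ioc 0 Q, (((Finset.Ioc 0 Q).filter fun a : ℤ =>
      (a : ℝ) / q.toNat ∈ J ∧ IsCoprime a q.toNat ∧ (L : ℤ) ∣ q.toNat - a).card : ℝ) *
      (1 / (q : ℝ) * ∑ s ∈ Finset.Ioc (Q - q) Q, wt Q N q s) =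
      ∑ a ∈ Finset.Ioc 0 Q, if (a : ℝ) / q ∈ J ∧ IsCoprime a q ∧ (L : ℤ) ∣ q - a then
        (1 / (q : ℝ) * ∑ s ∈ Finset.Ioc (Q - q) Q, wt Q N q s) else 0 := by
    intro q hq
    rw [Finset.mem_Ioc] at hq
    obtain ⟨n, rfl⟩ := Int.eq_ofNat_of_zero_le hq.1.le
    rw [← Finset.sum_filter, Finset.sum_const, nsmul_eq_mul]
    simp only [Int.toNat_natCast, Int.cast_natCast]
  rw [Finset.sum_congr rfl h1, Finset.sum_comm]
  unfold flatSum primPts slopeBox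
  rw [Finset.filter_filter, Finset.sum_filter, Finset.sum_product]

lemma exists_abs_flatSum_sub_le (L : ℕ) (hL : 0 < L) {δ : ℝ} (hδ : 0 < δ) (hlam : 0 < lam)
    (hlam1 : lam < 1) : ∃ C : ℝ, 0 ≤ C ∧ ∀ (Q N : ℤ) (J : Set ℝ), J.OrdConnected →
      J ⊆ Set.Icc 0 1 → 1 ≤ N → N < Q → (N : ℝ) ≤ lam * Q → lam * Q < N + 1 →
      |flatSum L Q N J - (volume J).toReal * (Cconst L / L * G1fun lam)| ≤
        C * (Q : ℝ) ^ (-1 + δ) := by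
  obtain ⟨C₁, hC₁, hdiv⟩ := exists_card_divisors_le δ hδ
  obtain ⟨C₂, hC₂, hlog⟩ := exists_one_add_log_le δ hδ
  set D : ℝ := 8 / lam ^ 2 + 8 / lam + 12 / lam * (1 - log lam) with hD
  have hD0 : 0 ≤ D := by
    have : log lam < 0 := log_neg hlam hlam1
    have : 0 ≤ 1 - log lam := by linarith
    positivity
  refine ⟨4 / lam * C₁ + 8 / lam * (L + 1) * C₂ + |Cconst L| * D, by positivity, ?_⟩
  intro Q N J hJ hJ1 hN1 hNQ hNl hN
  have hN0 : 0 ≤ N := by omega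
  have hQ0 : 0 < Q := by omega
  have hQ : (0 : ℝ) < Q := by exact_mod_cast hQ0
  have hQ1 : (1 : ℝ) ≤ Q := by exact_mod_cast hQ0
  have hL1 : (1 : ℝ) ≤ L := by exact_mod_cast hL
  have hpow : (Q : ℝ) ^ (-1 + δ) = (Q : ℝ) ^ δ / Q := by
    rw [rpow_add hQ, rpow_neg_one]; ring
  have hQδ : 1 ≤ (Q : ℝ) ^ δ := one_le_rpow hQ1 hδ.le
  set V := (volume J).toReal with hV
  have hV0 : 0 ≤ V := ENNReal.toReal_nonneg
  have hV1 : V ≤ 1 := by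
    have := ENNReal.toReal_mono (by simp) (measure_mono (μ := volume) hJ1)
    rwa [Real.volume_Icc, ENNReal.toReal_ofReal (by norm_num), sub_zero] at this
  set W : ℤ → ℝ := fun q => ∑ s ∈ Finset.Ioc (Q - q) Q, wt Q N q s with hW
  set S₁ := ∑ q ∈ Finset.Ioc 0 Q, totDens L q.toNat * W q
  set S₂ := ∑ q ∈ Finset.Ioc 0 Q, W q
  have b1 : |flatSum L Q N J - V / L * S₁| ≤ 4 / lam * C₁ * ((Q : ℝ) ^ δ / Q) := by
    classical
    rw [flatSum_eq, Finset.mul_sum, ← Finset.sum_sub_distrib]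
    refine (Finset.abs_sum_le_sum_abs _ _).trans ?_
    refine (Finset.sum_le_card_nsmul _ _ (4 / lam * C₁ * (Q : ℝ) ^ δ / Q ^ 2)
      fun q hq => ?_).trans (le_of_eq ?_)
    · rw [Finset.mem_Ioc] at hq
      have hq' : (0 : ℝ) < q := by exact_mod_cast hq.1
      have hWq := abs_sum_wt_le hlam hN0 hNQ hN hq.1 hq.2
      obtain ⟨n, hn⟩ := Int.eq_ofNat_of_zero_le hq.1.le
      have hn0 : 0 < n := by omega
      have hnt : q.toNat = n := by omega
      have hcount := abs_card_prim_slope_sub_le hJ hJ1 hL hn0 (Q := Q) (by omega)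
      have hqn : (q : ℝ) = n := by rw [hn]; simp
      rw [hnt, hqn]
      rw [hqn] at hWq hq'
      have hd : (n.divisors.card : ℝ) ≤ C₁ * (Q : ℝ) ^ δ := by
        refine (hdiv n hn0).trans ?_
        have : (n : ℝ) ≤ Q := by rw [← hqn]; exact_mod_cast hq.2
        gcongr
      calc |_| = |((((Finset.Ioc 0 Q).filter fun a : ℤ =>
            (a : ℝ) / n ∈ J ∧ IsCoprime a n ∧ (L : ℤ) ∣ n - a).card : ℝ) -
            totDens L n * (n * V / L)) * (1 / n * W q)| := by
            congr 1
            simp only [hW]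
            field_simp
        _ ≤ (2 * (C₁ * (Q : ℝ) ^ δ)) * (1 / n * (n * (2 / (lam * Q ^ 2)))) := by
            rw [abs_mul, abs_mul, abs_of_pos (by positivity : (0 : ℝ) < 1 / n)]
            gcongr
            exact hcount.trans (by linarith)
        _ = _ := by field_simp; ring
    · rw [nsmul_eq_mul, Int.card_Ioc, sub_zero]
      have : ((Q.toNat : ℕ) : ℝ) = Q := by exact_mod_cast Int.toNat_of_nonneg hQ0.le
      rw [this]
      field_simp
  have b2 : |S₁ - Cconst L * S₂| ≤ 8 / lam * (L + 1) * C₂ * ((Q : ℝ) ^ δ / Q) := by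
    refine (abs_sum_totDens_mul_wt_sub_le hL hlam hN0 hNQ hN).trans ?_
    have h1 := hlog Q hQ1
    have h2 : (L : ℝ) * (1 + log Q) + 1 ≤ (L + 1) * (C₂ * (Q : ℝ) ^ δ) := by
      have : 1 ≤ C₂ * (Q : ℝ) ^ δ := one_le_mul_of_one_le_of_one_le hC₂ hQδ
      have : (L : ℝ) * (1 + log Q) ≤ L * (C₂ * (Q : ℝ) ^ δ) := by gcongr
      linarith
    calc _ ≤ 8 / lam * ((L + 1) * (C₂ * (Q : ℝ) ^ δ)) / Q := by gcongr
      _ = _ := by ring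
  have b3 : |S₂ - G1fun lam| ≤ D * ((Q : ℝ) ^ δ / Q) := by
    have h := abs_sum_wt_sub_le hlam hlam1 hN1 hNl hN hNQ
    rw [integral_bigDens_add_eq_G1fun hlam hlam1] at h
    refine h.trans ?_
    rw [← hD, ← mul_div_assoc]
    gcongr
    nlinarith
  have e : flatSum L Q N J - V * (Cconst L / L * G1fun lam) =
      (flatSum L Q N J - V / L * S₁) + V / L * ((S₁ - Cconst L * S₂) +
        Cconst L * (S₂ - G1fun lam)) := by ring
  have hVL : V / L ≤ 1 := (div_le_one (by linarith)).mpr (hV1.trans hL1)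
  have hP : 0 ≤ (Q : ℝ) ^ δ / Q := by positivity
  rw [e, hpow]
  refine (abs_add_le _ _).trans ?_
  have k1 : |V / L * ((S₁ - Cconst L * S₂) + Cconst L * (S₂ - G1fun lam))| ≤
      1 * (8 / lam * (L + 1) * C₂ * ((Q : ℝ) ^ δ / Q) +
        |Cconst L| * (D * ((Q : ℝ) ^ δ / Q))) := by
    rw [abs_mul, abs_of_nonneg (by positivity : 0 ≤ V / L)]
    refine mul_le_mul hVL ((abs_add_le _ _).trans (add_le_add b2 ?_)) (abs_nonneg _) zero_le_one
    rw [abs_mul]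
    gcongr
  calc _ ≤ _ := add_le_add b1 k1
    _ = _ := by ring

end

/-- The points of `J` where the density of `arctan` is at least `t`. -/
def densCut (J : Set ℝ) (t : ℝ) : Set ℝ := J ∩ {u | t ≤ 1 / (1 + u ^ 2)}

lemma densCut_ordConnected {J : Set ℝ} (hJ : J.OrdConnected) (hJ1 : J ⊆ Set.Icc 0 1) (t : ℝ) :
    (densCut J t).OrdConnected := by
  refine ⟨fun x hx y hy z hz => ⟨hJ.out hx.1 hy.1 hz, ?_⟩⟩
  have hz0 : 0 ≤ z := (hJ1 hx.1).1.trans hz.1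
  have h : t ≤ 1 / (1 + y ^ 2) := hy.2
  refine h.trans (?_ : 1 / (1 + y ^ 2) ≤ 1 / (1 + z ^ 2))
  have := hz.2
  gcongr

lemma antitone_densCut (J : Set ℝ) : Antitone (densCut J) :=
  fun _ _ h _ hx => ⟨hx.1, h.trans hx.2⟩

lemma integrableOn_dens (J : Set ℝ) (hJ : J ⊆ Set.Icc 0 1) :
    IntegrableOn (fun u : ℝ => 1 / (1 + u ^ 2)) J := by
  have hc : Continuous fun u : ℝ => 1 / (1 + u ^ 2) :=
    continuous_const.div (by fun_prop) fun u => by positivity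
  exact (hc.continuousOn.integrableOn_Icc (a := 0) (b := 1)).mono_set hJ

lemma integral_dens_eq {J : Set ℝ} (hJ1 : J ⊆ Set.Icc 0 1) :
    ∫ u in J, 1 / (1 + u ^ 2) = ∫ t in (0 : ℝ)..1, (volume (densCut J t)).toReal := by
  rw [Integrable.integral_eq_integral_Ioc_meas_le (M := 1) (integrableOn_dens J hJ1)
    (Eventually.of_forall fun u => by positivity)
    (Eventually.of_forall fun u => by
      beta_reduce; rw [div_le_one (by positivity)]; nlinarith [sq_nonneg u]),
    intervalIntegral.integral_of_le zero_le_one]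
  refine setIntegral_congr_fun measurableSet_Ioc fun t _ => ?_
  rw [measureReal_def, Measure.restrict_apply (measurableSet_le measurable_const (by fun_prop)),
    Set.inter_comm]
  rfl

lemma intervalIntegrable_volume_densCut {J : Set ℝ} (hJ1 : J ⊆ Set.Icc 0 1) :
    IntervalIntegrable (fun t => (volume (densCut J t)).toReal) volume 0 1 := by
  refine Antitone.intervalIntegrable fun s t h => ?_
  refine ENNReal.toReal_mono ?_ (measure_mono (antitone_densCut J h))
  exact ((measure_mono (fun x hx => hJ1 hx.1)).trans_lt measure_Icc_lt_top).ne

lemma integral_indicator_Iic {h : ℝ} (h0 : 0 ≤ h) (h1 : h ≤ 1) (x : ℝ) :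
    ∫ t in (0 : ℝ)..1, (if t ≤ h then x else 0) = h * x ∧
    IntervalIntegrable (fun t => if t ≤ h then x else 0) volume 0 1 := by
  have e1 : Set.EqOn (fun t => if t ≤ h then x else 0) (fun _ => x) (Set.uIoc 0 h) := by
    intro t ht
    rw [Set.uIoc_of_le h0] at ht
    exact if_pos ht.2
  have e2 : Set.EqOn (fun t => if t ≤ h then x else 0) (fun _ => 0) (Set.uIoc h 1) := by
    intro t ht
    rw [Set.uIoc_of_le h1] at ht
    exact if_neg (not_le.mpr ht.1)
  have i1 : IntervalIntegrable (fun t => if t ≤ h then x else 0) volume 0 h :=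
    (intervalIntegrable_const (c := x)).congr e1.symm
  have i2 : IntervalIntegrable (fun t => if t ≤ h then x else 0) volume h 1 :=
    (intervalIntegrable_const (c := (0 : ℝ))).congr e2.symm
  refine ⟨?_, i1.trans i2⟩
  rw [← intervalIntegral.integral_add_adjacent_intervals i1 i2,
    intervalIntegral.integral_congr_ae (g := fun _ => x) (Eventually.of_forall fun t ht => e1 ht),
    intervalIntegral.integral_congr_ae (g := fun _ => 0) (Eventually.of_forall fun t ht => e2 ht)]
  simp

section
variable {Q N : ℤ}

lemma meanSum_eq_integral (L : ℕ) (J : Set ℝ) :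
    meanSum L Q N J = ∫ t in (0 : ℝ)..1, flatSum L Q N (densCut J t) ∧
    IntervalIntegrable (fun t => flatSum L Q N (densCut J t)) volume 0 1 := by
  set y : ℤ × ℤ → ℝ := fun v => 1 / (v.2 : ℝ) * ∑ s ∈ Finset.Ioc (Q - v.2) Q, wt Q N v.2 s
  have e : (fun t => flatSum L Q N (densCut J t)) = fun t =>
      ∑ v ∈ primPts L (slopeBox Q 0 Q J), if t ≤ slopeDens v then y v else 0 := by
    funext t
    rw [← Finset.sum_filter]
    unfold flatSum
    refine Finset.sum_congr ?_ fun _ _ => rfl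
    ext v
    rw [Finset.mem_filter]
    simp only [primPts, Finset.mem_filter, mem_slopeBox, densCut, slopeDens, Set.mem_inter_iff,
      Set.mem_ofPred_eq]
    tauto
  have hd : ∀ v : ℤ × ℤ, 0 ≤ slopeDens v ∧ slopeDens v ≤ 1 := by
    intro v
    unfold slopeDens
    refine ⟨by positivity, ?_⟩
    rw [div_le_one (by positivity)]
    nlinarith [sq_nonneg ((v.1 : ℝ) / v.2)]
  rw [e]
  constructor
  · rw [intervalIntegral.integral_finsetSum fun v _ =>
      (integral_indicator_Iic (hd v).1 (hd v).2 (y v)).2]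
    exact Finset.sum_congr rfl fun v _ => (integral_indicator_Iic (hd v).1 (hd v).2 (y v)).1.symm
  · have h := IntervalIntegrable.sum (primPts L (slopeBox Q 0 Q J)) fun v _ =>
      (integral_indicator_Iic (hd v).1 (hd v).2 (y v)).2
    refine h.congr fun t _ => ?_
    rw [Finset.sum_apply]

end

lemma exists_abs_meanSum_sub_le (L : ℕ) (hL : 0 < L) {δ lam : ℝ} (hδ : 0 < δ) (hlam : 0 < lam)
    (hlam1 : lam < 1) : ∃ C : ℝ, 0 ≤ C ∧ ∀ (Q N : ℤ) (J : Set ℝ), J.OrdConnected →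
      J ⊆ Set.Icc 0 1 → 1 ≤ N → N < Q → (N : ℝ) ≤ lam * Q → lam * Q < N + 1 →
      |meanSum L Q N J - (∫ u in J, 1 / (1 + u ^ 2)) * (Cconst L / L * G1fun lam)| ≤
        C * (Q : ℝ) ^ (-1 + δ) := by
  obtain ⟨C, hC, h⟩ := exists_abs_flatSum_sub_le L hL hδ hlam hlam1
  refine ⟨C, hC, fun Q N J hJ hJ1 hN1 hNQ hNl hN => ?_⟩
  obtain ⟨e, hi⟩ := meanSum_eq_integral (Q := Q) (N := N) L J
  rw [e, integral_dens_eq hJ1, ← intervalIntegral.integral_mul_const,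
    ← intervalIntegral.integral_sub hi ((intervalIntegrable_volume_densCut hJ1).mul_const _)]
  have := intervalIntegral.norm_integral_le_of_norm_le_const (a := 0) (b := 1)
    (f := fun t => flatSum L Q N (densCut J t) -
      (volume (densCut J t)).toReal * (Cconst L / L * G1fun lam))
    (C := C * (Q : ℝ) ^ (-1 + δ)) fun t _ =>
      h Q N (densCut J t) (densCut_ordConnected hJ hJ1 t) (fun x hx => hJ1 hx.1) hN1 hNQ hNl hN
  simpa using this

lemma exists_abs_pairSum_sub_le (L : ℕ) (hL : 0 < L) {c K₀ δ lam : ℝ} (hc0 : 0 < c)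
    (hc : c < 1 / 2) (hK₀ : 1 ≤ K₀) (hδ : 0 < δ) (hlam : 0 < lam) (hlam1 : lam < 1) :
    ∃ C : ℝ, 0 ≤ C ∧ ∀ (σ Q N : ℤ) (J : Set ℝ) (u η : ℝ), J.OrdConnected → J ⊆ Set.Icc 0 1 →
      J ⊆ Set.Icc u (u + η) → 0 ≤ η → η ≤ K₀ * (Q : ℝ) ^ (-c) → (σ = 1 ∨ σ = -1) →
      1 ≤ N → N < Q → (N : ℝ) ≤ lam * Q → lam * Q < N + 1 →
      |pairSum L σ Q N J - (∫ u in J, 1 / (1 + u ^ 2)) * (Cconst L / L * G1fun lam)| ≤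
        C * (Q : ℝ) ^ (-(c + (1 / 2 - c) / 3) + δ) := by
  obtain ⟨C₁, hC₁, h₁⟩ := exists_abs_pairSum_sub_meanSum_le L hL hc0 hc hK₀ hδ hlam hlam1.le
  obtain ⟨C₂, hC₂, h₂⟩ := exists_abs_meanSum_sub_le L hL hδ hlam hlam1
  refine ⟨C₁ + C₂, by positivity, ?_⟩
  intro σ Q N J u η hJ hJ1 hJu hη0 hη hσ hN1 hNQ hNl hN
  have hQ1 : (1 : ℝ) ≤ Q := by exact_mod_cast (show 1 ≤ Q by omega)
  have k1 := h₁ σ Q N J u η hJ hJu hη0 hη hσ (by omega) hNQ hN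
  have k2 := h₂ Q N J hJ hJ1 hN1 hNQ hNl hN
  have k3 : (Q : ℝ) ^ (-1 + δ) ≤ (Q : ℝ) ^ (-(c + (1 / 2 - c) / 3) + δ) :=
    rpow_le_rpow_of_exponent_le hQ1 (by linarith)
  have k4 := mul_le_mul_of_nonneg_left k3 hC₂
  have := abs_sub_le (pairSum L σ Q N J) (meanSum L Q N J)
    ((∫ u in J, 1 / (1 + u ^ 2)) * (Cconst L / L * G1fun lam))
  linarith

/-- No point of denominator at most `Q` has slope strictly between those of a unimodular pair of
denominator sum larger than `Q`. -/
lemma not_between_of_det_eq_one {a q b s n m Q : ℤ} (hdet : b * q - a * s = 1) (hq : 0 < q)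
    (hs : 0 < s) (hQ : Q < q + s) (hmQ : m ≤ Q) : n * q ≤ a * m ∨ b * m ≤ n * s := by
  by_contra! h
  have h1 : 1 ≤ n * q - a * m := by omega
  have h2 : 1 ≤ b * m - n * s := by omega
  have : m = s * (n * q - a * m) + q * (b * m - n * s) := by linear_combination (-m) * hdet
  nlinarith

lemma exists_farey_succ {a q Q : ℤ} (hq : 0 < q) (hcop : IsCoprime a q) :
    ∃ b s : ℤ, b * q - a * s = 1 ∧ Q - q < s ∧ s ≤ Q := by
  obtain ⟨x, y, hxy⟩ := hcop
  set k := (Q + x) / q with hk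
  have h1 : q * k + (Q + x) % q = Q + x := Int.mul_ediv_add_emod _ _
  have h2 := Int.emod_nonneg (Q + x) hq.ne'
  have h3 := Int.emod_lt_of_pos (Q + x) hq
  refine ⟨y + a * k, -x + q * k, by linear_combination hxy, ?_, ?_⟩ <;> linarith

lemma consecFarey_of_det {γ γ' : ℚ} {Q : ℕ} (hγ : γ ∈ FareyQ Q) (hγ' : γ' ∈ FareyQ Q)
    (hdet : γ'.num * γ.den - γ.num * γ'.den = 1) (hQ : Q < γ.den + γ'.den) :
    ConsecFarey Q γ γ' := by
  refine ⟨hγ, hγ', ?_, fun z hz h => ?_⟩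
  · rw [Rat.lt_iff]; omega
  · have := not_between_of_det_eq_one (n := z.num) (m := z.den) (Q := Q) hdet
      (by exact_mod_cast γ.den_pos) (by exact_mod_cast γ'.den_pos) (by exact_mod_cast hQ)
      (by exact_mod_cast hz.2.2)
    rw [Rat.lt_iff, Rat.lt_iff] at h
    omega

lemma isCoprime_num_den (γ : ℚ) : IsCoprime γ.num (γ.den : ℤ) := by
  rw [Int.isCoprime_iff_gcd_eq_one]; exact γ.reduced

lemma num_den_div {a q : ℤ} (hq : 0 < q) (h : IsCoprime a q) :
    ((a : ℚ) / q).num = a ∧ (((a : ℚ) / q).den : ℤ) = q := by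
  have h' : a.natAbs.Coprime q.natAbs := Int.isCoprime_iff_gcd_eq_one.mp h
  exact ⟨Rat.num_div_eq_of_coprime hq h', Rat.den_div_eq_of_coprime hq h'⟩

lemma mem_FareyQ_div {a q : ℤ} {Q : ℕ} (ha : 0 < a) (haq : a ≤ q) (hqQ : q ≤ Q)
    (h : IsCoprime a q) : (a : ℚ) / q ∈ FareyQ Q := by
  have hq : 0 < q := ha.trans_le haq
  have hq' : (0 : ℚ) < q := by exact_mod_cast hq
  refine ⟨div_pos (by exact_mod_cast ha) hq', (div_le_one hq').mpr (by exact_mod_cast haq), ?_⟩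
  have := (num_den_div hq h).2
  omega

lemma ConsecFarey.det {γ γ' : ℚ} {Q : ℕ} (h : ConsecFarey Q γ γ') :
    γ'.num * γ.den - γ.num * γ'.den = 1 ∧ Q < γ.den + γ'.den := by
  obtain ⟨hγ, hγ', hlt, hno⟩ := h
  have hd : (0 : ℤ) < γ.den := by exact_mod_cast γ.den_pos
  have hn : 0 < γ.num := Rat.num_pos.mpr hγ.1
  have hQd : (γ.den : ℤ) ≤ Q := by exact_mod_cast hγ.2.2
  have hlt1 : γ.num < γ.den := by
    have : γ < 1 := hlt.trans_le hγ'.2.1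
    rw [Rat.lt_iff] at this
    simpa using this
  obtain ⟨b, s, hdet, hs1, hs2⟩ := exists_farey_succ (Q := Q) hd (isCoprime_num_den γ)
  have hs0 : 0 < s := by omega
  have hb0 : 0 < b := by nlinarith
  have hbs : b ≤ s := by
    by_contra! h
    nlinarith
  have hcop : IsCoprime b s := ⟨γ.den, -γ.num, by linear_combination hdet⟩
  have hnd := num_den_div hs0 hcop
  have hmem := mem_FareyQ_div hb0 hbs hs2 hcop
  set z : ℚ := (b : ℚ) / s with hz
  have hzdet : z.num * γ.den - γ.num * z.den = 1 := by rw [hnd.1, hnd.2]; exact hdet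
  have hcons := consecFarey_of_det hγ hmem hzdet (by omega)
  have : γ' = z := by
    rcases lt_trichotomy γ' z with h | h | h
    · exact absurd ⟨hlt, h⟩ (hcons.2.2.2 γ' hγ')
    · exact h
    · exact absurd ⟨hcons.2.2.1, h⟩ (hno z hmem)
  rw [this]
  exact ⟨hzdet, by omega⟩

lemma mem_Zl_add_Vseg {l : ℕ} {ε x y : ℝ} : (x, y) ∈ Zl l + Vseg ε ↔
    ∃ m n : ℤ, x = m ∧ |y - n| ≤ ε ∧ ¬ (l : ℤ) ∣ m - n := by
  rw [Set.mem_add]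
  constructor
  · rintro ⟨_, ⟨m, n, rfl, h⟩, ⟨z, w⟩, hzw, he⟩
    simp only [Vseg, Set.mem_prod, Set.mem_singleton_iff, Set.mem_Icc] at hzw
    simp only [Prod.mk_add_mk, Prod.mk.injEq] at he
    refine ⟨m, n, by linarith [he.1, hzw.1], ?_, h⟩
    rw [abs_le]
    constructor <;> linarith [he.2, hzw.2.1, hzw.2.2]
  · rintro ⟨m, n, rfl, hy, h⟩
    rw [abs_le] at hy
    refine ⟨(m, n), ⟨m, n, rfl, h⟩, (0, y - n), ?_, by simp⟩
    simpa [Vseg] using hy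

lemma qfree_le {l : ℕ} {ε ω : ℝ} {m n : ℤ} (hm : 0 < m) (h : |m * tan ω - n| ≤ ε)
    (hmn : ¬ (l : ℤ) ∣ m - n) : qfree l ε ω ≤ ENNReal.ofReal m :=
  iInf_le (fun q : {q : ℝ // 0 < q ∧ (q, q * Real.tan ω) ∈ Zl l + Vseg ε} => ENNReal.ofReal q.1)
    ⟨(m : ℝ), by exact_mod_cast hm, mem_Zl_add_Vseg.mpr ⟨m, n, rfl, h, hmn⟩⟩

lemma lt_qfree_iff {l : ℕ} {ε ω x : ℝ} {N : ℤ} (hx0 : 0 ≤ x) (hN : N ≤ x) (hN' : x < N + 1) :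
    ENNReal.ofReal x < qfree l ε ω ↔
      ∀ m n : ℤ, 0 < m → |m * tan ω - n| ≤ ε → ¬ (l : ℤ) ∣ m - n → N < m := by
  constructor
  · intro h m n hm h1 h2
    have := h.trans_le (qfree_le hm h1 h2)
    have := (ENNReal.ofReal_lt_ofReal_iff (by exact_mod_cast hm)).mp this
    have : (N : ℝ) < m := by linarith
    exact_mod_cast this
  · intro h
    refine lt_of_lt_of_le (b := ENNReal.ofReal (N + 1)) ?_ (le_iInf ?_)
    · exact (ENNReal.ofReal_lt_ofReal_iff (by linarith)).mpr hN'
    · rintro ⟨q, hq, hmem⟩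
      obtain ⟨m, n, rfl, h1, h2⟩ := mem_Zl_add_Vseg.mp hmem
      refine ENNReal.ofReal_le_ofReal ?_
      have := h m n (by exact_mod_cast hq) h1 h2
      change (N : ℝ) + 1 ≤ (m : ℝ)
      exact_mod_cast this

lemma le_and_hit_of_hit {a q n m : ℤ} {ε u : ℝ} (hq : 0 < q) (hm : 0 < m) (hcop : IsCoprime a q)
    (hu : (a : ℝ) / q < u) (hle : n * q ≤ a * m) (hhit : m * u - n ≤ ε) (hεq : ε * q ≤ 1) :
    q ≤ m ∧ q * u - a ≤ ε := by
  have hq' : (0 : ℝ) < q := by exact_mod_cast hq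
  have hm' : (0 : ℝ) < m := by exact_mod_cast hm
  rw [div_lt_iff₀ hq'] at hu
  have hle' : (n : ℝ) * q ≤ a * m := by exact_mod_cast hle
  have e : q * (m * u - n) = m * (q * u - a) + (a * m - n * q) := by ring
  have hqm : q ≤ m := by
    by_contra! hlt
    rcases hle.eq_or_lt with heq | hlt'
    · have : q ∣ m := hcop.symm.dvd_of_dvd_mul_left (⟨n, by linarith⟩)
      have := Int.le_of_dvd hm this
      omega
    · have h1 : (1 : ℝ) ≤ a * m - n * q := by exact_mod_cast (show 1 ≤ a * m - n * q by omega)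
      have h2 : q * (m * u - n) ≤ q * ε := by gcongr
      have h3 : 0 < m * (q * u - a) := mul_pos hm' (by linarith)
      linarith
  refine ⟨hqm, ?_⟩
  have hqm' : (q : ℝ) ≤ m := by exact_mod_cast hqm
  have h2 : q * (m * u - n) ≤ q * ε := by gcongr
  have h3 : q * (q * u - a) ≤ m * (q * u - a) := by
    apply mul_le_mul_of_nonneg_right hqm'; linarith
  have h4 : q * (q * u - a) ≤ q * ε := by linarith
  exact le_of_mul_le_mul_left h4 hq'

lemma lt_qfree_iff_of_pair {l : ℕ} {ε lam u : ℝ} {a q b s N Q : ℤ} (hdet : b * q - a * s = 1)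
    (hq : 0 < q) (hs : 0 < s) (hqs : Q < q + s) (hqQ : q ≤ Q) (hsQ : s ≤ Q) (hε : 0 < ε)
    (hεQ : ε * Q ≤ 1) (hlam : 0 ≤ lam) (hNQ : N < Q) (hNl : (N : ℝ) ≤ lam * Q)
    (hN : lam * Q < N + 1) (hau : (a : ℝ) / q < u) (hub : u < (b : ℝ) / s)
    (h1 : ¬ (l : ℤ) ∣ q - a) (h2 : ¬ (l : ℤ) ∣ s - b) :
    ENNReal.ofReal (lam * Q) < qfree l ε (arctan u) ↔
      ¬ (q ≤ N ∧ q * u - a ≤ ε) ∧ ¬ (s ≤ N ∧ b - s * u ≤ ε) := by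
  have hq' : (0 : ℝ) < q := by exact_mod_cast hq
  have hs' : (0 : ℝ) < s := by exact_mod_cast hs
  have hQ' : (0 : ℝ) < Q := by exact_mod_cast (show 0 < Q by omega)
  have hau' := (div_lt_iff₀ hq').mp hau
  have hub' := (lt_div_iff₀ hs').mp hub
  rw [lt_qfree_iff (by positivity) hNl hN, tan_arctan]
  constructor
  · intro h
    refine ⟨fun h3 => ?_, fun h3 => ?_⟩
    · have := h q a hq (abs_le.mpr ⟨by linarith, h3.2⟩) h1
      omega
    · have := h s b hs (abs_le.mpr ⟨by linarith, by linarith⟩) h2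
      omega
  · rintro ⟨h3, h4⟩ m n hm hhit -
    by_contra! hmN
    rw [abs_le] at hhit
    have hcop : IsCoprime a q := ⟨-s, b, by linarith⟩
    have hcop' : IsCoprime (-b) s := ⟨-q, -a, by linarith⟩
    have hεq : ε * q ≤ 1 := le_trans (by gcongr) hεQ
    have hεs : ε * s ≤ 1 := le_trans (by gcongr) hεQ
    rcases not_between_of_det_eq_one (n := n) (m := m) hdet hq hs hqs (by omega) with h5 | h5
    · have := le_and_hit_of_hit hq hm hcop hau h5 hhit.2 hεq
      exact h3 ⟨by omega, this.2⟩
    · have := le_and_hit_of_hit (a := -b) (n := -n) (u := -u) (ε := ε) hs hm hcop'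
        (by push_cast; rw [neg_div]; linarith) (by linarith) (by push_cast; linarith) hεs
      refine h4 ⟨by omega, ?_⟩
      have := this.2
      push_cast at this
      linarith

lemma qfree_le_of_pair {l : ℕ} {ε u : ℝ} {a q b s Q : ℤ} (hdet : b * q - a * s = 1)
    (hq : 0 < q) (hs : 0 < s) (hqs : Q < q + s) (hqQ : q ≤ Q) (hsQ : s ≤ Q) (hε : 0 < ε)
    (hεQ : 1 < ε * (Q + 1)) (hau : (a : ℝ) / q < u) (hub : u < (b : ℝ) / s)
    (h1 : ¬ (l : ℤ) ∣ q - a) (h2 : ¬ (l : ℤ) ∣ s - b) :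
    qfree l ε (arctan u) ≤ ENNReal.ofReal Q := by
  have hq' : (0 : ℝ) < q := by exact_mod_cast hq
  have hs' : (0 : ℝ) < s := by exact_mod_cast hs
  have hau' := (div_lt_iff₀ hq').mp hau
  have hub' := (lt_div_iff₀ hs').mp hub
  have hdet' : (b : ℝ) * q - a * s = 1 := by exact_mod_cast hdet
  have hqs' : (Q : ℝ) + 1 ≤ q + s := by exact_mod_cast hqs
  by_cases h : q * u - a ≤ ε
  · refine (qfree_le hq (n := a) ?_ h1).trans (ENNReal.ofReal_le_ofReal (by exact_mod_cast hqQ))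
    rw [tan_arctan, abs_le]
    constructor <;> linarith
  · refine (qfree_le hs (n := b) ?_ h2).trans (ENNReal.ofReal_le_ofReal (by exact_mod_cast hsQ))
    rw [tan_arctan, abs_le]
    push Not at h
    have e : s * (q * u - a) + q * (b - s * u) = 1 := by linear_combination hdet'
    have h3 : s * ε ≤ s * (q * u - a) := by gcongr
    have h4 : b - s * u ≤ ε := by
      by_contra! h5
      have h6 : q * ε ≤ q * (b - s * u) := by gcongr
      have h7 : ε * (Q + 1) ≤ ε * (q + s) := by gcongr
      linarith
    constructor <;> linarith

lemma arctan_image_Ioo (x y : ℝ) : arctan '' Set.Ioo x y = Set.Ioo (arctan x) (arctan y) := by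
  ext ω
  constructor
  · rintro ⟨u, hu, rfl⟩
    exact ⟨arctan_strictMono hu.1, arctan_strictMono hu.2⟩
  · intro h
    have e : arctan (tan ω) = ω := arctan_tan ((neg_pi_div_two_lt_arctan x).trans h.1)
      (h.2.trans (arctan_lt_pi_div_two y))
    refine ⟨tan ω, ?_, e⟩
    rw [← e] at h
    exact ⟨arctan_strictMono.lt_iff_lt.mp h.1, arctan_strictMono.lt_iff_lt.mp h.2⟩

lemma abs_one_div_one_add_sq_sub_le (x y : ℝ) :
    |1 / (1 + x ^ 2) - 1 / (1 + y ^ 2)| ≤ |x - y| := by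
  have hx : 0 < 1 + x ^ 2 := by positivity
  have hy : 0 < 1 + y ^ 2 := by positivity
  have h2 : |x + y| ≤ (1 + x ^ 2) * (1 + y ^ 2) := by
    rw [abs_le]
    constructor <;> nlinarith [sq_nonneg (x - 1), sq_nonneg (x + 1), sq_nonneg (y - 1),
      sq_nonneg (y + 1), sq_nonneg (x * y)]
  have e : 1 / (1 + x ^ 2) - 1 / (1 + y ^ 2) =
      -((x - y) * (x + y)) / ((1 + x ^ 2) * (1 + y ^ 2)) := by field_simp; ring
  rw [e, abs_div, abs_neg, abs_mul, abs_of_pos (mul_pos hx hy), div_le_iff₀ (mul_pos hx hy)]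
  gcongr

lemma abs_arctan_sub_arctan_sub_le {x y z d : ℝ} (hxy : x ≤ y) (hx : z ≤ x)
    (hy : y ≤ z + d) : |arctan y - arctan x - 1 / (1 + z ^ 2) * (y - x)| ≤ d * (y - x) := by
  rcases hxy.eq_or_lt with rfl | hlt
  · simp
  obtain ⟨w, hw, he⟩ := exists_deriv_eq_slope arctan hlt continuous_arctan.continuousOn
    (differentiable_arctan.differentiableOn)
  rw [Real.deriv_arctan, eq_div_iff (by linarith)] at he
  have h1 := abs_one_div_one_add_sq_sub_le w z
  rw [abs_of_nonneg (a := w - z) (by linarith [hw.1])] at h1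
  rw [← he, ← sub_mul, abs_mul, abs_of_pos (a := y - x) (by linarith)]
  gcongr
  linarith [hw.2]

/-- The pairs `((a, q), (b, s))` of lattice points with slopes in `J`, denominators at most `Q`,
`q + s > Q` and `b q - a s = σ`. -/
noncomputable def nbPairs (σ Q : ℤ) (J : Set ℝ) : Finset ((ℤ × ℤ) × (ℤ × ℤ)) :=
  (slopeBox Q 0 Q J ×ˢ slopeBox Q 0 Q J).filter fun p =>
    p.2.1 * p.1.2 - p.1.1 * p.2.2 = σ ∧ Q < p.1.2 + p.2.2

lemma mem_nbPairs {σ Q : ℤ} {J : Set ℝ} {p : (ℤ × ℤ) × (ℤ × ℤ)} : p ∈ nbPairs σ Q J ↔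
    (p.1 ∈ slopeBox Q 0 Q J ∧ p.2 ∈ slopeBox Q 0 Q J) ∧
      p.2.1 * p.1.2 - p.1.1 * p.2.2 = σ ∧ Q < p.1.2 + p.2.2 := by
  simp [nbPairs]

lemma eq_of_isCoprime_of_mul_eq {v w : ℤ × ℤ} (hv : IsCoprime v.1 v.2) (hw : IsCoprime w.1 w.2)
    (hv0 : 0 < v.2) (hw0 : 0 < w.2) (h : v.1 * w.2 = w.1 * v.2) : v = w := by
  have h1 : v.2 ∣ w.2 := hv.symm.dvd_of_dvd_mul_left ⟨w.1, by linarith⟩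
  have h2 : w.2 ∣ v.2 := hw.symm.dvd_of_dvd_mul_left ⟨v.1, by linarith⟩
  have h3 : v.2 = w.2 := Int.dvd_antisymm hv0.le hw0.le h1 h2
  refine Prod.ext ?_ h3
  rw [h3] at h
  exact mul_right_cancel₀ hw0.ne' h

lemma nbPairs_slopes_sub {Q : ℤ} {J : Set ℝ} {p : (ℤ × ℤ) × (ℤ × ℤ)} (h : p ∈ nbPairs 1 Q J) :
    (p.2.1 : ℝ) / p.2.2 = (p.1.1 : ℝ) / p.1.2 + 1 / ((p.1.2 : ℝ) * p.2.2) := by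
  obtain ⟨⟨h1, h2⟩, h3, h4⟩ := mem_nbPairs.mp h
  rw [mem_slopeBox] at h1 h2
  have hq : (0 : ℝ) < p.1.2 := by exact_mod_cast h1.1.2.1
  have hs : (0 : ℝ) < p.2.2 := by exact_mod_cast h2.1.2.1
  have h3' : (p.2.1 : ℝ) * p.1.2 - p.1.1 * p.2.2 = 1 := by exact_mod_cast h3
  field_simp
  linear_combination h3'

lemma nbPairs_left_le {Q : ℤ} {J J' : Set ℝ} {p p' : (ℤ × ℤ) × (ℤ × ℤ)} {u : ℝ}
    (h : p ∈ nbPairs 1 Q J) (h' : p' ∈ nbPairs 1 Q J') (hu : u < (p.2.1 : ℝ) / p.2.2)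
    (hu' : (p'.1.1 : ℝ) / p'.1.2 < u) : p'.1.1 * p.1.2 ≤ p.1.1 * p'.1.2 := by
  obtain ⟨⟨h1, h2⟩, h3, h4⟩ := mem_nbPairs.mp h
  obtain ⟨⟨h1', -⟩, -, -⟩ := mem_nbPairs.mp h'
  rw [mem_slopeBox] at h1 h2 h1'
  refine (not_between_of_det_eq_one (n := p'.1.1) (m := p'.1.2) h3 h1.1.2.1 h2.1.2.1 h4
    h1'.1.2.2).resolve_right fun h5 => ?_
  have hs : (0 : ℝ) < p.2.2 := by exact_mod_cast h2.1.2.1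
  have hm : (0 : ℝ) < p'.1.2 := by exact_mod_cast h1'.1.2.1
  have h6 := hu'.trans hu
  rw [div_lt_div_iff₀ hm hs] at h6
  have h7 : p'.1.1 * p.2.2 < p.2.1 * p'.1.2 := by exact_mod_cast h6
  omega

lemma nbPairs_right_le {Q : ℤ} {J J' : Set ℝ} {p p' : (ℤ × ℤ) × (ℤ × ℤ)} {u : ℝ}
    (h : p ∈ nbPairs 1 Q J) (h' : p' ∈ nbPairs 1 Q J') (hu : (p.1.1 : ℝ) / p.1.2 < u)
    (hu' : u < (p'.2.1 : ℝ) / p'.2.2) : p.2.1 * p'.2.2 ≤ p'.2.1 * p.2.2 := by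
  obtain ⟨⟨h1, h2⟩, h3, h4⟩ := mem_nbPairs.mp h
  obtain ⟨⟨-, h1'⟩, -, -⟩ := mem_nbPairs.mp h'
  rw [mem_slopeBox] at h1 h2 h1'
  refine (not_between_of_det_eq_one (n := p'.2.1) (m := p'.2.2) h3 h1.1.2.1 h2.1.2.1 h4
    h1'.1.2.2).resolve_left fun h5 => ?_
  have hs : (0 : ℝ) < p.1.2 := by exact_mod_cast h1.1.2.1
  have hm : (0 : ℝ) < p'.2.2 := by exact_mod_cast h1'.1.2.1
  have h6 := hu.trans hu'
  rw [div_lt_div_iff₀ hs hm] at h6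
  have h7 : p.1.1 * p'.2.2 < p'.2.1 * p.1.2 := by exact_mod_cast h6
  omega

lemma nbPairs_eq {Q : ℤ} {J : Set ℝ} {p p' : (ℤ × ℤ) × (ℤ × ℤ)} {u : ℝ}
    (h : p ∈ nbPairs 1 Q J) (h' : p' ∈ nbPairs 1 Q J)
    (hu : u ∈ Set.Ioo ((p.1.1 : ℝ) / p.1.2) ((p.2.1 : ℝ) / p.2.2))
    (hu' : u ∈ Set.Ioo ((p'.1.1 : ℝ) / p'.1.2) ((p'.2.1 : ℝ) / p'.2.2)) : p = p' := by
  obtain ⟨⟨h1, h2⟩, h3, h4⟩ := mem_nbPairs.mp h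
  obtain ⟨⟨h1', h2'⟩, h3', h4'⟩ := mem_nbPairs.mp h'
  rw [mem_slopeBox] at h1 h2 h1' h2'
  refine Prod.ext (eq_of_isCoprime_of_mul_eq ⟨-p.2.2, p.2.1, by linarith⟩
    ⟨-p'.2.2, p'.2.1, by linarith⟩ h1.1.2.1 h1'.1.2.1 ?_)
    (eq_of_isCoprime_of_mul_eq ⟨p.1.2, -p.1.1, by linarith⟩
    ⟨p'.1.2, -p'.1.1, by linarith⟩ h2.1.2.1 h2'.1.2.1 ?_)
  · exact le_antisymm (nbPairs_left_le h' h hu'.2 hu.1) (nbPairs_left_le h h' hu.2 hu'.1)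
  · exact le_antisymm (nbPairs_right_le h h' hu.1 hu'.2) (nbPairs_right_le h' h hu'.1 hu.2)

lemma sum_nbPairs_le_one {Q : ℤ} {J : Set ℝ} (hJ : J ⊆ Set.Icc 0 1) :
    ∑ p ∈ nbPairs 1 Q J, 1 / ((p.1.2 : ℝ) * p.2.2) ≤ 1 := by
  set f : (ℤ × ℤ) × (ℤ × ℤ) → Set ℝ := fun p =>
    Set.Ioo ((p.1.1 : ℝ) / p.1.2) ((p.2.1 : ℝ) / p.2.2) with hf
  have hd : (↑(nbPairs 1 Q J) : Set _).PairwiseDisjoint f := fun p hp p' hp' hne =>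
    Set.disjoint_left.mpr fun u hu hu' => hne (nbPairs_eq hp hp' hu hu')
  have h1 : volume (⋃ p ∈ nbPairs 1 Q J, f p) ≤ volume (Set.Icc (0 : ℝ) 1) := by
    refine measure_mono (Set.iUnion₂_subset fun p hp => ?_)
    obtain ⟨⟨h1, h2⟩, -, -⟩ := mem_nbPairs.mp hp
    exact Set.Ioo_subset_Icc_self.trans (Set.Icc_subset_Icc (hJ (mem_slopeBox.mp h1).2).1
      (hJ (mem_slopeBox.mp h2).2).2)
  rw [measure_biUnion_finset hd (fun p _ => measurableSet_Ioo), Real.volume_Icc] at h1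
  have h2 : ∀ p ∈ nbPairs 1 Q J, volume (f p) = ENNReal.ofReal (1 / ((p.1.2 : ℝ) * p.2.2)) := by
    intro p hp
    rw [hf, Real.volume_Ioo, nbPairs_slopes_sub hp, add_sub_cancel_left]
  have h0 : ∀ p ∈ nbPairs 1 Q J, 0 ≤ 1 / ((p.1.2 : ℝ) * p.2.2) := by
    intro p hp
    obtain ⟨⟨h1, h2⟩, -, -⟩ := mem_nbPairs.mp hp
    have hq : (0 : ℝ) < p.1.2 := by exact_mod_cast (mem_slopeBox.mp h1).1.2.1
    have hs : (0 : ℝ) < p.2.2 := by exact_mod_cast (mem_slopeBox.mp h2).1.2.1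
    positivity
  rw [Finset.sum_congr rfl h2, ← ENNReal.ofReal_sum_of_nonneg h0] at h1
  have := (ENNReal.ofReal_le_ofReal_iff (by norm_num)).mp h1
  linarith

/-- Left end of the part of the gap of `p` on which the free path exceeds `N`. -/
noncomputable def gapLeft (ε : ℝ) (N : ℤ) (p : (ℤ × ℤ) × (ℤ × ℤ)) : ℝ :=
  if p.1.2 ≤ N then (p.1.1 + ε) / p.1.2 else (p.1.1 : ℝ) / p.1.2

/-- Right end of the part of the gap of `p` on which the free path exceeds `N`. -/
noncomputable def gapRight (ε : ℝ) (N : ℤ) (p : (ℤ × ℤ) × (ℤ × ℤ)) : ℝ :=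
  if p.2.2 ≤ N then (p.2.1 - ε) / p.2.2 else (p.2.1 : ℝ) / p.2.2

lemma mem_gap_iff {ε u : ℝ} {N : ℤ} {p : (ℤ × ℤ) × (ℤ × ℤ)} (hε : 0 < ε) (hq : 0 < p.1.2)
    (hs : 0 < p.2.2) : u ∈ Set.Ioo (gapLeft ε N p) (gapRight ε N p) ↔
      u ∈ Set.Ioo ((p.1.1 : ℝ) / p.1.2) ((p.2.1 : ℝ) / p.2.2) ∧
      ¬ (p.1.2 ≤ N ∧ p.1.2 * u - p.1.1 ≤ ε) ∧ ¬ (p.2.2 ≤ N ∧ p.2.1 - p.2.2 * u ≤ ε) := by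
  have hq' : (0 : ℝ) < p.1.2 := by exact_mod_cast hq
  have hs' : (0 : ℝ) < p.2.2 := by exact_mod_cast hs
  have e1 : gapLeft ε N p < u ↔ (p.1.1 : ℝ) / p.1.2 < u ∧
      ¬ (p.1.2 ≤ N ∧ p.1.2 * u - p.1.1 ≤ ε) := by
    unfold gapLeft
    split_ifs with h
    · rw [div_lt_iff₀ hq', div_lt_iff₀ hq']
      constructor
      · intro h1; exact ⟨by linarith, fun h2 => by linarith [h2.2]⟩
      · rintro ⟨-, h2⟩
        by_contra! h3
        exact h2 ⟨h, by linarith⟩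
    · simp [h]
  have e2 : u < gapRight ε N p ↔ u < (p.2.1 : ℝ) / p.2.2 ∧
      ¬ (p.2.2 ≤ N ∧ p.2.1 - p.2.2 * u ≤ ε) := by
    unfold gapRight
    split_ifs with h
    · rw [lt_div_iff₀ hs', lt_div_iff₀ hs']
      constructor
      · intro h1; exact ⟨by linarith, fun h2 => by linarith [h2.2]⟩
      · rintro ⟨-, h2⟩
        by_contra! h3
        exact h2 ⟨h, by linarith⟩
    · simp [h]
  rw [Set.mem_Ioo, e1, e2, Set.mem_Ioo]
  tauto

lemma abs_volume_gap_sub_le {ε : ℝ} {N Q : ℤ} {J : Set ℝ} {p : (ℤ × ℤ) × (ℤ × ℤ)}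
    (hp : p ∈ nbPairs 1 Q J) (hQ : 0 < Q) (hε : 0 < ε) (hεQ : ε * Q ≤ 1)
    (hεQ' : 1 < ε * (Q + 1)) :
    |(volume (arctan '' Set.Ioo (gapLeft ε N p) (gapRight ε N p))).toReal -
      slopeDens p.1 * wt Q N p.1.2 p.2.2| ≤ 2 / Q * (1 / ((p.1.2 : ℝ) * p.2.2)) := by
  obtain ⟨⟨h1, h2⟩, h3, h4⟩ := mem_nbPairs.mp hp
  have hslope := nbPairs_slopes_sub hp
  rw [mem_slopeBox] at h1 h2
  obtain ⟨⟨a, q⟩, ⟨b, s⟩⟩ := p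
  simp only [gapLeft, gapRight, slopeDens] at *
  have hq : (0 : ℝ) < q := by exact_mod_cast h1.1.2.1
  have hs : (0 : ℝ) < s := by exact_mod_cast h2.1.2.1
  have hqQ : (q : ℝ) ≤ Q := by exact_mod_cast h1.1.2.2
  have hsQ : (s : ℝ) ≤ Q := by exact_mod_cast h2.1.2.2
  have hQ' : (0 : ℝ) < Q := by exact_mod_cast hQ
  have hqs : (Q : ℝ) + 1 ≤ q + s := by exact_mod_cast h4
  have hq1 : (1 : ℝ) ≤ q := by exact_mod_cast h1.1.2.1
  have hs1 : (1 : ℝ) ≤ s := by exact_mod_cast h2.1.2.1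
  have hprod : (Q : ℝ) ≤ q * s := by nlinarith
  have hdet : (b : ℝ) * q - a * s = 1 := by exact_mod_cast h3
  set D : ℝ := 1 / (q * s) with hD
  have hD0 : 0 < D := by positivity
  have hDQ : D ≤ 1 / Q := by rw [hD]; gcongr
  have hh : 1 / (1 + ((a : ℝ) / q) ^ 2) ≤ 1 := by
    rw [div_le_one (by positivity)]; nlinarith [sq_nonneg ((a : ℝ) / q)]
  have hh0 : 0 < 1 / (1 + ((a : ℝ) / q) ^ 2) := by positivity
  set h := 1 / (1 + ((a : ℝ) / q) ^ 2) with hhdef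
  have hεQ1 : ε ≤ 1 / Q := by rw [le_div_iff₀ hQ']; exact hεQ
  have hεd : 1 / Q - ε ≤ 1 / (Q : ℝ) * (1 / Q) := by
    have : 1 / ((Q : ℝ) + 1) < ε := by rw [div_lt_iff₀ (by positivity)]; exact hεQ'
    have e : 1 / (Q : ℝ) - 1 / (Q + 1) = 1 / Q * (1 / (Q + 1)) := by field_simp; ring
    have : 1 / (Q : ℝ) * (1 / (Q + 1)) ≤ 1 / Q * (1 / Q) := by gcongr; linarith
    linarith
  have key : ∀ x y w : ℝ, x ≤ y → (a : ℝ) / q ≤ x → y ≤ a / q + D →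
      |y - x - w| ≤ 1 / Q * D →
      |(volume (arctan '' Set.Ioo x y)).toReal - h * w| ≤ 2 / Q * D := by
    intro x y w hxy hx hy hw
    rw [arctan_image_Ioo, Real.volume_Ioo, ENNReal.toReal_ofReal
      (sub_nonneg.mpr (arctan_mono hxy))]
    have k1 := abs_arctan_sub_arctan_sub_le hxy hx hy
    have k2 : D * (y - x) ≤ 1 / Q * D := by
      rw [mul_comm]; gcongr; linarith
    have k3 : |h * (y - x - w)| ≤ 1 / Q * D := by
      rw [abs_mul, abs_of_pos hh0]
      calc h * |y - x - w| ≤ 1 * |y - x - w| := by gcongr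
        _ ≤ _ := by rw [one_mul]; exact hw
    have e : arctan y - arctan x - h * w = (arctan y - arctan x - h * (y - x)) +
      h * (y - x - w) := by ring
    have e2 : 2 / Q * D = 1 / Q * D + 1 / Q * D := by ring
    rw [e, e2]
    exact (abs_add_le _ _).trans (add_le_add (k1.trans k2) k3)
  rw [hslope]
  have hqs0 : ε * q ≤ 1 := le_trans (by gcongr) hεQ
  have hss0 : ε * s ≤ 1 := le_trans (by gcongr) hεQ
  have e1 : ((a : ℝ) + ε) / q = a / q + ε / q := by ring
  have e2 : ((b : ℝ) - ε) / s = a / q + D - ε / s := by rw [← hslope]; ring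
  have f1 : ε / q = D * (ε * s) := by rw [hD]; field_simp
  have f2 : ε / s = D * (ε * q) := by rw [hD]; field_simp
  have g1 : ε / q ≤ D := by
    rw [f1]; exact mul_le_of_le_one_right hD0.le hss0
  have g2 : ε / s ≤ D := by
    rw [f2]; exact mul_le_of_le_one_right hD0.le hqs0
  have g1' : 0 < ε / q := by positivity
  have g2' : 0 < ε / s := by positivity
  unfold wt
  by_cases hqN : q ≤ N <;> by_cases hsN : s ≤ N
  · rw [if_pos hqN, if_pos hsN, if_neg (by omega), if_neg (by omega), e1, e2,
      Set.Ioo_eq_empty, Set.image_empty]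
    · simp; positivity
    · have : ε / q + ε / s = D * (ε * (q + s)) := by rw [f1, f2]; ring
      have : ε * (Q + 1) ≤ ε * (q + s) := by gcongr
      have : D * 1 ≤ D * (ε * (q + s)) := by gcongr; linarith
      linarith
  · rw [if_pos hqN, if_neg hsN, if_neg (by omega), if_pos (by omega), e1]
    refine key _ _ _ (by linarith) (by linarith) le_rfl ?_
    have e : (a : ℝ) / q + D - (a / q + ε / q) - 1 / q * (1 / s - 1 / Q) =
        (1 / Q - ε) * (s * D) := by rw [hD]; field_simp; ring
    rw [e, abs_of_nonneg (mul_nonneg (by linarith) (by positivity))]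
    calc (1 / (Q : ℝ) - ε) * (s * D) ≤ (1 / Q * (1 / Q)) * (Q * D) := by gcongr
      _ = _ := by field_simp
  · rw [if_neg hqN, if_pos hsN, if_pos (by omega), if_neg (by omega), e2]
    refine key _ _ _ (by linarith) le_rfl (by linarith) ?_
    have e : (a : ℝ) / q + D - ε / s - a / q - (1 / q - 1 / Q) / s =
        (1 / Q - ε) * (q * D) := by rw [hD]; field_simp; ring
    rw [e, abs_of_nonneg (mul_nonneg (by linarith) (by positivity))]
    calc (1 / (Q : ℝ) - ε) * (q * D) ≤ (1 / Q * (1 / Q)) * (Q * D) := by gcongr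
      _ = _ := by field_simp
  · rw [if_neg hqN, if_neg hsN, if_pos (by omega), if_pos (by omega)]
    refine key _ _ _ (by linarith) le_rfl le_rfl ?_
    have e : (a : ℝ) / q + D - a / q - D = 0 := by ring
    rw [e, abs_zero]
    positivity

lemma exists_consecFarey_of_mem_nbPairs {Q : ℕ} {J : Set ℝ} (hJ : J ⊆ Set.Icc 0 1)
    {p : (ℤ × ℤ) × (ℤ × ℤ)} (hp : p ∈ nbPairs 1 Q J) :
    ConsecFarey Q ((p.1.1 : ℚ) / p.1.2) ((p.2.1 : ℚ) / p.2.2) ∧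
    ((p.1.1 : ℚ) / p.1.2).num = p.1.1 ∧ ((((p.1.1 : ℚ) / p.1.2).den : ℕ) : ℤ) = p.1.2 ∧
    ((p.2.1 : ℚ) / p.2.2).num = p.2.1 ∧ ((((p.2.1 : ℚ) / p.2.2).den : ℕ) : ℤ) = p.2.2 := by
  obtain ⟨⟨h1, h2⟩, h3, h4⟩ := mem_nbPairs.mp hp
  rw [mem_slopeBox] at h1 h2
  have hq : (0 : ℝ) < p.1.2 := by exact_mod_cast h1.1.2.1
  have hs : (0 : ℝ) < p.2.2 := by exact_mod_cast h2.1.2.1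
  have hcv : IsCoprime p.1.1 p.1.2 := ⟨-p.2.2, p.2.1, by linarith⟩
  have hcw : IsCoprime p.2.1 p.2.2 := ⟨p.1.2, -p.1.1, by linarith⟩
  have l1 : p.1.1 ≤ p.1.2 := by
    have := (div_le_one hq).mp (hJ h1.2).2
    exact_mod_cast this
  have l2 : p.2.1 ≤ p.2.2 := by
    have := (div_le_one hs).mp (hJ h2.2).2
    exact_mod_cast this
  obtain ⟨n1, d1⟩ := num_den_div h1.1.2.1 hcv
  obtain ⟨n2, d2⟩ := num_den_div h2.1.2.1 hcw
  refine ⟨consecFarey_of_det (mem_FareyQ_div h1.1.1.1 l1 h1.1.2.2 hcv)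
    (mem_FareyQ_div h2.1.1.1 l2 h2.1.2.2 hcw) ?_ ?_, n1, d1, n2, d2⟩
  · rw [n1, d1, n2, d2]; exact h3
  · zify; rw [d1, d2]; exact h4

lemma mem_nbPairs_of_consecFarey {Q : ℕ} {J : Set ℝ} {γ γ' : ℚ} (h : ConsecFarey Q γ γ')
    (hγ : (γ : ℝ) ∈ J) (hγ' : (γ' : ℝ) ∈ J) :
    ((γ.num, (γ.den : ℤ)), (γ'.num, (γ'.den : ℤ))) ∈ nbPairs 1 Q J := by
  have aux : ∀ z : ℚ, z ∈ FareyQ Q → (z : ℝ) ∈ J → (z.num, (z.den : ℤ)) ∈ slopeBox Q 0 Q J := by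
    intro z hz hzJ
    have h1 : 0 < z.num := Rat.num_pos.mpr hz.1
    have h2 : z.num ≤ z.den := by simpa [Rat.le_iff] using hz.2.1
    have h3 : (z.den : ℤ) ≤ Q := by exact_mod_cast hz.2.2
    have h4 : (0 : ℤ) < z.den := by exact_mod_cast z.den_pos
    refine mem_slopeBox.mpr ⟨⟨⟨h1, h2.trans h3⟩, ⟨h4, h3⟩⟩, ?_⟩
    rw [Rat.cast_def] at hzJ
    exact_mod_cast hzJ
  exact mem_nbPairs.mpr ⟨⟨aux _ h.1 hγ, aux _ h.2.1 hγ'⟩, h.det.1, by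
    have := h.det.2
    zify at this
    exact this⟩

open Classical in
/-- The pairs of `nbPairs 1 Q J` neither of whose members satisfies the congruence. -/
noncomputable def freePairs (l : ℕ) (Q : ℤ) (J : Set ℝ) : Finset ((ℤ × ℤ) × (ℤ × ℤ)) :=
  (nbPairs 1 Q J).filter fun p => ¬ (l : ℤ) ∣ p.1.2 - p.1.1 ∧ ¬ (l : ℤ) ∣ p.2.2 - p.2.1

lemma mem_freePairs {l : ℕ} {Q : ℤ} {J : Set ℝ} {p : (ℤ × ℤ) × (ℤ × ℤ)} :
    p ∈ freePairs l Q J ↔ p ∈ nbPairs 1 Q J ∧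
      ¬ (l : ℤ) ∣ p.1.2 - p.1.1 ∧ ¬ (l : ℤ) ∣ p.2.2 - p.2.1 := by
  simp [freePairs]

lemma exists_mem_freePairs_iff {l Q : ℕ} {I : Set ℝ} {P : Prop} {ω : ℝ} (hI : I ⊆ Set.Icc 0 1)
    (hIo : I.OrdConnected) :
    (ω ∈ arctan '' I ∧ P ∧ ∃ γ γ' : ℚ, ConsecFarey Q γ γ' ∧ (γ : ℝ) ∈ I ∧
      (γ' : ℝ) ∈ I ∧ γ ∉ FareyCong l ∧ γ' ∉ FareyCong l ∧
      (γ : ℝ) < Real.tan ω ∧ Real.tan ω < (γ' : ℝ)) ↔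
    P ∧ ∃ p ∈ freePairs l Q I, ∃ u ∈ Set.Ioo ((p.1.1 : ℝ) / p.1.2) ((p.2.1 : ℝ) / p.2.2),
      arctan u = ω := by
  constructor
  · rintro ⟨⟨u, hu, rfl⟩, hP, γ, γ', hc, hγ, hγ', hf, hf', h1, h2⟩
    rw [tan_arctan] at h1 h2
    refine ⟨hP, ((γ.num, (γ.den : ℤ)), (γ'.num, (γ'.den : ℤ))), mem_freePairs.mpr
      ⟨mem_nbPairs_of_consecFarey hc hγ hγ', fun h => hf ⟨hc.1.1, hc.1.2.1, h⟩,
      fun h => hf' ⟨hc.2.1.1, hc.2.1.2.1, h⟩⟩, u, ?_, rfl⟩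
    rw [Rat.cast_def] at h1 h2
    simp only [Int.cast_natCast]
    exact ⟨h1, h2⟩
  · rintro ⟨hP, p, hp, u, hu, rfl⟩
    obtain ⟨hp1, hf, hf'⟩ := mem_freePairs.mp hp
    obtain ⟨hc, n1, d1, n2, d2⟩ := exists_consecFarey_of_mem_nbPairs hI hp1
    obtain ⟨⟨b1, b2⟩, -, -⟩ := mem_nbPairs.mp hp1
    have m1 := (mem_slopeBox.mp b1).2
    have m2 := (mem_slopeBox.mp b2).2
    refine ⟨⟨u, hIo.out m1 m2 (Set.Ioo_subset_Icc_self hu), rfl⟩, hP, _, _, hc, ?_, ?_, ?_, ?_,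
      ?_, ?_⟩
    · push_cast; exact m1
    · push_cast; exact m2
    · rintro ⟨-, -, h⟩
      rw [n1, d1] at h; exact hf h
    · rintro ⟨-, -, h⟩
      rw [n2, d2] at h; exact hf' h
    · rw [tan_arctan]; push_cast; exact hu.1
    · rw [tan_arctan]; push_cast; exact hu.2

lemma Gmeas1_eq_sum {l : ℕ} {I : Set ℝ} {ε lam : ℝ} {N Q : ℤ} (hI : I ⊆ Set.Icc 0 1)
    (hIo : I.OrdConnected) (hQ : Q = (⌊1 / ε⌋₊ : ℤ)) (hε : 0 < ε) (hεQ : ε * Q ≤ 1)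
    (hlam : 0 ≤ lam) (hNQ : N < Q) (hNl : (N : ℝ) ≤ lam * Q) (hN : lam * Q < N + 1) :
    Gmeas1 l I ε lam = ∑ p ∈ freePairs l Q I,
      (volume (arctan '' Set.Ioo (gapLeft ε N p) (gapRight ε N p))).toReal := by
  have hQR : ((⌊1 / ε⌋₊ : ℕ) : ℝ) = (Q : ℝ) := by rw [hQ]; norm_cast
  have hset : {ω ∈ Real.arctan '' I |
    ENNReal.ofReal (lam * (⌊1 / ε⌋₊ : ℝ)) < qfree l ε ω ∧
    ∃ γ γ' : ℚ, ConsecFarey ⌊1 / ε⌋₊ γ γ' ∧ (γ : ℝ) ∈ I ∧ (γ' : ℝ) ∈ I ∧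
      γ ∉ FareyCong l ∧ γ' ∉ FareyCong l ∧
      (γ : ℝ) < Real.tan ω ∧ Real.tan ω < (γ' : ℝ)} =
      ⋃ p ∈ freePairs l Q I, arctan '' Set.Ioo (gapLeft ε N p) (gapRight ε N p) := by
    ext ω
    rw [Set.mem_ofPred_eq, exists_mem_freePairs_iff hI hIo, ← hQ, hQR]
    simp only [Set.mem_iUnion, exists_prop]
    have aux : ∀ p ∈ freePairs l Q I, ∀ u, (u ∈ Set.Ioo (gapLeft ε N p) (gapRight ε N p) ↔
        u ∈ Set.Ioo ((p.1.1 : ℝ) / p.1.2) ((p.2.1 : ℝ) / p.2.2) ∧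
        ENNReal.ofReal (lam * Q) < qfree l ε (arctan u)) := by
      intro p hp u
      obtain ⟨hp1, hf, hf'⟩ := mem_freePairs.mp hp
      obtain ⟨⟨b1, b2⟩, h3, h4⟩ := mem_nbPairs.mp hp1
      rw [mem_slopeBox] at b1 b2
      rw [mem_gap_iff hε b1.1.2.1 b2.1.2.1]
      refine and_congr_right fun hu => ?_
      exact (lt_qfree_iff_of_pair h3 b1.1.2.1 b2.1.2.1 h4 b1.1.2.2 b2.1.2.2 hε hεQ hlam hNQ hNl hN
        hu.1 hu.2 hf hf').symm
    constructor
    · rintro ⟨hP, p, hp, u, hu, rfl⟩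
      exact ⟨p, hp, u, (aux p hp u).mpr ⟨hu, hP⟩, rfl⟩
    · rintro ⟨p, hp, u, hu, rfl⟩
      obtain ⟨h1, h2⟩ := (aux p hp u).mp hu
      exact ⟨h2, p, hp, u, h1, rfl⟩
  rw [Gmeas1, hset, measure_biUnion_finset, ENNReal.toReal_sum]
  · intro p _
    rw [arctan_image_Ioo, Real.volume_Ioo]
    exact ENNReal.ofReal_ne_top
  · intro p hp p' hp' hne
    refine Set.disjoint_left.mpr ?_
    rintro _ ⟨u, hu, rfl⟩ ⟨u', hu', he⟩
    obtain rfl := arctan_injective he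
    have hp1 := (mem_freePairs.mp hp).1
    have hp1' := (mem_freePairs.mp hp').1
    obtain ⟨⟨b1, b2⟩, -, -⟩ := mem_nbPairs.mp hp1
    obtain ⟨⟨b1', b2'⟩, -, -⟩ := mem_nbPairs.mp hp1'
    rw [mem_slopeBox] at b1 b2 b1' b2'
    exact hne (nbPairs_eq hp1 hp1' ((mem_gap_iff hε b1.1.2.1 b2.1.2.1).mp hu).1
      ((mem_gap_iff hε b1'.1.2.1 b2'.1.2.1).mp hu').1)
  · intro p _
    rw [arctan_image_Ioo]
    exact measurableSet_Ioo

lemma Gmeas1_eq_zero {l : ℕ} {I : Set ℝ} {ε lam : ℝ} (hI : I ⊆ Set.Icc 0 1)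
    (hIo : I.OrdConnected) (hε : 0 < ε) (hlam : 1 ≤ lam) : Gmeas1 l I ε lam = 0 := by
  set Q : ℕ := ⌊1 / ε⌋₊ with hQ
  have hεQ' : 1 < ε * ((Q : ℤ) + 1) := by
    have := Nat.lt_floor_add_one (1 / ε)
    rw [div_lt_iff₀ hε, ← hQ] at this
    push_cast; linarith
  rw [Gmeas1]
  suffices h : {ω ∈ Real.arctan '' I |
    ENNReal.ofReal (lam * (⌊1 / ε⌋₊ : ℝ)) < qfree l ε ω ∧
    ∃ γ γ' : ℚ, ConsecFarey ⌊1 / ε⌋₊ γ γ' ∧ (γ : ℝ) ∈ I ∧ (γ' : ℝ) ∈ I ∧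
      γ ∉ FareyCong l ∧ γ' ∉ FareyCong l ∧
      (γ : ℝ) < Real.tan ω ∧ Real.tan ω < (γ' : ℝ)} = ∅ by rw [h]; simp
  refine Set.eq_empty_of_forall_notMem fun ω hω => ?_
  rw [Set.mem_ofPred_eq, exists_mem_freePairs_iff hI hIo, ← hQ] at hω
  obtain ⟨hP, p, hp, u, hu, rfl⟩ := hω
  obtain ⟨hp1, hf, hf'⟩ := mem_freePairs.mp hp
  obtain ⟨⟨b1, b2⟩, h3, h4⟩ := mem_nbPairs.mp hp1
  rw [mem_slopeBox] at b1 b2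
  refine absurd hP (not_lt.mpr ((qfree_le_of_pair h3 b1.1.2.1 b2.1.2.1 h4 b1.1.2.2 b2.1.2.2 hε
    hεQ' hu.1 hu.2 hf hf').trans (ENNReal.ofReal_le_ofReal ?_)))
  push_cast
  exact le_mul_of_one_le_left (by positivity) hlam

lemma wt_comm (Q N q s : ℤ) : wt Q N q s = wt Q N s q := by
  unfold wt
  split_ifs <;> ring

lemma slopeDens_nonneg (v : ℤ × ℤ) : 0 ≤ slopeDens v := by unfold slopeDens; positivity

lemma slopeDens_le_one (v : ℤ × ℤ) : slopeDens v ≤ 1 := by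
  unfold slopeDens
  rw [div_le_one (by positivity)]
  nlinarith [sq_nonneg ((v.1 : ℝ) / v.2)]

lemma neighbour_mem_slopeBox {σ Q b s : ℤ} {J : Set ℝ} {v w : ℤ × ℤ} (hJo : J.OrdConnected)
    (hJ : J ⊆ Set.Icc 0 1) (hσ : σ = 1 ∨ σ = -1) (hv : v ∈ slopeBox Q 0 Q J)
    (hw : w ∈ slopeBox Q 0 Q J) (hs : Q - v.2 < s) (hsQ : s ≤ Q)
    (hb : b * v.2 - v.1 * s = σ) (hvw : 0 < σ * (w.1 * v.2 - v.1 * w.2)) :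
    (b, s) ∈ slopeBox Q 0 Q J := by
  rw [mem_slopeBox] at hv hw
  obtain ⟨⟨⟨a0, a1⟩, q0, q1⟩, hvJ⟩ := hv
  obtain ⟨⟨⟨n0, n1⟩, m0, m1⟩, hwJ⟩ := hw
  have hs0 : 0 < s := by omega
  have hs0' : (0 : ℝ) < s := by exact_mod_cast hs0
  have hq' : (0 : ℝ) < v.2 := by exact_mod_cast q0
  have hm' : (0 : ℝ) < w.2 := by exact_mod_cast m0
  suffices h : 0 < b ∧ (b : ℝ) / s ∈ J by
    have h1 := (div_le_one hs0').mp (hJ h.2).2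
    have h2 : b ≤ s := by exact_mod_cast h1
    exact mem_slopeBox.mpr ⟨⟨⟨h.1, h2.trans hsQ⟩, hs0, hsQ⟩, h.2⟩
  rcases hσ with rfl | rfl
  · have h1 := (not_between_of_det_eq_one (n := w.1) (m := w.2) hb q0 hs0 (by omega) m1).resolve_left
      (by intro h; linarith)
    constructor
    · have : 0 < v.1 * s := mul_pos a0 hs0
      by_contra! h
      nlinarith
    · refine hJo.out hvJ hwJ ⟨?_, ?_⟩
      · rw [div_le_div_iff₀ hq' hs0']
        exact_mod_cast (show v.1 * s ≤ b * v.2 by omega)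
      · rw [div_le_div_iff₀ hs0' hm']
        exact_mod_cast h1
  · have h1 := (not_between_of_det_eq_one (a := b) (q := s) (b := v.1) (s := v.2) (n := w.1)
      (m := w.2) (by linarith) hs0 q0 (by omega) m1).resolve_right (by intro h; linarith)
    constructor
    · have : 0 < w.1 * s := mul_pos n0 hs0
      by_contra! h
      nlinarith
    · refine hJo.out hwJ hvJ ⟨?_, ?_⟩
      · rw [div_le_div_iff₀ hm' hs0']
        exact_mod_cast h1
      · rw [div_le_div_iff₀ hs0' hq']
        exact_mod_cast (show b * v.2 ≤ v.1 * s by omega)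

lemma abs_pairSum_sub_sum_nbPairs_le {L : ℕ} {σ Q N : ℤ} {lam : ℝ} {J : Set ℝ}
    (hJo : J.OrdConnected) (hJ : J ⊆ Set.Icc 0 1) (hσ : σ = 1 ∨ σ = -1) (hlam : 0 < lam)
    (hN0 : 0 ≤ N) (hNQ : N < Q) (hN : lam * Q < N + 1) :
    |pairSum L σ Q N J - ∑ p ∈ (nbPairs σ Q J).filter (fun p => (L : ℤ) ∣ p.1.2 - p.1.1),
      slopeDens p.1 * wt Q N p.1.2 p.2.2| ≤ 2 / (lam * Q ^ 2) := by
  classical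
  have hQ0 : (0 : ℝ) < Q := by exact_mod_cast (hN0.trans_lt hNQ)
  set S := (primPts L (slopeBox Q 0 Q J)).sigma fun v =>
    (Finset.Ioc (Q - v.2) Q).filter (fun s => v.2 ∣ v.1 * s + σ) with hS
  have hmem : ∀ x ∈ S, x.1 ∈ slopeBox Q 0 Q J ∧ IsCoprime x.1.1 x.1.2 ∧
      (L : ℤ) ∣ x.1.2 - x.1.1 ∧ Q - x.1.2 < x.2 ∧ x.2 ≤ Q ∧ x.1.2 ∣ x.1.1 * x.2 + σ := by
    intro x hx
    simpa [hS, primPts, and_assoc] using hx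
  set good : (Σ _ : ℤ × ℤ, ℤ) → Prop := fun x =>
    ((x.1.1 * x.2 + σ) / x.1.2, x.2) ∈ slopeBox Q 0 Q J with hgood
  have hdet : ∀ x ∈ S, (x.1.1 * x.2 + σ) / x.1.2 * x.1.2 - x.1.1 * x.2 = σ := by
    intro x hx
    rw [Int.ediv_mul_cancel (hmem x hx).2.2.2.2.2]; ring
  have e0 : pairSum L σ Q N J = ∑ x ∈ S, slopeDens x.1 * wt Q N x.1.2 x.2 := by
    rw [pairSum, hS, Finset.sum_sigma]
    exact Finset.sum_congr rfl fun v _ => Finset.mul_sum _ _ _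
  have e1 : ∑ x ∈ S.filter good, slopeDens x.1 * wt Q N x.1.2 x.2 =
      ∑ p ∈ (nbPairs σ Q J).filter (fun p => (L : ℤ) ∣ p.1.2 - p.1.1),
        slopeDens p.1 * wt Q N p.1.2 p.2.2 := by
    refine Finset.sum_bij' (fun x _ => (x.1, ((x.1.1 * x.2 + σ) / x.1.2, x.2)))
      (fun p _ => ⟨p.1, p.2.2⟩) ?_ ?_ ?_ ?_ ?_
    · intro x hx
      obtain ⟨hx, hg⟩ := Finset.mem_filter.mp hx
      obtain ⟨h1, h2, h3, h4, h5, h6⟩ := hmem x hx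
      refine Finset.mem_filter.mpr ⟨mem_nbPairs.mpr ⟨⟨h1, hg⟩, hdet x hx, ?_⟩, h3⟩
      change Q < x.1.2 + x.2
      omega
    · intro p hp
      obtain ⟨hp, hL⟩ := Finset.mem_filter.mp hp
      obtain ⟨⟨h1, h2⟩, h3, h4⟩ := mem_nbPairs.mp hp
      have hq := (mem_slopeBox.mp h1).1.2.1
      have e : p.1.1 * p.2.2 + σ = p.2.1 * p.1.2 := by linarith
      have hcop : IsCoprime p.1.1 p.1.2 := by
        rcases hσ with rfl | rfl
        · exact ⟨-p.2.2, p.2.1, by linarith⟩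
        · exact ⟨p.2.2, -p.2.1, by linarith⟩
      refine Finset.mem_filter.mpr ⟨?_, ?_⟩
      · simp only [hS, primPts, Finset.mem_sigma, Finset.mem_filter, Finset.mem_Ioc]
        exact ⟨⟨h1, hcop, hL⟩, ⟨by omega, (mem_slopeBox.mp h2).1.2.2⟩, by rw [e]; exact ⟨_, mul_comm _ _⟩⟩
      · simp only [hgood]
        rw [e, Int.mul_ediv_cancel _ hq.ne']
        exact h2
    · intro x _; rfl
    · intro p hp
      obtain ⟨hp, hL⟩ := Finset.mem_filter.mp hp
      obtain ⟨⟨h1, h2⟩, h3, h4⟩ := mem_nbPairs.mp hp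
      have hq := (mem_slopeBox.mp h1).1.2.1
      have e : p.1.1 * p.2.2 + σ = p.2.1 * p.1.2 := by linarith
      simp only
      rw [e, Int.mul_ediv_cancel _ hq.ne']
    · intro x _; rfl
  have hcard : (S.filter fun x => ¬ good x).card ≤ 1 := by
    rw [Finset.card_le_one]
    intro x hx y hy
    obtain ⟨hx, hgx⟩ := Finset.mem_filter.mp hx
    obtain ⟨hy, hgy⟩ := Finset.mem_filter.mp hy
    obtain ⟨x1, x2, -, x4, x5, x6⟩ := hmem x hx
    obtain ⟨y1, y2, -, y4, y5, y6⟩ := hmem y hy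
    have hx0 := (mem_slopeBox.mp x1).1.2.1
    have hy0 := (mem_slopeBox.mp y1).1.2.1
    have hxy : x.1 = y.1 := by
      refine eq_of_isCoprime_of_mul_eq x2 y2 hx0 hy0 ?_
      rcases lt_trichotomy 0 (σ * (y.1.1 * x.1.2 - x.1.1 * y.1.2)) with h | h | h
      · exact absurd (neighbour_mem_slopeBox hJo hJ hσ x1 y1 x4 x5 (hdet x hx) h) hgx
      · rcases hσ with rfl | rfl <;> linarith
      · exact absurd (neighbour_mem_slopeBox hJo hJ hσ y1 x1 y4 y5 (hdet y hy) (by linarith)) hgy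
    obtain ⟨v, s⟩ := x
    obtain ⟨v', s'⟩ := y
    obtain rfl : v = v' := hxy
    have h1 : v.2 ∣ v.1 * (s - s') := by
      have := dvd_sub x6 y6
      simp only at this
      rwa [show v.1 * s + σ - (v.1 * s' + σ) = v.1 * (s - s') by ring] at this
    have h2 : v.2 ∣ s - s' := x2.symm.dvd_of_dvd_mul_left h1
    have h3 : s - s' = 0 := by
      refine Int.eq_zero_of_abs_lt_dvd h2 ?_
      simp only at x4 x5 y4 y5
      rw [abs_lt]; constructor <;> omega
    rw [show s = s' by omega]
  have hB : 0 ≤ 2 / (lam * (Q : ℝ) ^ 2) := by positivity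
  rw [e0, ← Finset.sum_filter_add_sum_filter_not S good, e1, add_sub_cancel_left]
  calc |∑ x ∈ S.filter (fun x => ¬ good x), slopeDens x.1 * wt Q N x.1.2 x.2|
      ≤ ∑ x ∈ S.filter (fun x => ¬ good x), |slopeDens x.1 * wt Q N x.1.2 x.2| :=
        Finset.abs_sum_le_sum_abs _ _
    _ ≤ (S.filter fun x => ¬ good x).card • (2 / (lam * (Q : ℝ) ^ 2)) := by
        refine Finset.sum_le_card_nsmul _ _ _ fun x hx => ?_
        obtain ⟨x1, x2, -, x4, x5, x6⟩ := hmem x (Finset.mem_filter.mp hx).1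
        have := abs_wt_le hlam hN0 hNQ hN (mem_slopeBox.mp x1).1.2.2 x5 (by omega)
        rw [abs_mul, abs_of_nonneg (slopeDens_nonneg _)]
        calc slopeDens x.1 * |wt Q N x.1.2 x.2| ≤ 1 * |wt Q N x.1.2 x.2| := by
              gcongr; exact slopeDens_le_one _
          _ ≤ _ := by rw [one_mul]; exact this
    _ ≤ _ := by
        rw [nsmul_eq_mul]
        exact mul_le_of_le_one_left hB (by exact_mod_cast hcard)

lemma sum_nbPairs_neg_one {L : ℕ} {Q N : ℤ} {J : Set ℝ} :
    ∑ p ∈ (nbPairs (-1) Q J).filter (fun p => (L : ℤ) ∣ p.1.2 - p.1.1),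
      slopeDens p.1 * wt Q N p.1.2 p.2.2 =
    ∑ p ∈ (nbPairs 1 Q J).filter (fun p => (L : ℤ) ∣ p.2.2 - p.2.1),
      slopeDens p.2 * wt Q N p.1.2 p.2.2 := by
  refine Finset.sum_nbij' Prod.swap Prod.swap ?_ ?_ (by simp) (by simp) ?_
  · intro p hp
    rw [Finset.mem_filter, mem_nbPairs] at hp ⊢
    exact ⟨⟨hp.1.1.symm, by simp only [Prod.fst_swap, Prod.snd_swap]; linarith [hp.1.2.1], by
      simp only [Prod.fst_swap, Prod.snd_swap]; linarith [hp.1.2.2]⟩, hp.2⟩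
  · intro p hp
    rw [Finset.mem_filter, mem_nbPairs] at hp ⊢
    exact ⟨⟨hp.1.1.symm, by simp only [Prod.fst_swap, Prod.snd_swap]; linarith [hp.1.2.1], by
      simp only [Prod.fst_swap, Prod.snd_swap]; linarith [hp.1.2.2]⟩, hp.2⟩
  · intro p _
    rw [wt_comm]; rfl

lemma abs_sum_slopeDens_swap_le {l : ℕ} {Q N : ℤ} {lam : ℝ} {J : Set ℝ} (hJ : J ⊆ Set.Icc 0 1)
    (hlam : 0 < lam) (hN0 : 0 ≤ N) (hNQ : N < Q) (hN : lam * Q < N + 1) :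
    |∑ p ∈ (nbPairs 1 Q J).filter (fun p => (l : ℤ) ∣ p.2.2 - p.2.1),
        slopeDens p.1 * wt Q N p.1.2 p.2.2 -
      ∑ p ∈ (nbPairs 1 Q J).filter (fun p => (l : ℤ) ∣ p.2.2 - p.2.1),
        slopeDens p.2 * wt Q N p.1.2 p.2.2| ≤ 2 / (lam * Q ^ 2) := by
  have hQ0 : (0 : ℝ) < Q := by exact_mod_cast (hN0.trans_lt hNQ)
  have hpos : ∀ p ∈ nbPairs 1 Q J, 0 ≤ 1 / ((p.1.2 : ℝ) * p.2.2) := by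
    intro p hp
    obtain ⟨⟨h1, h2⟩, -, -⟩ := mem_nbPairs.mp hp
    have hq : (0 : ℝ) < p.1.2 := by exact_mod_cast (mem_slopeBox.mp h1).1.2.1
    have hs : (0 : ℝ) < p.2.2 := by exact_mod_cast (mem_slopeBox.mp h2).1.2.1
    positivity
  rw [← Finset.sum_sub_distrib]
  calc _ ≤ ∑ p ∈ (nbPairs 1 Q J).filter (fun p => (l : ℤ) ∣ p.2.2 - p.2.1),
        |slopeDens p.1 * wt Q N p.1.2 p.2.2 - slopeDens p.2 * wt Q N p.1.2 p.2.2| :=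
        Finset.abs_sum_le_sum_abs _ _
    _ ≤ ∑ p ∈ (nbPairs 1 Q J).filter (fun p => (l : ℤ) ∣ p.2.2 - p.2.1),
        1 / ((p.1.2 : ℝ) * p.2.2) * (2 / (lam * (Q : ℝ) ^ 2)) := by
        refine Finset.sum_le_sum fun p hp => ?_
        have hp := (Finset.mem_filter.mp hp).1
        obtain ⟨⟨h1, h2⟩, h3, h4⟩ := mem_nbPairs.mp hp
        have hw := abs_wt_le hlam hN0 hNQ hN (mem_slopeBox.mp h1).1.2.2
          (mem_slopeBox.mp h2).1.2.2 h4
        rw [← sub_mul, abs_mul]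
        refine mul_le_mul ?_ hw (abs_nonneg _) (hpos p hp)
        refine (abs_one_div_one_add_sq_sub_le _ _).trans ?_
        rw [nbPairs_slopes_sub hp, abs_sub_comm, add_sub_cancel_left, abs_of_nonneg (hpos p hp)]
    _ ≤ ∑ p ∈ nbPairs 1 Q J, 1 / ((p.1.2 : ℝ) * p.2.2) * (2 / (lam * (Q : ℝ) ^ 2)) :=
        Finset.sum_le_sum_of_subset_of_nonneg (Finset.filter_subset _ _) fun p hp _ =>
          mul_nonneg (hpos p hp) (by positivity)
    _ ≤ _ := by
        rw [← Finset.sum_mul]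
        exact mul_le_of_le_one_left (by positivity) (sum_nbPairs_le_one hJ)

lemma sum_freePairs_eq {l : ℕ} (hl : 2 ≤ l) {Q : ℤ} {J : Set ℝ}
    (F : (ℤ × ℤ) × (ℤ × ℤ) → ℝ) : ∑ p ∈ freePairs l Q J, F p = ∑ p ∈ nbPairs 1 Q J, F p -
      ∑ p ∈ (nbPairs 1 Q J).filter (fun p => (l : ℤ) ∣ p.1.2 - p.1.1), F p -
      ∑ p ∈ (nbPairs 1 Q J).filter (fun p => (l : ℤ) ∣ p.2.2 - p.2.1), F p := by
  rw [freePairs, Finset.sum_filter, Finset.sum_filter, Finset.sum_filter,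
    ← Finset.sum_sub_distrib, ← Finset.sum_sub_distrib]
  refine Finset.sum_congr rfl fun p hp => ?_
  have hdet := (mem_nbPairs.mp hp).2.1
  have hnot : ¬ ((l : ℤ) ∣ p.1.2 - p.1.1 ∧ (l : ℤ) ∣ p.2.2 - p.2.1) := by
    rintro ⟨h1, h2⟩
    have h3 : (l : ℤ) ∣ 1 := by
      have := dvd_sub (h1.mul_left p.2.1) (h2.mul_left p.1.1)
      rwa [show p.2.1 * (p.1.2 - p.1.1) - p.1.1 * (p.2.2 - p.2.1) = 1 by linarith] at this
    have := Int.le_of_dvd one_pos h3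
    omega
  by_cases h1 : (l : ℤ) ∣ p.1.2 - p.1.1 <;> by_cases h2 : (l : ℤ) ∣ p.2.2 - p.2.1
  · exact absurd ⟨h1, h2⟩ hnot
  all_goals simp [h1, h2]

lemma abs_Gmeas1_sub_pairSum_le {l : ℕ} (hl : 2 ≤ l) {I : Set ℝ} {ε lam : ℝ} {N Q : ℤ}
    (hI : I ⊆ Set.Icc 0 1) (hIo : I.OrdConnected) (hQ : Q = (⌊1 / ε⌋₊ : ℤ)) (hε : 0 < ε)
    (hεQ : ε * Q ≤ 1) (hεQ' : 1 < ε * (Q + 1)) (hlam : 0 < lam) (hN0 : 0 ≤ N) (hNQ : N < Q)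
    (hNl : (N : ℝ) ≤ lam * Q) (hN : lam * Q < N + 1) :
    |Gmeas1 l I ε lam - (pairSum 1 1 Q N I - pairSum l 1 Q N I - pairSum l (-1) Q N I)| ≤
      (2 + 8 / lam) / Q := by
  have hQ0 : 0 < Q := hN0.trans_lt hNQ
  have hQR : (1 : ℝ) ≤ Q := by exact_mod_cast hQ0
  have hpos : ∀ p ∈ nbPairs 1 Q I, 0 ≤ 1 / ((p.1.2 : ℝ) * p.2.2) := by
    intro p hp
    obtain ⟨⟨h1, h2⟩, -, -⟩ := mem_nbPairs.mp hp
    have hq : (0 : ℝ) < p.1.2 := by exact_mod_cast (mem_slopeBox.mp h1).1.2.1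
    have hs : (0 : ℝ) < p.2.2 := by exact_mod_cast (mem_slopeBox.mp h2).1.2.1
    positivity
  have h1 : |Gmeas1 l I ε lam - ∑ p ∈ freePairs l Q I, slopeDens p.1 * wt Q N p.1.2 p.2.2| ≤
      2 / Q := by
    rw [Gmeas1_eq_sum hI hIo hQ hε hεQ hlam.le hNQ hNl hN, ← Finset.sum_sub_distrib]
    calc _ ≤ ∑ p ∈ freePairs l Q I,
          |(volume (arctan '' Set.Ioo (gapLeft ε N p) (gapRight ε N p))).toReal -
            slopeDens p.1 * wt Q N p.1.2 p.2.2| := Finset.abs_sum_le_sum_abs _ _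
      _ ≤ ∑ p ∈ freePairs l Q I, 2 / (Q : ℝ) * (1 / ((p.1.2 : ℝ) * p.2.2)) :=
          Finset.sum_le_sum fun p hp =>
            abs_volume_gap_sub_le (mem_freePairs.mp hp).1 hQ0 hε hεQ hεQ'
      _ ≤ ∑ p ∈ nbPairs 1 Q I, 2 / (Q : ℝ) * (1 / ((p.1.2 : ℝ) * p.2.2)) :=
          Finset.sum_le_sum_of_subset_of_nonneg (fun p hp => (mem_freePairs.mp hp).1)
            fun p hp _ => mul_nonneg (by positivity) (hpos p hp)
      _ ≤ _ := by
          rw [← Finset.mul_sum]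
          exact mul_le_of_le_one_right (by positivity) (sum_nbPairs_le_one hI)
  have h2 := abs_pairSum_sub_sum_nbPairs_le (L := 1) hIo hI (Or.inl rfl) hlam hN0 hNQ hN
  have h3 := abs_pairSum_sub_sum_nbPairs_le (L := l) hIo hI (Or.inl rfl) hlam hN0 hNQ hN
  have h4 := abs_pairSum_sub_sum_nbPairs_le (L := l) hIo hI (Or.inr rfl) hlam hN0 hNQ hN
  have h5 := abs_sum_slopeDens_swap_le (l := l) hI hlam hN0 hNQ hN
  rw [sum_nbPairs_neg_one] at h4
  rw [Finset.filter_true_of_mem (fun p _ => by simp)] at h2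
  rw [sum_freePairs_eq hl] at h1
  have hfin : 2 / (lam * (Q : ℝ) ^ 2) ≤ 2 / lam / Q := by
    rw [div_div]; gcongr; nlinarith
  have e : (2 + 8 / lam) / (Q : ℝ) = 2 / Q + 4 * (2 / lam / Q) := by ring
  rw [e]
  rw [abs_le] at *
  constructor <;> linarith [h1.1, h1.2, h2.1, h2.2, h3.1, h3.2, h4.1, h4.2, h5.1, h5.2]

lemma G1fun_eq_zero {lam : ℝ} (h : 1 ≤ lam) : G1fun lam = 0 := by
  rw [G1fun, if_neg (by linarith)]
  rcases h.eq_or_lt with rfl | h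
  · simp
  · rw [if_neg (by linarith)]

lemma subset_Icc_volume {I : Set ℝ} (hI : I ⊆ Set.Icc 0 1) (hIo : I.OrdConnected) :
    I ⊆ Set.Icc (sInf I) (sInf I + (volume I).toReal) := by
  have hfin : volume I ≠ ⊤ :=
    ne_top_of_le_ne_top (by simp) (measure_mono hI : volume I ≤ volume (Set.Icc (0 : ℝ) 1))
  intro y hy
  refine ⟨csInf_le ⟨0, fun z hz => (hI hz).1⟩ hy, ?_⟩
  suffices h : y - (volume I).toReal ≤ sInf I by linarith
  refine le_csInf ⟨y, hy⟩ fun b hb => ?_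
  have h1 : ENNReal.ofReal (y - b) ≤ volume I := by
    rw [← Real.volume_Icc]
    exact measure_mono (hIo.out hb hy)
  have := (ENNReal.ofReal_le_iff_le_toReal hfin).mp h1
  linarith

lemma abs_Gmeas1_le {l : ℕ} {I : Set ℝ} {ε lam : ℝ} (hI : I ⊆ Set.Icc 0 1)
    (hIo : I.OrdConnected) : |Gmeas1 l I ε lam| ≤ 2 * (volume I).toReal := by
  set η := (volume I).toReal with hη
  have hη0 : 0 ≤ η := ENNReal.toReal_nonneg
  have hη1 : η ≤ 1 := by
    have := ENNReal.toReal_mono (by simp) (measure_mono hI : volume I ≤ volume (Set.Icc (0 : ℝ) 1))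
    simpa using this
  rw [Gmeas1, abs_of_nonneg ENNReal.toReal_nonneg]
  set u := sInf I
  have h1 := abs_arctan_sub_arctan_sub_le (x := u) (y := u + η) (z := u) (d := η) (by linarith)
    le_rfl le_rfl
  have hh : 1 / (1 + u ^ 2) ≤ 1 := by
    rw [div_le_one (by positivity)]; nlinarith [sq_nonneg u]
  have h2 : arctan (u + η) - arctan u ≤ 2 * η := by
    have h3 := (abs_le.mp h1).2
    rw [add_sub_cancel_left] at h3
    nlinarith
  refine ENNReal.toReal_le_of_le_ofReal (by positivity)
    (le_trans ?_ (ENNReal.ofReal_le_ofReal h2))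
  rw [← Real.volume_Icc]
  refine measure_mono ?_
  rintro _ ⟨⟨x, hx, rfl⟩, -⟩
  have := subset_Icc_volume hI hIo hx
  exact ⟨arctan_mono this.1, arctan_mono this.2⟩

lemma abs_integral_slope_le {I : Set ℝ} (hI : I ⊆ Set.Icc 0 1) :
    |∫ u in I, 1 / (1 + u ^ 2)| ≤ (volume I).toReal := by
  have hfin : volume I < ⊤ :=
    (measure_mono hI : volume I ≤ volume (Set.Icc (0 : ℝ) 1)).trans_lt (by simp)
  have := norm_setIntegral_le_of_norm_le_const (f := fun u : ℝ => 1 / (1 + u ^ 2)) (C := 1) hfin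
    (fun u _ => by
      rw [Real.norm_of_nonneg (by positivity), div_le_one (by positivity)]
      nlinarith [sq_nonneg u])
  simpa [Measure.real] using this

lemma Gmeas1_asymptotic_of_one_le {l : ℕ} {lam : ℝ} (hlam : 1 ≤ lam) {I : Set ℝ} {ε : ℝ}
    (hε : 0 < ε) (hI : I ⊆ Set.Icc 0 1) (hIo : I.OrdConnected) :
    |Gmeas1 l I ε lam - (∫ u in I, 1 / (1 + u ^ 2)) * Aconst l * G1fun lam| = 0 := by
  rw [Gmeas1_eq_zero hI hIo hε hlam, G1fun_eq_zero hlam]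
  simp

lemma abs_Gmeas1_sub_le_trivial {l : ℕ} {lam : ℝ} {I : Set ℝ} {ε : ℝ} (hI : I ⊆ Set.Icc 0 1)
    (hIo : I.OrdConnected) :
    |Gmeas1 l I ε lam - (∫ u in I, 1 / (1 + u ^ 2)) * Aconst l * G1fun lam| ≤
      (2 + |Aconst l * G1fun lam|) * (volume I).toReal := by
  have h1 := abs_Gmeas1_le (l := l) (ε := ε) (lam := lam) hI hIo
  have h2 := abs_integral_slope_le hI
  rw [mul_assoc, add_mul]
  refine (abs_sub _ _).trans (add_le_add h1 ?_)
  rw [abs_mul, mul_comm |Aconst l * G1fun lam|]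
  gcongr

lemma exists_Gmeas1_asymptotic {l : ℕ} (hl : 2 ≤ l) {lam c δ K : ℝ} (hlam : 0 < lam)
    (hlam1 : lam < 1) (hc0 : 0 < c) (hc : c < 1 / 2) (hδ : 0 < δ) (hK : 1 ≤ K) :
    ∃ C : ℝ, 0 ≤ C ∧ ∀ ε : ℝ, 0 < ε → ε < lam / 2 → ∀ I : Set ℝ, I ⊆ Set.Icc 0 1 →
      I.OrdConnected → (volume I).toReal ≤ K * ε ^ c →
      |Gmeas1 l I ε lam - (∫ u in I, 1 / (1 + u ^ 2)) * Aconst l * G1fun lam| ≤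
        C * ε ^ (c + (1 / 2 - c) / 3 - δ) := by
  set β := c + (1 / 2 - c) / 3 with hβ
  set δ' := min δ β with hδ'
  have hβ0 : 0 < β := by rw [hβ]; linarith
  have hβ1 : β < 1 := by rw [hβ]; linarith
  have hδ'0 : 0 < δ' := lt_min hδ hβ0
  have hδ'β : δ' ≤ β := min_le_right _ _
  have hδ'δ : δ' ≤ δ := min_le_left _ _
  obtain ⟨C₁, hC₁, h₁⟩ := exists_abs_pairSum_sub_le 1 one_pos hc0 hc hK hδ'0 hlam hlam1
  obtain ⟨C₂, hC₂, h₂⟩ := exists_abs_pairSum_sub_le l (by omega) hc0 hc hK hδ'0 hlam hlam1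
  refine ⟨2 * (C₁ + 2 * C₂) + 2 * (2 + 8 / lam), by positivity, fun ε hε hε1 I hI hIo hvol => ?_⟩
  set Q : ℤ := (⌊1 / ε⌋₊ : ℤ) with hQ
  have hε2 : ε < 1 / 2 := by linarith
  have hQR : (Q : ℝ) = (⌊1 / ε⌋₊ : ℝ) := by rw [hQ]; norm_cast
  have hQle : (Q : ℝ) ≤ 1 / ε := by rw [hQR]; exact Nat.floor_le (by positivity)
  have hQlt : 1 / ε < Q + 1 := by rw [hQR]; exact Nat.lt_floor_add_one _
  have hε2' : 2 < 1 / ε := by rw [lt_div_iff₀ hε]; linarith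
  have hQhalf : 1 / (2 * ε) ≤ Q := by
    have : 1 / (2 * ε) = 1 / ε / 2 := by field_simp
    linarith
  have hQ0 : (0 : ℝ) < Q := by linarith
  have hQ1 : (1 : ℝ) ≤ Q := by linarith
  have hlamQ : 1 ≤ lam * Q := by
    have : lam * (1 / (2 * ε)) ≤ lam * Q := by gcongr
    have : 1 ≤ lam * (1 / (2 * ε)) := by
      rw [mul_one_div, le_div_iff₀ (by positivity)]; linarith
    linarith
  set N := ⌊lam * Q⌋ with hN
  have hN1 : 1 ≤ N := Int.le_floor.mpr (by exact_mod_cast hlamQ)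
  have hNl : (N : ℝ) ≤ lam * Q := Int.floor_le _
  have hN' : lam * Q < N + 1 := Int.lt_floor_add_one _
  have hNQ : N < Q := by
    have : (N : ℝ) < Q := by nlinarith
    exact_mod_cast this
  have hεQ : ε * Q ≤ 1 := by
    rw [le_div_iff₀ hε] at hQle; linarith
  have hεQ' : 1 < ε * (Q + 1) := by
    rw [div_lt_iff₀ hε] at hQlt; linarith
  have hη : (volume I).toReal ≤ K * (Q : ℝ) ^ (-c) := by
    refine hvol.trans ?_
    have : ε ^ c ≤ (Q : ℝ) ^ (-c) := by
      rw [Real.rpow_neg hQ0.le, ← Real.inv_rpow hQ0.le]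
      refine Real.rpow_le_rpow hε.le ?_ hc0.le
      rw [le_inv_comm₀ hε hQ0, ← one_div]; exact hQle
    gcongr
  have hsub := subset_Icc_volume hI hIo
  have hpow : (Q : ℝ) ^ (-β + δ') ≤ 2 * ε ^ (β - δ) := by
    calc (Q : ℝ) ^ (-β + δ') ≤ (1 / (2 * ε)) ^ (-β + δ') :=
          Real.rpow_le_rpow_of_nonpos (by positivity) hQhalf (by linarith)
      _ = 2 ^ (β - δ') * ε ^ (β - δ') := by
          rw [one_div, Real.inv_rpow (by positivity), ← Real.rpow_neg (by positivity),
            Real.mul_rpow (by norm_num) hε.le, show -(-β + δ') = β - δ' by ring]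
      _ ≤ 2 * ε ^ (β - δ) := by
          have k1 : (2 : ℝ) ^ (β - δ') ≤ 2 := by
            calc (2 : ℝ) ^ (β - δ') ≤ 2 ^ (1 : ℝ) :=
                  Real.rpow_le_rpow_of_exponent_le (by norm_num) (by linarith)
              _ = 2 := by norm_num
          have k2 : ε ^ (β - δ') ≤ ε ^ (β - δ) :=
            Real.rpow_le_rpow_of_exponent_ge hε (by linarith) (by linarith)
          gcongr
  have hinv : 1 / (Q : ℝ) ≤ 2 * ε ^ (β - δ) := by
    have k1 : 1 / (Q : ℝ) ≤ 2 * ε := by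
      rw [div_le_iff₀ hQ0]
      rw [div_le_iff₀ (by positivity)] at hQhalf; linarith
    have k2 : ε ^ (1 : ℝ) ≤ ε ^ (β - δ) :=
      Real.rpow_le_rpow_of_exponent_ge hε (by linarith) (by linarith)
    rw [Real.rpow_one] at k2
    linarith
  have a1 := h₁ 1 Q N I _ _ hIo hI hsub ENNReal.toReal_nonneg hη (Or.inl rfl) hN1 hNQ hNl hN'
  have a2 := h₂ 1 Q N I _ _ hIo hI hsub ENNReal.toReal_nonneg hη (Or.inl rfl) hN1 hNQ hNl hN'
  have a3 := h₂ (-1) Q N I _ _ hIo hI hsub ENNReal.toReal_nonneg hη (Or.inr rfl) hN1 hNQ hNl hN'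
  have a4 := abs_Gmeas1_sub_pairSum_le hl hI hIo hQ hε hεQ hεQ' hlam (by omega) hNQ hNl hN'
  rw [← hβ] at a1 a2 a3
  have b1 : C₁ * (Q : ℝ) ^ (-β + δ') ≤ C₁ * (2 * ε ^ (β - δ)) := by gcongr
  have b2 : C₂ * (Q : ℝ) ^ (-β + δ') ≤ C₂ * (2 * ε ^ (β - δ)) := by gcongr
  have b4 : (2 + 8 / lam) / (Q : ℝ) ≤ (2 + 8 / lam) * (2 * ε ^ (β - δ)) := by
    rw [div_eq_mul_one_div]; gcongr
  set cI := ∫ u in I, 1 / (1 + u ^ 2)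
  have e : cI * Aconst l * G1fun lam = cI * (Cconst 1 / (1 : ℕ) * G1fun lam) -
      2 * (cI * (Cconst l / l * G1fun lam)) := by
    rw [Cconst_one, Aconst]; push_cast; ring
  have e2 : (2 * (C₁ + 2 * C₂) + 2 * (2 + 8 / lam)) * ε ^ (β - δ) =
      C₁ * (2 * ε ^ (β - δ)) + 2 * (C₂ * (2 * ε ^ (β - δ))) +
        (2 + 8 / lam) * (2 * ε ^ (β - δ)) := by ring
  rw [e, e2]
  rw [abs_le] at *
  constructor <;> linarith [a1.1, a1.2, a2.1, a2.2, a3.1, a3.2, a4.1, a4.2]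

theorem statement9 (l : ℕ) (hl : 2 ≤ l) (lam : ℝ) (hlam : 0 < lam)
    (c c₁ δ K : ℝ) (hc : c ∈ Set.Ioo (0 : ℝ) 1) (hc₁ : c₁ ∈ Set.Ioo (0 : ℝ) 1)
    (hδ : 0 < δ) (hK : 1 ≤ K) :
    ∃ C > 0, ∃ ε₀ > 0, ∀ ε : ℝ, 0 < ε → ε < ε₀ →
      ∀ I : Set ℝ, I ⊆ Set.Icc 0 1 → I.OrdConnected →
      K⁻¹ * ε ^ c ≤ (volume I).toReal → (volume I).toReal ≤ K * ε ^ c →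
      |Gmeas1 l I ε lam - (∫ u in I, 1 / (1 + u ^ 2)) * Aconst l * G1fun lam| ≤
        C * ε ^ (min (c + c₁) (1 / 2 - 2 * c₁) - δ) := by
  obtain ⟨hc0, -⟩ := hc
  obtain ⟨hc10, -⟩ := hc₁
  have hθ1 := min_le_left (c + c₁) (1 / 2 - 2 * c₁)
  have hθ2 := min_le_right (c + c₁) (1 / 2 - 2 * c₁)
  set θ := min (c + c₁) (1 / 2 - 2 * c₁)
  rcases le_or_gt 1 lam with hlam1 | hlam1
  · refine ⟨1, one_pos, 1, one_pos, fun ε hε _ I hI hIo _ _ => ?_⟩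
    rw [Gmeas1_asymptotic_of_one_le hlam1 hε hI hIo]
    positivity
  rcases le_or_gt (1 / 2) c with hc2 | hc2
  · refine ⟨(2 + |Aconst l * G1fun lam|) * K, by positivity, 1, one_pos,
      fun ε hε hε1 I hI hIo _ hvol => (abs_Gmeas1_sub_le_trivial hI hIo).trans ?_⟩
    have k : ε ^ c ≤ ε ^ (θ - δ) :=
      Real.rpow_le_rpow_of_exponent_ge hε hε1.le (by linarith)
    rw [mul_assoc]
    refine mul_le_mul_of_nonneg_left (hvol.trans ?_) (by positivity)
    gcongr
  · obtain ⟨C, hC, h⟩ := exists_Gmeas1_asymptotic hl hlam hlam1 hc0 hc2 hδ hK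
    refine ⟨C + 1, by positivity, lam / 2, by positivity, fun ε hε hε1 I hI hIo _ hvol =>
      (h ε hε hε1 I hI hIo hvol).trans ?_⟩
    have k : ε ^ (c + (1 / 2 - c) / 3 - δ) ≤ ε ^ (θ - δ) :=
      Real.rpow_le_rpow_of_exponent_ge hε (by linarith) (by linarith)
    gcongr
    linarith
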